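/- Let Φ = {Φ_Λ}_{Λ∈𝒞} be a T-invariant interaction potential on X = S^ℤ with ∑_{Λ∋0} ‖Φ_Λ‖ < ∞. If there exist β < 1/2 and a nonnegative sequence (a_n) with ∑_n a_n < ∞ such that ∑_{Λ∋0, Λ∩[n,∞)≠∅} var(Φ_Λ) ≤ β n⁻¹ + a_n for all n ≥ 1, then Φ has a unique Gibbs state μ; moreover μ is T-invariant and the system (X,ℬ,μ,T) is Bernoulli. -/

import Mathlib

open MeasureTheory Filter Set Asymptotics

noncomputable section

namespace GibbsFormal

/-- The configuration space `X = S^ℤ`. -/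
abbrev Conf (S : Type) := ℤ → S

variable {S : Type} [Fintype S] [Nonempty S] [DecidableEq S]
  [TopologicalSpace S] [DiscreteTopology S]
  [MeasurableSpace S] [MeasurableSingletonClass S]

/-- The configuration obtained from `x` by replacing its coordinates on `Λ` by `ζ`. -/
def ov (x : Conf S) (Λ : Finset ℤ) (ζ : Λ → S) : Conf S :=
  fun i => if h : i ∈ Λ then ζ ⟨i, h⟩ else x i

/-- The configuration `x'_Λ x_{Λᶜ}`, agreeing with `x'` on `Λ` and with `x` off `Λ`. -/
def merge (Λ : Finset ℤ) (x' x : Conf S) : Conf S :=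
  fun i => if i ∈ Λ then x' i else x i

/-- The configuration `s_n x`. -/
def upd (s : S) (n : ℤ) (x : Conf S) : Conf S :=
  fun i => if i = n then s else x i

/-- The shift `Tⁿ`:  `(Tⁿ x) i = x (i + n)`. -/
def shift (n : ℤ) (x : Conf S) : Conf S := fun i => x (i + n)

/-- The sub-σ-algebra `ℬ_Λ` of the Borel (= product) σ-algebra, generated by
coordinates in `Λ`. -/
def cylSA (Λ : Set ℤ) : MeasurableSpace (Conf S) :=
  MeasurableSpace.comap (fun x => Λ.restrict x) inferInstance

/-- The cylinder set `[ζ]_Λ`. -/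
def cylEvent (Λ : Finset ℤ) (ζ : Λ → S) : Set (Conf S) :=
  {y | ∀ i : Λ, y i = ζ i}

/-- `r_Λ(f) = sup {f x / f y : x_Λ = y_Λ}`. -/
def rSup (Λ : Set ℤ) (f : Conf S → ℝ) : ℝ :=
  sSup {r : ℝ | ∃ x y : Conf S, (∀ i ∈ Λ, x i = y i) ∧ f x / f y = r}

/-- `r̄_Λ(f) = inf {f x / f y : x_Λ = y_Λ}`. -/
def rInf (Λ : Set ℤ) (f : Conf S → ℝ) : ℝ :=
  sInf {r : ℝ | ∃ x y : Conf S, (∀ i ∈ Λ, x i = y i) ∧ f x / f y = r}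

/-- A specification `𝒱 = {φ_Λ}` on `S^ℤ`:  a family of nonnegative Borel functions
satisfying the normalisation and consistency conditions.  (The value on the empty set
is normalised to `1`, which is forced by the unguarded normalisation condition.) -/
structure Specification (A : Type) [Fintype A] [MeasurableSpace A] where
  φ : Finset ℤ → Conf A → ℝ
  nonneg : ∀ Λ x, 0 ≤ φ Λ x
  measurable : ∀ Λ, Measurable (φ Λ)
  sum_one : ∀ (Λ : Finset ℤ) (x : Conf A), ∑ ζ : Λ → A, φ Λ (ov x Λ ζ) = 1
  consistent : ∀ (K Λ : Finset ℤ), K ⊆ Λ → ∀ x : Conf A,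
    φ Λ x = φ K x * ∑ ζ : K → A, φ Λ (ov x K ζ)

/-- A positive specification. -/
def Specification.Positive (V : Specification S) : Prop := ∀ Λ x, 0 < V.φ Λ x

/-- A continuous specification. -/
def Specification.IsCont (V : Specification S) : Prop := ∀ Λ, Continuous (V.φ Λ)

/-- A `T`-invariant specification: `φ_{n+Λ}(x) = φ_Λ(Tⁿ x)`. -/
def Specification.TInvariant (V : Specification S) : Prop :=
  ∀ (n : ℤ) (Λ : Finset ℤ) (x : Conf S),
    V.φ (Λ.image fun i => n + i) x = V.φ Λ (shift n x)

/-- The DLR (Gibbs) condition for a family `φfam` of conditional probabilities: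
for each finite nonempty `Λ` and each pattern `ζ` on `Λ`, the conditional probability
of the cylinder `[ζ]_Λ` given `ℬ_{Λᶜ}` is `x ↦ φfam Λ (ζ x_{Λᶜ})`, `μ`-a.e. -/
def GibbsCond (φfam : Finset ℤ → Conf S → ℝ) (μ : Measure (Conf S)) : Prop :=
  ∀ (Λ : Finset ℤ), Λ.Nonempty → ∀ ζ : Λ → S,
    (fun x => φfam Λ (ov x Λ ζ)) =ᵐ[μ]
      μ[(cylEvent Λ ζ).indicator (fun _ => (1 : ℝ)) | cylSA ((↑Λ : Set ℤ)ᶜ)]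

/-- `μ` is a Gibbs state for the specification `V`. -/
def IsGibbs (V : Specification S) (μ : Measure (Conf S)) : Prop :=
  IsProbabilityMeasure μ ∧ GibbsCond V.φ μ

/-- `g ∈ 𝒢_X`: a nonnegative bounded `ℬ_{ℤ⁻}`-measurable function with
`∑_{s ∈ S} g (s_0 x) = 1`. -/
def MemG (g : Conf S → ℝ) : Prop :=
  (∃ C, ∀ x, |g x| ≤ C) ∧ (∀ x, 0 ≤ g x) ∧
    Measurable[cylSA (Set.Iic (0 : ℤ))] g ∧
    ∀ x : Conf S, ∑ s : S, g (upd s 0 x) = 1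

/-- `μ` is a `g`-chain: for every `n` the conditional probability of the symbol at
site `n` given `ℬ_{(-∞,n-1]}` is `x ↦ g (Tⁿ (s_n x))`, `μ`-a.e. -/
def IsGChain (g : Conf S → ℝ) (μ : Measure (Conf S)) : Prop :=
  IsProbabilityMeasure μ ∧ ∀ (n : ℤ) (s : S),
    (fun x => g (shift n (upd s n x))) =ᵐ[μ]
      μ[({y : Conf S | y n = s}).indicator (fun _ => (1 : ℝ)) | cylSA (Set.Iic (n - 1))]

/-- The probability `π^𝒱_{[0,n]}([x]_{{0}} | x)`. -/
def piG (V : Specification S) (n : ℕ) (x : Conf S) : ℝ :=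
  ∑ ζ : (Finset.Icc (0 : ℤ) (n : ℤ)) → S,
    V.φ (Finset.Icc (0 : ℤ) (n : ℤ)) (ov x (Finset.Icc (0 : ℤ) (n : ℤ)) ζ) *
      (if ov x (Finset.Icc (0 : ℤ) (n : ℤ)) ζ 0 = x 0 then 1 else 0)

/-- A specification sequence of the form `{([0,n], f_n)}`: each `f_n` is bounded,
strictly positive and `ℬ_{[0,n-1]ᶜ}`-measurable. -/
def IsSpecSeq (f : ℕ → Conf S → ℝ) : Prop :=
  ∀ n : ℕ, (∃ C, ∀ x, f n x ≤ C) ∧ (∀ x, 0 < f n x) ∧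
    Measurable[cylSA ((Set.Ico (0 : ℤ) (n : ℤ))ᶜ)] (f n)

/-- `{([0,n], f_n)}` is a specification sequence for the family `φfam`. -/
def IsSpecSeqForFam (φfam : Finset ℤ → Conf S → ℝ) (f : ℕ → Conf S → ℝ) : Prop :=
  IsSpecSeq f ∧ ∀ (n : ℕ) (x : Conf S),
    φfam (Finset.Icc (0 : ℤ) (n : ℤ)) x =
      (∏ j ∈ Finset.range (n + 1), f j x) /
        ∑ ζ : (Finset.Icc (0 : ℤ) (n : ℤ)) → S,
          ∏ j ∈ Finset.range (n + 1), f j (ov x (Finset.Icc (0 : ℤ) (n : ℤ)) ζ)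

/-- `{([0,n], f_n)}` is a specification sequence for the specification `V`. -/
def IsSpecSeqFor (V : Specification S) (f : ℕ → Conf S → ℝ) : Prop :=
  IsSpecSeqForFam V.φ f

/-- The operator `L_{m,n} h (x) = ∑_{y ∈ [x]_{[m,n]ᶜ}} (∏_{i=m}^n f_i y) · h y`. -/
def Lop (f : ℕ → Conf S → ℝ) (m n : ℕ) (h : Conf S → ℝ) (x : Conf S) : ℝ :=
  ∑ ζ : (Finset.Icc (m : ℤ) (n : ℤ)) → S,
    (∏ i ∈ Finset.Icc m n, f i (ov x (Finset.Icc (m : ℤ) (n : ℤ)) ζ)) *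
      h (ov x (Finset.Icc (m : ℤ) (n : ℤ)) ζ)

/-- The ratio bounds `ρ_k^{(n)}(x,y)` (with `ρ_{-1}^{(n)}` for negative `k`). -/
def rho (f : ℕ → Conf S → ℝ) (k : ℤ) (n : ℕ) (x y : Conf S) : ℝ :=
  if k < 0 then
    sInf {r : ℝ | ∃ m : ℕ,
      Lop f m (m + n) (fun _ => 1) x / Lop f m (m + n) (fun _ => 1) y = r}
  else
    sInf {r : ℝ | ∃ (m : ℕ) (ζ : (Finset.Icc (m : ℤ) ((m : ℤ) + k)) → S),
      Lop f m (m + n) ((cylEvent (Finset.Icc (m : ℤ) ((m : ℤ) + k)) ζ).indicator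
          fun _ => 1) x /
        Lop f m (m + n) ((cylEvent (Finset.Icc (m : ℤ) ((m : ℤ) + k)) ζ).indicator
          fun _ => 1) y = r}

/-- A `T`-invariant interaction potential `Φ = {Φ_Λ}`. -/
structure Potential (A : Type) [Fintype A] [MeasurableSpace A] where
  Φ : Finset ℤ → Conf A → ℝ
  measurable : ∀ Λ : Finset ℤ, Λ.Nonempty → Measurable[cylSA (↑Λ : Set ℤ)] (Φ Λ)
  bounded : ∀ Λ : Finset ℤ, ∃ C, ∀ x, |Φ Λ x| ≤ C
  invariant : ∀ (n : ℤ) (Λ : Finset ℤ), Λ.Nonempty → ∀ x : Conf A,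
    Φ (Λ.image fun i => n + i) x = Φ Λ (shift n x)

/-- `var(h) = sup h − inf h`. -/
def pvar (h : Conf S → ℝ) : ℝ := (⨆ x, h x) - ⨅ x, h x

/-- `‖h‖ = sup |h|`. -/
def pnorm (h : Conf S → ℝ) : ℝ := ⨆ x, |h x|

/-- `∑_{Λ ∋ 0} ‖Φ_Λ‖ < ∞`. -/
def NormSummable (P : Potential S) : Prop :=
  Summable fun Λ : {Λ : Finset ℤ // (0 : ℤ) ∈ Λ} => pnorm (P.Φ ↑Λ)

/-- `∑_{Λ ∋ 0, Λ ∩ [n,∞) ≠ ∅} var(Φ_Λ)`. -/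
def varTail (P : Potential S) (n : ℕ) : ℝ :=
  ∑' Λ : {Λ : Finset ℤ // (0 : ℤ) ∈ Λ ∧ ∃ i ∈ Λ, (n : ℤ) ≤ i}, pvar (P.Φ ↑Λ)

/-- The Hamiltonian `H_Λ(x) = ∑_{K ∩ Λ ≠ ∅} Φ_K(x)`. -/
def HPot (P : Potential S) (Λ : Finset ℤ) (x : Conf S) : ℝ :=
  ∑' K : {K : Finset ℤ // (K ∩ Λ).Nonempty}, P.Φ ↑K x

/-- The specification `𝒱_Φ` associated with an interaction potential. -/
def potPhi (P : Potential S) (Λ : Finset ℤ) (x : Conf S) : ℝ :=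
  Real.exp (-HPot P Λ x) / ∑ ζ : Λ → S, Real.exp (-HPot P Λ (ov x Λ ζ))

/-- `μ` is a Gibbs state for the potential `P`. -/
def IsGibbsPot (P : Potential S) (μ : Measure (Conf S)) : Prop :=
  IsProbabilityMeasure μ ∧ GibbsCond (potPhi P) μ

/-- `(T,μ)` is Bernoulli: the shift on `(S^ℤ, μ)` is measure-theoretically isomorphic
(mod 0) to the shift on `A^ℤ` carrying an i.i.d. product probability measure for some
finite alphabet `A` (wlog `A = Fin m`). -/
def IsBernoulliSystem (μ : Measure (Conf S)) : Prop :=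
  ∃ (m : ℕ) (p : Fin m → ENNReal) (ν : Measure (ℤ → Fin m)),
    IsProbabilityMeasure ν ∧ (∑ a, p a = 1) ∧
    (∀ (Λ : Finset ℤ) (ζ : Λ → Fin m),
      ν {y : ℤ → Fin m | ∀ i : Λ, y ↑i = ζ i} = ∏ i : Λ, p (ζ i)) ∧
    ∃ (θ : Conf S → ℤ → Fin m) (θinv : (ℤ → Fin m) → Conf S),
      Measurable θ ∧ Measurable θinv ∧ μ.map θ = ν ∧
      (∀ᵐ x ∂μ, θ (shift 1 x) = fun i => θ x (i + 1)) ∧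
      (∀ᵐ x ∂μ, θinv (θ x) = x) ∧ (∀ᵐ y ∂ν, θ (θinv y) = y)

/-- The recursively defined quantities `p_k^{(n)}` of Lemma 3.3 (`k = -1` is encoded
by any negative argument). -/
def pSeq (v : ℕ → ℝ) : ℕ → ℤ → ℝ
  | 0, k => if k < 0 then 1 else v 0
  | n + 1, k =>
    if k < 0 then 1
    else v k.toNat * pSeq v n (k - 1) +
      ∑ j ∈ Finset.Ico k.toNat (n + 1), (v (j + 1) - v j) * pSeq v n (j : ℤ)

open Finset (sum_congr sum_le_sum mul_sum sum_comm sum_nonneg sum_add_distrib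
  sum_mul sum_sub_distrib sum_div sum_const single_le_sum sum_eq_zero sum_eq_zero_iff_of_nonneg)
open Real (exp log negMulLog exp_pos exp_add negMulLog_nonneg)

/-! ### Entropy of finite-valued random variables -/

/-- Pinsker's inequality (with a non-optimal constant). -/
lemma pinsker {ι : Type*} [Fintype ι] (p q : ι → ℝ) (hp : ∀ i, 0 ≤ p i) (hq : ∀ i, 0 ≤ q i)
    (habs : ∀ i, q i = 0 → p i = 0) (hs : ∑ i, p i = 1) (hq1 : ∑ i, q i ≤ 1) :
    (∑ i, |p i - q i|) ^ 2 ≤ 4 * ∑ i, p i * (log (p i) - log (q i)) := by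
  have key : ∀ i, p i + q i - 2 * (√(p i) * √(q i)) + (p i - q i) ≤
      p i * (log (p i) - log (q i)) := by
    intro i
    rcases (hp i).eq_or_lt with h0 | h0
    · simp [← h0]
    · have hq0 : 0 < q i := lt_of_le_of_ne (hq i) fun h => h0.ne' (habs i h.symm)
      have h1 := Real.log_le_sub_one_of_pos (x := √(q i) / √(p i)) (by positivity)
      rw [Real.log_div (by positivity) (by positivity), Real.log_sqrt hq0.le,
        Real.log_sqrt h0.le] at h1
      have h2 : p i * (√(q i) / √(p i)) = √(p i) * √(q i) := by
        nth_rewrite 1 [← Real.mul_self_sqrt h0.le]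
        field_simp
      nlinarith [mul_le_mul_of_nonneg_left h1 h0.le]
  have h2 : ∑ i, (√(p i) - √(q i)) ^ 2 ≤ ∑ i, p i * (log (p i) - log (q i)) := by
    have h3 := sum_le_sum fun i (_ : i ∈ Finset.univ) => key i
    have h4 : ∑ i, (p i + q i - 2 * (√(p i) * √(q i)) + (p i - q i)) =
        ∑ i, (√(p i) - √(q i)) ^ 2 + (∑ i, p i - ∑ i, q i) := by
      rw [← sum_sub_distrib, ← sum_add_distrib]
      refine sum_congr rfl fun i _ => ?_
      nlinarith [Real.sq_sqrt (hp i), Real.sq_sqrt (hq i)]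
    linarith
  have h5 : ∑ i, (√(p i) + √(q i)) ^ 2 ≤ 4 := by
    have : ∀ i, (√(p i) + √(q i)) ^ 2 ≤ 2 * p i + 2 * q i := fun i => by
      nlinarith [Real.sq_sqrt (hp i), Real.sq_sqrt (hq i), sq_nonneg (√(p i) - √(q i))]
    have := sum_le_sum fun i (_ : i ∈ Finset.univ) => this i
    rw [sum_add_distrib, ← mul_sum, ← mul_sum] at this
    linarith
  have h6 : ∑ i, |p i - q i| = ∑ i, |√(p i) - √(q i)| * (√(p i) + √(q i)) := by
    refine sum_congr rfl fun i _ => ?_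
    rw [← abs_of_nonneg (a := √(p i) + √(q i)) (by positivity), ← abs_mul]
    congr 1
    nlinarith [Real.sq_sqrt (hp i), Real.sq_sqrt (hq i)]
  rw [h6]
  refine (Finset.sum_mul_sq_le_sq_mul_sq _ _ _).trans ?_
  simp only [sq_abs]
  have h7 : 0 ≤ ∑ i, (√(p i) - √(q i)) ^ 2 := sum_nonneg fun i _ => sq_nonneg _
  nlinarith

section Entropy

variable {Ω : Type*} [MeasurableSpace Ω] {α β γ : Type*}

/-- Measurability of a map to a finite set. -/
def FinMeas (X : Ω → α) : Prop := ∀ a, MeasurableSet (X ⁻¹' ({a} : Set α))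

/-- The distribution of a finite-valued random variable. -/
def pr (μ : Measure Ω) (X : Ω → α) (a : α) : ℝ := μ.real (X ⁻¹' ({a} : Set α))

/-- Shannon entropy. -/
def ent [Fintype α] (μ : Measure Ω) (X : Ω → α) : ℝ := ∑ a, negMulLog (pr μ X a)

lemma FinMeas.preimage [Finite α] {X : Ω → α} (hX : FinMeas X) (s : Set α) : MeasurableSet (X ⁻¹' s) := by
  rw [← biUnion_preimage_singleton]
  exact s.toFinite.measurableSet_biUnion fun a _ => hX a

lemma FinMeas.of_det [Finite β] {X : Ω → α} {Y : Ω → β} (hY : FinMeas Y)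
    (h : ∀ ω ω', Y ω = Y ω' → X ω = X ω') : FinMeas X := by
  intro a
  have : X ⁻¹' {a} = Y ⁻¹' (Y '' (X ⁻¹' {a})) := by
    ext ω
    simp only [mem_preimage, mem_singleton_iff, mem_image]
    exact ⟨fun hh => ⟨ω, hh, rfl⟩, fun ⟨ω', h1, h2⟩ => (h _ _ h2).symm.trans h1⟩
  rw [this]; exact hY.preimage _

lemma FinMeas.pair {X : Ω → α} {Y : Ω → β} (hX : FinMeas X) (hY : FinMeas Y) :
    FinMeas fun ω => (X ω, Y ω) := by
  rintro ⟨a, b⟩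
  have : (fun ω => (X ω, Y ω)) ⁻¹' {(a, b)} = X ⁻¹' {a} ∩ Y ⁻¹' {b} := by
    ext ω; simp
  rw [this]; exact (hX a).inter (hY b)

variable [Fintype α] [Fintype β] [Fintype γ]

lemma FinMeas.comp {X : Ω → α} (hX : FinMeas X) (f : α → β) : FinMeas fun ω => f (X ω) :=
  hX.of_det fun _ _ h => by rw [h]

lemma pr_nonneg (μ : Measure Ω) (X : Ω → α) (a : α) : 0 ≤ pr μ X a := measureReal_nonneg

variable {μ : Measure Ω} [IsProbabilityMeasure μ]

lemma pr_le_one (X : Ω → α) (a : α) : pr μ X a ≤ 1 := measureReal_le_one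

lemma measureReal_preimage {X : Ω → α} (hX : FinMeas X) (s : Set α) [DecidablePred (· ∈ s)] :
    μ.real (X ⁻¹' s) = ∑ a, if a ∈ s then pr μ X a else 0 := by
  rw [← Finset.sum_filter, ← biUnion_preimage_singleton]
  have : (⋃ y ∈ s, X ⁻¹' {y}) = ⋃ y ∈ Finset.univ.filter (· ∈ s), X ⁻¹' {y} := by
    ext; simp
  rw [this, measureReal_biUnion_finset]
  · rfl
  · intro a _ b _ hab
    exact Disjoint.preimage X (by simpa using hab)
  · exact fun a _ => hX a

lemma pr_comp [DecidableEq β] {X : Ω → α} (hX : FinMeas X) (f : α → β) (b : β) :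
    pr μ (fun ω => f (X ω)) b = ∑ a, if f a = b then pr μ X a else 0 := by
  classical
  have := measureReal_preimage (μ := μ) hX (f ⁻¹' {b})
  simpa [pr, preimage_preimage] using this

lemma sum_pr {X : Ω → α} (hX : FinMeas X) : ∑ a, pr μ X a = 1 := by
  have := measureReal_preimage (μ := μ) hX univ
  simpa using this.symm

/-- Pushing a sum through a function of a random variable. -/
lemma sum_pr_comp {X : Ω → α} (hX : FinMeas X) (f : α → β) (g : β → ℝ) :
    ∑ b, pr μ (fun ω => f (X ω)) b * g b = ∑ a, pr μ X a * g (f a) := by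
  classical
  simp only [pr_comp hX, sum_mul]
  rw [sum_comm]
  simp [ite_mul]

lemma pr_le_comp {X : Ω → α} (f : α → β) (a : α) :
    pr μ X a ≤ pr μ (fun ω => f (X ω)) (f a) := by
  refine measureReal_mono fun ω h => ?_
  simp only [mem_preimage, mem_singleton_iff] at h ⊢
  rw [h]

lemma ent_eq (X : Ω → α) : ent μ X = -∑ a, pr μ X a * log (pr μ X a) := by
  simp [ent, negMulLog, Finset.sum_neg_distrib]

lemma ent_nonneg (X : Ω → α) : 0 ≤ ent μ X :=
  sum_nonneg fun _ _ => negMulLog_nonneg (pr_nonneg ..) (pr_le_one ..)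

lemma ent_comp_le {X : Ω → α} (hX : FinMeas X) (f : α → β) :
    ent μ (fun ω => f (X ω)) ≤ ent μ X := by
  rw [ent_eq, ent_eq, sum_pr_comp hX f fun b => log (pr μ (fun ω => f (X ω)) b), neg_le_neg_iff]
  refine sum_le_sum fun a _ => ?_
  rcases (pr_nonneg μ X a).eq_or_lt with h | h
  · simp [← h]
  · exact mul_le_mul_of_nonneg_left (Real.log_le_log h (pr_le_comp f a)) h.le

lemma ent_mono {X : Ω → α} {Y : Ω → β} (hY : FinMeas Y)
    (h : ∀ ω ω', Y ω = Y ω' → X ω = X ω') : ent μ X ≤ ent μ Y := by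
  have : Nonempty α := by
    have : Nonempty Ω := by
      by_contra hne
      rw [not_nonempty_iff] at hne
      have := measure_univ (μ := μ)
      simp [univ_eq_empty_iff.2 hne] at this
    exact this.map X
  obtain ⟨f, hf⟩ : ∃ f : β → α, X = f ∘ Y := by
    refine ⟨Function.extend Y X fun _ => Classical.arbitrary _, ?_⟩
    ext ω
    exact (Function.FactorsThrough.extend_apply (fun a b hab => h a b hab) _ ω).symm
  subst hf
  exact ent_comp_le hY f

lemma ent_congr {X : Ω → α} {Y : Ω → β} (hY : FinMeas Y)
    (h : ∀ ω ω', Y ω = Y ω' ↔ X ω = X ω') : ent μ X = ent μ Y :=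
  le_antisymm (ent_mono hY fun ω ω' => (h ω ω').1)
    (ent_mono (hY.of_det fun ω ω' => (h ω ω').1) fun ω η => (h ω η).2)

/-- The quantitative form of strong subadditivity. -/
lemma cmi_pinsker {X : Ω → α} {Y : Ω → β} {Z : Ω → γ} (hX : FinMeas X) (hY : FinMeas Y)
    (hZ : FinMeas Z) :
    (∑ x, ∑ y, ∑ z, |pr μ (fun ω => (X ω, Y ω, Z ω)) (x, y, z) -
      pr μ (fun ω => (X ω, Z ω)) (x, z) * pr μ (fun ω => (Y ω, Z ω)) (y, z) / pr μ Z z|) ^ 2 ≤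
    4 * (ent μ (fun ω => (X ω, Z ω)) + ent μ (fun ω => (Y ω, Z ω))
      - ent μ (fun ω => (X ω, Y ω, Z ω)) - ent μ Z) := by
  classical
  have hT := hX.pair (hY.pair hZ)
  set T : Ω → α × β × γ := fun ω => (X ω, Y ω, Z ω) with hTdef
  set q : α × β × γ → ℝ := fun t => pr μ (fun ω => (X ω, Z ω)) (t.1, t.2.2) *
    pr μ (fun ω => (Y ω, Z ω)) t.2 / pr μ Z t.2.2 with hq
  have hXZ : ∀ t, pr μ T t ≤ pr μ (fun ω => (X ω, Z ω)) (t.1, t.2.2) := fun t =>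
    pr_le_comp (X := T) (fun t => (t.1, t.2.2)) t
  have hYZ : ∀ t, pr μ T t ≤ pr μ (fun ω => (Y ω, Z ω)) t.2 := fun t =>
    pr_le_comp (X := T) (fun t => t.2) t
  have hZZ : ∀ t, pr μ T t ≤ pr μ Z t.2.2 := fun t => pr_le_comp (X := T) (fun t => t.2.2) t
  have h := pinsker (pr μ T) q (pr_nonneg μ T)
    (fun t => div_nonneg (mul_nonneg (pr_nonneg ..) (pr_nonneg ..)) (pr_nonneg ..)) ?_ (sum_pr hT) ?_
  · have e1 : ∑ x, ∑ y, ∑ z, |pr μ T (x, y, z) -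
        pr μ (fun ω => (X ω, Z ω)) (x, z) * pr μ (fun ω => (Y ω, Z ω)) (y, z) / pr μ Z z| =
        ∑ t, |pr μ T t - q t| := by
      simp [Fintype.sum_prod_type, hq]
    rw [e1]
    refine h.trans_eq ?_
    congr 1
    have a1 := sum_pr_comp (μ := μ) hT (fun t => (t.1, t.2.2))
      fun b => log (pr μ (fun ω => (X ω, Z ω)) b)
    have a2 := sum_pr_comp (μ := μ) hT (fun t => t.2)
      fun b => log (pr μ (fun ω => (Y ω, Z ω)) b)
    have a3 := sum_pr_comp (μ := μ) hT (fun t => t.2.2) fun b => log (pr μ Z b)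
    rw [ent_eq, ent_eq, ent_eq, ent_eq]
    simp only [hTdef] at a1 a2 a3
    rw [a1, a2, a3]
    simp only [← hTdef]
    rw [← sub_eq_zero]
    simp only [← Finset.sum_neg_distrib, ← sum_sub_distrib, ← sum_add_distrib]
    refine sum_eq_zero fun t _ => ?_
    rcases (pr_nonneg μ T t).eq_or_lt with h0 | h0
    · simp [← h0]
    · simp only [hq]
      have b1 := h0.trans_le (hXZ t)
      have b2 := h0.trans_le (hYZ t)
      have b3 := h0.trans_le (hZZ t)
      rw [Real.log_div (mul_ne_zero b1.ne' b2.ne') b3.ne', Real.log_mul b1.ne' b2.ne']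
      ring
  · intro t ht
    refine le_antisymm ?_ (pr_nonneg ..)
    simp only [hq, div_eq_zero_iff, mul_eq_zero] at ht
    rcases ht with (h | h) | h
    · exact h ▸ hXZ t
    · exact h ▸ hYZ t
    · exact h ▸ hZZ t
  · have : ∀ z, ∑ x, pr μ (fun ω => (X ω, Z ω)) (x, z) = pr μ Z z := fun z => by
      rw [pr_comp (hX.pair hZ) (fun t => t.2), Fintype.sum_prod_type]
      simp
    have h2 : ∑ t, q t = ∑ t : β × γ, pr μ (fun ω => (Y ω, Z ω)) t := by
      rw [Fintype.sum_prod_type, sum_comm]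
      refine sum_congr rfl fun t _ => ?_
      simp only [hq]
      rw [← sum_div, ← sum_mul, this]
      rcases (pr_nonneg μ Z t.2).eq_or_lt with h0 | h0
      · rw [← h0]
        have := pr_le_comp (μ := μ) (X := fun ω => (Y ω, Z ω)) (fun t => t.2) t
        simp only [← h0] at this
        simp [le_antisymm this (pr_nonneg ..)]
      · field_simp
    rw [h2, sum_pr (hY.pair hZ)]

lemma ent_submod {X : Ω → α} {Y : Ω → β} {Z : Ω → γ} (hX : FinMeas X) (hY : FinMeas Y)
    (hZ : FinMeas Z) : ent μ (fun ω => (X ω, Y ω, Z ω)) + ent μ Z ≤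
      ent μ (fun ω => (X ω, Z ω)) + ent μ (fun ω => (Y ω, Z ω)) := by
  nlinarith [cmi_pinsker (μ := μ) hX hY hZ, sq_nonneg (∑ x, ∑ y, ∑ z, |pr μ (fun ω => (X ω, Y ω, Z ω)) (x, y, z) -
      pr μ (fun ω => (X ω, Z ω)) (x, z) * pr μ (fun ω => (Y ω, Z ω)) (y, z) / pr μ Z z|)]

lemma ent_const (c : α) : ent μ (fun _ => c) = 0 := by
  refine sum_eq_zero fun a _ => ?_
  by_cases h : a = c
  · subst h; simp [pr]
  · have : (fun _ : Ω => c) ⁻¹' {a} = ∅ := by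
      ext; simpa using fun h' => h h'.symm
    simp [pr, this]

lemma finMeas_const (c : α) : FinMeas (fun _ : Ω => c) := fun a => by
  by_cases h : c = a <;> simp [h]

lemma ent_pair_le {X : Ω → α} {Y : Ω → β} (hX : FinMeas X) (hY : FinMeas Y) :
    ent μ (fun ω => (X ω, Y ω)) ≤ ent μ X + ent μ Y := by
  have h := ent_submod (μ := μ) hX hY (finMeas_const ())
  rw [ent_const, ent_congr (X := fun ω => (X ω, Y ω, ())) (Y := fun ω => (X ω, Y ω)) (hX.pair hY)
    (by simp), ent_congr (X := fun ω => (X ω, ())) hX (by simp),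
    ent_congr (X := fun ω => (Y ω, ())) hY (by simp)] at h
  linarith

lemma pr_map {Ω' : Type*} [MeasurableSpace Ω'] {T : Ω → Ω'} (hT : Measurable T) {X : Ω' → α}
    (hX : FinMeas X) (a : α) : pr (μ.map T) X a = pr μ (fun ω => X (T ω)) a := by
  rw [pr, map_measureReal_apply hT (hX a)]; rfl

lemma ent_map {Ω' : Type*} [MeasurableSpace Ω'] {T : Ω → Ω'} (hT : Measurable T) {X : Ω' → α}
    (hX : FinMeas X) : ent (μ.map T) X = ent μ (fun ω => X (T ω)) := by
  simp only [ent, pr_map hT hX]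

end Entropy

lemma sum_negMulLog_le {ι : Type*} [Fintype ι] [Nonempty ι] (r : ι → ℝ) (hr : ∀ i, 0 ≤ r i) :
    ∑ i, negMulLog (r i) ≤
      (∑ i, r i) * log (Fintype.card ι) + negMulLog (∑ i, r i) := by
  set e := ∑ i, r i with he
  rcases (sum_nonneg fun i _ => hr i : 0 ≤ e).eq_or_lt with h0 | h0
  · have : ∀ i, r i = 0 := fun i =>
      (sum_eq_zero_iff_of_nonneg fun i _ => hr i).1 (he ▸ h0.symm) i (Finset.mem_univ i)
    have h1 : e = 0 := h0.symm
    simp [h1, this]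
  · have hn : (0 : ℝ) < Fintype.card ι := by exact_mod_cast Fintype.card_pos
    have key : ∀ i, negMulLog (r i) ≤ e / Fintype.card ι - r i
        + r i * (log (Fintype.card ι) - log e) := fun i => by
      rcases (hr i).eq_or_lt with h1 | h1
      · simp [← h1]; positivity
      · have := Real.log_le_sub_one_of_pos (x := e / Fintype.card ι / r i) (by positivity)
        rw [Real.log_div (by positivity) h1.ne', Real.log_div h0.ne' hn.ne'] at this
        have h2 := mul_le_mul_of_nonneg_left this h1.le
        have h3 : r i * (e / Fintype.card ι / r i - 1) = e / Fintype.card ι - r i := by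
          field_simp
        rw [h3] at h2
        simp only [negMulLog]
        linarith
    refine (sum_le_sum fun i _ => key i).trans_eq ?_
    rw [sum_add_distrib, sum_sub_distrib, ← sum_mul, ← he]
    simp only [sum_const, Finset.card_univ, nsmul_eq_mul, negMulLog]
    field_simp
    ring

lemma negMulLog_le_one (x : ℝ) (hx : 0 ≤ x) : negMulLog x ≤ 1 := by
  rcases hx.eq_or_lt with h | h
  · simp [← h]
  · have := Real.log_le_sub_one_of_pos (inv_pos.2 h)
    rw [Real.log_inv] at this
    have h2 := mul_le_mul_of_nonneg_left this hx
    rw [mul_sub, mul_inv_cancel₀ h.ne'] at h2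
    simp only [negMulLog]; linarith

/-- The function `-x log x` loses at most `r` when its argument increases by `r`. -/
lemma negMulLog_add_ge {m r : ℝ} (hm : 0 ≤ m) (hr : 0 ≤ r) (h : m + r ≤ 1) :
    negMulLog m - r ≤ negMulLog (m + r) := by
  rcases hm.eq_or_lt with h0 | h0
  · subst h0
    have := negMulLog_nonneg (x := 0 + r) (by linarith) h
    simp only [Real.negMulLog_zero]; linarith
  · have h1 := Real.log_le_sub_one_of_pos (x := (m + r) / m) (by positivity)
    rw [Real.log_div (by linarith) h0.ne'] at h1
    have h2 := mul_le_mul_of_nonneg_left h1 hm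
    have h3 : m * ((m + r) / m - 1) = r := by field_simp; ring
    have h4 : log (m + r) ≤ 0 := Real.log_nonpos (by linarith) h
    simp only [negMulLog]
    nlinarith

lemma negMulLog_add_le {m r : ℝ} (hm : 0 ≤ m) (hr : 0 ≤ r) :
    negMulLog (m + r) ≤ negMulLog m + negMulLog r := by
  rcases hm.eq_or_lt with h0 | h0
  · simp [← h0]
  rcases hr.eq_or_lt with h1 | h1
  · simp [← h1]
  have e1 := Real.log_le_log h0 (by linarith : m ≤ m + r)
  have e2 := Real.log_le_log h1 (by linarith : r ≤ m + r)
  simp only [negMulLog]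
  nlinarith

/-- Continuity of entropy. -/
lemma entropy_ge {ι : Type*} [Fintype ι] [Nonempty ι] (p q : ι → ℝ) (hp : ∀ i, 0 ≤ p i)
    (hq : ∀ i, 0 ≤ q i) (hs : ∑ i, p i = 1) :
    ∑ i, negMulLog (q i) - (∑ i, |p i - q i|) * log (Fintype.card ι) - 2 ≤
      ∑ i, negMulLog (p i) := by
  have hp1 : ∀ i, p i ≤ 1 := fun i =>
    hs ▸ single_le_sum (fun i _ => hp i) (Finset.mem_univ i)
  have h1 : ∀ i, negMulLog (min (p i) (q i)) - (p i - min (p i) (q i)) ≤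
      negMulLog (p i) := fun i => by
    have := negMulLog_add_ge (m := min (p i) (q i)) (r := p i - min (p i) (q i))
      (le_min (hp i) (hq i)) (by simp) (by simpa using hp1 i)
    simpa using this
  have h2 : ∀ i, negMulLog (q i) ≤ negMulLog (min (p i) (q i)) +
      negMulLog (q i - min (p i) (q i)) := fun i => by
    have := negMulLog_add_le (m := min (p i) (q i)) (r := q i - min (p i) (q i))
      (le_min (hp i) (hq i)) (by simp)
    simpa using this
  have h3 := sum_negMulLog_le (fun i => q i - min (p i) (q i)) (fun i => by simp)
  have h4 := negMulLog_le_one (∑ i, (q i - min (p i) (q i)))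
    (sum_nonneg fun i _ => by simp)
  have h5 : ∑ i, (q i - min (p i) (q i)) ≤ ∑ i, |p i - q i| :=
    sum_le_sum fun i _ => by
      rcases min_cases (p i) (q i) with h | h <;> rw [h.1]
      · rw [abs_sub_comm]; exact le_abs_self _
      · simp
  have h6 : 0 ≤ log (Fintype.card ι) := Real.log_natCast_nonneg _
  have h7 := sum_le_sum fun i (_ : i ∈ Finset.univ) => h1 i
  have h8 := sum_le_sum fun i (_ : i ∈ Finset.univ) => h2 i
  rw [sum_sub_distrib] at h7
  rw [sum_add_distrib] at h8
  have h9 : ∑ i, (p i - min (p i) (q i)) ≤ 1 := by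
    rw [← hs]
    exact sum_le_sum fun i _ => by
      have := le_min (hp i) (hq i)
      linarith
  have h10 := mul_le_mul_of_nonneg_right h5 h6
  linarith

/-! ### Stationary processes -/

section Stationary

/-- `f` depends only on the coordinates in `I`. -/
def Dep {A : Type} {α : Sort*} (I : Set ℤ) (f : Conf A → α) : Prop :=
  ∀ x y : Conf A, (∀ i ∈ I, x i = y i) → f x = f y

/-- The restriction of a configuration to a finite window. -/
def rs {A : Type} (I : Finset ℤ) (x : Conf A) : I → A := fun i => x i

variable {A : Type}

lemma rs_eq_iff {I : Finset ℤ} {x y : Conf A} : rs I x = rs I y ↔ ∀ i ∈ I, x i = y i := by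
  simp [rs, funext_iff]

lemma dep_rs (I : Finset ℤ) : Dep (I : Set ℤ) (rs (A := A) I) := fun _ _ h => rs_eq_iff.2 h

lemma Dep.mono {α : Sort*} {I J : Set ℤ} {f : Conf A → α} (hf : Dep I f) (h : I ⊆ J) : Dep J f :=
  fun x y hxy => hf x y fun i hi => hxy i (h hi)

lemma Dep.comp {α β : Sort*} {I : Set ℤ} {f : Conf A → α} (hf : Dep I f) (g : α → β) :
    Dep I fun x => g (f x) := fun x y hxy =>
  congrArg g (hf x y hxy)

lemma shift_shift (m n : ℤ) (x : Conf A) : shift m (shift n x) = shift (m + n) x := by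
  ext i; simp [shift, add_assoc]

lemma shift_zero (x : Conf A) : shift 0 x = x := by ext i; simp [shift]

lemma Dep.shift {α : Sort*} {a b : ℤ} {f : Conf A → α} (hf : Dep (Ico a b) f) (n : ℤ) :
    Dep (Ico (a + n) (b + n)) fun x => f (shift n x) := fun x y hxy => hf _ _ fun i hi =>
  hxy _ (by simp only [mem_Ico] at hi ⊢; omega)

variable [Fintype A] [MeasurableSpace A] [MeasurableSingletonClass A]

lemma finMeas_rs (I : Finset ℤ) : FinMeas (rs (A := A) I) := by
  intro a
  have : rs I ⁻¹' {a} = ⋂ i : I, {x : Conf A | x i = a i} := by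
    ext x; simp [rs, funext_iff]
  rw [this]
  exact MeasurableSet.iInter fun i => measurable_pi_apply (i : ℤ) (measurableSet_singleton _)

lemma Dep.finMeas {α : Type*} {I : Finset ℤ} {f : Conf A → α} (hf : Dep (I : Set ℤ) f) :
    FinMeas f := (finMeas_rs I).of_det fun x y h => hf x y (rs_eq_iff.1 h)

lemma Dep.measurableSet {I : Finset ℤ} {s : Set (Conf A)} (hf : Dep (I : Set ℤ) (· ∈ s)) :
    MeasurableSet s := by
  have := hf.finMeas True
  convert this using 1
  ext x; simp

lemma Dep.measurableSet_past {l : ℕ} {s : Set (Conf A)} (hf : Dep (Ico (-(l : ℤ)) 0) (· ∈ s)) :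
    MeasurableSet s := Dep.measurableSet (I := Finset.Ico (-(l : ℤ)) 0) (by simpa using hf)

lemma measurable_shift {A : Type} [MeasurableSpace A] (n : ℤ) : Measurable (shift (S := A) n) :=
  measurable_pi_lambda _ fun i => measurable_pi_apply (i + n)

/-- Shift invariance. -/
def Inv (μ : Measure (Conf A)) : Prop := ∀ n : ℤ, μ.map (shift n) = μ

variable {μ : Measure (Conf A)} [IsProbabilityMeasure μ]

lemma Inv.ent (h : Inv μ) {α : Type*} [Fintype α] {f : Conf A → α} (hf : FinMeas f) (n : ℤ) :
    ent μ (fun x => f (shift n x)) = ent μ f := by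
  conv_rhs => rw [← h n]
  rw [ent_map (measurable_shift n) hf]

lemma Inv.pr (h : Inv μ) {α : Type*} [Fintype α] {f : Conf A → α} (hf : FinMeas f) (n : ℤ) (a : α) :
    pr μ (fun x => f (shift n x)) a = pr μ f a := by
  conv_rhs => rw [← h n]
  rw [pr_map (measurable_shift n) hf]

lemma Inv.real (h : Inv μ) {s : Set (Conf A)} (hs : MeasurableSet s) (n : ℤ) :
    μ.real (shift n ⁻¹' s) = μ.real s := by
  conv_rhs => rw [← h n]
  rw [map_measureReal_apply (measurable_shift n) hs]

/-- Two families of coordinates carrying the same information have the same entropy. -/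
lemma Inv.ent_rs (h : Inv μ) (a b n : ℤ) :
    GibbsFormal.ent μ (rs (Finset.Ico (a + n) (b + n))) = GibbsFormal.ent μ (rs (Finset.Ico a b)) := by
  rw [← h.ent (finMeas_rs (Finset.Ico a b)) n]
  refine (ent_congr (finMeas_rs _) fun x y => ?_).symm
  rw [rs_eq_iff, rs_eq_iff]
  simp only [Finset.mem_Ico, GibbsFormal.shift]
  constructor
  · intro h i hi; exact h (i + n) (by omega)
  · intro h i hi; simpa using h (i - n) (by omega)

/-- The entropy of a window of length `n`. -/
def Hw (μ : Measure (Conf A)) (n : ℕ) : ℝ := GibbsFormal.ent μ (rs (Finset.Ico (0 : ℤ) n))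

/-- The conditional entropy of a symbol given the `n` previous ones. -/
def crate (μ : Measure (Conf A)) (n : ℕ) : ℝ := Hw μ (n + 1) - Hw μ n

/-- The entropy of a stationary process. -/
def hrate (μ : Measure (Conf A)) : ℝ := ⨅ n, crate μ n

lemma Hw_zero : Hw μ 0 = 0 := by
  rw [Hw, ent_congr (Y := fun _ : Conf A => ()) (finMeas_const ()), ent_const]
  intro x y; simp [rs_eq_iff]

lemma crate_nonneg (n : ℕ) : 0 ≤ crate μ n := by
  rw [crate, sub_nonneg]
  refine ent_mono (finMeas_rs _) fun x y => ?_
  rw [rs_eq_iff, rs_eq_iff]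
  intro h i hi; refine h i ?_
  simp only [Finset.mem_Ico] at hi ⊢; push_cast; omega

lemma Inv.crate_antitone (h : Inv μ) : Antitone (crate μ) := by
  refine antitone_nat_of_succ_le fun n => ?_
  have hX : FinMeas fun x : Conf A => x 0 :=
    Dep.finMeas (I := {0}) fun x y h => h 0 (by simp)
  have hY : FinMeas fun x : Conf A => x (n + 1) :=
    Dep.finMeas (I := {(n : ℤ) + 1}) fun x y h => h _ (by simp)
  have hs := ent_submod (μ := μ) hX hY (finMeas_rs (Finset.Ico (1 : ℤ) (n + 1)))
  have e1 : GibbsFormal.ent μ (fun x : Conf A => (x 0, x (n + 1), rs (Finset.Ico (1 : ℤ) (n + 1)) x))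
      = Hw μ (n + 2) := by
    refine ent_congr (finMeas_rs _) fun x y => ?_
    simp only [Prod.mk.injEq, rs_eq_iff, Finset.mem_Ico]
    push_cast
    constructor
    · intro h; exact ⟨h _ (by omega), h _ (by omega), fun i hi => h _ (by omega)⟩
    · rintro ⟨h0, h1, h2⟩ i hi
      rcases (show i = 0 ∨ i = n + 1 ∨ (1 ≤ i ∧ i < n + 1) by omega) with rfl | rfl | h'
      exacts [h0, h1, h2 i h']
  have e2 : GibbsFormal.ent μ (fun x : Conf A => (x 0, rs (Finset.Ico (1 : ℤ) (n + 1)) x))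
      = Hw μ (n + 1) := by
    refine ent_congr (finMeas_rs _) fun x y => ?_
    simp only [Prod.mk.injEq, rs_eq_iff, Finset.mem_Ico]
    push_cast
    constructor
    · intro h; exact ⟨h _ (by omega), fun i hi => h _ (by omega)⟩
    · rintro ⟨h0, h2⟩ i hi
      rcases (show i = 0 ∨ (1 ≤ i ∧ i < n + 1) by omega) with rfl | h'
      exacts [h0, h2 i h']
  have e3 : GibbsFormal.ent μ (fun x : Conf A => (x (n + 1), rs (Finset.Ico (1 : ℤ) (n + 1)) x))
      = Hw μ (n + 1) := by
    rw [Hw, ← h.ent_rs 0 _ 1]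
    refine ent_congr (finMeas_rs _) fun x y => ?_
    simp only [Prod.mk.injEq, rs_eq_iff, Finset.mem_Ico]
    push_cast
    constructor
    · intro h; exact ⟨h _ (by omega), fun i hi => h _ (by omega)⟩
    · rintro ⟨h0, h2⟩ i hi
      rcases (show i = n + 1 ∨ (1 ≤ i ∧ i < n + 1) by omega) with rfl | h'
      exacts [h0, h2 i h']
  have e4 : GibbsFormal.ent μ (rs (A := A) (Finset.Ico (1 : ℤ) (n + 1))) = Hw μ n := by
    rw [Hw, ← h.ent_rs 0 _ 1, zero_add]
  rw [e1, e2, e3, e4] at hs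
  simp only [crate]; linarith

lemma hrate_le (n : ℕ) : hrate μ ≤ crate μ n :=
  ciInf_le ⟨0, by rintro _ ⟨n, rfl⟩; exact crate_nonneg n⟩ n

lemma hrate_nonneg : 0 ≤ hrate μ := le_ciInf fun n => crate_nonneg n

lemma Hw_add (m n : ℕ) : Hw μ (m + n) = Hw μ m + ∑ i ∈ Finset.range n, crate μ (m + i) := by
  induction n with
  | zero => simp
  | succ n ih => rw [Finset.sum_range_succ, ← add_assoc, crate, ← add_assoc, ih]; ring

lemma mul_hrate_le (n : ℕ) : n * hrate μ ≤ Hw μ n := by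
  have := Hw_add (μ := μ) 0 n
  rw [Hw_zero, zero_add, zero_add] at this
  rw [this]
  have := Finset.card_nsmul_le_sum (Finset.range n) (fun i => crate μ (0 + i)) (hrate μ)
    fun i _ => hrate_le _
  simpa using this

lemma add_mul_hrate_le (m n : ℕ) : Hw μ m + n * hrate μ ≤ Hw μ (m + n) := by
  rw [Hw_add]
  have := Finset.card_nsmul_le_sum (Finset.range n) (fun i => crate μ (m + i)) (hrate μ)
    fun i _ => hrate_le _
  simpa using this

lemma Inv.Hw_add_le (h : Inv μ) (m n : ℕ) : Hw μ (m + n) ≤ Hw μ m + n * crate μ m := by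
  rw [Hw_add]
  have := Finset.sum_le_card_nsmul (Finset.range n) (fun i => crate μ (m + i)) (crate μ m)
    fun i _ => h.crate_antitone (by omega)
  simp only [Finset.card_range, nsmul_eq_mul] at this
  linarith

lemma Inv.exists_crate_le (h : Inv μ) {ε : ℝ} (hε : 0 < ε) :
    ∃ m0, ∀ m ≥ m0, crate μ m ≤ hrate μ + ε := by
  obtain ⟨m0, hm⟩ := exists_lt_of_ciInf_lt (show ⨅ n, crate μ n < hrate μ + ε by
    rw [← hrate]; linarith)
  exact ⟨m0, fun m hm' => (h.crate_antitone hm').trans hm.le⟩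

lemma Inv.le_hrate (h : Inv μ) {b C : ℝ} (hb : ∀ k : ℕ, k * b - C ≤ Hw μ k) : b ≤ hrate μ := by
  refine le_ciInf fun m => ?_
  by_contra! hlt
  obtain ⟨n, hn⟩ := exists_nat_gt ((Hw μ m + C - m * b) / (b - crate μ m))
  rw [div_lt_iff₀ (by linarith)] at hn
  have h1 := h.Hw_add_le m n
  have h2 := hb (m + n)
  push_cast at h2
  nlinarith

end Stationary

/-! ### Uniform mixing and finite determination -/

section Tvp

variable {Ω : Type*} [MeasurableSpace Ω] {α β γ : Type*} [Fintype α] [Fintype β] [Fintype γ]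

/-- The distance between the joint law of `(P, C)` and the product of the law of `P` with `κ`. -/
def tvp (μ : Measure Ω) (P : Ω → α) (C : Ω → γ) (κ : γ → ℝ) : ℝ :=
  ∑ c, ∑ a, |pr μ (fun ω => (P ω, C ω)) (a, c) - pr μ P a * κ c|

variable {μ : Measure Ω} [IsProbabilityMeasure μ]

lemma sum_pr_left {P : Ω → α} {C : Ω → γ} (hP : FinMeas P) (hC : FinMeas C) (c : γ) :
    ∑ a, pr μ (fun ω => (P ω, C ω)) (a, c) = pr μ C c := by
  classical
  have := pr_comp (μ := μ) (hP.pair hC) (fun t => t.2) c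
  rw [this, Fintype.sum_prod_type]
  simp

lemma sum_pr_right {P : Ω → α} {C : Ω → γ} (hP : FinMeas P) (hC : FinMeas C) (a : α) :
    ∑ c, pr μ (fun ω => (P ω, C ω)) (a, c) = pr μ P a := by
  classical
  have := pr_comp (μ := μ) (hP.pair hC) (fun t => t.1) a
  rw [this, Fintype.sum_prod_type_right]
  simp

lemma exists_factor [Nonempty Ω] {P : Ω → α} {Q : Ω → β} (h : ∀ ω ω', Q ω = Q ω' → P ω = P ω') :
    ∃ f : β → α, ∀ ω, P ω = f (Q ω) :=
  ⟨Function.extend Q P fun _ => P (Classical.arbitrary _), fun ω =>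
    (Function.FactorsThrough.extend_apply (fun a b hab => h a b hab) _ ω).symm⟩

lemma nonempty_of_prob (μ : Measure Ω) [IsProbabilityMeasure μ] : Nonempty Ω :=
  μ.nonempty_of_neZero

lemma tvp_mono {P : Ω → α} {Q : Ω → β} {C : Ω → γ} (hQ : FinMeas Q) (hC : FinMeas C) (κ : γ → ℝ)
    (h : ∀ ω ω', Q ω = Q ω' → P ω = P ω') : tvp μ P C κ ≤ tvp μ Q C κ := by
  classical
  have := nonempty_of_prob μ
  obtain ⟨f, hf⟩ := exists_factor h
  obtain rfl : P = fun ω => f (Q ω) := funext hf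
  refine sum_le_sum fun c _ => ?_
  have h1 : ∀ a, pr μ (fun ω => (f (Q ω), C ω)) (a, c) - pr μ (fun ω => f (Q ω)) a * κ c =
      ∑ b, if f b = a then pr μ (fun ω => (Q ω, C ω)) (b, c) - pr μ Q b * κ c else 0 := fun a => by
    rw [pr_comp (hQ.pair hC) (fun t => (f t.1, t.2)), pr_comp hQ f, sum_mul,
      Fintype.sum_prod_type, ← sum_sub_distrib]
    refine sum_congr rfl fun b _ => ?_
    by_cases hb : f b = a <;> simp [hb]
  simp only [h1]
  calc _ ≤ ∑ a, ∑ b, if f b = a then |pr μ (fun ω => (Q ω, C ω)) (b, c) - pr μ Q b * κ c| else 0 :=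
        sum_le_sum fun a _ => (Finset.abs_sum_le_sum_abs _ _).trans
          (sum_le_sum fun b _ => by split_ifs <;> simp)
    _ = _ := by
        rw [sum_comm]
        simp

/-- Splitting the dependence of `C` on `(Y, Z)` into the dependence on `Z` and a conditional
mutual information. -/
lemma tvp_pair_le {X : Ω → α} {Y : Ω → β} {Z : Ω → γ} (hX : FinMeas X) (hY : FinMeas Y)
    (hZ : FinMeas Z) (κ : α → ℝ) {I : ℝ} (hI : 4 * (ent μ (fun ω => (X ω, Z ω))
      + ent μ (fun ω => (Y ω, Z ω)) - ent μ (fun ω => (X ω, Y ω, Z ω)) - ent μ Z) ≤ I ^ 2)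
    (hI0 : 0 ≤ I) : tvp μ (fun ω => (Y ω, Z ω)) X κ ≤ I + tvp μ Z X κ := by
  have h1 := abs_le_of_sq_le_sq ((cmi_pinsker (μ := μ) hX hY hZ).trans hI) hI0
  refine le_trans ?_ (add_le_add ((le_abs_self _).trans h1) le_rfl)
  rw [tvp, tvp, ← sum_add_distrib]
  refine sum_le_sum fun x _ => ?_
  have h2 : ∀ z, |pr μ (fun ω => (Z ω, X ω)) (z, x) - pr μ Z z * κ x| =
      ∑ y, pr μ (fun ω => (Y ω, Z ω)) (y, z) / pr μ Z z *
        |pr μ (fun ω => (X ω, Z ω)) (x, z) - pr μ Z z * κ x| := fun z => by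
    have e : pr μ (fun ω => (Z ω, X ω)) (z, x) = pr μ (fun ω => (X ω, Z ω)) (x, z) := by
      simp only [pr]; congr 1; ext ω; simp [and_comm]
    rw [e, ← sum_mul, ← sum_div, sum_pr_left hY hZ]
    rcases (pr_nonneg μ Z z).eq_or_lt with h0 | h0
    · have := pr_le_comp (μ := μ) (X := fun ω => (X ω, Z ω)) (fun t => t.2) (x, z)
      simp only [← h0] at this
      simp [← h0, le_antisymm this (pr_nonneg ..)]
    · field_simp
  simp only [h2]
  rw [sum_comm (s := (Finset.univ : Finset γ)), ← sum_add_distrib,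
    Fintype.sum_prod_type]
  refine sum_le_sum fun y _ => ?_
  rw [← sum_add_distrib]
  refine sum_le_sum fun z _ => ?_
  have e : pr μ (fun ω => ((Y ω, Z ω), X ω)) ((y, z), x) =
      pr μ (fun ω => (X ω, Y ω, Z ω)) (x, y, z) := by
    simp only [pr]; congr 1; ext ω; simp [and_comm]
  rw [e]
  set p := pr μ (fun ω => (X ω, Y ω, Z ω)) (x, y, z)
  set q := pr μ (fun ω => (Y ω, Z ω)) (y, z) with hq
  have hq0 : 0 ≤ q := pr_nonneg ..
  have hz0 : 0 ≤ pr μ Z z := pr_nonneg ..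
  rw [← abs_of_nonneg (div_nonneg hq0 hz0), ← abs_mul]
  refine le_trans (le_of_eq ?_) (abs_add_le _ _)
  congr 1
  rcases hz0.eq_or_lt with h0 | h0
  · have := pr_le_comp (μ := μ) (X := fun ω => (Y ω, Z ω)) (fun t => t.2) (y, z)
    simp only [← h0] at this
    have h3 : q = 0 := le_antisymm this hq0
    simp [h3, ← h0]
  · field_simp; ring

end Tvp

section UM

variable {A : Type} [Fintype A] [MeasurableSpace A] [MeasurableSingletonClass A]

/-- Uniform mixing: the future beyond a gap is almost independent of every past event. -/
def UM (μ : Measure (Conf A)) : Prop := ∀ δ > 0, ∃ g : ℕ, ∀ (k m : ℕ) (P C : Set (Conf A)),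
  Dep (Ico (-(k : ℤ)) 0) (· ∈ P) → Dep (Ico (g : ℤ) (g + m)) (· ∈ C) →
    |μ.real (P ∩ C) - μ.real P * μ.real C| ≤ δ * μ.real P

/-- Beyond a gap of length `g`, the future is almost independent of each past event. -/
def MixGap (μ : Measure (Conf A)) (g : ℕ) (δ : ℝ) : Prop :=
  ∀ (k m : ℕ) {α γ : Type} [Fintype α] [Fintype γ] (P : Conf A → α) (C : Conf A → γ),
    Dep (Ico (-(k : ℤ)) 0) P → Dep (Ico (g : ℤ) (g + m)) C →
    ∀ a, ∑ c, |pr μ (fun ω => (P ω, C ω)) (a, c) - pr μ P a * pr μ C c| ≤ δ * pr μ P a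

lemma MixGap.event {μ : Measure (Conf A)} {g : ℕ} {δ : ℝ} (h : MixGap μ g δ) {k m : ℕ}
    {P C : Set (Conf A)} (hP : Dep (Ico (-(k : ℤ)) 0) (· ∈ P)) (hC : Dep (Ico (g : ℤ) (g + m)) (· ∈ C)) :
    |μ.real (P ∩ C) - μ.real P * μ.real C| ≤ δ * μ.real P := by
  simpa [pr, preimage, ofPred_and] using
    (single_le_sum (fun _ _ => abs_nonneg _) (Finset.mem_univ True)).trans (h k m _ _ hP hC True)

variable {μ : Measure (Conf A)} [IsProbabilityMeasure μ]

lemma UM.exists_gap (h : UM μ) {δ : ℝ} (hδ : 0 < δ) :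
    ∃ g : ℕ, MixGap μ g δ := by
  classical
  obtain ⟨g, hg⟩ := h (δ / 2) (half_pos hδ)
  refine ⟨g, fun k m α γ _ _ P C hP hC a => ?_⟩
  have hPm : FinMeas P := Dep.finMeas (I := Finset.Ico (-(k : ℤ)) 0) (by simpa using hP)
  have hCm : FinMeas C := Dep.finMeas (I := Finset.Ico (g : ℤ) (g + m)) (by simpa using hC)
  set d : γ → ℝ := fun c => pr μ (fun ω => (P ω, C ω)) (a, c) - pr μ P a * pr μ C c with hd
  have key : ∀ s : Finset γ, |∑ c ∈ s, d c| ≤ δ / 2 * pr μ P a := fun s => by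
    have h1 := hg k m (P ⁻¹' {a}) (C ⁻¹' s) (hP.comp (· = a)) (hC.comp (· ∈ s))
    have e1 : μ.real (C ⁻¹' s) = ∑ c ∈ s, pr μ C c := by
      rw [measureReal_preimage hCm]; simp
    have e2 : μ.real (P ⁻¹' {a} ∩ C ⁻¹' s) = ∑ c ∈ s, pr μ (fun ω => (P ω, C ω)) (a, c) := by
      have : P ⁻¹' {a} ∩ C ⁻¹' s = (fun ω => (P ω, C ω)) ⁻¹' {t | t.1 = a ∧ t.2 ∈ s} := by
        ext; simp
      rw [this, measureReal_preimage (hPm.pair hCm), Fintype.sum_prod_type_right,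
        ← Finset.sum_subset (Finset.subset_univ s)]
      · refine sum_congr rfl fun c hc => ?_
        simp [hc]
      · intro c _ hc; simp [hc]
    rw [e1, e2, mul_sum, ← sum_sub_distrib] at h1
    exact h1
  have h1 := key (Finset.univ.filter fun c => 0 ≤ d c)
  have h2 := key (Finset.univ.filter fun c => ¬ 0 ≤ d c)
  calc ∑ c, |d c| = ∑ c with 0 ≤ d c, d c - ∑ c with ¬ 0 ≤ d c, d c := by
        rw [← Finset.sum_filter_add_sum_filter_not _ (fun c => 0 ≤ d c), sub_eq_add_neg,
          ← Finset.sum_neg_distrib]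
        congr 1
        · exact sum_congr rfl fun c hc => abs_of_nonneg (by simpa using hc)
        · exact sum_congr rfl fun c hc => abs_of_neg (by simpa using hc)
    _ ≤ _ := by linarith [(abs_le.1 h1).2, (abs_le.1 h2).1]

lemma UM.exists_gap_tvp (h : UM μ) {δ : ℝ} (hδ : 0 < δ) :
    ∃ g : ℕ, ∀ (k m : ℕ) {α γ : Type} [Fintype α] [Fintype γ] (P : Conf A → α) (C : Conf A → γ),
      Dep (Ico (-(k : ℤ)) 0) P → Dep (Ico (g : ℤ) (g + m)) C → tvp μ P C (pr μ C) ≤ δ := by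
  obtain ⟨g, hg⟩ := h.exists_gap hδ
  refine ⟨g, fun k m α γ _ _ P C hP hC => ?_⟩
  have hPm : FinMeas P := Dep.finMeas (I := Finset.Ico (-(k : ℤ)) 0) (by simpa using hP)
  rw [tvp, sum_comm]
  refine (sum_le_sum fun a _ => hg k m P C hP hC a).trans ?_
  rw [← mul_sum, sum_pr hPm, mul_one]

lemma ent_shift_rs (hμ : Inv μ) {a b : ℤ} {n : ℕ} (h : b = a + n) :
    ent μ (rs (A := A) (Finset.Ico a b)) = Hw μ n := by
  rw [Hw, ← hμ.ent_rs 0 n a, h, zero_add, add_comm]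

/-- Convergence of all finite-dimensional distributions. -/
def TendstoFdd {ι : Type*} (l : Filter ι) (ν' : ι → Measure (Conf A)) (ν : Measure (Conf A)) : Prop :=
  ∀ (I : Finset ℤ) (a : I → A), Tendsto (fun i => pr (ν' i) (rs I) a) l (nhds (pr ν (rs I) a))

lemma TendstoFdd.pr {ι : Type*} {l : Filter ι} {ν' : ι → Measure (Conf A)} {ν : Measure (Conf A)}
    [IsProbabilityMeasure ν] [∀ i, IsProbabilityMeasure (ν' i)]
    (h : TendstoFdd l ν' ν) {α : Type*} [Fintype α] {I : Finset ℤ} {f : Conf A → α}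
    (hf : Dep (I : Set ℤ) f) (a : α) :
    Tendsto (fun i => pr (ν' i) f a) l (nhds (GibbsFormal.pr ν f a)) := by
  classical
  have := nonempty_of_prob ν
  obtain ⟨φ, hφ⟩ := exists_factor (P := f) (Q := rs I) fun x y hxy => hf x y (rs_eq_iff.1 hxy)
  obtain rfl : f = fun x => φ (rs I x) := funext hφ
  simp only [pr_comp (finMeas_rs I)]
  refine tendsto_finsetSum _ fun b _ => ?_
  split_ifs
  exacts [h I b, tendsto_const_nhds]

lemma TendstoFdd.ent {ι : Type*} {l : Filter ι} {ν' : ι → Measure (Conf A)} {ν : Measure (Conf A)}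
    (h : TendstoFdd l ν' ν) (I : Finset ℤ) :
    Tendsto (fun i => ent (ν' i) (rs I)) l (nhds (GibbsFormal.ent ν (rs I))) :=
  tendsto_finsetSum _ fun a _ => (Real.continuous_negMulLog.tendsto _).comp (h I a)

/-- Uniformly mixing processes are finitely determined. -/
lemma finitely_determined {ν : Measure (Conf A)} [IsProbabilityMeasure ν] (hν : Inv ν) (hUM : UM ν)
    {ε : ℝ} (hε : 0 < ε) : ∃ g : ℕ, ∀ (n : ℕ) {ι : Type} (l : Filter ι) (ν' : ι → Measure (Conf A))
      [∀ i, IsProbabilityMeasure (ν' i)], (∀ i, Inv (ν' i)) → TendstoFdd l ν' ν →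
      (∀ η > 0, ∀ᶠ i in l, hrate ν - η ≤ hrate (ν' i)) →
      ∀ᶠ i in l, ∀ M : ℕ, tvp (ν' i) (rs (Finset.Ico (-(M : ℤ)) 0))
        (rs (Finset.Ico (g : ℤ) (g + n))) (pr ν (rs (Finset.Ico (g : ℤ) (g + n)))) ≤ ε := by
  obtain ⟨g, hg⟩ := hUM.exists_gap_tvp (half_pos (half_pos hε))
  refine ⟨g, fun n ι l ν' _ hinv hfdd hent => ?_⟩
  set N := g + n with hN
  set e := ε ^ 2 / 64 / (N + 1) with he
  have he0 : 0 < e := by positivity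
  obtain ⟨m, hm⟩ := hν.exists_crate_le he0
  have hcr := hν.Hw_add_le m N
  have hcm := hm m le_rfl
  have hH : ∀ k, Tendsto (fun i => Hw (ν' i) k) l (nhds (Hw ν k)) := fun k => hfdd.ent _
  have h1 := ((hH (m + N)).sub (hH m)).eventually (gt_mem_nhds (lt_add_of_pos_right _ he0))
  set C := rs (A := A) (Finset.Ico (g : ℤ) (g + n)) with hC
  set Z := rs (A := A) (Finset.Ico (-(m : ℤ)) 0) with hZ
  have hZm : FinMeas Z := finMeas_rs _
  have hCm : FinMeas C := finMeas_rs _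
  have h2 : ∀ᶠ i in l, tvp (ν' i) Z C (pr ν C) < ε / 2 := by
    have ht : Tendsto (fun i => tvp (ν' i) Z C (pr ν C)) l (nhds (tvp ν Z C (pr ν C))) := by
      refine tendsto_finsetSum _ fun c _ => tendsto_finsetSum _ fun a _ => Tendsto.abs ?_
      refine (hfdd.pr (I := Finset.Ico (-(m : ℤ)) (g + n)) ?_ _).sub ((hfdd _ _).mul_const _)
      intro x y h
      simp only [hZ, hC, Prod.mk.injEq, rs_eq_iff]
      simp only [Finset.coe_Ico, mem_Ico, Finset.mem_Ico] at h ⊢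
      exact ⟨fun i hi => h i (by omega), fun i hi => h i (by omega)⟩
    refine ht.eventually (gt_mem_nhds (lt_of_le_of_lt (hg m n Z C ?_ ?_) (by linarith)))
    · simpa using dep_rs (A := A) (Finset.Ico (-(m : ℤ)) 0)
    · simpa using dep_rs (A := A) (Finset.Ico (g : ℤ) (g + n))
  filter_upwards [h1, h2, hent e he0] with i h1 h2 h3 M
  set M' := m + M with hM'
  set Y := rs (A := A) (Finset.Ico (-(M' : ℤ)) (-m)) with hY
  have hYm : FinMeas Y := finMeas_rs _
  have hi := hinv i
  refine (tvp_mono (Q := fun ω => (Y ω, Z ω)) (hYm.pair hZm) hCm _ ?_).trans ?_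
  · intro x y h
    simp only [hY, hZ, Prod.mk.injEq, rs_eq_iff, Finset.mem_Ico] at h ⊢
    intro i hi
    by_cases h' : i < -m
    exacts [h.1 i ⟨by omega, h'⟩, h.2 i (by omega)]
  · have h4 := tvp_pair_le (μ := ν' i) hCm hYm hZm (pr ν C) (I := ε / 2) ?_ (by positivity)
    · linarith
    set X := rs (A := A) (Finset.Ico 0 (g + n : ℤ)) with hX
    have hXm : FinMeas X := finMeas_rs _
    have h5 := ent_submod (μ := ν' i) hXm hYm (hCm.pair hZm)
    have e1 : ent (ν' i) (fun x => (X x, Y x, C x, Z x)) = Hw (ν' i) (M' + N) := by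
      rw [← ent_shift_rs hi (a := -M') (b := g + n) (by push_cast [hN]; ring)]
      refine ent_congr (finMeas_rs _) fun x y => ?_
      simp only [hX, hY, hZ, hC, Prod.mk.injEq, rs_eq_iff, Finset.mem_Ico]
      constructor
      · intro h
        exact ⟨fun i hi => h i (by omega), fun i hi => h i (by omega), fun i hi => h i (by omega),
          fun i hi => h i (by omega)⟩
      · rintro ⟨h0, h1, h2, h3⟩ i hi
        by_cases h' : 0 ≤ i
        · exact h0 i (by omega)
        · by_cases h'' : -m ≤ i
          exacts [h3 i (by omega), h1 i (by omega)]
    have e2 : ent (ν' i) (fun x => (X x, C x, Z x)) = Hw (ν' i) (m + N) := by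
      rw [← ent_shift_rs hi (a := -m) (b := g + n) (by push_cast [hN]; ring)]
      refine ent_congr (finMeas_rs _) fun x y => ?_
      simp only [hX, hZ, hC, Prod.mk.injEq, rs_eq_iff, Finset.mem_Ico]
      constructor
      · intro h
        exact ⟨fun i hi => h i (by omega), fun i hi => h i (by omega), fun i hi => h i (by omega)⟩
      · rintro ⟨h0, h1, h2⟩ i hi
        by_cases h' : 0 ≤ i
        exacts [h0 i (by omega), h2 i (by omega)]
    have e3 : ent (ν' i) (fun x => (Y x, Z x)) = Hw (ν' i) M' := by
      rw [← ent_shift_rs hi (a := -M') (b := 0) (by ring)]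
      refine ent_congr (finMeas_rs _) fun x y => ?_
      simp only [hY, hZ, Prod.mk.injEq, rs_eq_iff, Finset.mem_Ico]
      constructor
      · intro h
        exact ⟨fun i hi => h i (by omega), fun i hi => h i (by omega)⟩
      · rintro ⟨h0, h1⟩ i hi
        by_cases h' : -m ≤ i
        exacts [h1 i (by omega), h0 i (by omega)]
    have e4 : ent (ν' i) Z = Hw (ν' i) m := ent_shift_rs hi (by ring)
    have e5 : ent (ν' i) (fun x => (Y x, C x, Z x)) = ent (ν' i) (fun x => (C x, Y x, Z x)) := by
      refine ent_congr (hCm.pair (hYm.pair hZm)) fun x y => ?_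
      simp only [Prod.mk.injEq]; tauto
    have h6 := add_mul_hrate_le (μ := ν' i) M' N
    have h7 : e * (N + 1) = ε ^ 2 / 64 := by rw [he]; field_simp
    have h8 : (N : ℝ) * (hrate ν - e) ≤ N * hrate (ν' i) := by gcongr
    have h9 : (N : ℝ) * crate ν m ≤ N * (hrate ν + e) := by gcongr
    rw [e1, e2, e5] at h5
    rw [e3, e4]
    nlinarith

end UM

/-! ### Finite couplings -/

section Coupling

variable {α β V : Type*} [Fintype α] [Fintype β] [Fintype V] [DecidableEq V]

/-- The image of a weight vector. -/
def push (f : α → V) (p : α → ℝ) (v : V) : ℝ := ∑ a, if f a = v then p a else 0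

lemma push_nonneg {f : α → V} {p : α → ℝ} (hp : ∀ a, 0 ≤ p a) (v : V) : 0 ≤ push f p v :=
  sum_nonneg fun a _ => by split_ifs; exacts [hp a, le_rfl]

lemma le_push {f : α → V} {p : α → ℝ} (hp : ∀ a, 0 ≤ p a) (a : α) : p a ≤ push f p (f a) := by
  have := single_le_sum (f := fun b => if f b = f a then p b else 0)
    (fun b _ => by split_ifs; exacts [hp b, le_rfl]) (Finset.mem_univ a)
  simpa [push] using this

lemma mul_push (f : α → V) (p : α → ℝ) (c : ℝ) (v : V) :
    c * push f p v = ∑ a, if f a = v then c * p a else 0 := by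
  rw [push, mul_sum]
  exact sum_congr rfl fun a _ => by split_ifs <;> simp

lemma sum_push_mul (f : α → V) (p : α → ℝ) (w : V → ℝ) :
    ∑ v, push f p v * w v = ∑ a, p a * w (f a) := by
  simp only [push, sum_mul]
  rw [sum_comm]
  simp

lemma sum_push (f : α → V) (p : α → ℝ) : ∑ v, push f p v = ∑ a, p a := by
  simpa using sum_push_mul f p fun _ => 1

/-- The maximal coupling of two weight vectors with respect to a pair of observables. -/
lemma exists_max_coupling (f : α → V) (f' : β → V) (p : α → ℝ) (q : β → ℝ) (hp : ∀ a, 0 ≤ p a)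
    (hq : ∀ b, 0 ≤ q b) (hpq : ∑ a, p a = ∑ b, q b) :
    ∃ m : α → β → ℝ, (∀ a b, 0 ≤ m a b) ∧ (∀ a, ∑ b, m a b = p a) ∧ (∀ b, ∑ a, m a b = q b) ∧
      ∑ a, ∑ b, (if f a = f' b then 0 else m a b) ≤ (∑ v, |push f p v - push f' q v|) / 2 := by
  set P := push f p with hP
  set Q := push f' q with hQ
  have hP0 : ∀ v, 0 ≤ P v := push_nonneg hp
  have hQ0 : ∀ v, 0 ≤ Q v := push_nonneg hq
  set D : V → ℝ := fun v => min (P v) (Q v) with hD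
  have hD0 : ∀ v, 0 ≤ D v := fun v => le_min (hP0 v) (hQ0 v)
  set ρ := ∑ v, (P v - D v) with hρ
  have hPe : ∑ v, P v = ∑ a, p a := sum_push f p
  have hQe : ∑ v, Q v = ∑ b, q b := sum_push f' q
  have hρ' : ρ = ∑ v, (Q v - D v) := by
    rw [hρ, sum_sub_distrib, sum_sub_distrib, hPe, hQe, hpq]
  set R : α → ℝ := fun a => p a * (1 - D (f a) / P (f a)) with hR
  set R' : β → ℝ := fun b => q b * (1 - D (f' b) / Q (f' b)) with hR'
  have hR0 : ∀ a, 0 ≤ R a := fun a => mul_nonneg (hp a) (sub_nonneg.2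
    (div_le_one_of_le₀ (min_le_left _ _) (hP0 _)))
  have hR'0 : ∀ b, 0 ≤ R' b := fun b => mul_nonneg (hq b) (sub_nonneg.2
    (div_le_one_of_le₀ (min_le_right _ _) (hQ0 _)))
  have hRs : ∑ a, R a = ρ := by
    rw [hρ, ← sum_push_mul f p fun v => 1 - D v / P v]
    refine sum_congr rfl fun v _ => ?_
    rcases (hP0 v).eq_or_lt with h | h
    · have : D v = 0 := le_antisymm (h ▸ min_le_left _ _) (hD0 v)
      rw [← hP, ← h, this]; simp
    · rw [← hP]; field_simp
  have hRs' : ∑ b, R' b = ρ := by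
    rw [hρ', ← sum_push_mul f' q fun v => 1 - D v / Q v]
    refine sum_congr rfl fun v _ => ?_
    rcases (hQ0 v).eq_or_lt with h | h
    · have : D v = 0 := le_antisymm (h ▸ min_le_right _ _) (hD0 v)
      rw [← hQ, ← h, this]; simp
    · rw [← hQ]; field_simp
  have hρ0 : 0 ≤ ρ := hRs ▸ sum_nonneg fun a _ => hR0 a
  have hcancel : ∀ x, 0 ≤ x → x ≤ ρ → x * ρ / ρ = x := fun x h0 h1 => by
    rcases hρ0.eq_or_lt with h | h
    · rw [← h] at h1 ⊢; simp [le_antisymm h1 h0]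
    · field_simp
  have hRle : ∀ a, R a ≤ ρ := fun a =>
    hRs ▸ single_le_sum (fun a _ => hR0 a) (Finset.mem_univ a)
  have hRle' : ∀ b, R' b ≤ ρ := fun b =>
    hRs' ▸ single_le_sum (fun b _ => hR'0 b) (Finset.mem_univ b)
  refine ⟨fun a b => (if f a = f' b then D (f a) * (p a / P (f a)) * (q b / Q (f a)) else 0) +
    R a * R' b / ρ, fun a b => ?_, fun a => ?_, fun b => ?_, ?_⟩
  · refine add_nonneg ?_ (div_nonneg (mul_nonneg (hR0 a) (hR'0 b)) hρ0)
    split_ifs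
    · exact mul_nonneg (mul_nonneg (hD0 _) (div_nonneg (hp a) (hP0 _)))
        (div_nonneg (hq b) (hQ0 _))
    · exact le_rfl
  · rw [sum_add_distrib, ← sum_div, ← mul_sum, hRs', hcancel _ (hR0 a) (hRle a)]
    have : ∑ b, (if f a = f' b then D (f a) * (p a / P (f a)) * (q b / Q (f a)) else 0)
        = D (f a) * (p a / P (f a)) * (Q (f a) / Q (f a)) := by
      rw [show D (f a) * (p a / P (f a)) * (Q (f a) / Q (f a)) =
        D (f a) * (p a / P (f a)) / Q (f a) * Q (f a) by ring]
      nth_rewrite 3 [hQ]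
      rw [mul_push]
      refine sum_congr rfl fun b _ => ?_
      by_cases h : f a = f' b
      · simp only [h, if_true]; ring
      · simp [h, Ne.symm h]
    rw [this]
    rcases (hQ0 (f a)).eq_or_lt with h | h
    · have h' : D (f a) = 0 := le_antisymm (h ▸ min_le_right _ _) (hD0 _)
      simp [hR, h']
    · rw [div_self h.ne', hR]; ring
  · rw [sum_add_distrib, ← sum_div, ← sum_mul, hRs, mul_comm ρ,
      hcancel _ (hR'0 b) (hRle' b)]
    have : ∑ a, (if f a = f' b then D (f a) * (p a / P (f a)) * (q b / Q (f a)) else 0)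
        = D (f' b) * (P (f' b) / P (f' b)) * (q b / Q (f' b)) := by
      rw [show ∀ c x y z : ℝ, c * (x / y) * z = c / y * z * x by intros; ring, hP, mul_push]
      refine sum_congr rfl fun a _ => ?_
      by_cases h : f a = f' b
      · simp only [h, if_true]; ring
      · simp [h]
    rw [this]
    rcases (hP0 (f' b)).eq_or_lt with h | h
    · have h' : D (f' b) = 0 := le_antisymm (h ▸ min_le_left _ _) (hD0 _)
      simp [hR', h']
    · rw [div_self h.ne', hR']; ring
  · calc _ ≤ ∑ a, ∑ b, R a * R' b / ρ := by
          refine sum_le_sum fun a _ => sum_le_sum fun b _ => ?_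
          split_ifs with h
          · exact div_nonneg (mul_nonneg (hR0 a) (hR'0 b)) hρ0
          · simp [h]
      _ = ρ := by
          simp only [← sum_div, ← mul_sum, hRs', ← sum_mul, hRs]
          exact hcancel ρ hρ0 le_rfl
      _ = _ := by
          rw [eq_div_iff two_ne_zero, mul_two]
          nth_rewrite 1 [hρ]
          rw [hρ', ← sum_add_distrib]
          refine sum_congr rfl fun v _ => ?_
          simp only [hD]
          rcases le_total (P v) (Q v) with h | h
          · rw [min_eq_left h, abs_of_nonpos (by linarith)]; ring
          · rw [min_eq_right h, abs_of_nonneg (by linarith)]; ring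

end Coupling

section Extend

variable {α β α' β' V : Type*} [Fintype α] [Fintype β] [Fintype α'] [Fintype β'] [Fintype V]
  [DecidableEq V] [DecidableEq α] [DecidableEq β]

/-- A coupling of factors extends to a coupling, almost synchronising two observables which
are almost independent of these factors. -/
lemma exists_extend_coupling (ψ : α' → α) (ψ' : β' → β) (f : α' → V) (f' : β' → V)
    (p : α' → ℝ) (q : β' → ℝ) (hp : ∀ a, 0 ≤ p a) (hq : ∀ b, 0 ≤ q b) (κ : V → ℝ)
    (r : α → β → ℝ) (hr : ∀ a b, 0 ≤ r a b) (hr1 : ∀ a, ∑ b, r a b = push ψ p a)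
    (hr2 : ∀ b, ∑ a, r a b = push ψ' q b) {ε : ℝ}
    (h1 : ∑ v, ∑ a, |(∑ u, if ψ u = a ∧ f u = v then p u else 0) - push ψ p a * κ v| ≤ ε)
    (h2 : ∑ v, ∑ b, |(∑ u, if ψ' u = b ∧ f' u = v then q u else 0) - push ψ' q b * κ v| ≤ ε) :
    ∃ r' : α' → β' → ℝ, (∀ u v, 0 ≤ r' u v) ∧ (∀ u, ∑ v, r' u v = p u) ∧
      (∀ v, ∑ u, r' u v = q v) ∧
      (∀ F : α → β → ℝ, ∑ u, ∑ v, r' u v * F (ψ u) (ψ' v) = ∑ a, ∑ b, r a b * F a b) ∧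
      ∑ u, ∑ v, (if f u = f' v then 0 else r' u v) ≤ ε := by
  classical
  set p₁ := push ψ p with hp₁
  set q₁ := push ψ' q with hq₁
  have hp₁0 : ∀ a, 0 ≤ p₁ a := push_nonneg hp
  have hq₁0 : ∀ b, 0 ≤ q₁ b := push_nonneg hq
  have hrp : ∀ a b, p₁ a = 0 → r a b = 0 := fun a b h => by
    have := hr1 a
    rw [h, sum_eq_zero_iff_of_nonneg fun b _ => hr a b] at this
    exact this b (Finset.mem_univ b)
  have hrq : ∀ a b, q₁ b = 0 → r a b = 0 := fun a b h => by
    have := hr2 b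
    rw [h, sum_eq_zero_iff_of_nonneg fun a _ => hr a b] at this
    exact this a (Finset.mem_univ a)
  set P : α → β → α' → ℝ := fun a b u => if ψ u = a then r a b / p₁ a * p u else 0 with hP
  set Q : α → β → β' → ℝ := fun a b u => if ψ' u = b then r a b / q₁ b * q u else 0 with hQ
  have hPs : ∀ a b, ∑ u, P a b u = r a b := fun a b => by
    have : ∑ u, P a b u = r a b / p₁ a * p₁ a := by
      rw [hp₁, mul_push]
    rw [this]
    by_cases h : p₁ a = 0
    · rw [h, hrp a b h]; simp
    · field_simp
  have hQs : ∀ a b, ∑ u, Q a b u = r a b := fun a b => by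
    have : ∑ u, Q a b u = r a b / q₁ b * q₁ b := by
      rw [hq₁, mul_push]
    rw [this]
    by_cases h : q₁ b = 0
    · rw [h, hrq a b h]; simp
    · field_simp
  have hP0 : ∀ a b u, 0 ≤ P a b u := fun a b u => by
    simp only [hP]; split_ifs
    exacts [mul_nonneg (div_nonneg (hr a b) (hp₁0 a)) (hp u), le_rfl]
  have hQ0 : ∀ a b u, 0 ≤ Q a b u := fun a b u => by
    simp only [hQ]; split_ifs
    exacts [mul_nonneg (div_nonneg (hr a b) (hq₁0 b)) (hq u), le_rfl]
  have hex := fun a b => exists_max_coupling f f' (P a b) (Q a b) (hP0 a b) (hQ0 a b)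
    ((hPs a b).trans (hQs a b).symm)
  choose m hm0 hm1 hm2 hm3 using hex
  have hmψ : ∀ a b u v, m a b u v ≠ 0 → ψ u = a ∧ ψ' v = b := fun a b u v h => by
    constructor
    · by_contra hne
      have h3 := hm1 a b u
      simp only [hP, if_neg hne] at h3
      rw [sum_eq_zero_iff_of_nonneg fun v _ => hm0 a b u v] at h3
      exact h (h3 v (Finset.mem_univ v))
    · by_contra hne
      have h3 := hm2 a b v
      simp only [hQ, if_neg hne] at h3
      rw [sum_eq_zero_iff_of_nonneg fun u _ => hm0 a b u v] at h3
      exact h (h3 u (Finset.mem_univ u))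
  refine ⟨fun u v => ∑ a, ∑ b, m a b u v, fun u v => sum_nonneg fun a _ =>
    sum_nonneg fun b _ => hm0 a b u v, fun u => ?_, fun v => ?_, fun F => ?_, ?_⟩
  · rw [sum_comm]
    simp only [sum_comm (s := (Finset.univ : Finset β')), hm1, hP]
    rw [Finset.sum_eq_single (ψ u)]
    · simp only [if_pos]
      rw [← sum_mul, ← sum_div, hr1]
      by_cases h : p₁ (ψ u) = 0
      · have := le_push (f := ψ) hp u
        rw [← hp₁, h] at this
        rw [h, le_antisymm this (hp u)]; simp
      · rw [div_self h, one_mul]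
    · intro a _ ha; simp [ha.symm]
    · simp
  · rw [sum_comm]
    simp only [sum_comm (s := (Finset.univ : Finset α')), hm2, hQ]
    rw [sum_comm, Finset.sum_eq_single (ψ' v)]
    · simp only [if_pos]
      rw [← sum_mul, ← sum_div, hr2]
      by_cases h : q₁ (ψ' v) = 0
      · have := le_push (f := ψ') hq v
        rw [← hq₁, h] at this
        rw [h, le_antisymm this (hq v)]; simp
      · rw [div_self h, one_mul]
    · intro a _ ha; simp [ha.symm]
    · simp
  · have : ∀ u v, (∑ a, ∑ b, m a b u v) * F (ψ u) (ψ' v) = ∑ a, ∑ b, m a b u v * F a b := by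
      intro u v
      rw [sum_mul]
      refine sum_congr rfl fun a _ => ?_
      rw [sum_mul]
      refine sum_congr rfl fun b _ => ?_
      by_cases h : m a b u v = 0
      · simp [h]
      · rw [(hmψ a b u v h).1, (hmψ a b u v h).2]
    simp only [this]
    calc _ = ∑ a, ∑ b, ∑ u, ∑ v, m a b u v * F a b := by
          simp only [sum_comm (s := (Finset.univ : Finset β')) (t := (Finset.univ : Finset α)),
            sum_comm (s := (Finset.univ : Finset α')) (t := (Finset.univ : Finset α)),
            sum_comm (s := (Finset.univ : Finset β')) (t := (Finset.univ : Finset β)),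
            sum_comm (s := (Finset.univ : Finset α')) (t := (Finset.univ : Finset β))]
      _ = _ := by
          simp only [← sum_mul, hm1, hPs]
  · calc _ = ∑ a, ∑ b, ∑ u, ∑ v, (if f u = f' v then 0 else m a b u v) := by
          simp only [sum_comm (s := (Finset.univ : Finset α)) (t := (Finset.univ : Finset α')),
            sum_comm (s := (Finset.univ : Finset α)) (t := (Finset.univ : Finset β')),
            sum_comm (s := (Finset.univ : Finset β)) (t := (Finset.univ : Finset α')),
            sum_comm (s := (Finset.univ : Finset β)) (t := (Finset.univ : Finset β'))]
          refine sum_congr rfl fun u _ => sum_congr rfl fun v _ => ?_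
          split_ifs <;> simp
      _ ≤ ∑ a, ∑ b, (∑ v, |push f (P a b) v - push f' (Q a b) v|) / 2 :=
          sum_le_sum fun a _ => sum_le_sum fun b _ => hm3 a b
      _ ≤ ∑ a, ∑ b, (∑ v, (r a b / p₁ a *
            |(∑ u, if ψ u = a ∧ f u = v then p u else 0) - p₁ a * κ v| + r a b / q₁ b *
            |(∑ u, if ψ' u = b ∧ f' u = v then q u else 0) - q₁ b * κ v|)) / 2 := by
          refine sum_le_sum fun a _ => sum_le_sum fun b _ => ?_
          gcongr with v
          have e1 : push f (P a b) v = r a b / p₁ a * ∑ u, if ψ u = a ∧ f u = v then p u else 0 := by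
            rw [push, mul_sum]
            refine sum_congr rfl fun u _ => ?_
            simp only [hP]
            by_cases ha : ψ u = a <;> by_cases hb : f u = v <;> simp [ha, hb]
          have e2 : push f' (Q a b) v =
              r a b / q₁ b * ∑ u, if ψ' u = b ∧ f' u = v then q u else 0 := by
            rw [push, mul_sum]
            refine sum_congr rfl fun u _ => ?_
            simp only [hQ]
            by_cases ha : ψ' u = b <;> by_cases hb : f' u = v <;> simp [ha, hb]
          have e3 : r a b / p₁ a * (p₁ a * κ v) = r a b / q₁ b * (q₁ b * κ v) := by
            by_cases h : p₁ a = 0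
            · simp [hrp a b h]
            by_cases h' : q₁ b = 0
            · simp [hrq a b h']
            field_simp
          rw [e1, e2, ← abs_of_nonneg (div_nonneg (hr a b) (hp₁0 a)), ← abs_mul,
            ← abs_of_nonneg (div_nonneg (hr a b) (hq₁0 b)), ← abs_mul,
            abs_of_nonneg (div_nonneg (hr a b) (hp₁0 a)), abs_of_nonneg (div_nonneg (hr a b) (hq₁0 b)),
            mul_sub, mul_sub, e3]
          set X := r a b / p₁ a * ∑ u, if ψ u = a ∧ f u = v then p u else 0
          set Y := r a b / q₁ b * ∑ u, if ψ' u = b ∧ f' u = v then q u else 0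
          set Z := r a b / q₁ b * (q₁ b * κ v)
          calc |X - Y| = |(X - Z) - (Y - Z)| := by congr 1; ring
            _ ≤ _ := abs_sub _ _
      _ ≤ (ε + ε) / 2 := by
          simp only [← sum_div, sum_add_distrib]
          gcongr
          · refine le_trans (le_of_eq ?_) h1
            rw [sum_comm (t := (Finset.univ : Finset α))]
            refine sum_congr rfl fun a _ => ?_
            simp only [← mul_sum]
            rw [← sum_mul, ← sum_div, hr1]
            by_cases h : p₁ a = 0
            · rw [h, div_zero, zero_mul]
              refine (sum_eq_zero fun v _ => ?_).symm
              rw [zero_mul, sub_zero, abs_eq_zero]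
              refine sum_eq_zero fun u _ => ?_
              split_ifs with hu
              · have := le_push (f := ψ) hp u
                rw [← hp₁, hu.1, h] at this
                exact le_antisymm this (hp u)
              · rfl
            · rw [div_self h, one_mul]
          · refine le_trans (le_of_eq ?_) h2
            rw [sum_comm, sum_comm (s := (Finset.univ : Finset V))]
            refine sum_congr rfl fun b _ => ?_
            simp only [← mul_sum]
            rw [← sum_mul, ← sum_div, hr2]
            by_cases h : q₁ b = 0
            · rw [h, div_zero, zero_mul]
              refine (sum_eq_zero fun v _ => ?_).symm
              rw [zero_mul, sub_zero, abs_eq_zero]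
              refine sum_eq_zero fun u _ => ?_
              split_ifs with hu
              · have := le_push (f := ψ') hq u
                rw [← hq₁, hu.1, h] at this
                exact le_antisymm this (hq u)
              · rfl
            · rw [div_self h, one_mul]
      _ = ε := by ring

end Extend

/-! ### Block couplings of stationary processes -/

section Words

variable {A : Type} [Nonempty A]

/-- A configuration extending a given word. -/
def xt {I : Finset ℤ} (s : I → A) : Conf A := fun i =>
  if h : i ∈ I then s ⟨i, h⟩ else Classical.arbitrary A

lemma Dep.xt_rs {α : Type*} {J : Set ℤ} {I : Finset ℤ} {f : Conf A → α} (hf : Dep J f)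
    (h : J ⊆ I) (x : Conf A) : f (xt (rs I x)) = f x :=
  hf _ _ fun i hi => by
    have : i ∈ I := h hi
    simp [xt, rs, this]

variable [Fintype A] [MeasurableSpace A] [MeasurableSingletonClass A]

lemma push_pr_rs [DecidableEq A] {μ : Measure (Conf A)} [IsProbabilityMeasure μ] {α : Type*}
    [Fintype α] [DecidableEq α] {J : Set ℤ} {I : Finset ℤ} {f : Conf A → α} (hf : Dep J f)
    (h : J ⊆ I) (a : α) : push (fun s => f (xt s)) (pr μ (rs I)) a = pr μ f a := by
  have := pr_comp (μ := μ) (finMeas_rs I) (fun s => f (xt s)) a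
  simp only [hf.xt_rs h] at this
  exact this.symm

end Words

section Block

variable {B : Type} [Nonempty B] [Fintype B] [DecidableEq B] [MeasurableSpace B]
  [MeasurableSingletonClass B]

lemma Dep.shift_set {A : Type} {α : Sort*} {I J : Set ℤ} {f : Conf A → α} (hf : Dep I f) (n : ℤ)
    (h : ∀ i ∈ I, i + n ∈ J) : Dep J fun x => f (GibbsFormal.shift n x) :=
  fun _ _ hxy => hf _ _ fun i hi => hxy _ (h i hi)

/-- The window `[g, g + n)`. -/
abbrev win (g n : ℕ) (x : Conf B) : Finset.Ico (g : ℤ) (g + n) → B := rs _ x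

/-- The words on `[0, n)`. -/
abbrev Word (A : Type) (n : ℕ) : Type := Finset.Ico (0 : ℤ) n → A

/-- The window `[0, n)`. -/
abbrev iwin (n : ℕ) (x : Conf B) : Word B n := rs _ x

lemma sum_block_eq {ν : Measure (Conf B)} [IsProbabilityMeasure ν] (hν : Inv ν) {g n : ℕ}
    {κ : (Finset.Ico (g : ℤ) (g + n) → B) → ℝ} {ε : ℝ} (K : ℕ)
    (h : ∀ M : ℕ, tvp ν (rs (Finset.Ico (-(M : ℤ)) 0)) (win g n) κ ≤ ε) :
    ∑ v, ∑ a, |(∑ u, if iwin K (xt (I := Finset.Ico (0 : ℤ) (K + (g + n) : ℕ)) u) = a ∧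
      win g n (shift K (xt u)) = v then pr ν (iwin (K + (g + n))) u else 0) -
      push (fun u => iwin K (xt u)) (pr ν (iwin (K + (g + n)))) a * κ v| ≤ ε := by
  classical
  have hd : Dep (Ico (0 : ℤ) K) (iwin (B := B) K) := by
    have := dep_rs (A := B) (Finset.Ico (0 : ℤ) K)
    rwa [Finset.coe_Ico] at this
  have hd' : Dep (Ico (g : ℤ) (g + n)) (win (B := B) g n) := by
    have := dep_rs (A := B) (Finset.Ico (g : ℤ) (g + n))
    rwa [Finset.coe_Ico] at this
  have hT := h K
  have h1 := tvp_mono (μ := ν) (P := fun x => iwin K (shift (-K) x)) (finMeas_rs (A := B)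
    (Finset.Ico (-(K : ℤ)) 0)) (finMeas_rs (A := B) (Finset.Ico (g : ℤ) (g + n))) κ fun x y hxy => by
      refine (hd.shift_set (-K) (J := Ico (-(K : ℤ)) 0) fun i hi => ?_) x y fun i hi => ?_
      · simp only [mem_Ico] at hi ⊢; omega
      · exact (rs_eq_iff.1 hxy) i (by simpa using hi)
  refine le_trans (le_of_eq ?_) (h1.trans (h K))
  refine sum_congr rfl fun v _ => sum_congr rfl fun a _ => ?_
  have e1 : push (fun u => iwin K (xt u)) (pr ν (iwin (K + (g + n)))) a =
      pr ν (fun x => iwin K (shift (-K) x)) a := by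
    rw [push_pr_rs hd (fun i hi => ?_), hν.pr (finMeas_rs _)]
    simp only [mem_Ico, Finset.coe_Ico] at hi ⊢; push_cast; omega
  have e2 : (∑ u, if iwin K (xt (I := Finset.Ico (0 : ℤ) (K + (g + n) : ℕ)) u) = a ∧
      win g n (shift K (xt u)) = v then pr ν (iwin (K + (g + n))) u else 0) =
      pr ν (fun x => (iwin K (shift (-K) x), win g n x)) (a, v) := by
    have hm : FinMeas fun x : Conf B => (iwin K (shift (-K) x), win g n x) := by
      refine Dep.finMeas (I := Finset.Ico (-(K : ℤ)) (g + n)) fun x y hxy => ?_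
      simp only [Finset.coe_Ico, mem_Ico] at hxy
      refine Prod.ext ?_ ?_
      · refine hd.shift_set (-K) (J := Ico (-(K : ℤ)) (g + n)) (fun i hi => ?_) x y hxy
        simp only [mem_Ico] at hi ⊢; omega
      · exact hd'.mono (J := Ico (-(K : ℤ)) (g + n)) (Ico_subset_Ico (by omega) le_rfl) x y hxy
    rw [← hν.pr hm K]
    have := push_pr_rs (μ := ν) (I := Finset.Ico (0 : ℤ) (K + (g + n) : ℕ))
      (J := Ico (0 : ℤ) (K + (g + n) : ℕ)) (f := fun x => (iwin K x, win g n (shift K x)))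
      (fun x y hxy => ?_) (by simp) (a, v)
    · simp only [shift_shift, neg_add_cancel, shift_zero]
      rw [← this, push]
      simp only [Prod.mk.injEq]
    · refine Prod.ext ?_ ?_
      · exact hd.mono (Ico_subset_Ico le_rfl (by push_cast; omega)) x y hxy
      · refine hd'.shift_set K (J := Ico (0 : ℤ) (K + (g + n) : ℕ)) (fun i hi => ?_) x y hxy
        simp only [mem_Ico] at hi ⊢; push_cast; omega
  rw [e1, e2]

/-- The number of blocks on which two configurations disagree. -/
def nbad (g n J : ℕ) (x y : Conf B) : ℝ :=
  ∑ j ∈ Finset.range J, if win g n (shift (j * (g + n) : ℕ) x) = win g n (shift (j * (g + n) : ℕ) y)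
    then 0 else 1

lemma exists_block_coupling {ν' ν : Measure (Conf B)} [IsProbabilityMeasure ν']
    [IsProbabilityMeasure ν] (hν' : Inv ν') (hν : Inv ν) {g n : ℕ}
    {κ : (Finset.Ico (g : ℤ) (g + n) → B) → ℝ} {ε : ℝ}
    (h' : ∀ M : ℕ, tvp ν' (rs (Finset.Ico (-(M : ℤ)) 0)) (win g n) κ ≤ ε)
    (h : ∀ M : ℕ, tvp ν (rs (Finset.Ico (-(M : ℤ)) 0)) (win g n) κ ≤ ε) (J : ℕ) :
    ∃ r : (Finset.Ico (0 : ℤ) (J * (g + n) : ℕ) → B) → (Finset.Ico (0 : ℤ) (J * (g + n) : ℕ) → B) → ℝ,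
      (∀ s t, 0 ≤ r s t) ∧ (∀ s, ∑ t, r s t = pr ν' (iwin (J * (g + n))) s) ∧
      (∀ t, ∑ s, r s t = pr ν (iwin (J * (g + n))) t) ∧
      ∑ s, ∑ t, r s t * nbad g n J (xt s) (xt t) ≤ J * ε := by
  induction J with
  | zero =>
    refine ⟨fun s t => pr ν' (iwin _) s * pr ν (iwin _) t, fun s t => mul_nonneg (pr_nonneg ..)
      (pr_nonneg ..), fun s => ?_, fun t => ?_, ?_⟩
    · rw [← mul_sum, sum_pr (finMeas_rs _), mul_one]
    · rw [← sum_mul, sum_pr (finMeas_rs _), one_mul]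
    · simp [nbad]
  | succ J ih =>
    obtain ⟨K, hK⟩ : ∃ K, K = J * (g + n) := ⟨_, rfl⟩
    rw [← hK] at ih
    obtain ⟨r, hr0, hr1, hr2, hr3⟩ := ih
    have hd : Dep (Ico (0 : ℤ) K) (iwin (B := B) K) := by
      have := dep_rs (A := B) (Finset.Ico (0 : ℤ) K)
      rwa [Finset.coe_Ico] at this
    have hsub : Ico (0 : ℤ) K ⊆ Finset.Ico (0 : ℤ) (K + (g + n) : ℕ) := fun i hi => by
      simp only [mem_Ico, Finset.coe_Ico] at hi ⊢; push_cast; omega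
    obtain ⟨r', h0, h1, h2, h3, h4⟩ := exists_extend_coupling
      (fun u : Finset.Ico (0 : ℤ) (K + (g + n) : ℕ) → B => iwin K (xt u)) (fun u => iwin K (xt u))
      (fun u => win g n (shift K (xt u))) (fun u => win g n (shift K (xt u)))
      (pr ν' (iwin (K + (g + n)))) (pr ν (iwin (K + (g + n)))) (fun _ => pr_nonneg ..)
      (fun _ => pr_nonneg ..) κ r hr0
      (fun a => by rw [hr1, push_pr_rs hd hsub]) (fun a => by rw [hr2, push_pr_rs hd hsub])
      (sum_block_eq hν' K h') (sum_block_eq hν K h)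
    rw [show (J + 1) * (g + n) = K + (g + n) by rw [hK]; ring]
    refine ⟨r', h0, h1, h2, ?_⟩
    have e : ∀ u v : Finset.Ico (0 : ℤ) (K + (g + n) : ℕ) → B, r' u v * nbad g n (J + 1) (xt u) (xt v) =
        r' u v * nbad g n J (xt (iwin K (xt u))) (xt (iwin K (xt v))) +
        if win g n (shift K (xt u)) = win g n (shift K (xt v)) then 0 else r' u v := fun u v => by
      rw [nbad, Finset.sum_range_succ, mul_add, ← hK]
      congr 1
      · congr 1
        refine sum_congr rfl fun j hj => ?_
        have hw : ∀ x : Conf B, win g n (shift (j * (g + n) : ℕ) (xt (iwin K x))) =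
            win g n (shift (j * (g + n) : ℕ) x) := fun x => by
          refine Dep.xt_rs (J := Ico (0 : ℤ) K) (f := fun x => win g n (shift (j * (g + n) : ℕ) x)) ?_
            (by simp) x
          refine (dep_rs _).shift_set _ fun i hi => ?_
          simp only [Finset.coe_Ico, mem_Ico] at hi ⊢
          have : (j + 1) * (g + n) ≤ K := hK ▸ Nat.mul_le_mul_right _ (Finset.mem_range.1 hj)
          have h5 : (j + 1) * (g + n) = j * (g + n) + (g + n) := by ring
          constructor
          · have : (0 : ℤ) ≤ (j * (g + n) : ℕ) := by positivity
            omega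
          · omega
        rw [hw, hw]
      · split_ifs <;> simp
    simp only [e, sum_add_distrib]
    rw [h3 fun s t => nbad g n J (xt s) (xt t)]
    exact (add_le_add hr3 h4).trans (le_of_eq (by push_cast; ring))

end Block

/-! ### Limits of measures on configurations -/

section Limits

variable {A : Type} [Fintype A] [MeasurableSpace A] [MeasurableSingletonClass A]

lemma ext_of_pr_rs {μ ν : Measure (Conf A)} [IsProbabilityMeasure μ] [IsProbabilityMeasure ν]
    (h : ∀ (I : Finset ℤ) (a : I → A), pr μ (rs I) a = pr ν (rs I) a) : μ = ν := by
  classical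
  refine ext_of_generate_finite _ generateFrom_measurableCylinders.symm
    (isPiSystem_measurableCylinders) (fun t ht => ?_) (by simp)
  obtain ⟨I, s, -, rfl⟩ := (mem_measurableCylinders t).1 ht
  rw [← measureReal_eq_measureReal_iff]
  have hμ := measureReal_preimage (μ := μ) (finMeas_rs (A := A) I) s
  have hν := measureReal_preimage (μ := ν) (finMeas_rs (A := A) I) s
  simp only [h] at hμ
  exact hμ.trans hν.symm

lemma exists_limit {ι : Type} (l : Ultrafilter ι) (m : ι → Measure (Conf A))
    [hm : ∀ i, IsProbabilityMeasure (m i)] :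
    ∃ μ : Measure (Conf A), IsProbabilityMeasure μ ∧ TendstoFdd (l : Filter ι) m μ := by
  let _ : TopologicalSpace A := ⊥
  have : DiscreteTopology A := ⟨rfl⟩
  have : BorelSpace A := ⟨by
    rw [borel_eq_top_of_discrete]
    exact top_le_iff.1 fun s _ => (Set.toFinite s).measurableSet⟩
  let f : ι → ProbabilityMeasure (Conf A) := fun i => ⟨m i, hm i⟩
  obtain ⟨μ, -, hμ⟩ := isCompact_univ.ultrafilter_le_nhds (l.map f) (by simp)
  refine ⟨μ, inferInstance, fun I a => ?_⟩
  have hcl : IsClopen (rs (A := A) I ⁻¹' {a}) := by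
    refine (isClopen_discrete _).preimage ?_
    exact continuous_pi fun i => continuous_apply (i : ℤ)
  have ht : Tendsto f (l : Filter ι) (nhds μ) := hμ
  have := ProbabilityMeasure.tendsto_measure_of_null_frontier_of_tendsto' ht
    (E := rs (A := A) I ⁻¹' {a}) (by rw [hcl.frontier_eq]; simp)
  exact (ENNReal.tendsto_toReal (measure_ne_top _ _)).comp this

lemma inv_of_pr_rs {μ : Measure (Conf A)} [IsProbabilityMeasure μ]
    (h : ∀ (I : Finset ℤ) (a : I → A), pr μ (fun x => rs I (shift 1 x)) a = pr μ (rs I) a) :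
    Inv μ := by
  have h1 : μ.map (shift 1) = μ := by
    have := Measure.isProbabilityMeasure_map (μ := μ) (measurable_shift (A := A) 1).aemeasurable
    refine ext_of_pr_rs fun I a => ?_
    rw [← h I a, pr_map (measurable_shift 1) (finMeas_rs I)]
  have hc : ∀ m n : ℤ, shift (S := A) m ∘ shift n = shift (m + n) := fun m n =>
    funext fun x => shift_shift m n x
  have h2 : μ.map (shift (-1)) = μ := by
    conv_lhs => rw [← h1, Measure.map_map (measurable_shift _) (measurable_shift _), hc]
    have : shift (S := A) (-1 + 1) = id := funext fun x => by rw [neg_add_cancel, shift_zero]; rfl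
    rw [this, Measure.map_id]
  intro n
  induction n using Int.induction_on with
  | zero => rw [show shift (S := A) 0 = id from funext shift_zero, Measure.map_id]
  | succ i ih => rw [← hc, ← Measure.map_map (measurable_shift _) (measurable_shift _), h1, ih]
  | pred i ih => rw [sub_eq_add_neg, ← hc, ← Measure.map_map (measurable_shift _)
      (measurable_shift _), h2, ih]

/-- The average of the first `n` translates of a measure. -/
def avgM (μ : Measure (Conf A)) (n : ℕ) : Measure (Conf A) :=
  (n : ENNReal)⁻¹ • ∑ k ∈ Finset.range n, μ.map (shift (k : ℤ))

lemma avgM_real (μ : Measure (Conf A)) [IsProbabilityMeasure μ] (n : ℕ) {E : Set (Conf A)}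
    (hE : MeasurableSet E) :
    (avgM μ n).real E = (∑ k ∈ Finset.range n, μ.real (shift (k : ℤ) ⁻¹' E)) / n := by
  rw [avgM, measureReal_ennreal_smul_apply, Measure.real, Measure.finsetSum_apply,
    ENNReal.toReal_sum fun k _ => by
      rw [Measure.map_apply (measurable_shift _) hE]; exact measure_ne_top _ _]
  simp only [Measure.map_apply (measurable_shift _) hE, ENNReal.toReal_inv, ENNReal.toReal_natCast]
  rw [inv_mul_eq_div]; rfl

lemma avgM_prob (μ : Measure (Conf A)) [IsProbabilityMeasure μ] {n : ℕ} (hn : n ≠ 0) :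
    IsProbabilityMeasure (avgM μ n) := by
  constructor
  rw [avgM, Measure.smul_apply, Measure.finsetSum_apply]
  simp only [Measure.map_apply (measurable_shift _) MeasurableSet.univ, preimage_univ, measure_univ,
    sum_const, Finset.card_range, nsmul_eq_mul, mul_one, smul_eq_mul]
  exact ENNReal.inv_mul_cancel (by simpa using hn) (by simp)

end Limits

/-! ### Gluing -/

section Glue

variable {Ω Ω' σ τ : Type*} [MeasurableSpace Ω] [MeasurableSpace Ω'] [Fintype σ] [Fintype τ]

lemma exists_glue (μ : Measure Ω) [IsProbabilityMeasure μ] {X : Ω → σ} (hX : FinMeas X)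
    (r : σ → τ → ℝ) (hr : ∀ s t, 0 ≤ r s t) (hr1 : ∀ s, ∑ t, r s t = pr μ X s)
    (G : τ → Ω → Ω') (hG : ∀ t, Measurable (G t)) :
    ∃ m : Measure Ω', IsProbabilityMeasure m ∧ ∀ E, MeasurableSet E →
      m.real E = ∑ s, ∑ t, r s t / pr μ X s * μ.real (X ⁻¹' {s} ∩ G t ⁻¹' E) := by
  set m : Measure Ω' := ∑ s, ∑ t, ENNReal.ofReal (r s t / pr μ X s) •
    (μ.restrict (X ⁻¹' {s})).map (G t) with hm
  have key : ∀ E, MeasurableSet E →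
      m E = ENNReal.ofReal (∑ s, ∑ t, r s t / pr μ X s * μ.real (X ⁻¹' {s} ∩ G t ⁻¹' E)) := by
    intro E hE
    have h0 : ∀ s t, 0 ≤ r s t / pr μ X s := fun s t => div_nonneg (hr s t) (pr_nonneg ..)
    rw [hm, Measure.finsetSum_apply, ENNReal.ofReal_sum_of_nonneg fun s _ =>
      sum_nonneg fun t _ => mul_nonneg (h0 s t) measureReal_nonneg]
    refine sum_congr rfl fun s _ => ?_
    rw [Measure.finsetSum_apply, ENNReal.ofReal_sum_of_nonneg fun t _ =>
      mul_nonneg (h0 s t) measureReal_nonneg]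
    refine sum_congr rfl fun t _ => ?_
    rw [Measure.smul_apply, Measure.map_apply (hG t) hE, Measure.restrict_apply (hG t hE),
      ENNReal.ofReal_mul (h0 s t), inter_comm, ofReal_measureReal, smul_eq_mul]
  have hnn : ∀ E, 0 ≤ ∑ s, ∑ t, r s t / pr μ X s * μ.real (X ⁻¹' {s} ∩ G t ⁻¹' E) := fun E =>
    sum_nonneg fun s _ => sum_nonneg fun t _ => mul_nonneg
      (div_nonneg (hr s t) (pr_nonneg ..)) measureReal_nonneg
  refine ⟨m, ⟨?_⟩, fun E hE => ?_⟩
  · rw [key _ MeasurableSet.univ, ← ENNReal.ofReal_one, ← sum_pr (μ := μ) hX]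
    congr 1
    refine sum_congr rfl fun s _ => ?_
    simp only [preimage_univ, inter_univ]
    rw [← sum_mul, ← sum_div, hr1]
    change pr μ X s / pr μ X s * pr μ X s = _
    exact div_mul_cancel_of_imp id
  · rw [Measure.real, key E hE, ENNReal.toReal_ofReal (hnn E)]

end Glue

/-! ### Joinings -/

section Joining

variable {A B : Type}

/-- The pair of two configurations. -/
def zipc (x : Conf A) (y : Conf B) : Conf (A × B) := fun i => (x i, y i)

/-- The first component of a pair of configurations. -/
def fstc (z : Conf (A × B)) : Conf A := fun i => (z i).1

/-- The second component of a pair of configurations. -/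
def sndc (z : Conf (A × B)) : Conf B := fun i => (z i).2

lemma fstc_shift (n : ℤ) (z : Conf (A × B)) : fstc (shift n z) = shift n (fstc z) := rfl

lemma sndc_shift (n : ℤ) (z : Conf (A × B)) : sndc (shift n z) = shift n (sndc z) := rfl

lemma fstc_zipc (x : Conf A) (y : Conf B) : fstc (zipc x y) = x := rfl

lemma sndc_zipc (x : Conf A) (y : Conf B) : sndc (zipc x y) = y := rfl

lemma Dep.fstc {α : Sort*} {I : Set ℤ} {f : Conf A → α} (hf : Dep I f) :
    Dep I fun z : Conf (A × B) => f (fstc z) := fun x y h => hf _ _ fun i hi => by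
  simp only [GibbsFormal.fstc, h i hi]

lemma Dep.sndc {α : Sort*} {I : Set ℤ} {f : Conf B → α} (hf : Dep I f) :
    Dep I fun z : Conf (A × B) => f (sndc z) := fun x y h => hf _ _ fun i hi => by
  simp only [GibbsFormal.sndc, h i hi]

/-- The stationary code defined by an observable. -/
def code (F : Conf A → B) (x : Conf A) : Conf B := fun i => F (shift i x)

lemma code_shift (F : Conf A → B) (n : ℤ) (x : Conf A) : code F (shift n x) = shift n (code F x) := by
  ext i; simp only [code, shift_shift]; rfl

variable [MeasurableSpace A] [MeasurableSpace B]

lemma measurable_fstc : Measurable (fstc (A := A) (B := B)) :=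
  measurable_pi_lambda _ fun i => measurable_fst.comp (measurable_pi_apply i)

lemma measurable_sndc : Measurable (sndc (A := A) (B := B)) :=
  measurable_pi_lambda _ fun i => measurable_snd.comp (measurable_pi_apply i)

lemma measurable_zipc_left (y : Conf B) : Measurable fun x : Conf A => zipc x y :=
  measurable_pi_lambda _ fun i => (measurable_pi_apply i).prodMk measurable_const

lemma FinMeas.comp_meas {Ω Ω' α : Type*} [MeasurableSpace Ω] [MeasurableSpace Ω'] {X : Ω' → α}
    (hX : FinMeas X) {T : Ω → Ω'} (hT : Measurable T) : FinMeas fun ω => X (T ω) := fun a =>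
  hT (hX a)

variable [Fintype A] [Fintype B] [MeasurableSingletonClass A] [MeasurableSingletonClass B]

lemma measurable_code {F : Conf A → B} (hF : FinMeas F) : Measurable (code F) :=
  measurable_pi_lambda _ fun i => Measurable.comp (g := F) (fun s _ => hF.preimage s)
    (measurable_shift i)

lemma Inv.map_of_comm {μ : Measure (Conf A)} (h : Inv μ) {T : Conf A → Conf B} (hT : Measurable T)
    (hc : ∀ n x, T (shift n x) = shift n (T x)) : Inv (μ.map T) := fun n => by
  rw [Measure.map_map (measurable_shift n) hT]
  conv_rhs => rw [← h n, Measure.map_map hT (measurable_shift n)]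
  congr 1
  ext1 x; exact (hc n x).symm

/-- `l` is a stationary joining of `μ` and `ν`. -/
structure IsJoin (l : Measure (Conf (A × B))) (μ : Measure (Conf A)) (ν : Measure (Conf B)) :
    Prop where
  prob : IsProbabilityMeasure l
  inv : Inv l
  map_fst : l.map fstc = μ
  map_snd : l.map sndc = ν

end Joining

section JoinCode

variable {A B : Type} [Fintype A] [MeasurableSpace A] [MeasurableSingletonClass A]
  [Fintype B] [Nonempty B] [DecidableEq B] [MeasurableSpace B] [MeasurableSingletonClass B]

lemma sum_ne_le_nbad {g n : ℕ} (J : ℕ) (x y : Conf B) :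
    ∑ k ∈ Finset.range (J * (g + n)), (if x k = y k then (0 : ℝ) else 1) ≤
      J * g + n * nbad g n J x y := by
  induction J with
  | zero => simp [nbad]
  | succ J ih =>
    rw [nbad, Finset.sum_range_succ, ← nbad, add_mul, one_mul, Finset.sum_range_add,
      Finset.sum_range_add]
    have h1 : ∑ k ∈ Finset.range g, (if x ((J * (g + n) + k : ℕ) : ℤ) = y ((J * (g + n) + k : ℕ) : ℤ)
        then (0 : ℝ) else 1) ≤ g := by
      refine (Finset.sum_le_card_nsmul _ _ 1 fun k _ => ?_).trans (by simp)
      split_ifs <;> norm_num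
    have h2 : ∑ k ∈ Finset.range n, (if x ((J * (g + n) + (g + k) : ℕ) : ℤ) =
        y ((J * (g + n) + (g + k) : ℕ) : ℤ) then (0 : ℝ) else 1) ≤
        n * (if win g n (shift (J * (g + n) : ℕ) x) = win g n (shift (J * (g + n) : ℕ) y)
          then 0 else 1) := by
      split_ifs with h
      · rw [mul_zero]
        refine (sum_eq_zero fun k hk => ?_).le
        rw [Finset.mem_range] at hk
        have := rs_eq_iff.1 h (g + k : ℕ) (by rw [Finset.mem_Ico]; push_cast; omega)
        simp only [shift] at this
        rw [if_pos]
        convert this using 2 <;> push_cast <;> ring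
      · rw [mul_one]
        refine (Finset.sum_le_card_nsmul _ _ 1 fun k _ => ?_).trans (by simp)
        split_ifs <;> norm_num
    push_cast at ih h1 h2 ⊢
    linarith

/-- A measure on pairs whose first marginal is given, and whose second component is coupled on
a long window to a code of the first. -/
lemma exists_finite_joining {μ : Measure (Conf A)} [IsProbabilityMeasure μ] {ν : Measure (Conf B)}
    [IsProbabilityMeasure ν] (hμ : Inv μ) (hν : Inv ν) {F : Conf A → B} (hF : FinMeas F) {g n : ℕ}
    {κ : (Finset.Ico (g : ℤ) (g + n) → B) → ℝ} {ε : ℝ}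
    (h' : ∀ M : ℕ, tvp (μ.map (code F)) (rs (Finset.Ico (-(M : ℤ)) 0)) (win g n) κ ≤ ε)
    (h : ∀ M : ℕ, tvp ν (rs (Finset.Ico (-(M : ℤ)) 0)) (win g n) κ ≤ ε) (J : ℕ) :
    ∃ l : Measure (Conf (A × B)), IsProbabilityMeasure l ∧
      (∀ E, MeasurableSet E → l.real (fstc ⁻¹' E) = μ.real E) ∧
      (∀ E, Dep (Ico (0 : ℤ) (J * (g + n) : ℕ)) (· ∈ E) → l.real (sndc ⁻¹' E) = ν.real E) ∧
      ∑ k ∈ Finset.range (J * (g + n)), l.real {z | sndc z k ≠ code F (fstc z) k} ≤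
        J * (g + n * ε) := by
  classical
  have hcm := measurable_code hF
  have := Measure.isProbabilityMeasure_map (μ := μ) hcm.aemeasurable
  obtain ⟨r, hr0, hr1, hr2, hr3⟩ := exists_block_coupling (hμ.map_of_comm hcm (code_shift F)) hν h' h J
  obtain ⟨K, hK⟩ : ∃ K, K = J * (g + n) := ⟨_, rfl⟩
  have hX : FinMeas fun x => iwin (J * (g + n)) (code F x) := (finMeas_rs _).comp_meas hcm
  simp only [pr_map hcm (finMeas_rs _)] at hr1
  obtain ⟨l, hl, hlE⟩ := exists_glue (Ω' := Conf (A × B)) μ hX r hr0 hr1 (fun t x => zipc x (xt t))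
    fun t => measurable_zipc_left _
  have hrp : ∀ s t, r s t / pr μ (fun x => iwin (J * (g + n)) (code F x)) s *
      pr μ (fun x => iwin (J * (g + n)) (code F x)) s = r s t := fun s t => by
    refine div_mul_cancel_of_imp fun h0 => ?_
    have h1 := hr1 s
    rw [h0, sum_eq_zero_iff_of_nonneg fun t _ => hr0 s t] at h1
    exact h1 t (Finset.mem_univ t)
  refine ⟨l, hl, fun E hE => ?_, fun E hE => ?_, ?_⟩
  · rw [hlE _ (measurable_fstc hE)]
    have e : ∀ s, ∑ t, r s t / pr μ (fun x => iwin (J * (g + n)) (code F x)) s *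
        μ.real ((fun x => iwin (J * (g + n)) (code F x)) ⁻¹' {s} ∩
          (fun x => zipc x (xt t)) ⁻¹' (fstc ⁻¹' E)) =
        μ.real (E ∩ (fun x => iwin (J * (g + n)) (code F x)) ⁻¹' {s}) := fun s => by
      have : ∀ t : Finset.Ico (0 : ℤ) (J * (g + n) : ℕ) → B,
        (fun x : Conf A => zipc x (xt t)) ⁻¹' (fstc ⁻¹' E) = E := fun t => rfl
      simp only [this]
      rw [← sum_mul, ← sum_div, hr1, inter_comm]
      by_cases h0 : pr μ (fun x => iwin (J * (g + n)) (code F x)) s = 0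
      swap
      · rw [div_self h0, one_mul]
      rw [h0, div_zero, zero_mul]
      refine Eq.symm ?_
      exact le_antisymm ((measureReal_mono inter_subset_right).trans h0.le) measureReal_nonneg
    simp only [e]
    have hfib := sum_measureReal_preimage_singleton (μ := μ.restrict E)
      (f := fun x => iwin (J * (g + n)) (code F x)) Finset.univ (fun y _ => hX y)
    simp only [Finset.coe_univ, preimage_univ, measureReal_restrict_apply MeasurableSet.univ,
      univ_inter] at hfib
    rw [← hfib]
    exact sum_congr rfl fun s _ => by rw [measureReal_restrict_apply (hX s), inter_comm]
  · have hEm : MeasurableSet E := Dep.measurableSet (I := Finset.Ico (0 : ℤ) (J * (g + n) : ℕ))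
      (by rwa [Finset.coe_Ico])
    rw [hlE _ (measurable_sndc hEm)]
    have e : ∀ s t, r s t / pr μ (fun x => iwin (J * (g + n)) (code F x)) s *
        μ.real ((fun x => iwin (J * (g + n)) (code F x)) ⁻¹' {s} ∩
          (fun x => zipc x (xt t)) ⁻¹' (sndc ⁻¹' E)) = if xt t ∈ E then r s t else 0 := fun s t => by
      by_cases ht : xt t ∈ E
      · rw [if_pos ht]
        conv_rhs => rw [← hrp s t]
        congr 1
        change μ.real _ = μ.real _
        congr 1
        ext x; simp [sndc_zipc, ht]
      · rw [if_neg ht]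
        convert mul_zero _
        convert measureReal_empty
        ext x; simp [sndc_zipc, ht]
    simp only [e]
    rw [sum_comm]
    have e2 : E = (iwin (J * (g + n)) ⁻¹' {t | xt t ∈ E}) := by
      ext x
      simp only [mem_preimage, mem_ofPred_eq]
      rw [hE.xt_rs (by simp) x]
    conv_rhs => rw [e2, measureReal_preimage (finMeas_rs _)]
    refine sum_congr rfl fun t _ => ?_
    simp only [mem_ofPred_eq]
    split_ifs
    · exact hr2 t
    · simp
  · have e : ∀ k ∈ Finset.range (J * (g + n)), l.real {z | sndc z k ≠ code F (fstc z) k} =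
        ∑ s, ∑ t, r s t * (if (xt s : Conf B) k = (xt t : Conf B) k then 0 else 1) := fun k hk => by
      have hm : MeasurableSet {z : Conf (A × B) | sndc z k ≠ code F (fstc z) k} := by
        refine (measurableSet_eq_fun ?_ ?_).compl
        · exact (measurable_pi_apply (k : ℤ)).comp measurable_sndc
        · exact (measurable_pi_apply (k : ℤ)).comp (hcm.comp measurable_fstc)
      rw [hlE _ hm]
      refine sum_congr rfl fun s _ => sum_congr rfl fun t _ => ?_
      have hs : ∀ x, iwin (J * (g + n)) (code F x) = s → code F x k = xt s k := fun x hx => by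
        rw [← hx]
        refine (Dep.xt_rs (J := {(k : ℤ)}) (f := fun x : Conf B => x k) (fun x y h => h _ rfl) ?_ _).symm
        have := Finset.mem_range.1 hk
        simp only [Finset.coe_Ico, singleton_subset_iff, mem_Ico]
        omega
      split_ifs with hst
      · rw [mul_zero]
        convert mul_zero _
        convert measureReal_empty
        ext x
        simp only [mem_inter_iff, mem_preimage, mem_singleton_iff, mem_ofPred_eq, sndc_zipc, fstc_zipc,
          mem_empty_iff_false, iff_false, not_and, not_not]
        intro hx; rw [hs x hx, hst]
      · rw [mul_one]
        conv_rhs => rw [← hrp s t]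
        congr 1
        change μ.real _ = μ.real _
        congr 1
        ext x
        simp only [mem_inter_iff, mem_preimage, mem_singleton_iff, mem_ofPred_eq, sndc_zipc, fstc_zipc,
          and_iff_left_iff_imp]
        intro hx; rw [hs x hx]; exact Ne.symm hst
    rw [sum_congr rfl e, sum_comm]
    calc _ = ∑ s, ∑ t, r s t * ∑ k ∈ Finset.range (J * (g + n)),
          (if (xt s : Conf B) k = (xt t : Conf B) k then 0 else 1) := by
          refine sum_congr rfl fun s _ => ?_
          rw [sum_comm]
          simp only [mul_sum]
      _ ≤ ∑ s, ∑ t, r s t * (J * g + n * nbad g n J (xt s) (xt t)) :=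
          sum_le_sum fun s _ => sum_le_sum fun t _ =>
            mul_le_mul_of_nonneg_left (sum_ne_le_nbad J _ _) (hr0 s t)
      _ = (∑ s, ∑ t, r s t) * (J * g) + n * ∑ s, ∑ t, r s t * nbad g n J (xt s) (xt t) := by
          simp only [mul_sum, sum_mul, ← sum_add_distrib]
          refine sum_congr rfl fun s _ => sum_congr rfl fun t _ => by ring
      _ ≤ 1 * (J * g) + n * (J * ε) := by
          have : ∑ s, ∑ t, r s t = 1 := by simp only [hr1]; exact sum_pr hX
          rw [this]
          gcongr
      _ = _ := by ring

lemma avgM_shift_sub {C : Type} [Fintype C] [MeasurableSpace C] [MeasurableSingletonClass C]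
    (μ : Measure (Conf C)) [IsProbabilityMeasure μ] (n : ℕ) {E : Set (Conf C)}
    (hE : MeasurableSet E) :
    |(avgM μ n).real (shift 1 ⁻¹' E) - (avgM μ n).real E| ≤ 1 / n := by
  rw [avgM_real μ n hE, avgM_real μ n (measurable_shift 1 hE), ← sub_div, abs_div, Nat.abs_cast]
  gcongr
  have e : ∀ k : ℕ, shift (S := C) (k : ℤ) ⁻¹' (shift 1 ⁻¹' E) = shift ((k + 1 : ℕ) : ℤ) ⁻¹' E :=
    fun k => by
      ext x; simp only [mem_preimage, shift_shift]; push_cast; rw [add_comm]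
  simp only [e]
  rw [← sum_sub_distrib, Finset.sum_range_sub fun k : ℕ => μ.real (shift (k : ℤ) ⁻¹' E), abs_le]
  have h1 := fun k : ℕ => measureReal_nonneg (μ := μ) (s := shift (k : ℤ) ⁻¹' E)
  have h2 := fun k : ℕ => measureReal_le_one (μ := μ) (s := shift (k : ℤ) ⁻¹' E)
  constructor <;> linarith [h1 n, h1 0, h2 n, h2 0]

lemma tendsto_one_div_mul {c : ℕ} (hc : 0 < c) (K : ℝ) :
    Tendsto (fun j : ℕ => K / (((j + 1) * c : ℕ) : ℝ)) atTop (nhds 0) := by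
  refine tendsto_const_nhds.div_atTop ?_
  refine tendsto_natCast_atTop_atTop.comp ?_
  exact tendsto_atTop_mono (fun j => (Nat.le_succ j).trans (Nat.le_mul_of_pos_right _ hc)) tendsto_id

/-- If a finite window code of `μ` and the process `ν` both have windows nearly independent of
the past, with the same approximate law, then there is a stationary joining of `μ` and `ν` in
which the code nearly predicts the second coordinate. -/
theorem joining_of_code {μ : Measure (Conf A)} [IsProbabilityMeasure μ] {ν : Measure (Conf B)}
    [IsProbabilityMeasure ν] (hμ : Inv μ) (hν : Inv ν) {W : Finset ℤ} {F : Conf A → B}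
    (hF : Dep (W : Set ℤ) F) {g n : ℕ} (hgn : 0 < g + n)
    {κ : (Finset.Ico (g : ℤ) (g + n) → B) → ℝ} {ε : ℝ}
    (h' : ∀ M : ℕ, tvp (μ.map (code F)) (rs (Finset.Ico (-(M : ℤ)) 0)) (win g n) κ ≤ ε)
    (h : ∀ M : ℕ, tvp ν (rs (Finset.Ico (-(M : ℤ)) 0)) (win g n) κ ≤ ε) :
    ∃ l : Measure (Conf (A × B)), IsJoin l μ ν ∧
      l.real {z | sndc z 0 ≠ F (fstc z)} ≤ (g + n * ε) / (g + n) := by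
  classical
  have hFm : FinMeas F := hF.finMeas
  have hcm := measurable_code hFm
  choose l hl hl1 hl2 hl3 using fun j : ℕ => exists_finite_joining hμ hν hFm h' h (j + 1)
  have hN : ∀ j : ℕ, (j + 1) * (g + n) ≠ 0 := fun j => by positivity
  have hNr : ∀ j : ℕ, (0 : ℝ) < ((j + 1) * (g + n) : ℕ) := fun j => by exact_mod_cast (hN j).bot_lt
  have hm := fun j => avgM_prob (l j) (hN j)
  obtain ⟨L, hL, hlim⟩ := exists_limit (hyperfilter ℕ) fun j => avgM (l j) ((j + 1) * (g + n))
  have hle : ((hyperfilter ℕ : Ultrafilter ℕ) : Filter ℕ) ≤ atTop := Nat.hyperfilter_le_atTop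
  have hz := fun K => (tendsto_one_div_mul hgn K).mono_left hle
  have key : ∀ {α : Type _} [Fintype α] {I : Finset ℤ} {f : Conf (A × B) → α}
    (_ : Dep (I : Set ℤ) f) (a : α) (c K : ℝ),
    (∀ j : ℕ, |pr (avgM (l j) ((j + 1) * (g + n))) f a - c| ≤ K / (((j + 1) * (g + n) : ℕ) : ℝ)) →
      pr L f a = c := by
    intro α _ I f hf a c K hb
    refine tendsto_nhds_unique (hlim.pr hf a) ?_
    exact tendsto_iff_dist_tendsto_zero.2 (squeeze_zero (fun _ => dist_nonneg) hb (hz K))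
  refine ⟨L, ⟨hL, inv_of_pr_rs fun I a => ?_, ?_, ?_⟩, ?_⟩
  · have h1 : Tendsto _ _ _ := hlim.pr (f := fun x => rs I (shift 1 x)) (I := I.image (· + 1))
      (fun x y h => by
        rw [rs_eq_iff]; intro i hi; exact h (i + 1) (by simpa using hi)) a
    have h2 : Tendsto _ _ _ := hlim.pr (dep_rs I) a
    have h3 := h1.sub h2
    refine sub_eq_zero.1 (tendsto_nhds_unique h3 ?_)
    refine squeeze_zero_norm (fun j => ?_) (hz 1)
    have hb := avgM_shift_sub (l j) ((j + 1) * (g + n)) (finMeas_rs I a)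
    have e : shift 1 ⁻¹' (rs I ⁻¹' {a}) = (fun x : Conf (A × B) => rs I (shift 1 x)) ⁻¹' {a} := rfl
    rw [e] at hb
    simp only [pr]
    rw [Real.norm_eq_abs]
    exact hb
  · have := hL
    have := Measure.isProbabilityMeasure_map (μ := L) (measurable_fstc (A := A) (B := B)).aemeasurable
    refine ext_of_pr_rs fun I a => ?_
    rw [pr_map measurable_fstc (finMeas_rs I)]
    refine key (dep_rs I).fstc a _ 0 fun j => ?_
    have : pr (avgM (l j) ((j + 1) * (g + n))) (fun z => rs I (fstc z)) a = pr μ (rs I) a := by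
      have h4 : (fun z : Conf (A × B) => rs I (fstc z)) ⁻¹' {a} = fstc ⁻¹' (rs I ⁻¹' {a}) := rfl
      rw [pr, h4, avgM_real _ _ (measurable_fstc (finMeas_rs I a))]
      have e : ∀ k : ℕ, (l j).real (shift (k : ℤ) ⁻¹' (fstc ⁻¹' (rs I ⁻¹' {a}))) = pr μ (rs I) a :=
        fun k => by
          rw [← hμ.pr (finMeas_rs I) k a]
          exact hl1 j _ (measurable_shift k (finMeas_rs I a))
      simp only [e, sum_const, Finset.card_range, nsmul_eq_mul]
      rw [mul_div_cancel_left₀ _ (hNr j).ne']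
    rw [this]; simp
  · have := hL
    have := Measure.isProbabilityMeasure_map (μ := L) (measurable_sndc (A := A) (B := B)).aemeasurable
    refine ext_of_pr_rs fun I a => ?_
    rw [pr_map measurable_sndc (finMeas_rs I)]
    obtain ⟨K, hK⟩ : ∃ K : ℕ, ∀ i ∈ I, -(K : ℤ) ≤ i ∧ i < K := by
      refine ⟨I.sup fun i => i.natAbs + 1, fun i hi => ?_⟩
      have := Finset.le_sup (f := fun i : ℤ => i.natAbs + 1) hi
      have h2 : i.natAbs + 1 ≤ I.sup fun i : ℤ => i.natAbs + 1 := this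
      omega
    refine key (dep_rs I).sndc a _ (2 * K) fun j => ?_
    have h4 : (fun z : Conf (A × B) => rs I (sndc z)) ⁻¹' {a} = sndc ⁻¹' (rs I ⁻¹' {a}) := rfl
    rw [pr, h4, avgM_real _ _ (measurable_sndc (finMeas_rs I a)), div_sub' (hNr j).ne', abs_div,
      Nat.abs_cast]
    gcongr
    have e : (((j + 1) * (g + n) : ℕ) : ℝ) * pr ν (rs I) a =
        ∑ k ∈ Finset.range ((j + 1) * (g + n)), pr ν (rs I) a := by simp
    rw [e, ← sum_sub_distrib]
    refine (Finset.abs_sum_le_sum_abs _ _).trans ?_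
    have e2 : ∀ k ∈ Finset.range ((j + 1) * (g + n)),
        |(l j).real (shift (k : ℤ) ⁻¹' (sndc ⁻¹' (rs I ⁻¹' {a}))) - pr ν (rs I) a| ≤
        if k < K ∨ (j + 1) * (g + n) < k + K then 1 else 0 := fun k hk => by
      split_ifs with hkK
      · rw [abs_le]
        have := (hl j)
        have h1 := measureReal_nonneg (μ := l j) (s := (shift (k : ℤ) ⁻¹' (sndc ⁻¹' (rs I ⁻¹' {a}))))
        have h2 := measureReal_le_one (μ := l j) (s := (shift (k : ℤ) ⁻¹' (sndc ⁻¹' (rs I ⁻¹' {a}))))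
        have h3 := pr_nonneg ν (rs I) a
        have h4 : pr ν (rs I) a ≤ 1 := measureReal_le_one
        constructor <;> linarith
      · rw [abs_nonpos_iff, sub_eq_zero, ← hν.pr (finMeas_rs I) k a]
        refine hl2 j (shift (k : ℤ) ⁻¹' (rs I ⁻¹' {a})) fun x y hxy => ?_
        simp only [mem_preimage, mem_singleton_iff]
        have : rs I (shift (k : ℤ) x) = rs I (shift k y) := by
          rw [rs_eq_iff]
          intro i hi
          refine hxy _ ?_
          have := hK i hi
          rw [mem_Ico]; omega
        rw [this]
    refine (sum_le_sum e2).trans ?_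
    rw [← Finset.sum_filter, sum_const, nsmul_eq_mul, mul_one]
    have hsub : (Finset.range ((j + 1) * (g + n))).filter
        (fun k => k < K ∨ (j + 1) * (g + n) < k + K) ⊆ Finset.range K ∪
          Finset.Ico ((j + 1) * (g + n) - K) ((j + 1) * (g + n)) := fun k hk => by
      simp only [Finset.mem_filter, Finset.mem_range, Finset.mem_union, Finset.mem_Ico] at hk ⊢
      omega
    have := (Finset.card_le_card hsub).trans (Finset.card_union_le _ _)
    rw [Finset.card_range, Nat.card_Ico] at this
    exact_mod_cast this.trans (by omega)
  · have hd : Dep ((insert 0 W : Finset ℤ) : Set ℤ) fun z : Conf (A × B) => (sndc z 0 ≠ F (fstc z)) :=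
      fun x y hxy => by
        have h1 : sndc x 0 = sndc y 0 := by simp only [sndc, hxy 0 (by simp)]
        have h2 : F (fstc x) = F (fstc y) := hF.fstc x y fun i hi => hxy i (by simp [Finset.mem_coe.1 hi])
        change (sndc x 0 ≠ F (fstc x)) = (sndc y 0 ≠ F (fstc y))
        rw [h1, h2]
    have e : ∀ m : Measure (Conf (A × B)), pr m (fun z : Conf (A × B) => (sndc z 0 ≠ F (fstc z))) True =
        m.real {z | sndc z 0 ≠ F (fstc z)} := fun m => by
      rw [pr]; congr 1; ext z; simp
    have h1 := hlim.pr hd True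
    simp only [e] at h1
    refine le_of_tendsto' h1 fun j => ?_
    have hmE : MeasurableSet {z : Conf (A × B) | sndc z 0 ≠ F (fstc z)} := by
      refine (measurableSet_eq_fun ?_ ?_).compl
      · exact (measurable_pi_apply (0 : ℤ)).comp measurable_sndc
      · exact Measurable.comp (g := F) (fun s _ => hFm.preimage s) measurable_fstc
    rw [avgM_real _ _ hmE]
    have e3 : ∀ k : ℕ, shift (k : ℤ) ⁻¹' {z : Conf (A × B) | sndc z 0 ≠ F (fstc z)} =
        {z | sndc z k ≠ code F (fstc z) k} := fun k => by
      ext z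
      simp only [mem_preimage, mem_ofPred_eq, sndc_shift, fstc_shift, code]
      simp [shift]
    simp only [e3]
    refine (div_le_div_of_nonneg_right (hl3 j) (hNr j).le).trans ?_
    rw [div_le_div_iff₀ (hNr j) (by exact_mod_cast hgn)]
    push_cast
    apply le_of_eq; ring

end JoinCode

/-! ### Asymptotic equipartition, one-sided -/

section PowerSum

lemma exp_neg_le_quad {u : ℝ} (hu : 0 ≤ u) : exp (-u) ≤ 1 - u + u ^ 2 := by
  rcases le_or_gt u 1 with h | h
  · have := abs_le.1 (Real.abs_exp_sub_one_sub_id_le (x := -u) (by rwa [abs_neg, abs_of_nonneg hu]))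
    nlinarith [this.2]
  · have : exp (-u) ≤ 1 := Real.exp_le_one_iff.2 (by linarith)
    nlinarith

lemma mul_log_sq_le {p : ℝ} (hp : 0 < p) (hp1 : p ≤ 1) : p * log p ^ 2 ≤ 4 := by
  have h1 := Real.log_le_sub_one_of_pos (inv_pos.2 (Real.sqrt_pos.2 hp))
  rw [Real.log_inv, Real.log_sqrt hp.le] at h1
  have h2 : log p ≤ 0 := Real.log_nonpos hp.le hp1
  have h3 : (-log p) ^ 2 ≤ (2 * (√p)⁻¹) ^ 2 := by
    refine pow_le_pow_left₀ (by linarith) (by linarith) 2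
  have h4 : (2 * (√p)⁻¹) ^ 2 = 4 / p := by
    rw [mul_pow, inv_pow, Real.sq_sqrt hp.le]; ring
  rw [h4, neg_sq, le_div_iff₀ hp] at h3
  linarith

lemma mul_rpow_le {p t : ℝ} (hp : 0 ≤ p) (hp1 : p ≤ 1) (ht : 0 ≤ t) :
    p * p ^ t ≤ p - t * negMulLog p + 4 * t ^ 2 := by
  rcases hp.eq_or_lt with h | h
  · rw [← h]; simp; positivity
  · have h2 : log p ≤ 0 := Real.log_nonpos hp hp1
    have h1 := exp_neg_le_quad (u := -(log p * t)) (by nlinarith)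
    rw [neg_neg, ← Real.rpow_def_of_pos h] at h1
    have h3 := mul_le_mul_of_nonneg_left h1 hp
    have h4 := mul_le_mul_of_nonneg_left (mul_log_sq_le h hp1) (sq_nonneg t)
    rw [negMulLog]
    nlinarith

variable {Ω : Type*} [MeasurableSpace Ω] {α β : Type*} [Fintype α] [Fintype β]
  {μ : Measure Ω} [IsProbabilityMeasure μ]

/-- The moment of order `1 + t` of the distribution of `X`. -/
def pmom (μ : Measure Ω) (t : ℝ) (X : Ω → α) : ℝ := ∑ a, pr μ X a * pr μ X a ^ t

lemma pmom_mono {t : ℝ} (ht : 0 ≤ t) {X : Ω → α} {Y : Ω → β} (hY : FinMeas Y)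
    (h : ∀ ω ω', Y ω = Y ω' → X ω = X ω') : pmom μ t Y ≤ pmom μ t X := by
  classical
  have := nonempty_of_prob μ
  obtain ⟨f, hf⟩ := exists_factor h
  obtain rfl : X = fun ω => f (Y ω) := funext hf
  rw [pmom, pmom, sum_pr_comp hY f fun b => pr μ (fun ω => f (Y ω)) b ^ t]
  refine sum_le_sum fun a _ => mul_le_mul_of_nonneg_left ?_ (pr_nonneg ..)
  exact Real.rpow_le_rpow (pr_nonneg ..) (pr_le_comp f a) ht

lemma sum_mul_rpow_le {ι : Type*} [Fintype ι] (p : ι → ℝ) (hp : ∀ i, 0 ≤ p i) (hs : ∑ i, p i = 1)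
    {t H : ℝ} (ht : 0 ≤ t) (hH : H ≤ ∑ i, negMulLog (p i)) :
    ∑ i, p i * p i ^ t ≤ exp (-t * H + t ^ 2 * (4 * Fintype.card ι)) := by
  have hp1 : ∀ i, p i ≤ 1 := fun i =>
    hs ▸ single_le_sum (fun i _ => hp i) (Finset.mem_univ i)
  calc _ ≤ ∑ i, (p i - t * negMulLog (p i) + 4 * t ^ 2) :=
        sum_le_sum fun i _ => mul_rpow_le (hp i) (hp1 i) ht
    _ = 1 - t * ∑ i, negMulLog (p i) + t ^ 2 * (4 * Fintype.card ι) := by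
        rw [sum_add_distrib, sum_sub_distrib, hs, mul_sum]; simp; ring
    _ ≤ (-t * H + t ^ 2 * (4 * Fintype.card ι)) + 1 := by nlinarith
    _ ≤ _ := Real.add_one_le_exp _

/-- The law of `C` given an atom of `P` has large entropy if it is close to a law with large
entropy. -/
lemma sum_negMulLog_cond_ge [Nonempty β] {P : Ω → α} {C : Ω → β} (hP : FinMeas P) (hC : FinMeas C)
    {q : β → ℝ} (hq : ∀ c, 0 ≤ q c) {δ : ℝ} {a : α} (ha : 0 < pr μ P a)
    (h : ∑ c, |pr μ (fun ω => (P ω, C ω)) (a, c) - pr μ P a * q c| ≤ δ * pr μ P a) :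
    ∑ c, negMulLog (q c) - δ * log (Fintype.card β) - 2 ≤
      ∑ c, negMulLog (pr μ (fun ω => (P ω, C ω)) (a, c) / pr μ P a) := by
  have h1 := entropy_ge (fun c => pr μ (fun ω => (P ω, C ω)) (a, c) / pr μ P a) q
    (fun c => div_nonneg (pr_nonneg ..) ha.le) hq (by
      rw [← sum_div, sum_pr_right hP hC, div_self ha.ne'])
  have h2 : ∑ c, |pr μ (fun ω => (P ω, C ω)) (a, c) / pr μ P a - q c| ≤ δ := by
    have e : ∀ c, |pr μ (fun ω => (P ω, C ω)) (a, c) / pr μ P a - q c| =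
        |pr μ (fun ω => (P ω, C ω)) (a, c) - pr μ P a * q c| / pr μ P a := fun c => by
      rw [div_sub' ha.ne', abs_div, abs_of_pos ha]
    simp only [e]
    rw [← sum_div]
    exact div_le_of_le_mul₀ ha.le (by
      have := (sum_nonneg fun c _ => abs_nonneg
        (pr μ (fun ω => (P ω, C ω)) (a, c) - pr μ P a * q c) : (0 : ℝ) ≤ _).trans h
      exact nonneg_of_mul_nonneg_left this ha) h
  have h3 : 0 ≤ log (Fintype.card β) := Real.log_nonneg (by exact_mod_cast Fintype.card_pos)
  have h4 := mul_le_mul_of_nonneg_right h2 h3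
  linarith

lemma pmom_pair_le [Nonempty β] {P : Ω → α} {C : Ω → β} (hP : FinMeas P) (hC : FinMeas C)
    {q : β → ℝ} (hq : ∀ c, 0 ≤ q c) {δ t H : ℝ} (ht : 0 ≤ t)
    (hH : H ≤ ∑ c, negMulLog (q c) - δ * log (Fintype.card β) - 2)
    (h : ∀ a, ∑ c, |pr μ (fun ω => (P ω, C ω)) (a, c) - pr μ P a * q c| ≤ δ * pr μ P a) :
    pmom μ t (fun ω => (P ω, C ω)) ≤
      pmom μ t P * exp (-t * H + t ^ 2 * (4 * Fintype.card β)) := by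
  rw [pmom, pmom, Fintype.sum_prod_type, sum_mul]
  refine sum_le_sum fun a _ => ?_
  rcases (pr_nonneg μ P a).eq_or_lt with ha | ha
  · rw [← ha, zero_mul, zero_mul]
    refine (sum_eq_zero fun c _ => ?_).le
    have h1 := sum_pr_right (μ := μ) hP hC a
    rw [← ha, sum_eq_zero_iff_of_nonneg fun _ _ => pr_nonneg ..] at h1
    rw [h1 c (Finset.mem_univ _), zero_mul]
  · set p := fun c => pr μ (fun ω => (P ω, C ω)) (a, c) / pr μ P a with hp
    have hp0 : ∀ c, 0 ≤ p c := fun c => div_nonneg (pr_nonneg ..) ha.le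
    have e : ∀ c, pr μ (fun ω => (P ω, C ω)) (a, c) = pr μ P a * p c := fun c => by
      rw [hp]; field_simp
    have h2 := sum_mul_rpow_le p hp0 (by
      rw [hp, ← sum_div, sum_pr_right hP hC, div_self ha.ne']) ht
      (hH.trans (sum_negMulLog_cond_ge hP hC hq ha (h a)))
    refine le_of_eq_of_le ?_ (mul_le_mul_of_nonneg_left h2
      (mul_nonneg ha.le (Real.rpow_nonneg ha.le t)))
    rw [mul_sum]
    refine sum_congr rfl fun c _ => ?_
    rw [e, Real.mul_rpow ha.le (hp0 c)]; ring

lemma sum_large_le {X : Ω → α} {t c : ℝ} (ht : 0 ≤ t) :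
    ∑ a, (if exp (-c) < pr μ X a then pr μ X a else 0) ≤ exp (t * c) * pmom μ t X := by
  rw [pmom, mul_sum]
  refine sum_le_sum fun a _ => ?_
  have h0 := pr_nonneg μ X a
  split_ifs with h
  · have h1 : exp (-c) ^ t ≤ pr μ X a ^ t := Real.rpow_le_rpow (exp_pos _).le h.le ht
    rw [← Real.exp_mul] at h1
    have h2 : (1 : ℝ) = exp (t * c) * exp (-c * t) := by
      rw [← exp_add, ← Real.exp_zero]; congr 1; ring
    have h3 : 1 ≤ exp (t * c) * pr μ X a ^ t := by
      rw [h2]; exact mul_le_mul_of_nonneg_left h1 (exp_pos _).le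
    nlinarith
  · exact mul_nonneg (exp_pos _).le (mul_nonneg h0 (Real.rpow_nonneg h0 t))

end PowerSum

section AEP

variable {A : Type} [Fintype A] [Nonempty A] [MeasurableSpace A] [MeasurableSingletonClass A]
  {μ : Measure (Conf A)} [IsProbabilityMeasure μ]

lemma card_win (a b : ℤ) : (Fintype.card (Finset.Ico a b → A) : ℝ) =
    (Fintype.card A : ℝ) ^ (b - a).toNat := by
  classical
  simp

lemma pmom_iwin_le (hμ : Inv μ) {g n : ℕ} {δ t H : ℝ} (ht : 0 ≤ t)
    (hg : MixGap μ g δ)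
    (hH : H ≤ Hw μ n - δ * (n * log (Fintype.card A)) - 2) (k : ℕ) :
    pmom μ t (iwin (B := A) (k * (g + n))) ≤
      exp (k * (-t * H + t ^ 2 * (4 * (Fintype.card A : ℝ) ^ n))) := by
  classical
  induction k with
  | zero =>
    simp only [CharP.cast_eq_zero, zero_mul, Real.exp_zero]
    rw [← sum_pr (μ := μ) (finMeas_rs (Finset.Ico (0 : ℤ) (0 * (g + n) : ℕ)))]
    refine sum_le_sum fun a _ => ?_
    exact mul_le_of_le_one_right (pr_nonneg ..)
      (Real.rpow_le_one (pr_nonneg ..) (pr_le_one ..) ht)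
  | succ k ih =>
    obtain ⟨m, hm⟩ : ∃ m, m = k * (g + n) := ⟨_, rfl⟩
    have h1 : pmom μ t (iwin (B := A) ((k + 1) * (g + n))) ≤
        pmom μ t (fun x => (iwin m x, win g n (shift m x))) := by
      refine pmom_mono ht (finMeas_rs _) fun x y h => ?_
      have h := rs_eq_iff.1 h
      simp only [Finset.mem_Ico] at h
      have e : (k + 1) * (g + n) = m + g + n := by rw [hm]; ring
      rw [e] at h
      rw [Prod.mk.injEq]
      refine ⟨rs_eq_iff.2 fun i hi => h i ?_, rs_eq_iff.2 fun i hi => h (i + m) ?_⟩ <;>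
      · rw [Finset.mem_Ico] at hi; push_cast; omega
    have hPm : FinMeas fun x : Conf A => iwin m x := finMeas_rs _
    have hCm : FinMeas fun x : Conf A => win g n (shift m x) :=
      (finMeas_rs _).comp_meas (measurable_shift _)
    have h2 : ∀ a, ∑ c, |pr μ (fun x => (iwin m x, win g n (shift m x))) (a, c) -
        pr μ (iwin m) a * pr μ (win (B := A) g n) c| ≤ δ * pr μ (iwin m) a := fun a => by
      have hd : Dep (Ico (-(m : ℤ)) 0) fun x : Conf A => iwin m (shift (-m) x) := by
        have := (dep_rs (A := A) (Finset.Ico (0 : ℤ) m))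
        rw [Finset.coe_Ico] at this
        simpa using this.shift (-m)
      have hd2 : Dep (Ico (g : ℤ) (g + n)) (win (B := A) g n) := by
        have := (dep_rs (A := A) (Finset.Ico (g : ℤ) (g + n)))
        rwa [Finset.coe_Ico] at this
      have := hg m n _ _ hd hd2 a
      have e1 : ∀ a, pr μ (fun x : Conf A => iwin m (shift (-m) x)) a = pr μ (iwin m) a :=
        fun a => hμ.pr (finMeas_rs _) (-m) a
      have e2 : ∀ c, pr μ (fun x : Conf A => (iwin m (shift (-m) x), win g n x)) (a, c) =
          pr μ (fun x : Conf A => (iwin m x, win g n (shift m x))) (a, c) := fun c => by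
        rw [← hμ.pr (hPm.pair hCm) (-m) (a, c)]
        simp only [shift_shift]
        congr 2
        funext x; rw [add_neg_cancel, shift_zero]
      simpa only [e1, e2] using this
    have hcard : (Fintype.card (Finset.Ico (g : ℤ) (g + n) → A) : ℝ) = (Fintype.card A : ℝ) ^ n := by
      rw [card_win]; congr 1; omega
    have hent : ∑ c, negMulLog (pr μ (win (B := A) g n) c) = Hw μ n := by
      have := ent_shift_rs hμ (a := g) (b := g + n) (n := n) rfl
      exact this
    have h3 := pmom_pair_le (t := t) (H := H) hPm hCm (fun c => pr_nonneg μ (win (B := A) g n) c) ht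
      (by rw [hent, hcard, Real.log_pow]; exact hH) h2
    rw [hcard] at h3
    refine h1.trans (h3.trans ?_)
    push_cast
    rw [add_mul (k : ℝ), one_mul, exp_add (k * _)]
    refine mul_le_mul_of_nonneg_right ?_ (exp_pos _).le
    rw [hm]; exact ih

/-- The words of length `N` whose probability is much larger than `exp (-N h)` have small total
probability. -/
theorem aep (hμ : Inv μ) (hUM : UM μ) {ε η : ℝ} (hε : 0 < ε) (hη : 0 < η) :
    ∀ᶠ N : ℕ in atTop, ∑ s, (if exp (-(N * (hrate μ - ε))) < pr μ (iwin (B := A) N) s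
      then pr μ (iwin N) s else 0) ≤ η := by
  set lA := log (Fintype.card A) with hlA
  have hlA0 : 0 ≤ lA := Real.log_nonneg (by exact_mod_cast Fintype.card_pos)
  have hh := hrate_nonneg (μ := μ)
  obtain ⟨δ, hδ0, hδ⟩ : ∃ δ > 0, δ * lA ≤ ε / 8 :=
    ⟨ε / (8 * (lA + 1)), by positivity, by
      rw [div_mul_eq_mul_div, div_le_div_iff₀ (by positivity) (by positivity)]; nlinarith⟩
  obtain ⟨g, hg⟩ := hUM.exists_gap hδ0
  obtain ⟨n, hn⟩ := exists_nat_gt ((g * hrate μ + 2) / (ε / 8))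
  rw [div_lt_iff₀ (by positivity)] at hn
  have hgh : 0 ≤ g * hrate μ := by positivity
  have hn0 : 0 < n := by
    rcases Nat.eq_zero_or_pos n with h | h
    · rw [h] at hn; norm_num at hn; linarith
    · exact h
  have hn0' : (0 : ℝ) < n := by exact_mod_cast hn0
  set Q : ℝ := 4 * (Fintype.card A : ℝ) ^ n with hQ
  have hQ0 : 0 < Q := by have : 0 < Fintype.card A := Fintype.card_pos
                         positivity
  obtain ⟨t, ht0, ht⟩ : ∃ t > 0, t * Q ≤ n * (ε / 16) :=
    ⟨n * (ε / 16) / Q, by positivity, by rw [div_mul_cancel₀ _ hQ0.ne']⟩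
  set H := n * hrate μ - δ * (n * lA) - 2 with hH
  have hHw := mul_hrate_le (μ := μ) n
  have hp := fun k => pmom_iwin_le (H := H) hμ ht0.le hg (by linarith) k
  set ℓ := g + n with hℓ
  have hℓ0 : 0 < ℓ := by omega
  have hkey : (ℓ : ℝ) * (hrate μ - ε / 2) - H + t * Q ≤ - (n * (ε / 16)) := by
    rw [hℓ, hH]; push_cast
    have : δ * (n * lA) ≤ n * (ε / 8) := by nlinarith
    have : (0 : ℝ) ≤ g * ε := by positivity
    nlinarith
  have hlim : Tendsto (fun N : ℕ => exp (t * (ℓ * hrate μ) - ((N / ℓ : ℕ) : ℝ) * (t * (n * (ε / 16)))))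
      atTop (nhds 0) := by
    refine Real.tendsto_exp_atBot.comp ?_
    refine tendsto_atBot_add_const_left _ _ ?_
    refine tendsto_neg_atTop_atBot.comp ?_
    refine Tendsto.atTop_mul_const (by positivity) ?_
    exact tendsto_natCast_atTop_atTop.comp (Nat.tendsto_div_const_atTop hℓ0.ne')
  filter_upwards [hlim.eventually_le_const hη] with N hN
  refine le_trans ?_ hN
  have h1 : pmom μ t (iwin (B := A) N) ≤ pmom μ t (iwin (B := A) (N / ℓ * ℓ)) := by
    refine pmom_mono ht0.le (finMeas_rs _) fun x y h => ?_
    rw [rs_eq_iff] at h ⊢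
    intro i hi
    have := Nat.div_mul_le_self N ℓ
    exact h i (by rw [Finset.mem_Ico] at hi ⊢; omega)
  refine (sum_large_le ht0.le).trans ((mul_le_mul_of_nonneg_left (h1.trans (hp _))
    (exp_pos _).le).trans ?_)
  rw [← exp_add, Real.exp_le_exp]
  set k : ℕ := N / ℓ with hk
  have hr : N = k * ℓ + N % ℓ := by rw [hk, mul_comm]; exact (Nat.div_add_mod N ℓ).symm
  have hr2 : N % ℓ < ℓ := Nat.mod_lt _ hℓ0
  obtain ⟨r, hrd⟩ : ∃ r, r = N % ℓ := ⟨_, rfl⟩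
  rw [← hrd] at hr hr2
  have hNr : (N : ℝ) = k * ℓ + r := by exact_mod_cast hr
  have hr3 : (r : ℝ) * hrate μ ≤ ℓ * hrate μ := by
    refine mul_le_mul_of_nonneg_right ?_ hh; exact_mod_cast hr2.le
  have h5 : (N : ℝ) * (hrate μ - ε) ≤ k * (ℓ * (hrate μ - ε / 2)) + ℓ * hrate μ := by
    rw [hNr]
    have : (0 : ℝ) ≤ k * ℓ * ε := by positivity
    have : (0 : ℝ) ≤ r * ε := by positivity
    nlinarith
  have h6 := mul_le_mul_of_nonneg_left h5 ht0.le
  have h7 := mul_le_mul_of_nonneg_left hkey (show 0 ≤ (k : ℝ) * t by positivity)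
  nlinarith

end AEP

/-! ### Random codes -/

section RandomCode

variable {α β : Type*} [Fintype α] [Fintype β] [DecidableEq α] [DecidableEq β]

/-- The expectation over random maps with independent values, of laws `κ w`. -/
def rex (κ : α → β → ℝ) (f : (α → β) → ℝ) : ℝ := ∑ F : α → β, (∏ w, κ w (F w)) * f F

variable {κ : α → β → ℝ}

lemma rex_prod (f : α → β → ℝ) : rex κ (fun F => ∏ w, f w (F w)) = ∏ w, ∑ y, κ w y * f w y := by
  rw [Finset.prod_univ_sum, Fintype.piFinset_univ]
  simp only [rex, Finset.prod_mul_distrib]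

lemma rex_sum {ι : Type*} (s : Finset ι) (f : ι → (α → β) → ℝ) :
    rex κ (fun F => ∑ i ∈ s, f i F) = ∑ i ∈ s, rex κ (f i) := by
  simp only [rex, mul_sum]; rw [sum_comm]

lemma rex_mul_left (c : ℝ) (f : (α → β) → ℝ) : rex κ (fun F => c * f F) = c * rex κ f := by
  simp only [rex, mul_sum]; exact sum_congr rfl fun F _ => by ring

lemma rex_add (f g : (α → β) → ℝ) : rex κ (fun F => f F + g F) = rex κ f + rex κ g := by
  simp only [rex, mul_add, sum_add_distrib]

lemma rex_mono (hκ : ∀ w y, 0 ≤ κ w y) {f g : (α → β) → ℝ} (h : ∀ F, f F ≤ g F) :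
    rex κ f ≤ rex κ g :=
  sum_le_sum fun F _ => mul_le_mul_of_nonneg_left (h F) (Finset.prod_nonneg fun w _ => hκ w _)

lemma rex_one_val (hs : ∀ w, ∑ y, κ w y = 1) (w : α) (f : β → ℝ) :
    rex κ (fun F => f (F w)) = ∑ y, κ w y * f y := by
  have h := rex_prod (κ := κ) (fun w' y => if w' = w then f y else 1)
  rw [Finset.prod_eq_single w (fun w' _ hw => by simp [hw, hs]) (by simp)] at h
  simpa [Finset.prod_ite_eq'] using h

lemma rex_const (hs : ∀ w, ∑ y, κ w y = 1) (c : ℝ) : rex κ (fun _ => c) = c := by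
  have h := rex_prod (κ := κ) (fun _ _ => 1)
  simp only [Finset.prod_const_one, mul_one, hs] at h
  have := rex_mul_left (κ := κ) c (fun _ => 1)
  rw [h] at this; simpa using this

lemma rex_two_mul (hs : ∀ w, ∑ y, κ w y = 1) {w w' : α} (hw : w ≠ w') (f g : β → ℝ) :
    rex κ (fun F => f (F w) * g (F w')) = (∑ y, κ w y * f y) * ∑ y, κ w' y * g y := by
  have h := rex_prod (κ := κ) (fun v y => (if v = w then f y else 1) * (if v = w' then g y else 1))
  rw [← Finset.mul_prod_erase _ _ (Finset.mem_univ w),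
    ← Finset.mul_prod_erase (Finset.univ.erase w) _ (Finset.mem_erase.2 ⟨hw.symm, Finset.mem_univ w'⟩),
    Finset.prod_eq_one (s := (Finset.univ.erase w).erase w')] at h
  · have e : (fun F : α → β => ∏ v, (if v = w then f (F v) else 1) * (if v = w' then g (F v) else 1)) =
        fun F => f (F w) * g (F w') := by
      funext F
      rw [Finset.prod_mul_distrib, Finset.prod_eq_single w (fun v _ hv => if_neg hv) (by simp),
        Finset.prod_eq_single w' (fun v _ hv => if_neg hv) (by simp), if_pos rfl, if_pos rfl]
    rw [e] at h
    simpa only [if_true, if_neg hw, if_neg hw.symm, mul_one, one_mul] using h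
  · intro v hv
    simp only [Finset.mem_erase, Finset.mem_univ, and_true] at hv
    simp [hv.1, hv.2, hs]

lemma rex_two (hs : ∀ w, ∑ y, κ w y = 1) {w w' : α} (hw : w ≠ w') (φ : β → β → ℝ) :
    rex κ (fun F => φ (F w) (F w')) = ∑ y, ∑ y', κ w y * κ w' y' * φ y y' := by
  have e : (fun F : α → β => φ (F w) (F w')) = fun F => ∑ y, ∑ y', φ y y' *
      ((if F w = y then 1 else 0) * (if F w' = y' then 1 else 0)) := by
    funext F; simp
  rw [e, rex_sum]
  refine sum_congr rfl fun y _ => ?_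
  rw [rex_sum]
  refine sum_congr rfl fun y' _ => ?_
  rw [rex_mul_left, rex_two_mul hs hw (fun z => if z = y then 1 else 0) (fun z => if z = y' then 1 else 0)]
  simp; ring

lemma exists_lt_of_rex_lt (hκ : ∀ w y, 0 ≤ κ w y) (hs : ∀ w, ∑ y, κ w y = 1) {f : (α → β) → ℝ}
    {c : ℝ} (h : rex κ f < c) : ∃ F, f F < c := by
  by_contra! hc
  have := rex_mono hκ hc
  rw [rex_const hs] at this
  linarith

variable {p : α → ℝ} {τ η : ℝ}

lemma sum_sq_le (hp : ∀ w, 0 ≤ p w) (hp1 : ∑ w, p w = 1) (hτ : 0 < τ)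
    (h : ∑ w, (if τ < p w then p w else 0) ≤ η) : ∑ w, p w ^ 2 ≤ τ + η := by
  calc ∑ w, p w ^ 2 ≤ ∑ w, (τ * p w + if τ < p w then p w else 0) := by
        refine sum_le_sum fun w _ => ?_
        have h1 : p w ≤ 1 := hp1 ▸ single_le_sum (fun i _ => hp i) (Finset.mem_univ w)
        have h0 := hp w
        split_ifs with hw
        · nlinarith
        · nlinarith
    _ ≤ _ := by rw [sum_add_distrib, ← mul_sum, hp1]; linarith

lemma rex_dev_sq_le (hκ : ∀ w y, 0 ≤ κ w y) (hs : ∀ w, ∑ y, κ w y = 1)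
    {φ : α → β → ℝ} (hφ0 : ∀ w y, 0 ≤ φ w y) (hφ1 : ∀ w y, φ w y ≤ 1) :
    rex κ (fun F => (∑ w, p w * φ w (F w) - ∑ w, p w * ∑ y, κ w y * φ w y) ^ 2) ≤ ∑ w, p w ^ 2 := by
  set m : α → ℝ := fun w => ∑ y, κ w y * φ w y with hm
  have hm0 : ∀ w, 0 ≤ m w := fun w => sum_nonneg fun y _ => mul_nonneg (hκ w y) (hφ0 w y)
  have hm1 : ∀ w, m w ≤ 1 := fun w => by
    rw [← hs w]; exact sum_le_sum fun y _ => mul_le_of_le_one_right (hκ w y) (hφ1 w y)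
  have e : (fun F : α → β => (∑ w, p w * φ w (F w) - ∑ w, p w * m w) ^ 2) = fun F =>
      ∑ w, ∑ w', (p w * p w') * ((φ w (F w) - m w) * (φ w' (F w') - m w')) := by
    funext F
    rw [← sum_sub_distrib, sq, Finset.sum_mul_sum]
    exact sum_congr rfl fun w _ => sum_congr rfl fun w' _ => by ring
  have h0 : ∀ w, ∑ y, κ w y * (φ w y - m w) = 0 := fun w => by
    simp only [mul_sub, sum_sub_distrib, ← sum_mul, hs, one_mul, hm, sub_self]
  rw [e, rex_sum]
  refine sum_le_sum fun w _ => ?_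
  rw [rex_sum, Finset.sum_eq_single w]
  · rw [rex_mul_left, rex_one_val hs w fun y => (φ w y - m w) * (φ w y - m w), ← sq]
    refine mul_le_of_le_one_right (sq_nonneg _) ?_
    rw [← hs w]
    refine sum_le_sum fun y _ => mul_le_of_le_one_right (hκ w y) ?_
    have := hφ0 w y; have := hφ1 w y; have := hm0 w; have := hm1 w
    have : |φ w y - m w| ≤ 1 := abs_le.2 ⟨by linarith, by linarith⟩
    rw [← sq]; exact (sq_le_one_iff_abs_le_one _).2 this
  · intro w' _ hw
    rw [rex_mul_left, rex_two_mul hs hw.symm (fun y => φ w y - m w) (fun y => φ w' y - m w'), h0]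
    simp
  · simp

/-- The part of the image measure coming from typical pairs. -/
def goodPush (p : α → ℝ) (ν : β → ℝ) (τ : ℝ) (F : α → β) (y : β) : ℝ :=
  ∑ w, if F w = y ∧ p w ≤ τ ∧ ν y ≤ τ then p w else 0

lemma rex_sq_goodPush_le (hκ : ∀ w y, 0 ≤ κ w y) (hs : ∀ w, ∑ y, κ w y = 1) (hp : ∀ w, 0 ≤ p w)
    (hp1 : ∑ w, p w = 1) {ν : β → ℝ} (hν : ∀ y, ν y = ∑ w, p w * κ w y) (hτ : 0 < τ) :
    rex κ (fun F => ∑ y, goodPush p ν τ F y ^ 2) ≤ 2 * τ := by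
  have hν0 : ∀ y, 0 ≤ ν y := fun y => by
    rw [hν]; exact sum_nonneg fun w _ => mul_nonneg (hp w) (hκ w y)
  have hν1 : ∑ y, ν y = 1 := by
    simp only [hν]; rw [sum_comm]; simp only [← mul_sum, hs, mul_one, hp1]
  set φ : β → β → ℝ := fun y y' => if y = y' ∧ ν y ≤ τ then 1 else 0 with hφ
  have h1 : ∀ F : α → β, ∑ y, goodPush p ν τ F y ^ 2 ≤
      ∑ w, ∑ w', (if w = w' then τ * p w else p w * p w' * φ (F w) (F w')) := fun F => by
    have e : ∀ y, goodPush p ν τ F y ^ 2 = ∑ w, ∑ w', (if F w = y ∧ p w ≤ τ ∧ ν y ≤ τ then p w else 0) *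
        (if F w' = y ∧ p w' ≤ τ ∧ ν y ≤ τ then p w' else 0) := fun y => by
      rw [sq, goodPush, Finset.sum_mul_sum]
    simp only [e]
    rw [sum_comm]
    refine sum_le_sum fun w _ => ?_
    rw [sum_comm]
    refine sum_le_sum fun w' _ => ?_
    rw [Finset.sum_eq_single (F w) (fun y _ hy => by rw [if_neg (fun h => hy h.1.symm), zero_mul])
      (by simp)]
    have := hp w; have := hp w'
    split_ifs with h1 h2 h3 h3 h4 h4
    · subst h3; nlinarith [h1.2.1]
    · rw [hφ]; simp only; rw [if_pos ⟨h2.1.symm, h2.2.2⟩, mul_one]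
    · rw [mul_zero]; positivity
    · rw [mul_zero, hφ]; positivity
    · rw [zero_mul]; positivity
    · rw [zero_mul]; positivity
    · rw [zero_mul]; positivity
    · rw [zero_mul, hφ]; positivity
  refine (rex_mono hκ h1).trans ?_
  rw [rex_sum]
  have h2 : ∀ w w', rex κ (fun F => if w = w' then τ * p w else p w * p w' * φ (F w) (F w')) ≤
      (if w = w' then τ * p w else 0) + p w * p w' * ∑ y, κ w y * κ w' y * (if ν y ≤ τ then 1 else 0) :=
    fun w w' => by
      have h0 : 0 ≤ p w * p w' * ∑ y, κ w y * κ w' y * (if ν y ≤ τ then 1 else 0) :=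
        mul_nonneg (mul_nonneg (hp w) (hp w')) (sum_nonneg fun y _ =>
          mul_nonneg (mul_nonneg (hκ _ _) (hκ _ _)) (by split_ifs <;> norm_num))
      by_cases hw : w = w'
      · simp only [if_pos hw, rex_const hs]; linarith
      · simp only [if_neg hw]
        rw [rex_mul_left, rex_two hs hw, zero_add]
        refine le_of_eq ?_
        congr 1
        refine sum_congr rfl fun y _ => ?_
        rw [Finset.sum_eq_single y (fun y' _ hy => by
          rw [hφ]; simp only; rw [if_neg (fun h => hy h.1.symm), mul_zero]) (by simp)]
        simp [hφ]
  calc ∑ w, rex κ (fun F => ∑ w', if w = w' then τ * p w else p w * p w' * φ (F w) (F w'))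
      ≤ ∑ w, ∑ w', ((if w = w' then τ * p w else 0) +
          p w * p w' * ∑ y, κ w y * κ w' y * (if ν y ≤ τ then 1 else 0)) :=
        sum_le_sum fun w _ => by
          rw [rex_sum]; exact sum_le_sum fun w' _ => h2 w w'
    _ = τ + ∑ y, (if ν y ≤ τ then ν y ^ 2 else 0) := by
        simp only [sum_add_distrib, Finset.sum_ite_eq, Finset.mem_univ, if_true,
          ← mul_sum, hp1, mul_one]
        refine congrArg₂ (· + ·) rfl ?_
        symm
        have e : ∀ y, (if ν y ≤ τ then ν y ^ 2 else 0) = ∑ w, ∑ w', p w * p w' *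
            (κ w y * κ w' y * (if ν y ≤ τ then 1 else 0)) := fun y => by
          have : ν y ^ 2 = ∑ w, ∑ w', p w * p w' * (κ w y * κ w' y) := by
            rw [sq, hν, Finset.sum_mul_sum]
            exact sum_congr rfl fun w _ => sum_congr rfl fun w' _ => by ring
          rw [this]; split_ifs <;> simp
        simp only [e]
        rw [sum_comm]
        refine sum_congr rfl fun w _ => ?_
        rw [sum_comm]
        refine sum_congr rfl fun w' _ => ?_
        rw [← mul_sum]
    _ ≤ τ + ∑ y, τ * ν y := by
        gcongr with y
        have := hν0 y
        split_ifs with h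
        · nlinarith
        · positivity
    _ = 2 * τ := by rw [← mul_sum, hν1]; ring

lemma rex_bad_le (hκ : ∀ w y, 0 ≤ κ w y) (hs : ∀ w, ∑ y, κ w y = 1) (hp : ∀ w, 0 ≤ p w)
    {ν : β → ℝ} (hν : ∀ y, ν y = ∑ w, p w * κ w y)
    (h1 : ∑ w, (if τ < p w then p w else 0) ≤ η) (h2 : ∑ y, (if τ < ν y then ν y else 0) ≤ η) :
    rex κ (fun F => ∑ w, if p w ≤ τ ∧ ν (F w) ≤ τ then 0 else p w) ≤ 2 * η := by
  have hb : ∀ F : α → β, (∑ w, if p w ≤ τ ∧ ν (F w) ≤ τ then 0 else p w) ≤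
      ∑ w, ((if τ < p w then p w else 0) + p w * (if τ < ν (F w) then 1 else 0)) := fun F => by
    refine sum_le_sum fun w _ => ?_
    have := hp w
    rcases le_or_gt (p w) τ with h | h <;> rcases le_or_gt (ν (F w)) τ with h' | h'
    · rw [if_pos ⟨h, h'⟩]; positivity
    · simp [h.not_gt, h', h'.not_ge]
    · simp [h, h.not_ge, h'.not_gt]
    · simp [h, h.not_ge, h']; linarith
  refine (rex_mono hκ hb).trans ?_
  rw [rex_sum]
  have e : ∀ w, rex κ (fun F => (if τ < p w then p w else 0) + p w * (if τ < ν (F w) then 1 else 0)) =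
      (if τ < p w then p w else 0) + p w * ∑ y, κ w y * (if τ < ν y then 1 else 0) := fun w => by
    rw [rex_add, rex_const hs, rex_mul_left, rex_one_val hs w fun y => if τ < ν y then 1 else 0]
  simp only [e, sum_add_distrib]
  have e2 : ∑ w, p w * ∑ y, κ w y * (if τ < ν y then 1 else 0) = ∑ y, (if τ < ν y then ν y else 0) := by
    simp only [mul_sum]
    rw [sum_comm]
    refine sum_congr rfl fun y _ => ?_
    rw [hν]; split_ifs <;> simp
  rw [e2]; linarith

lemma sum_negMulLog_push_ge (hp : ∀ w, 0 ≤ p w) (hp1 : ∑ w, p w = 1) (ν : β → ℝ) (F : α → β)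
    {c θ : ℝ} (hc : 0 < c) (hc1 : c ≤ 1) (hS : ∑ y, goodPush p ν τ F y ^ 2 ≤ c)
    (hθ : (∑ w, if p w ≤ τ ∧ ν (F w) ≤ τ then 0 else p w) ≤ θ) :
    (1 - θ) * -log c - 2 ≤ ∑ y, negMulLog (push F p y) := by
  set b : β → ℝ := fun y => push F p y - goodPush p ν τ F y with hb
  have hg0 : ∀ y, 0 ≤ goodPush p ν τ F y := fun y => sum_nonneg fun w _ => by
    have := hp w; split_ifs <;> simp [*]
  have hbe : ∀ y, b y = ∑ w, if F w = y then (if p w ≤ τ ∧ ν (F w) ≤ τ then 0 else p w) else 0 :=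
    fun y => by
      rw [hb]; simp only [push, goodPush]
      rw [← sum_sub_distrib]
      refine sum_congr rfl fun w _ => ?_
      by_cases h : F w = y
      · subst h; by_cases h2 : p w ≤ τ ∧ ν (F w) ≤ τ <;> simp [h2]
      · simp [h]
  have hb0 : ∀ y, 0 ≤ b y := fun y => by
    rw [hbe]; refine sum_nonneg fun w _ => ?_
    have := hp w; split_ifs <;> simp [*]
  have hbs : ∑ y, b y = ∑ w, if p w ≤ τ ∧ ν (F w) ≤ τ then 0 else p w := by
    simp only [hbe]; rw [sum_comm]; simp
  have hq1 : ∑ y, push F p y = 1 := by rw [sum_push, hp1]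
  have hgb : ∀ y, push F p y = goodPush p ν τ F y + b y := fun y => by rw [hb]; ring
  have hm : ∑ y, goodPush p ν τ F y = 1 - ∑ y, b y := by
    rw [← hq1]; simp only [hgb, sum_add_distrib]; ring
  have h1 : ∀ y, -log c * goodPush p ν τ F y - goodPush p ν τ F y ^ 2 / c + goodPush p ν τ F y
      - b y ≤ negMulLog (push F p y) := fun y => by
    have hle : goodPush p ν τ F y + b y ≤ 1 := by
      rw [← hgb, ← hq1]
      exact single_le_sum (fun y _ => push_nonneg (fun w => hp w) y) (Finset.mem_univ y)
    have h2 := negMulLog_add_ge (hg0 y) (hb0 y) hle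
    rw [hgb]
    refine le_trans ?_ h2
    gcongr
    rcases (hg0 y).eq_or_lt with h | h
    · rw [← h]; simp
    · have h3 := Real.log_le_sub_one_of_pos (div_pos h hc)
      rw [Real.log_div h.ne' hc.ne'] at h3
      have h4 := mul_le_mul_of_nonneg_left h3 h.le
      rw [negMulLog, sq, mul_div_assoc]
      linarith
  have h2 := sum_le_sum fun y (_ : y ∈ Finset.univ) => h1 y
  simp only [sum_add_distrib, sum_sub_distrib, ← mul_sum, ← sum_div] at h2
  refine le_trans ?_ h2
  rw [hm]
  have hlog : 0 ≤ -log c := neg_nonneg.2 (Real.log_nonpos hc.le hc1)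
  have h3 : (∑ y, goodPush p ν τ F y ^ 2) / c ≤ 1 := (div_le_one hc).2 hS
  have h4 : ∑ y, b y ≤ 1 := by
    have := sum_nonneg fun y (_ : y ∈ Finset.univ) => hg0 y
    rw [hm] at this; linarith
  have h5 : 0 ≤ ∑ y, b y := sum_nonneg fun y _ => hb0 y
  rw [← hbs] at hθ
  nlinarith [mul_nonneg hlog (sub_nonneg.2 hθ)]

/-- Existence of a code whose image has large entropy and which reproduces given statistics. -/
theorem exists_random_code {C : Type*} [Fintype C] (hκ : ∀ w y, 0 ≤ κ w y)
    (hs : ∀ w, ∑ y, κ w y = 1) (hp : ∀ w, 0 ≤ p w) (hp1 : ∑ w, p w = 1) {ν : β → ℝ}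
    (hν : ∀ y, ν y = ∑ w, p w * κ w y) (hτ : 0 < τ) (hτ1 : 8 * τ ≤ 1) (hη : 0 < η)
    (h1 : ∑ w, (if τ < p w then p w else 0) ≤ η) (h2 : ∑ y, (if τ < ν y then ν y else 0) ≤ η)
    (φ : C → α → β → ℝ) (hφ0 : ∀ c w y, 0 ≤ φ c w y) (hφ1 : ∀ c w y, φ c w y ≤ 1) :
    ∃ F : α → β, (1 - 8 * η) * -log (8 * τ) - 2 ≤ ∑ y, negMulLog (push F p y) ∧
      ∀ c, (∑ w, p w * φ c w (F w) - ∑ w, p w * ∑ y, κ w y * φ c w y) ^ 2 ≤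
        4 * (Fintype.card C + 1) * (τ + η) := by
  set D : ℝ := 4 * (Fintype.card C + 1) * (τ + η) with hD
  have hD0 : 0 < D := by positivity
  have hex : rex κ (fun F => (8 * τ)⁻¹ * (∑ y, goodPush p ν τ F y ^ 2) + ((8 * η)⁻¹ *
      (∑ w, if p w ≤ τ ∧ ν (F w) ≤ τ then 0 else p w) + D⁻¹ * ∑ c, (∑ w, p w * φ c w (F w) -
        ∑ w, p w * ∑ y, κ w y * φ c w y) ^ 2)) < 1 := by
    rw [rex_add, rex_add, rex_mul_left, rex_mul_left, rex_mul_left,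
      rex_sum Finset.univ fun c F => (∑ w, p w * φ c w (F w) - ∑ w, p w * ∑ y, κ w y * φ c w y) ^ 2]
    have i1 := mul_le_mul_of_nonneg_left (rex_sq_goodPush_le hκ hs hp hp1 hν hτ)
      (show 0 ≤ (8 * τ)⁻¹ by positivity)
    have i2 := mul_le_mul_of_nonneg_left (rex_bad_le hκ hs hp hν h1 h2)
      (show 0 ≤ (8 * η)⁻¹ by positivity)
    have i3 := mul_le_mul_of_nonneg_left (sum_le_sum fun c (_ : c ∈ Finset.univ) =>
      (rex_dev_sq_le (p := p) hκ hs (hφ0 c) (hφ1 c)).trans (sum_sq_le hp hp1 hτ h1))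
      (show 0 ≤ D⁻¹ by positivity)
    have j1 : (8 * τ)⁻¹ * (2 * τ) = 1 / 4 := by field_simp; norm_num
    have j2 : (8 * η)⁻¹ * (2 * η) = 1 / 4 := by field_simp; norm_num
    have j3 : D⁻¹ * ∑ _c : C, (τ + η) ≤ 1 / 4 := by
      rw [sum_const, Finset.card_univ, nsmul_eq_mul, inv_mul_le_iff₀ hD0, hD]
      nlinarith
    refine lt_of_le_of_lt (add_le_add i1 (add_le_add i2 i3)) ?_
    rw [j1, j2]
    linarith
  obtain ⟨F, hF⟩ := exists_lt_of_rex_lt hκ hs hex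
  have k1 : 0 ≤ ∑ y, goodPush p ν τ F y ^ 2 := sum_nonneg fun y _ => sq_nonneg _
  have k2 : 0 ≤ ∑ w, if p w ≤ τ ∧ ν (F w) ≤ τ then 0 else p w := sum_nonneg fun w _ => by
    have := hp w; split_ifs <;> simp [*]
  have k3 : 0 ≤ ∑ c, (∑ w, p w * φ c w (F w) - ∑ w, p w * ∑ y, κ w y * φ c w y) ^ 2 :=
    sum_nonneg fun c _ => sq_nonneg _
  have l1 : 0 ≤ (8 * τ)⁻¹ * (∑ y, goodPush p ν τ F y ^ 2) := by positivity
  have l2 : 0 ≤ (8 * η)⁻¹ * ∑ w, if p w ≤ τ ∧ ν (F w) ≤ τ then 0 else p w := by positivity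
  have l3 : 0 ≤ D⁻¹ * ∑ c, (∑ w, p w * φ c w (F w) - ∑ w, p w * ∑ y, κ w y * φ c w y) ^ 2 := by
    positivity
  refine ⟨F, sum_negMulLog_push_ge (τ := τ) hp hp1 ν F (by positivity) hτ1 ?_ ?_, fun c => ?_⟩
  · have : (8 * τ)⁻¹ * (∑ y, goodPush p ν τ F y ^ 2) ≤ 1 := by linarith
    rwa [inv_mul_le_iff₀ (by positivity), mul_one] at this
  · have : (8 * η)⁻¹ * (∑ w, if p w ≤ τ ∧ ν (F w) ≤ τ then 0 else p w) ≤ 1 := by linarith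
    rwa [inv_mul_le_iff₀ (by positivity), mul_one] at this
  · have : D⁻¹ * ∑ c, (∑ w, p w * φ c w (F w) - ∑ w, p w * ∑ y, κ w y * φ c w y) ^ 2 ≤ 1 := by
      linarith
    rw [inv_mul_le_iff₀ hD0, mul_one] at this
    exact (single_le_sum (f := fun c => (∑ w, p w * φ c w (F w) -
      ∑ w, p w * ∑ y, κ w y * φ c w y) ^ 2) (fun c _ => sq_nonneg _) (Finset.mem_univ c)).trans this

end RandomCode

/-! ### Marker towers -/

section Tower

variable {A : Type} [Fintype A] [Nonempty A] [DecidableEq A] [MeasurableSpace A]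
  [MeasurableSingletonClass A] {μ : Measure (Conf A)} [IsProbabilityMeasure μ]

lemma exists_small_word (hμ : Inv μ) (hUM : UM μ) (hh : 0 < hrate μ) {δ : ℝ} (hδ : 0 < δ) :
    ∃ (l : ℕ) (W : Set (Conf A)), Dep (Ico (-(l : ℤ)) 0) (· ∈ W) ∧ 0 < μ.real W ∧ μ.real W < δ := by
  have h1 := aep hμ hUM (half_pos hh) (show (0 : ℝ) < 1 / 2 by norm_num)
  have h2 : Tendsto (fun N : ℕ => exp (-(N * (hrate μ - hrate μ / 2)))) atTop (nhds 0) := by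
    refine Real.tendsto_exp_neg_atTop_nhds_zero.comp ?_
    exact tendsto_natCast_atTop_atTop.atTop_mul_const (by linarith)
  obtain ⟨N, h3, h4⟩ := (h1.and (h2.eventually (gt_mem_nhds hδ))).exists
  have hf : FinMeas (iwin (B := A) N) := finMeas_rs _
  obtain ⟨s, hs0, hs⟩ : ∃ s, 0 < pr μ (iwin (B := A) N) s ∧
      pr μ (iwin (B := A) N) s ≤ exp (-(N * (hrate μ - hrate μ / 2))) := by
    by_contra! hc
    have : ∑ s, (if exp (-(N * (hrate μ - hrate μ / 2))) < pr μ (iwin (B := A) N) s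
      then pr μ (iwin N) s else 0) = ∑ s, pr μ (iwin (B := A) N) s := by
      refine sum_congr rfl fun s _ => ?_
      rcases (pr_nonneg (μ := μ) (X := iwin (B := A) N) (a := s)).eq_or_lt with h | h
      · simp [← h]
      · rw [if_pos (hc s h)]
    rw [this, sum_pr hf] at h3
    norm_num at h3
  refine ⟨N, shift (-N) ⁻¹' (iwin N ⁻¹' {s}), ?_, ?_, ?_⟩
  · refine Dep.shift_set (I := Ico (0 : ℤ) N) (f := fun x => iwin N x ∈ ({s} : Set _)) ?_ _ ?_
    · exact Dep.comp (by simpa using dep_rs (A := A) (Finset.Ico (0 : ℤ) N)) (· ∈ ({s} : Set _))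
    · intro i hi; simp only [mem_Ico] at hi ⊢; omega
  · rw [hμ.real (hf s)]; exact hs0
  · rw [hμ.real (hf s)]; exact hs.trans_lt h4

/-- Configurations avoiding `W` at the times `0, -G, …, -(j-1)G`. -/
def avoid (W : Set (Conf A)) (G j : ℕ) : Set (Conf A) := {x | ∀ i < j, shift (-(i * G : ℕ)) x ∉ W}

lemma dep_avoid {W : Set (Conf A)} {l : ℕ} (hW : Dep (Ico (-(l : ℤ)) 0) (· ∈ W)) (G j : ℕ) :
    Dep (Ico (-((l + j * G : ℕ) : ℤ)) 0) (· ∈ avoid W G j) := by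
  intro x y hxy
  refine propext (forall_congr' fun i => forall_congr' fun hi => not_congr (iff_of_eq ?_))
  refine hW _ _ fun t ht => hxy _ ?_
  have := Nat.mul_le_mul_right G hi.le
  simp only [mem_Ico] at ht ⊢
  push_cast at *
  omega

lemma exists_avoid_le (hμ : Inv μ) (hUM : UM μ) {W : Set (Conf A)} {l : ℕ}
    (hW : Dep (Ico (-(l : ℤ)) 0) (· ∈ W)) (hp : 0 < μ.real W) {δ : ℝ} (hδ : 0 < δ) :
    ∃ G j : ℕ, μ.real (avoid W G j) ≤ δ := by
  obtain ⟨g, hg⟩ := hUM (μ.real W / 2) (half_pos hp)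
  set G := g + l with hG
  have hWm : MeasurableSet W := Dep.measurableSet_past hW
  have hp1 : μ.real W ≤ 1 := measureReal_le_one
  have step : ∀ j, μ.real (avoid W G (j + 1)) ≤ (1 - μ.real W / 2) * μ.real (avoid W G j) := by
    intro j
    have hm : ∀ j, MeasurableSet (avoid W G j) := fun j =>
      Dep.measurableSet_past (dep_avoid hW G j)
    have hC : MeasurableSet (shift (G : ℤ) ⁻¹' W) := measurable_shift _ hWm
    have e : shift (G : ℤ) ⁻¹' avoid W G (j + 1) = avoid W G j \ (shift (G : ℤ) ⁻¹' W) := by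
      ext x
      simp only [mem_preimage, avoid, Set.mem_sdiff, Set.mem_ofPred_eq, shift_shift]
      constructor
      · refine fun h => ⟨fun i hi => ?_, ?_⟩
        · have := h (i + 1) (by omega)
          convert this using 3
          push_cast; ring
        · have := h 0 (by omega)
          simpa using this
      · rintro ⟨h1, h2⟩ i hi
        rcases i with _ | i
        · simpa using h2
        · have := h1 i (by omega)
          convert this using 3
          push_cast; ring
    have h1 := hg (l + j * G) l (avoid W G j) (shift (G : ℤ) ⁻¹' W) (dep_avoid hW G j)
      (hW.shift_set _ fun i hi => by simp only [mem_Ico] at hi ⊢; push_cast [hG]; omega)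
    rw [hμ.real hWm] at h1
    have h2 := measureReal_sdiff_add_inter (μ := μ) (s := avoid W G j) hC
    rw [← hμ.real (hm (j + 1)) G, e]
    nlinarith [(abs_le.1 h1).1]
  have hpow : ∀ j, μ.real (avoid W G j) ≤ (1 - μ.real W / 2) ^ j := by
    intro j
    induction j with
    | zero => simp
    | succ j ih =>
      rw [pow_succ']
      exact (step j).trans (mul_le_mul_of_nonneg_left ih (by linarith))
  obtain ⟨j, hj⟩ := exists_pow_lt_of_lt_one hδ (show 1 - μ.real W / 2 < 1 by linarith)
  exact ⟨G, j, (hpow j).trans hj.le⟩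

/-- Bases of disjoint clopen towers, measurable with respect to the past. -/
theorem exists_tower (hμ : Inv μ) (hUM : UM μ) (hh : 0 < hrate μ) {ε : ℝ} (hε : 0 < ε) {L : ℕ}
    (hL : 0 < L) : ∃ (M : ℕ) (E : Set (Conf A)), Dep (Ico (-(M : ℤ)) 0) (· ∈ E) ∧
      (∀ x ∈ E, ∀ i : ℤ, 0 < i → i < L → shift i x ∉ E) ∧ 1 - ε ≤ L * μ.real E := by
  have hL' : (0 : ℝ) < L := by exact_mod_cast hL
  obtain ⟨l, W, hW, hp, hpε⟩ := exists_small_word hμ hUM hh (show 0 < ε / (2 * L) by positivity)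
  obtain ⟨G, j, hj⟩ := exists_avoid_le hμ hUM hW hp (half_pos hε)
  have hWm : MeasurableSet W := Dep.measurableSet_past hW
  set K := j * G + 1 with hK
  set E : Set (Conf A) := {x | ∃ k ∈ Finset.Icc 1 K, shift (-(k * L : ℕ)) x ∈ W ∧
    ∀ s ∈ Finset.range (k * L), shift (-(s : ℕ)) x ∉ W} with hE
  have hdep : Dep (Ico (-((K * L + l : ℕ) : ℤ)) 0) (· ∈ E) := by
    intro x y hxy
    have key : ∀ s : ℕ, s ≤ K * L → (shift (-(s : ℕ)) x ∈ W) = (shift (-(s : ℕ)) y ∈ W) := fun s hs =>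
      hW _ _ fun t ht => hxy _ (by simp only [mem_Ico] at ht ⊢; push_cast at *; omega)
    refine propext (exists_congr fun k => and_congr_right fun hk => ?_)
    have hkK := Nat.mul_le_mul_right L (Finset.mem_Icc.1 hk).2
    refine and_congr (iff_of_eq (key _ hkK)) (forall_congr' fun s => forall_congr' fun hs =>
      not_congr (iff_of_eq (key _ ((Finset.mem_range.1 hs).le.trans hkK))))
  have hEm : MeasurableSet E :=
    Dep.measurableSet_past hdep
  refine ⟨K * L + l, E, hdep, ?_, ?_⟩
  · rintro x ⟨k, hk, hk1, hk2⟩ i hi0 hiL ⟨k', hk', hk1', hk2'⟩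
    obtain ⟨i, rfl⟩ := Int.eq_ofNat_of_zero_le hi0.le
    simp only [Int.natCast_pos, Nat.cast_lt] at hi0 hiL
    simp only [shift_shift] at hk1' hk2'
    have hkL : L ≤ k' * L := Nat.le_mul_of_pos_left L (Finset.mem_Icc.1 hk').1
    rcases lt_trichotomy (k' * L) (k * L + i) with h | h | h
    · refine hk2 (k' * L - i) (Finset.mem_range.2 (by omega)) ?_
      convert hk1' using 2
      push_cast [Nat.cast_sub (show i ≤ k' * L by omega)]; ring
    · have : L ∣ i := (Nat.dvd_add_right (Dvd.intro_left k rfl)).1 (h ▸ Dvd.intro_left k' rfl)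
      exact absurd (Nat.le_of_dvd hi0 this) (by omega)
    · refine hk2' (k * L + i) (Finset.mem_range.2 h) ?_
      convert hk1 using 2
      push_cast; ring
  · have hcov : (Set.univ : Set (Conf A)) ⊆ (⋃ i ∈ Finset.range L, shift (-(i : ℕ)) ⁻¹' E) ∪
        ((⋃ i ∈ Finset.range L, shift (-(i : ℕ)) ⁻¹' W) ∪ avoid W G j) := by
      intro x _
      by_cases hx : ∃ s : ℕ, s ≤ K * L ∧ shift (-(s : ℕ)) x ∈ W
      · classical
        have hex : ∃ s : ℕ, shift (-(s : ℕ)) x ∈ W := hx.imp fun s hs => hs.2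
        obtain ⟨s₀, hs₀, hs₀'⟩ := hx
        set t := Nat.find hex with ht
        have ht1 : shift (-(t : ℕ)) x ∈ W := Nat.find_spec hex
        have ht2 : ∀ s < t, shift (-(s : ℕ)) x ∉ W := fun s hs => Nat.find_min hex hs
        have ht3 : t ≤ K * L := (Nat.find_min' hex hs₀').trans hs₀
        rcases lt_or_ge t L with h | h
        · right; left
          simp only [mem_iUnion, mem_preimage]
          exact ⟨t, Finset.mem_range.2 h, ht1⟩
        · left
          simp only [mem_iUnion, mem_preimage]
          have hdm := Nat.div_add_mod' t L
          refine ⟨t % L, Finset.mem_range.2 (Nat.mod_lt _ hL), t / L, Finset.mem_Icc.2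
            ⟨Nat.div_pos h hL, Nat.div_le_of_le_mul (by rwa [mul_comm])⟩, ?_, fun s hs => ?_⟩
          · rw [shift_shift]; convert ht1 using 2
            conv_rhs => rw [← hdm]
            push_cast; ring
          · rw [shift_shift]
            have := ht2 (s + t % L) (by have := Finset.mem_range.1 hs; omega)
            convert this using 3
            push_cast; ring
      · right; right
        push Not at hx
        intro i hi
        refine hx _ ?_
        have := Nat.mul_le_mul_right G hi.le
        have := Nat.le_mul_of_pos_right K hL
        omega
    have h1 : (1 : ℝ) ≤ L * μ.real E + (L * μ.real W + μ.real (avoid W G j)) := by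
      calc (1 : ℝ) = μ.real Set.univ := by simp
        _ ≤ _ := measureReal_mono hcov
        _ ≤ _ := measureReal_union_le _ _
        _ ≤ _ := by
          refine add_le_add ?_ ((measureReal_union_le _ _).trans (add_le_add ?_ le_rfl))
          · refine (measureReal_biUnion_finset_le _ _).trans (le_of_eq ?_)
            rw [sum_congr rfl fun i _ => hμ.real hEm _]; simp
          · refine (measureReal_biUnion_finset_le _ _).trans (le_of_eq ?_)
            rw [sum_congr rfl fun i _ => hμ.real hWm _]; simp
    have h2 : L * μ.real W ≤ ε / 2 := by
      have := mul_le_mul_of_nonneg_left hpε.le hL'.le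
      refine this.trans (le_of_eq ?_)
      field_simp
    linarith

end Tower

/-! ### Block codes -/

section CondEntropy

variable {Ω α β γ ζ : Type*} [MeasurableSpace Ω] [Fintype α] [Fintype β] [Fintype γ] [Fintype ζ]
  {μ : Measure Ω} [IsProbabilityMeasure μ]

lemma ent_pair_eq {Y : Ω → α} {C : Ω → β} (hY : FinMeas Y) (hC : FinMeas C) :
    ent μ (fun ω => (Y ω, C ω)) = ent μ Y + ∑ a, pr μ Y a *
      ∑ c, negMulLog (pr μ (fun ω => (Y ω, C ω)) (a, c) / pr μ Y a) := by
  rw [ent, ent, Fintype.sum_prod_type, ← sum_add_distrib]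
  refine sum_congr rfl fun a _ => ?_
  have hs := sum_pr_right (μ := μ) hY hC a
  rcases (pr_nonneg μ Y a).eq_or_lt with h | h
  · have : ∀ c, pr μ (fun ω => (Y ω, C ω)) (a, c) = 0 := by
      rw [← h, sum_eq_zero_iff_of_nonneg fun _ _ => pr_nonneg ..] at hs
      exact fun c => hs c (Finset.mem_univ c)
    simp [← h, this]
  · have : ∀ c, negMulLog (pr μ (fun ω => (Y ω, C ω)) (a, c)) =
        pr μ (fun ω => (Y ω, C ω)) (a, c) / pr μ Y a * negMulLog (pr μ Y a) +
        pr μ Y a * negMulLog (pr μ (fun ω => (Y ω, C ω)) (a, c) / pr μ Y a) := fun c => by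
      rw [← Real.negMulLog_mul, mul_div_cancel₀ _ h.ne']
    simp only [this]
    rw [sum_add_distrib, ← sum_mul, ← sum_div, hs, div_self h.ne', one_mul,
      ← mul_sum]

/-- If, on an event `P ∈ s`, `P` determines `V`, `X` determines `C`, and `C` is almost independent
of `P` with law close to `q`, then the conditional entropy of `X` given `V` is large. -/
lemma ent_cond_ge [Nonempty β] {X : Ω → γ} {V : Ω → ζ} {P : Ω → α} {C : Ω → β} (hX : FinMeas X)
    (hV : FinMeas V) (hP : FinMeas P) (hC : FinMeas C) (s : Set α)
    (hPV : ∀ ω ω', P ω ∈ s → P ω = P ω' → V ω = V ω')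
    (hXC : ∀ ω ω', P ω ∈ s → P ω' ∈ s → X ω = X ω' → C ω = C ω')
    {q : β → ℝ} (hq : ∀ c, 0 ≤ q c) {δ : ℝ}
    (h : ∀ a ∈ s, ∑ c, |pr μ (fun ω => (P ω, C ω)) (a, c) - pr μ P a * q c| ≤ δ * pr μ P a) :
    ent μ V + μ.real (P ⁻¹' s) * (∑ c, negMulLog (q c) - δ * log (Fintype.card β) - 2) ≤
      ent μ (fun ω => (X ω, V ω)) := by
  classical
  set Y : Ω → α ⊕ ζ := fun ω => if P ω ∈ s then Sum.inl (P ω) else Sum.inr (V ω) with hYd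
  set C' : Ω → β := fun ω => if P ω ∈ s then C ω else Classical.arbitrary β with hCd
  have hY : FinMeas Y := (hP.pair hV).of_det fun ω ω' h => by
    simp only [Prod.mk.injEq] at h; simp only [hYd, h.1, h.2]
  have hC' : FinMeas C' := (hP.pair hC).of_det fun ω ω' h => by
    simp only [Prod.mk.injEq] at h; simp only [hCd, h.1, h.2]
  have hY1 : ∀ ω a, Y ω = Sum.inl a ↔ P ω ∈ s ∧ P ω = a := fun ω a => by
    by_cases h : P ω ∈ s <;> simp [hYd, h]
  have hYV : ∀ ω ω', Y ω = Y ω' → V ω = V ω' ∧ (P ω ∈ s ↔ P ω' ∈ s) := fun ω ω' h => by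
    by_cases h1 : P ω ∈ s
    · have := (hY1 ω (P ω)).2 ⟨h1, rfl⟩
      rw [h, hY1] at this
      exact ⟨hPV _ _ h1 this.2.symm, by simp [h1, this.1]⟩
    · by_cases h2 : P ω' ∈ s
      · simp [hYd, h1, h2] at h
      · simp only [hYd, h1, h2, if_false, Sum.inr.injEq] at h
        exact ⟨h, by simp [h1, h2]⟩
  have h1 := ent_submod (μ := μ) hX hY hV
  have h2 : ent μ (fun ω => (Y ω, V ω)) = ent μ Y := ent_congr hY fun ω ω' => by
    simp only [Prod.mk.injEq]
    exact ⟨fun h => ⟨h, (hYV _ _ h).1⟩, fun h => h.1⟩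
  have h3 : ent μ (fun ω => (Y ω, C' ω)) ≤ ent μ (fun ω => (X ω, Y ω, V ω)) :=
    ent_mono (hX.pair (hY.pair hV)) fun ω ω' h => by
      simp only [Prod.mk.injEq] at h ⊢
      refine ⟨h.2.1, ?_⟩
      have h4 := (hYV _ _ h.2.1).2
      by_cases h5 : P ω ∈ s
      · simp only [hCd, h5, h4.1 h5, if_true]; exact hXC _ _ h5 (h4.1 h5) h.1
      · simp only [hCd, h5, h4.not.1 h5, if_false]
  rw [ent_pair_eq hY hC'] at h3
  suffices μ.real (P ⁻¹' s) * (∑ c, negMulLog (q c) - δ * log (Fintype.card β) - 2) ≤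
      ∑ a, pr μ Y a * ∑ c, negMulLog (pr μ (fun ω => (Y ω, C' ω)) (a, c) / pr μ Y a) by
    linarith
  have hnn : ∀ a, 0 ≤ pr μ Y a * ∑ c, negMulLog (pr μ (fun ω => (Y ω, C' ω)) (a, c) / pr μ Y a) :=
    fun a => mul_nonneg (pr_nonneg ..) (sum_nonneg fun c _ => negMulLog_nonneg
      (div_nonneg (pr_nonneg ..) (pr_nonneg ..)) (div_le_one_of_le₀ (by
        rw [← sum_pr_right hY hC']
        exact single_le_sum (f := fun c => pr μ (fun ω => (Y ω, C' ω)) (a, c))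
          (fun _ _ => pr_nonneg ..) (Finset.mem_univ c)) (pr_nonneg ..)))
  rw [Fintype.sum_sum_type, measureReal_preimage hP, sum_mul]
  refine le_add_of_le_of_nonneg (sum_le_sum fun a _ => ?_) (sum_nonneg fun a _ => hnn _)
  by_cases ha : a ∈ s
  · have e1 : pr μ Y (Sum.inl a) = pr μ P a := by
      simp only [pr]; congr 1; ext ω
      simp only [mem_preimage, mem_singleton_iff, hY1]
      exact ⟨fun h => h.2, fun h => ⟨h ▸ ha, h⟩⟩
    have e2 : ∀ c, pr μ (fun ω => (Y ω, C' ω)) (Sum.inl a, c) = pr μ (fun ω => (P ω, C ω)) (a, c) := by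
      intro c
      simp only [pr]; congr 1; ext ω
      simp only [mem_preimage, mem_singleton_iff, Prod.mk.injEq, hY1]
      constructor
      · rintro ⟨⟨h, h'⟩, h2⟩; refine ⟨h', ?_⟩; simpa [hCd, h] using h2
      · rintro ⟨h, h'⟩; have : P ω ∈ s := h ▸ ha
        exact ⟨⟨this, h⟩, by simpa [hCd, this] using h'⟩
    rw [if_pos ha, e1]
    simp only [e2]
    rcases (pr_nonneg μ P a).eq_or_lt with h0 | h0
    · simp [← h0]
    · exact mul_le_mul_of_nonneg_left (sum_negMulLog_cond_ge hP hC hq h0 (h a ha)) h0.le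
  · rw [if_neg ha, zero_mul]; exact hnn _

end CondEntropy

section BlockCode

variable {A B : Type} [Fintype A] [Nonempty A] [DecidableEq A] [MeasurableSpace A]
  [MeasurableSingletonClass A] [Fintype B] [Nonempty B] [DecidableEq B] [MeasurableSpace B]
  [MeasurableSingletonClass B]

open Classical in
/-- The stationary code which writes the word `F w` over the word `w` found at distance `g` after
each visit to `E`. -/
def blockCode (E : Set (Conf A)) (g N : ℕ)
    (F : Word A N → Word B N) (x : Conf A) : B :=
  if h : ∃ i : Finset.Ico (0 : ℤ) N, shift (-(g + i)) x ∈ E then F (iwin N (shift (-h.choose) x)) h.choose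
  else Classical.arbitrary B

variable {E : Set (Conf A)} {g N M : ℕ} {F : Word A N → Word B N}

/-- Visits to `E` are at distance at least `L`. -/
def Spaced (E : Set (Conf A)) (L : ℕ) : Prop := ∀ x ∈ E, ∀ i : ℤ, 0 < i → i < L → shift i x ∉ E

lemma Spaced.eq {L : ℕ} (h : Spaced E L) {x : Conf A} {i j : ℤ} (hi : shift i x ∈ E) (hj : shift j x ∈ E)
    (h1 : i < j + L) (h2 : j < i + L) : i = j := by
  rcases lt_trichotomy i j with h3 | h3 | h3
  · refine absurd ?_ (h _ hi (j - i) (by omega) (by omega))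
    rw [shift_shift]; convert hj using 2; ring
  · exact h3
  · refine absurd ?_ (h _ hj (i - j) (by omega) (by omega))
    rw [shift_shift]; convert hi using 2; ring

lemma blockCode_eq (hE : Spaced E (g + N)) {x : Conf A} (i : Finset.Ico (0 : ℤ) N)
    (hi : shift (-(g + i)) x ∈ E) : blockCode E g N F x = F (iwin N (shift (-i) x)) i := by
  have h : ∃ i : Finset.Ico (0 : ℤ) N, shift (-(g + i)) x ∈ E := ⟨i, hi⟩
  have h1 := Finset.mem_Ico.1 i.2
  have h2 := Finset.mem_Ico.1 h.choose.2
  have : h.choose = i := by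
    have := hE.eq hi h.choose_spec (by push_cast; omega) (by push_cast; omega)
    ext; omega
  rw [blockCode, dif_pos h, this]

lemma blockCode_dep (hE : Spaced E (g + N)) (hM : Dep (Ico (-(M : ℤ)) 0) (· ∈ E)) :
    Dep (Ico (-((M + g + N : ℕ) : ℤ)) N) (blockCode E g N F) := by
  intro x y hxy
  have key : ∀ i : Finset.Ico (0 : ℤ) N, (shift (-(g + i)) x ∈ E) = (shift (-(g + i)) y ∈ E) := fun i =>
    hM _ _ fun t ht => hxy _ (by
      have h1 := Finset.mem_Ico.1 i.2
      simp only [mem_Ico] at ht ⊢; push_cast; omega)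
  by_cases h : ∃ i : Finset.Ico (0 : ℤ) N, shift (-(g + i)) x ∈ E
  · obtain ⟨i, hi⟩ := h
    rw [blockCode_eq hE i hi, blockCode_eq hE i (key i ▸ hi)]
    have : iwin N (shift (-i) x) = iwin N (shift (-i) y) := by
      refine rs_eq_iff.2 fun t ht => hxy _ ?_
      have h1 := Finset.mem_Ico.1 i.2
      have h2 := Finset.mem_Ico.1 ht
      simp only [mem_Ico]; push_cast; omega
    rw [this]
  · rw [blockCode, dif_neg h, blockCode, dif_neg (by simpa only [key] using h)]

lemma code_blockCode (hE : Spaced E (g + N)) {x : Conf A} {t : ℤ} (ht : shift t x ∈ E)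
    (i : Finset.Ico (0 : ℤ) N) : code (blockCode E g N F) x (t + g + i) = F (iwin N (shift (t + g) x)) i := by
  rw [code, blockCode_eq hE i (by rw [shift_shift]; convert ht using 2; ring), shift_shift]
  congr 3; ring

variable {μ : Measure (Conf A)} [IsProbabilityMeasure μ]

/-- Lower bound for the joint law of a process and its block code. -/
lemma blockCode_law (hμ : Inv μ) (hE : Spaced E (g + N)) (hM : Dep (Ico (-(M : ℤ)) 0) (· ∈ E))
    {δ : ℝ} (hg : MixGap μ g δ) {n : ℕ} (hn0 : 0 < n) (hn : n ≤ N) (s : Word (A × B) n) :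
    μ.real E * ∑ i ∈ Finset.range (N - n + 1), ((∑ w, pr μ (iwin N) w *
      if iwin n (shift i (zipc (xt w) (xt (F w)))) = s then 1 else 0) - δ) ≤
      pr μ (fun x => iwin n (zipc x (code (blockCode E g N F) x))) s := by
  have hEm : MeasurableSet E := Dep.measurableSet_past hM
  set S : ℕ → Set (Word A N) := fun i =>
    {w | iwin n (shift (i : ℤ) (zipc (xt w) (xt (F w)))) = s} with hS
  set C : ℕ → Set (Conf A) := fun i => shift (g : ℤ) ⁻¹' (iwin N ⁻¹' S i) with hC
  have hf : FinMeas (iwin (B := A) N) := finMeas_rs _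
  have hCm : ∀ i, MeasurableSet (C i) := fun i => measurable_shift _ (hf.preimage _)
  have hCr : ∀ i, μ.real (C i) = ∑ w, pr μ (iwin N) w *
      if iwin n (shift (i : ℤ) (zipc (xt w) (xt (F w)))) = s then 1 else 0 := fun i => by
    classical
    rw [hμ.real (hf.preimage _), measureReal_preimage hf]
    refine sum_congr rfl fun w _ => ?_
    simp [hS]
  have hCd : ∀ i, Dep (Ico (g : ℤ) (g + N)) (· ∈ C i) := fun i => by
    refine Dep.shift_set (I := Ico (0 : ℤ) N) (f := fun x => iwin N x ∈ S i) ?_ _ ?_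
    · exact Dep.comp (by simpa using dep_rs (A := A) (Finset.Ico (0 : ℤ) N)) (· ∈ S i)
    · intro i hi; simp only [mem_Ico] at hi ⊢; omega
  have hsub : (⋃ i ∈ Finset.range (N - n + 1), shift (-(g + i : ℕ) : ℤ) ⁻¹' (E ∩ C i)) ⊆
      (fun x => iwin n (zipc x (code (blockCode E g N F) x))) ⁻¹' {s} := by
    intro x hx
    simp only [mem_iUnion, mem_preimage, mem_inter_iff, exists_prop] at hx
    obtain ⟨i, hi, hxE, hxC⟩ := hx
    have hi' := Finset.mem_range.1 hi
    simp only [hC, mem_preimage, hS, Set.mem_ofPred_eq, shift_shift] at hxC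
    rw [mem_preimage, mem_singleton_iff, ← hxC]
    refine rs_eq_iff.2 fun k hk => ?_
    have hk' := Finset.mem_Ico.1 hk
    have hmem : k + i ∈ Finset.Ico (0 : ℤ) N := Finset.mem_Ico.2 (by omega)
    have h1 := code_blockCode (F := F) hE hxE ⟨k + i, hmem⟩
    simp only [zipc, shift, xt, hmem, dif_pos]
    refine Prod.ext ?_ ?_
    · simp only [iwin, rs, shift]; congr 1; push_cast; ring
    · simp only
      have e : k = -((g + i : ℕ) : ℤ) + g + (⟨k + i, hmem⟩ : Finset.Ico (0 : ℤ) N) := by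
        push_cast; ring
      refine (congrArg _ e).trans (h1.trans ?_)
      rw [add_comm (-((g + i : ℕ) : ℤ))]
  have hdisj : Set.PairwiseDisjoint (Finset.range (N - n + 1) : Set ℕ)
      fun i : ℕ => shift (-(g + i : ℕ) : ℤ) ⁻¹' (E ∩ C i) := by
    intro i hi j hj hij
    refine Set.disjoint_left.2 fun x hx hx' => hij ?_
    have hi' := Finset.mem_range.1 hi
    have hj' := Finset.mem_range.1 hj
    have := hE.eq (i := -((g + i : ℕ) : ℤ)) (j := -((g + j : ℕ) : ℤ)) hx.1 hx'.1 (by push_cast; omega) (by push_cast; omega)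
    push_cast at this; omega
  rw [pr]
  refine le_trans ?_ (measureReal_mono hsub)
  rw [measureReal_biUnion_finset hdisj fun i _ => measurable_shift _ (hEm.inter (hCm i)),
    mul_sum]
  refine sum_le_sum fun i _ => ?_
  rw [hμ.real (hEm.inter (hCm i)), ← hCr]
  have := (abs_le.1 (hg.event hM (hCd i))).1
  linarith

open Classical in
/-- The name written by `blockCode` at a visit to `E`. -/
def visitName (E : Set (Conf A)) (g N : ℕ)
    (F : Word A N → Word B N) (x : Conf A) :
    Option (Word B N) :=
  if x ∈ E then some (F (iwin N (shift g x))) else none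

open Classical in
/-- The indicator of a set, as a process. -/
def visit (E : Set (Conf A)) (x : Conf A) : Bool := decide (x ∈ E)

lemma visit_dep (hM : Dep (Ico (-(M : ℤ)) 0) (· ∈ E)) : Dep (Ico (-(M : ℤ)) 0) (visit E) :=
  fun x y h => by
    have h1 : x ∈ E ↔ y ∈ E := iff_of_eq (hM x y h)
    by_cases hx : x ∈ E
    · simp [visit, hx, h1.1 hx]
    · simp [visit, hx, h1.not.1 hx]

lemma visitName_dep (hM : Dep (Ico (-(M : ℤ)) 0) (· ∈ E)) :
    Dep (Ico (-(M : ℤ)) (g + N)) (visitName E g N F) := fun x y h => by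
  have h1 : x ∈ E ↔ y ∈ E :=
    iff_of_eq (hM x y fun i hi => h i (by simp only [mem_Ico] at hi ⊢; omega))
  have h2 : iwin N (shift (g : ℤ) x) = iwin N (shift (g : ℤ) y) := rs_eq_iff.2 fun i hi => h _ (by
    have := Finset.mem_Ico.1 hi
    simp only [mem_Ico] at hi ⊢; omega)
  by_cases hx : x ∈ E
  · simp [visitName, hx, h1.1 hx, h2]
  · simp [visitName, hx, h1.not.1 hx]

lemma visitName_crate (hE : Spaced E (g + N)) (hM : Dep (Ico (-(M : ℤ)) 0) (· ∈ E)) {δ : ℝ}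
    (hμ : Inv μ) (hg : MixGap μ g δ) (j : ℕ) :
    ent μ (fun x => rs (Finset.Ico (-(j : ℤ)) 0) (code (visitName E g N F) x)) +
      μ.real E * (∑ y, negMulLog (push F (pr μ (iwin N)) y) -
      δ * log (Fintype.card (Word B N)) - 2) ≤
      ent μ (fun x => rs (Finset.Ico (-(j : ℤ)) 1) (code (visitName E g N F) x)) := by
  set v := visitName E g N F with hv
  have hdep : ∀ a b : ℤ, Dep (Ico (a - M) (b + (g + N))) fun x => rs (Finset.Ico a b) (code v x) := by
    intro a b x y h
    refine rs_eq_iff.2 fun i hi => visitName_dep hM _ _ fun t ht => h _ ?_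
    have := Finset.mem_Ico.1 hi
    simp only [mem_Ico] at ht ⊢; omega
  have hfm : ∀ a b : ℤ, FinMeas fun x => rs (Finset.Ico a b) (code v x) := fun a b =>
    Dep.finMeas (I := Finset.Ico (a - M) (b + (g + N))) (by simpa using hdep a b)
  set P : Conf A → (Finset.Ico (-((M + j : ℕ) : ℤ)) 0 → A) := rs (Finset.Ico (-((M + j : ℕ) : ℤ)) 0) with hP
  have hPE : ∀ x, (xt (P x) ∈ E) = (x ∈ E) := fun x => Dep.xt_rs hM (by
    intro i hi; simp only [mem_Ico, Finset.coe_Ico] at hi ⊢; push_cast; omega) x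
  set C : Conf A → (Word B N) := fun x => F (iwin N (shift (g : ℤ) x)) with hC
  have hCd : Dep (Ico (g : ℤ) (g + N)) C := by
    refine Dep.shift_set (I := Ico (0 : ℤ) N) (f := fun x => F (iwin N x)) ?_ _ ?_
    · exact Dep.comp (by simpa using dep_rs (A := A) (Finset.Ico (0 : ℤ) N)) F
    · intro i hi; simp only [mem_Ico] at hi ⊢; omega
  have hCm : FinMeas C := Dep.finMeas (I := Finset.Ico (g : ℤ) (g + N)) (by simpa using hCd)
  have hVm : FinMeas v := Dep.finMeas (I := Finset.Ico (-(M : ℤ)) (g + N))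
    (by simpa using visitName_dep hM)
  have hCp : ∀ c, pr μ C c = push F (pr μ (iwin N)) c := fun c => by
    have hf : FinMeas fun x : Conf A => F (iwin N x) := (finMeas_rs _).comp F
    exact (hμ.pr hf g c).trans (pr_comp (finMeas_rs _) F c)
  have h1 := ent_cond_ge (μ := μ) hVm (hfm (-j) 0) (finMeas_rs (Finset.Ico (-((M + j : ℕ) : ℤ)) 0)) hCm
    {a | xt a ∈ E} (q := push F (pr μ (iwin N))) (δ := δ) ?_ ?_
    (fun c => push_nonneg (fun _ => pr_nonneg ..) c) ?_
  · have e1 : rs (Finset.Ico (-((M + j : ℕ) : ℤ)) 0) ⁻¹' {a : _ → A | xt a ∈ E} = E := by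
      ext x; exact iff_of_eq (hPE x)
    have e2 : ent μ (fun x => rs (Finset.Ico (-(j : ℤ)) 1) (code v x)) =
        ent μ (fun x => (v x, rs (Finset.Ico (-(j : ℤ)) 0) (code v x))) := by
      refine ent_congr (hVm.pair (hfm _ _)) fun x y => ?_
      simp only [Prod.mk.injEq, rs_eq_iff]
      constructor
      · rintro ⟨h0, h⟩ i hi
        rcases eq_or_ne i 0 with rfl | hi0
        · simpa only [code, shift_zero] using h0
        · exact h i (Finset.mem_Ico.2 (by have := Finset.mem_Ico.1 hi; omega))
      · intro h
        refine ⟨by simpa only [code, shift_zero] using h 0 (by simp), fun i hi => h i ?_⟩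
        exact Finset.mem_Ico.2 (by have := Finset.mem_Ico.1 hi; omega)
    rw [e1] at h1
    rw [e2]; exact h1
  · intro x y hx hxy
    have hx' : x ∈ E := (hPE x) ▸ hx
    have hy' : y ∈ E := (hPE y) ▸ (show xt (P y) ∈ E by rw [← show P x = P y from hxy]; exact hx)
    refine rs_eq_iff.2 fun i hi => ?_
    have hi' := Finset.mem_Ico.1 hi
    rcases lt_or_ge (-(g + N : ℕ) : ℤ) i with h | h
    · have hno : ∀ z ∈ E, shift i z ∉ E := fun z hz hz' => by
        have := hE.eq (i := i) (j := 0) hz' (by rwa [shift_zero]) (by push_cast at *; omega)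
          (by push_cast at *; omega)
        omega
      simp only [code, hv, visitName, if_neg (hno x hx'), if_neg (hno y hy')]
    · refine visitName_dep hM _ _ fun t ht => ?_
      refine rs_eq_iff.1 hxy (t + i) (Finset.mem_Ico.2 ?_)
      simp only [mem_Ico] at ht; push_cast at *; omega
  · intro x y hx hy hxy
    have hx' : x ∈ E := (hPE x) ▸ hx
    have hy' : y ∈ E := (hPE y) ▸ hy
    simpa only [hv, visitName, if_pos hx', if_pos hy', Option.some.injEq] using hxy
  · intro a _
    simp only [← hCp]
    exact hg (M + j) N _ C (by simpa using dep_rs (A := A) (Finset.Ico (-((M + j : ℕ) : ℤ)) 0)) hCd a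

/-- Lower bound for the entropy of a block code. -/
theorem blockCode_hrate (hE : Spaced E (g + N)) (hM : Dep (Ico (-(M : ℤ)) 0) (· ∈ E)) {δ : ℝ}
    (hμ : Inv μ) (hg : MixGap μ g δ) :
    μ.real E * (∑ y, negMulLog (push F (pr μ (iwin N)) y) -
      δ * log (Fintype.card (Word B N)) - 2) -
      (negMulLog (μ.real E) + negMulLog (1 - μ.real E)) ≤
      hrate (μ.map (code (blockCode E g N F))) := by
  set b := μ.real E * (∑ y, negMulLog (push F (pr μ (iwin N)) y) -
      δ * log (Fintype.card (Word B N)) - 2) with hb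
  have hEm : MeasurableSet E := Dep.measurableSet_past hM
  have hYm : FinMeas (blockCode E g N F) := Dep.finMeas (I := Finset.Ico (-((M + g + N : ℕ) : ℤ)) N)
    (by simpa using blockCode_dep hE hM)
  have hSm : FinMeas (visit E) := Dep.finMeas (I := Finset.Ico (-(M : ℤ)) 0) (by simpa using visit_dep hM)
  have hVm : FinMeas (visitName E g N F) := Dep.finMeas (I := Finset.Ico (-(M : ℤ)) (g + N))
    (by simpa using visitName_dep hM)
  let _ : MeasurableSpace (Option (Word B N)) := ⊤
  have hYc := measurable_code hYm
  have hSc := measurable_code hSm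
  have hVc := measurable_code hVm
  have := Measure.isProbabilityMeasure_map (μ := μ) hYc.aemeasurable
  have := Measure.isProbabilityMeasure_map (μ := μ) hSc.aemeasurable
  have := Measure.isProbabilityMeasure_map (μ := μ) hVc.aemeasurable
  have hYi := hμ.map_of_comm hYc (code_shift _)
  have hSi := hμ.map_of_comm hSc (code_shift _)
  have hVi := hμ.map_of_comm hVc (code_shift _)
  set hS := negMulLog (μ.real E) + negMulLog (1 - μ.real E) with hhS
  have hS0 : 0 ≤ hS := add_nonneg (negMulLog_nonneg measureReal_nonneg measureReal_le_one)
    (negMulLog_nonneg (sub_nonneg.2 measureReal_le_one) (sub_le_self _ measureReal_nonneg))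
  have hSle : ∀ k : ℕ, Hw (μ.map (code (visit E))) k ≤ k * hS := fun k => by
    have h1 := hSi.Hw_add_le 0 k
    rw [zero_add, Hw_zero, zero_add, crate, Hw_zero, sub_zero, zero_add] at h1
    refine h1.trans (mul_le_mul_of_nonneg_left (le_of_eq ?_) (Nat.cast_nonneg k))
    rw [Hw, ent_map hSc (finMeas_rs _), ent_congr (X := fun x => rs (Finset.Ico (0 : ℤ) (1 : ℕ))
      (code (visit E) x)) (Y := visit E) hSm]
    · have e1 : pr μ (visit E) true = μ.real E := by
        simp only [pr]; congr 1; ext x; simp [visit]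
      have e2 : pr μ (visit E) false = 1 - μ.real E := by
        have := sum_pr (μ := μ) hSm
        rw [Fintype.sum_bool, e1] at this; linarith
      rw [ent, Fintype.sum_bool, e1, e2]
    · intro x y
      rw [rs_eq_iff]
      constructor
      · intro h i hi
        have : i = 0 := by have := Finset.mem_Ico.1 hi; omega
        subst this; simpa only [code, shift_zero] using h
      · intro h; simpa only [code, shift_zero] using h 0 (by simp)
  have hcr : ∀ j : ℕ, b ≤ crate (μ.map (code (visitName E g N F))) j := fun j => by
    have h1 := visitName_crate (F := F) hE hM hμ hg j
    have e1 := hVi.ent_rs (-j) 0 j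
    have e2 := hVi.ent_rs (-j) 1 j
    rw [ent_map hVc (finMeas_rs (Finset.Ico (-(j : ℤ)) 0))] at e1
    rw [ent_map hVc (finMeas_rs (Finset.Ico (-(j : ℤ)) 1))] at e2
    rw [neg_add_cancel, zero_add] at e1
    rw [neg_add_cancel] at e2
    have e3 : ((j + 1 : ℕ) : ℤ) = 1 + j := by push_cast; ring
    rw [crate, Hw, Hw, e3, e1, e2]
    linarith
  have hVge : ∀ j : ℕ, j * b ≤ Hw (μ.map (code (visitName E g N F))) j := fun j => by
    have := Hw_add (μ := μ.map (code (visitName E g N F))) 0 j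
    rw [zero_add, Hw_zero, zero_add] at this
    rw [this, ← nsmul_eq_mul]
    simpa using Finset.card_nsmul_le_sum (Finset.range j) (fun i => crate _ (0 + i)) b fun i _ => hcr _
  refine hYi.le_hrate (C := (g + N) * |b|) fun k => ?_
  have hHw0 : 0 ≤ Hw (μ.map (code (blockCode E g N F))) k := ent_nonneg _
  have hk0 : (0 : ℝ) ≤ k := Nat.cast_nonneg k
  rcases lt_or_ge k (g + N) with hk | hk
  · have h1 : (k : ℝ) * b ≤ (g + N) * |b| :=
      (mul_le_mul_of_nonneg_left (le_abs_self b) hk0).trans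
        (mul_le_mul_of_nonneg_right (by exact_mod_cast hk.le) (abs_nonneg b))
    have h2 := mul_nonneg hk0 hS0
    linarith
  · obtain ⟨m, rfl⟩ := Nat.exists_eq_add_of_le hk
    have h1 : Hw (μ.map (code (visitName E g N F))) m ≤
        Hw (μ.map (code (blockCode E g N F))) (g + N + m) + Hw (μ.map (code (visit E))) (g + N + m) := by
      rw [Hw, Hw, Hw, ent_map hVc (finMeas_rs _), ent_map hYc (finMeas_rs _), ent_map hSc (finMeas_rs _)]
      refine le_trans ?_ (ent_pair_le ((finMeas_rs _).comp_meas hYc) ((finMeas_rs _).comp_meas hSc))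
      refine ent_mono (((finMeas_rs _).comp_meas hYc).pair ((finMeas_rs _).comp_meas hSc)) fun x y h => ?_
      simp only [Prod.mk.injEq, rs_eq_iff] at h
      refine rs_eq_iff.2 fun t ht => ?_
      have ht' := Finset.mem_Ico.1 ht
      have h2 := h.2 t (Finset.mem_Ico.2 (by push_cast; omega))
      simp only [code, visit, decide_eq_decide] at h2
      by_cases h3 : shift t x ∈ E
      · simp only [code, visitName, if_pos h3, if_pos (h2.1 h3), Option.some.injEq, shift_shift]
        ext i
        have hi := Finset.mem_Ico.1 i.2
        rw [add_comm (g : ℤ) t, ← code_blockCode (F := F) hE h3 i,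
          ← code_blockCode (F := F) hE (h2.1 h3) i]
        exact h.1 _ (Finset.mem_Ico.2 (by push_cast; omega))
      · simp only [code, visitName, if_neg h3, if_neg (h2.not.1 h3)]
    have h2 := hSle (g + N + m)
    have h3 := hVge m
    have h4 : (g + N : ℝ) * b ≤ (g + N) * |b| :=
      mul_le_mul_of_nonneg_left (le_abs_self b) (by positivity)
    push_cast at *
    linarith

end BlockCode

/-! ### The isomorphism theorem -/

section Approx

variable {A : Type} [Fintype A] [Nonempty A] [MeasurableSpace A] [MeasurableSingletonClass A]

lemma abs_pr_sub_le [DecidableEq A] {l m : Measure (Conf A)} [IsProbabilityMeasure l]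
    [IsProbabilityMeasure m] {n : ℕ} {ε : ℝ} (h : ∀ s, |pr l (iwin n) s - pr m (iwin n) s| ≤ ε)
    {α : Type*} [Fintype α] {f : Conf A → α} (hf : Dep (Ico (0 : ℤ) n) f) (a : α) :
    |pr l f a - pr m f a| ≤ Fintype.card (Word A n) * ε := by
  classical
  have hf' : Dep (Finset.Ico (0 : ℤ) n : Set ℤ) f := by simpa using hf
  rw [← push_pr_rs (μ := l) hf' subset_rfl, ← push_pr_rs (μ := m) hf' subset_rfl, push, push,
    ← sum_sub_distrib]
  refine (Finset.abs_sum_le_sum_abs _ _).trans ((sum_le_sum (g := fun _ => ε) fun s _ => ?_).trans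
    (by simp))
  split_ifs
  · exact h s
  · rw [sub_zero, abs_zero]; exact (abs_nonneg _).trans (h s)

lemma tendstoFdd_of_iwin [DecidableEq A] {l : ℕ → Measure (Conf A)} {m : Measure (Conf A)}
    [∀ i, IsProbabilityMeasure (l i)] [IsProbabilityMeasure m] (hl : ∀ i, Inv (l i)) (hm : Inv m)
    (h : ∀ (k : ℕ) s, |pr (l k) (iwin k) s - pr m (iwin k) s| ≤
      1 / ((k + 1) * Fintype.card (Word A k))) : TendstoFdd atTop l m := by
  intro I a
  obtain ⟨c, hc⟩ : ∃ c : ℕ, ∀ i ∈ I, -(c : ℤ) ≤ i ∧ i < c := by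
    refine ⟨I.sup Int.natAbs + 1, fun i hi => ?_⟩
    have := Finset.le_sup (f := Int.natAbs) hi
    omega
  rw [tendsto_iff_dist_tendsto_zero]
  refine squeeze_zero' (Eventually.of_forall fun _ => dist_nonneg) ?_ tendsto_one_div_add_atTop_nhds_zero_nat
  filter_upwards [eventually_ge_atTop (2 * c)] with k hk
  rw [Real.dist_eq, ← (hl k).pr (finMeas_rs I) c, ← hm.pr (finMeas_rs I) c]
  refine (abs_pr_sub_le (h k) (fun x y hxy => ?_) a).trans (le_of_eq ?_)
  · refine rs_eq_iff.2 fun i hi => hxy _ ?_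
    have := hc i hi
    simp only [mem_Ico]; omega
  · have : 0 < Fintype.card (Word A k) := Fintype.card_pos
    field_simp

lemma abs_pr_sub_pr_le {Ω α : Type*} [MeasurableSpace Ω] {l : Measure Ω} [IsProbabilityMeasure l]
    (X Y : Ω → α) (a : α) : |pr l X a - pr l Y a| ≤ l.real {ω | X ω ≠ Y ω} := by
  have key : ∀ X Y : Ω → α, pr l X a ≤ pr l Y a + l.real {ω | X ω ≠ Y ω} := fun X Y => by
    refine (measureReal_mono fun ω (h : X ω = a) => ?_).trans (measureReal_union_le _ _)
    by_cases h' : X ω = Y ω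
    · exact Or.inl (h'.symm.trans h)
    · exact Or.inr h'
  have h1 := key X Y
  have h2 := key Y X
  simp only [ne_comm (a := Y _)] at h2
  rw [abs_le]; constructor <;> linarith

end Approx

section Iso

variable {A B : Type} [Fintype A] [Nonempty A] [DecidableEq A] [MeasurableSpace A]
  [MeasurableSingletonClass A] [Fintype B] [Nonempty B] [DecidableEq B] [MeasurableSpace B]
  [MeasurableSingletonClass B]
  {l : Measure (Conf (A × B))} {μ : Measure (Conf A)} {ν : Measure (Conf B)}
  [IsProbabilityMeasure μ] [IsProbabilityMeasure ν]

lemma Spaced.mul_real_le (hμ : Inv μ)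
    {E : Set (Conf A)} (hEm : MeasurableSet E) {L : ℕ} (hE : Spaced E L) : L * μ.real E ≤ 1 := by
  have h := measureReal_biUnion_finset (μ := μ) (s := Finset.range L)
    (f := fun i : ℕ => shift (S := A) i ⁻¹' E) (fun i hi j hj hij => by
      rw [Function.onFun, Set.disjoint_left]
      intro x h1 h2
      simp only [Finset.coe_range, mem_Iio] at hi hj
      exact hij (by exact_mod_cast hE.eq h1 h2 (by omega) (by omega)))
    (fun i _ => measurable_shift _ hEm)
  simp only [hμ.real hEm, sum_const, Finset.card_range, nsmul_eq_mul] at h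
  rw [← h]; exact measureReal_le_one

lemma exists_word_code (hl : IsJoin l μ ν)
    {n N : ℕ} (hn : n ≤ N) {τ η : ℝ} (hτ : 0 < τ) (hτ1 : 8 * τ ≤ 1) (hη : 0 < η)
    (h1 : ∑ s, (if τ < pr μ (iwin N) s then pr μ (iwin N) s else 0) ≤ η)
    (h2 : ∑ s, (if τ < pr ν (iwin N) s then pr ν (iwin N) s else 0) ≤ η) :
    ∃ F : Word A N → Word B N,
      (1 - 8 * η) * -log (8 * τ) - 2 ≤ ∑ y, negMulLog (push F (pr μ (iwin N)) y) ∧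
      ∀ s : Word (A × B) n, ((∑ i ∈ Finset.range (N - n + 1), ∑ w, pr μ (iwin N) w *
        if iwin n (shift i (zipc (xt w) (xt (F w)))) = s then 1 else 0) / (N - n + 1 : ℕ) -
        pr l (iwin n) s) ^ 2 ≤ 4 * (Fintype.card (Word (A × B) n) + 1) * (τ + η) := by
  have := hl.prob
  have hf : FinMeas (iwin (B := A) N) := finMeas_rs _
  have hs : FinMeas (iwin (B := B) N) := finMeas_rs _
  have hf' := hf.comp_meas (measurable_fstc (A := A) (B := B))
  have hs' := hs.comp_meas (measurable_sndc (A := A) (B := B))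
  set J := pr l (fun z => (iwin N (fstc z), iwin N (sndc z))) with hJ
  have e1 : ∀ w, ∑ y, J (w, y) = pr μ (iwin N) w := fun w => by
    rw [sum_pr_right hf' hs', ← pr_map measurable_fstc hf, hl.map_fst]
  have e2 : ∀ y, ∑ w, J (w, y) = pr ν (iwin N) y := fun y => by
    rw [sum_pr_left hf' hs', ← pr_map measurable_sndc hs, hl.map_snd]
  have hJ0 : ∀ w y, 0 ≤ J (w, y) := fun w y => pr_nonneg ..
  set κ : Word A N → Word B N → ℝ := fun w y =>
    if pr μ (iwin N) w = 0 then (if y = Classical.arbitrary _ then 1 else 0)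
    else J (w, y) / pr μ (iwin N) w with hκ
  have hpκ : ∀ w y, pr μ (iwin N) w * κ w y = J (w, y) := fun w y => by
    by_cases h : pr μ (iwin N) w = 0
    · rw [h, zero_mul]
      have := e1 w
      rw [h, sum_eq_zero_iff_of_nonneg fun y _ => hJ0 w y] at this
      exact (this y (Finset.mem_univ y)).symm
    · simp only [hκ, if_neg h]; field_simp
  set R : ℕ := N - n + 1 with hR
  have hR0 : (0 : ℝ) < R := by positivity
  obtain ⟨F, hF1, hF2⟩ := exists_random_code (p := pr μ (iwin N)) (κ := κ) (ν := pr ν (iwin N))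
    (C := Word (A × B) n)
    (fun w y => by
      simp only [hκ]; split_ifs <;> first | positivity | exact div_nonneg (hJ0 ..) (pr_nonneg ..))
    (fun w => by
      by_cases h : pr μ (iwin N) w = 0
      · simp [hκ, h]
      · simp only [hκ, if_neg h]; rw [← sum_div, e1, div_self h])
    (fun w => pr_nonneg ..) (sum_pr hf) (fun y => by simp only [hpκ, e2]) hτ hτ1 hη h1 h2
    (fun s w y => (∑ i ∈ Finset.range R, if iwin n (shift i (zipc (xt w) (xt y))) = s then 1 else 0) / R)
    (fun s w y => div_nonneg (sum_nonneg fun i _ => by positivity) hR0.le)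
    (fun s w y => by
      rw [div_le_one hR0]
      refine (sum_le_sum (g := fun _ => (1 : ℝ)) fun i _ => ?_).trans (by simp)
      split_ifs <;> norm_num)
  refine ⟨F, hF1, fun s => ?_⟩
  convert hF2 s using 3
  · rw [sum_comm, sum_div]
    exact sum_congr rfl fun w _ => by rw [← mul_sum, mul_div_assoc]
  · have key : ∀ i ∈ Finset.range R, ∑ w, ∑ y, J (w, y) *
        (if iwin n (shift i (zipc (xt w) (xt y))) = s then 1 else 0) = pr l (iwin n) s := by
      intro i hi
      have hi := Finset.mem_range.1 hi
      have h3 := pr_comp (μ := l) (hf'.pair hs')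
        (fun a => iwin n (shift i (zipc (xt a.1) (xt a.2)))) s
      have h4 : (fun z : Conf (A × B) => iwin n (shift i (zipc (xt (iwin N (fstc z)))
          (xt (iwin N (sndc z)))))) = fun z => iwin n (shift i z) := by
        funext z
        refine rs_eq_iff.2 fun t ht => ?_
        have ht := Finset.mem_Ico.1 ht
        have h5 : t + i ∈ Finset.Ico (0 : ℤ) N := Finset.mem_Ico.2 (by omega)
        simp only [GibbsFormal.shift, zipc, xt, h5, dif_pos, rs, GibbsFormal.fstc, GibbsFormal.sndc]
      rw [h4, hl.inv.pr (finMeas_rs _)] at h3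
      rw [h3, Fintype.sum_prod_type]
      simp only [mul_ite, mul_one, mul_zero]; rfl
    calc pr l (iwin n) s = (∑ i ∈ Finset.range R, pr l (iwin n) s) / R := by
          simp only [sum_const, Finset.card_range, nsmul_eq_mul]; field_simp
      _ = (∑ i ∈ Finset.range R, ∑ w, ∑ y, J (w, y) *
        (if iwin n (shift i (zipc (xt w) (xt y))) = s then 1 else 0)) / R := by
          rw [sum_congr rfl key]
      _ = _ := by
          rw [sum_comm, sum_div]
          refine sum_congr rfl fun w _ => ?_
          rw [sum_comm, sum_div, mul_sum]
          refine sum_congr rfl fun y _ => ?_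
          rw [← mul_sum, ← mul_assoc, hpκ, mul_div_assoc]

lemma exists_entropy_modulus {ε : ℝ} (hε : 0 < ε) :
    ∃ ρ > 0, ∀ t, 0 ≤ t → t ≤ ρ → negMulLog t + negMulLog (1 - t) ≤ ε := by
  have h : Continuous fun t : ℝ => negMulLog t + negMulLog (1 - t) :=
    Real.continuous_negMulLog.add (Real.continuous_negMulLog.comp (by fun_prop))
  have h0 := (h.tendsto 0).eventually_lt_const (u := ε) (by simpa using hε)
  obtain ⟨ρ, hρ, h1⟩ := Metric.eventually_nhds_iff.1 h0
  exact ⟨ρ / 2, by positivity, fun t ht ht' => (h1 (by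
    rw [Real.dist_eq, sub_zero, abs_of_nonneg ht]; linarith)).le⟩

lemma abs_sub_le_of_sub_le {α : Type*} [Fintype α] {p q : α → ℝ} (hp : ∑ a, p a = 1) (hq : ∑ a, q a = 1)
    {ε : ℝ} (hε : 0 ≤ ε) (h : ∀ a, q a - ε ≤ p a) (a : α) : |p a - q a| ≤ Fintype.card α * ε := by
  classical
  have h1 : ∑ b ∈ Finset.univ.erase a, (q b - ε) ≤ ∑ b ∈ Finset.univ.erase a, p b :=
    sum_le_sum fun b _ => h b
  have h2 : 0 < Fintype.card α := Fintype.card_pos_iff.2 ⟨a⟩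
  have h3 : (1 : ℝ) ≤ Fintype.card α := by exact_mod_cast h2
  rw [sum_sub_distrib, sum_const, Finset.card_erase_of_mem (Finset.mem_univ a),
    Finset.card_univ, nsmul_eq_mul, Nat.cast_sub h2, Nat.cast_one] at h1
  have h4 := Finset.add_sum_erase Finset.univ p (Finset.mem_univ a)
  have h5 := Finset.add_sum_erase Finset.univ q (Finset.mem_univ a)
  rw [abs_le]
  constructor <;> nlinarith [h a]

set_option maxHeartbeats 400000 in
variable (μ ν) in
/-- Uniformly mixing invariant measures of equal positive entropy. -/
structure EqualEntropy : Prop where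
  inv_left : Inv μ
  inv_right : Inv ν
  um_left : UM μ
  um_right : UM ν
  pos : 0 < hrate μ
  eq : hrate μ = hrate ν

lemma EqualEntropy.symm (h : EqualEntropy μ ν) : EqualEntropy ν μ :=
  ⟨h.inv_right, h.inv_left, h.um_right, h.um_left, h.eq ▸ h.pos, h.eq.symm⟩

lemma exists_code_aux (hμν : EqualEntropy μ ν) (hl : IsJoin l μ ν) {n : ℕ} (hn0 : 0 < n) {ε : ℝ} (hε : 0 < ε) (hεh : ε ≤ hrate μ) :
    ∃ (W : Finset ℤ) (F : Conf A → B), Dep (W : Set ℤ) F ∧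
      (∀ s, |pr μ (fun x => iwin n (zipc x (code F x))) s - pr l (iwin n) s| ≤ ε) ∧
      hrate μ - ε ≤ hrate (μ.map (code F)) := by
  obtain ⟨hμ, hν, hUμ, hUν, hh, hhν⟩ := hμν
  have := hl.prob
  set h := hrate μ with hh'
  set K : ℝ := ((Fintype.card (Word (A × B) n) : ℕ) : ℝ) with hK
  have hK1 : 1 ≤ K := by
    have : 0 < Fintype.card (Word (A × B) n) := Fintype.card_pos
    rw [hK]; exact_mod_cast this
  set e := min (ε / (3 * K)) (ε / (4 * h)) with he
  have he0 : 0 < e := lt_min (by positivity) (by positivity)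
  have heK : K * (3 * e) ≤ ε := by
    have := (min_le_left (ε / (3 * K)) (ε / (4 * h)))
    rw [le_div_iff₀ (by positivity)] at this; linarith
  have heh : e * h ≤ ε / 4 := by
    have := (min_le_right (ε / (3 * K)) (ε / (4 * h)))
    rw [le_div_iff₀ (by positivity)] at this; linarith
  have he1 : e ≤ 1 / 4 := by
    by_contra hc; push Not at hc; linarith [mul_lt_mul_of_pos_right hc hh]
  set c := log (Fintype.card B) with hc
  have hc0 : 0 ≤ c := Real.log_natCast_nonneg _
  set δ := min e (ε / (16 * (c + 1))) with hδ
  have hδ0 : 0 < δ := lt_min he0 (by positivity)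
  have hδe : δ ≤ e := min_le_left ..
  have hδc : δ * c ≤ ε / 16 := by
    have := (min_le_right e (ε / (16 * (c + 1))))
    rw [← hδ, le_div_iff₀ (by positivity)] at this; linarith
  set η := min (ε / (128 * h)) (min (e ^ 2 / (8 * (K + 1))) (1 / 8)) with hη
  have hη0 : 0 < η := lt_min (by positivity) (lt_min (by positivity) (by norm_num))
  have hη1 : 8 * η * h ≤ ε / 16 := by
    have := (min_le_left (ε / (128 * h)) (min (e ^ 2 / (8 * (K + 1))) (1 / 8)))
    rw [← hη, le_div_iff₀ (by positivity)] at this; linarith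
  have hη2 : η * (8 * (K + 1)) ≤ e ^ 2 := by
    have := (min_le_right (ε / (128 * h)) (min (e ^ 2 / (8 * (K + 1))) (1 / 8))).trans (min_le_left ..)
    rwa [← hη, le_div_iff₀ (by positivity)] at this
  have hη3 : η ≤ 1 / 8 :=
    (min_le_right (ε / (128 * h)) (min (e ^ 2 / (8 * (K + 1))) (1 / 8))).trans (min_le_right ..)
  obtain ⟨g, hg⟩ := hUμ.exists_gap hδ0
  obtain ⟨ρ, hρ, hρ'⟩ := exists_entropy_modulus (ε := ε / 4) (by positivity)
  have hτt : Tendsto (fun N : ℕ => exp (-(N * (h - ε / 16)))) atTop (nhds 0) := by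
    refine Real.tendsto_exp_neg_atTop_nhds_zero.comp ?_
    exact tendsto_natCast_atTop_atTop.atTop_mul_const (by linarith)
  have hNt := tendsto_natCast_atTop_atTop (R := ℝ)
  obtain ⟨N, ⟨⟨⟨⟨⟨hN1, hN2⟩, hN3⟩, hN4⟩, hN5⟩, hN6⟩, hN7⟩ :=
    (((((((aep hμ hUμ (ε := ε / 16) (by positivity) hη0).and
      (aep hν hUν (ε := ε / 16) (by positivity) hη0)).and
      (hτt.eventually (ge_mem_nhds (lt_min (a := (0 : ℝ)) (b := 1 / 8) (c := η) (by norm_num) hη0)))).and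
      (hNt.eventually_ge_atTop (1 / ρ))).and
      (hNt.eventually_ge_atTop ((g + n) / (e / 2)))).and
      (hNt.eventually_ge_atTop ((log 8 + 4) / (ε / 16)))).and (eventually_ge_atTop n)).exists
  rw [← hhν] at hN2
  set τ := exp (-(N * (h - ε / 16))) with hτ
  have hτ1 := hN3.trans (min_le_left ..)
  have hτ2 := hN3.trans (min_le_right ..)
  have hN0 : (0 : ℝ) < N := by exact_mod_cast hn0.trans_le hN7
  rw [div_le_iff₀ (by positivity)] at hN4 hN5 hN6
  obtain ⟨F, hF1, hF2⟩ := exists_word_code hl hN7 (exp_pos _) (by linarith) hη0 hN1 hN2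
  obtain ⟨M, E, hM, hE, hEL⟩ := exists_tower hμ hUμ hh (ε := e / 2) (by positivity)
    (L := g + N) (by have := hn0.trans_le hN7; omega)
  have hEm : MeasurableSet E := Dep.measurableSet_past hM
  have hE' : Spaced E (g + N) := hE
  have hE1 := hE'.mul_real_le hμ hEm
  push_cast at hEL hE1
  have hm0 : 0 ≤ μ.real E := measureReal_nonneg
  have hR : 1 - e ≤ μ.real E * (N - n) := by
    have h1 : (1 - e / 2) * ((g : ℝ) + N) ≤ N - n := by linarith [mul_nonneg he0.le (Nat.cast_nonneg (α := ℝ) g)]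
    linarith [mul_le_mul_of_nonneg_left h1 hm0, sq_nonneg e,
      mul_le_mul_of_nonneg_left hEL (show 0 ≤ 1 - e / 2 by linarith)]
  have hYd := blockCode_dep (F := F) hE' hM
  refine ⟨Finset.Ico (-((M + g + N : ℕ) : ℤ)) N, blockCode E g N F, by simpa using hYd, ?_, ?_⟩
  · have hYm : FinMeas (blockCode E g N F) := Dep.finMeas (I := Finset.Ico (-((M + g + N : ℕ) : ℤ)) N)
      (by simpa using hYd)
    have hm : Measurable fun x => zipc x (code (blockCode E g N F) x) :=
      measurable_pi_lambda _ fun i => (measurable_pi_apply i).prodMk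
        ((measurable_pi_apply i).comp (measurable_code hYm))
    intro s
    refine (abs_sub_le_of_sub_le (ε := 3 * e) (sum_pr ((finMeas_rs _).comp_meas hm))
      (sum_pr (finMeas_rs _)) (by positivity) (fun s => ?_) s).trans heK
    have h1 := blockCode_law (F := F) hμ hE' hM hg hn0 hN7 s
    have h2 := hF2 s
    rw [sum_sub_distrib, sum_const, Finset.card_range, nsmul_eq_mul] at h1
    set Q := ∑ i ∈ Finset.range (N - n + 1), ∑ w, pr μ (iwin N) w *
        if iwin n (shift i (zipc (xt w) (xt (F w)))) = s then (1 : ℝ) else 0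
    have hRc : ((N - n + 1 : ℕ) : ℝ) = N - n + 1 := by push_cast [Nat.cast_sub hN7]; ring
    rw [hRc] at h1 h2
    set R : ℝ := N - n + 1 with hRd
    have hR0 : 0 < R := by
      have : (n : ℝ) ≤ N := by exact_mod_cast hN7
      rw [hRd]; linarith
    have h3 : (Q / R - pr l (iwin n) s) ^ 2 ≤ e ^ 2 := by
      have : 4 * (K + 1) * (τ + η) ≤ 4 * (K + 1) * (η + η) := by gcongr
      linarith
    have h4 := (abs_le_of_sq_le_sq' h3 he0.le).1
    have h5 : 1 - e ≤ μ.real E * R := by rw [hRd]; linarith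
    have h6 : pr l (iwin n) s ≤ 1 := pr_le_one ..
    have h7 : μ.real E * (Q - R * δ) = μ.real E * R * (Q / R - δ) := by field_simp
    rw [h7] at h1
    rcases le_total (pr l (iwin n) s - 2 * e) 0 with h8 | h8
    · have : 0 ≤ pr μ (fun x => iwin n (zipc x (code (blockCode E g N F) x))) s := pr_nonneg ..
      linarith
    · have h9 : (1 - e) * (pr l (iwin n) s - 2 * e) ≤ μ.real E * R * (Q / R - δ) :=
        mul_le_mul h5 (by linarith) h8 (by positivity)
      have h10 : e * pr l (iwin n) s ≤ e := mul_le_of_le_one_right he0.le h6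
      linarith [sq_nonneg e]
  · refine le_trans ?_ (blockCode_hrate (F := F) hE' hM hμ hg)
    have hcard : log (Fintype.card (Word B N)) = N * c := by
      simp [hc, Real.log_pow]
    rw [hcard]
    have h1 := hρ' (μ.real E) hm0 (by
      have hg0 : (0 : ℝ) ≤ g := by positivity
      have : N * μ.real E ≤ 1 := by linarith [mul_nonneg hg0 hm0]
      by_contra hcon; push Not at hcon
      linarith [mul_lt_mul_of_pos_left hcon hN0])
    have hlog : log (8 * τ) = log 8 - N * (h - ε / 16) := by
      rw [Real.log_mul (by norm_num) (exp_pos _).ne', Real.log_exp]; ring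
    rw [hlog] at hF1
    have hl8 : 0 ≤ log 8 := Real.log_nonneg (by norm_num)
    have h2 : N * (h - ε / 4) ≤ ∑ y, negMulLog (push F (pr μ (iwin N)) y) - δ * (N * c) - 2 := by
      have a1 : (1 - 8 * η) * (h - ε / 16) ≥ h - ε / 8 := by linarith [mul_nonneg hη0.le hε.le]
      have a2 : N * ((1 - 8 * η) * (h - ε / 16)) ≥ N * (h - ε / 8) :=
        mul_le_mul_of_nonneg_left a1 hN0.le
      have a3 : N * (δ * c) ≤ N * (ε / 16) := mul_le_mul_of_nonneg_left hδc hN0.le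
      have a4 : (1 - 8 * η) * log 8 ≤ log 8 := by linarith [mul_nonneg hη0.le hl8]
      linarith
    have h3 : 1 - e ≤ μ.real E * N := by linarith [mul_nonneg hm0 (Nat.cast_nonneg (α := ℝ) n)]
    have h4 : (1 - e) * (h - ε / 4) ≤ μ.real E * (N * (h - ε / 4)) := by
      rw [← mul_assoc]; exact mul_le_mul_of_nonneg_right h3 (by linarith)
    have h5 := mul_le_mul_of_nonneg_left h2 hm0
    linarith [mul_nonneg he0.le hε.le]

/-- A joining of uniformly mixing processes with equal entropy is approximated by codes. -/
theorem exists_code (hμν : EqualEntropy μ ν) (hl : IsJoin l μ ν) (n : ℕ)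
    {ε : ℝ} (hε : 0 < ε) : ∃ (W : Finset ℤ) (F : Conf A → B), Dep (W : Set ℤ) F ∧
      (∀ s, |pr μ (fun x => iwin n (zipc x (code F x))) s - pr l (iwin n) s| ≤ ε) ∧
      hrate μ - ε ≤ hrate (μ.map (code F)) := by
  have := hl.prob
  rcases n.eq_zero_or_pos with rfl | hn
  · obtain ⟨W, F, h1, -, h2⟩ := exists_code_aux hμν hl one_pos (lt_min hε hμν.pos) (min_le_right ε _)
    refine ⟨W, F, h1, fun s => ?_, le_trans (by linarith [min_le_left ε (hrate μ)]) h2⟩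
    have : ∀ {Ω : Type} (X : Ω → Word (A × B) 0), X ⁻¹' {s} = univ := fun X => by
      ext ω; simp [funext_iff]
    simp only [pr, this, probReal_univ, sub_self, abs_zero]; exact hε.le
  · obtain ⟨W, F, h1, h2, h3⟩ := exists_code_aux hμν hl hn (lt_min hε hμν.pos) (min_le_right ε _)
    exact ⟨W, F, h1, fun s => (h2 s).trans (min_le_left ..),
      le_trans (by linarith [min_le_left ε (hrate μ)]) h3⟩

lemma measurable_zipc_code {F : Conf A → B} (hF : FinMeas F) : Measurable fun x => zipc x (code F x) :=
  measurable_pi_lambda _ fun i => (measurable_pi_apply i).prodMk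
    ((measurable_pi_apply i).comp (measurable_code hF))

lemma approx_of_join (hμν : EqualEntropy μ ν) (hl : IsJoin l μ ν)
    (n : ℕ) {ε : ℝ} (hε : 0 < ε) : ∃ l', IsJoin l' μ ν ∧
      (∀ s, |pr l' (iwin n) s - pr l (iwin n) s| ≤ ε) ∧
      ∃ (W : Finset ℤ) (F : Conf A → B), Dep (W : Set ℤ) F ∧ l'.real {z | sndc z 0 ≠ F (fstc z)} ≤ ε := by
  have ⟨hμ, hν, _, hUν, _, hhν⟩ := hμν
  have := hl.prob
  have hc0 : ∀ j : ℕ, (0 : ℝ) < Fintype.card (Word (A × B) j) := fun j => by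
    exact_mod_cast Fintype.card_pos
  choose W F hF hlaw hent using fun j : ℕ => exists_code hμν hl j
    (ε := 1 / ((j + 1) * Fintype.card (Word (A × B) j)))
    (by have := hc0 j; positivity)
  have hFm : ∀ j, FinMeas (F j) := fun j => (hF j).finMeas
  have hzm := fun j => measurable_zipc_code (hFm j)
  have hcm := fun j => measurable_code (hFm j)
  have i1 := fun j => Measure.isProbabilityMeasure_map (μ := μ) (hzm j).aemeasurable
  have i2 := fun j => Measure.isProbabilityMeasure_map (μ := μ) (hcm j).aemeasurable
  have t1 : TendstoFdd atTop (fun j => μ.map fun x => zipc x (code (F j) x)) l := by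
    refine tendstoFdd_of_iwin (fun j => hμ.map_of_comm (hzm j) fun k x => ?_) hl.inv fun k s => ?_
    · rw [code_shift]; rfl
    · rw [pr_map (hzm k) (finMeas_rs _)]; exact hlaw k s
  have t2 : TendstoFdd atTop (fun j => μ.map (code (F j))) ν := fun I a => by
    have h1 := t1.pr (f := fun z => rs I (sndc z)) (I := I) (Dep.sndc (dep_rs I)) a
    rw [← pr_map measurable_sndc (finMeas_rs I), hl.map_snd] at h1
    convert h1 using 2 with j
    rw [pr_map (hcm j) (finMeas_rs I),
      pr_map (hzm j) ((finMeas_rs I).comp_meas measurable_sndc)]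
    rfl
  set c : ℝ := max n 1 with hc
  have hc1 : 1 ≤ c := le_max_right ..
  have hcn : (n : ℝ) ≤ c := le_max_left ..
  set e := ε / (4 * c) with he
  have he0 : 0 < e := by positivity
  obtain ⟨g, hg⟩ := finitely_determined hν hUν he0
  obtain ⟨N, hN⟩ := exists_nat_gt (g / e)
  rw [div_lt_iff₀ he0] at hN
  have hNn : (0 : ℝ) < N := by
    by_contra hcon
    have : (g : ℝ) ≥ 0 := by positivity
    nlinarith
  have hg1 := hg N atTop _ (fun j => hμ.map_of_comm (hcm j) fun k x => code_shift _ _ _) t2 fun η hη => by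
    have := (tendsto_one_div_add_atTop_nhds_zero_nat (𝕜 := ℝ)).eventually_lt_const hη
    filter_upwards [this] with j hj
    rw [← hhν]
    refine le_trans ?_ (hent j)
    have h1 : (1 : ℝ) ≤ Fintype.card (Word (A × B) j) := by
      exact_mod_cast Fintype.card_pos
    have h2 : 1 / (((j : ℝ) + 1) * Fintype.card (Word (A × B) j)) ≤ 1 / (j + 1) :=
      one_div_le_one_div_of_le (by positivity) (le_mul_of_one_le_right (by positivity) h1)
    linarith
  have hg2 := hg N (ι := Unit) ⊤ (fun _ => ν) (fun _ => hν) (fun I a => tendsto_const_nhds)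
    (fun η hη => Eventually.of_forall fun _ => by linarith)
  have t3 : ∀ᶠ j : ℕ in atTop, ∀ s, |pr μ (fun x => iwin n (zipc x (code (F j) x))) s -
      pr l (iwin n) s| ≤ ε / 4 := by
    refine eventually_all.2 fun s => ?_
    have h1 := (t1 (Finset.Ico (0 : ℤ) n) s)
    rw [tendsto_iff_dist_tendsto_zero] at h1
    filter_upwards [h1.eventually_lt_const (u := ε / 4) (by positivity)] with j hj
    rw [pr_map (hzm j) (finMeas_rs _), Real.dist_eq] at hj
    exact hj.le
  obtain ⟨j, hj1, hj2⟩ := (hg1.and t3).exists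
  obtain ⟨l', hl', hle⟩ := joining_of_code hμ hν (hF j) (g := g) (n := N)
    (by have : 0 < N := by exact_mod_cast hNn
        omega) hj1 (by simpa using hg2)
  have := hl'.prob
  have hle2 : l'.real {z | sndc z 0 ≠ F j (fstc z)} ≤ 2 * e := by
    refine hle.trans ?_
    have : (0 : ℝ) ≤ g := by positivity
    rw [div_le_iff₀ (by positivity)]
    nlinarith
  have hec : e * (4 * c) = ε := by rw [he]; field_simp
  refine ⟨l', hl', fun s => ?_, W j, F j, hF j, by nlinarith⟩
  have h3 : pr μ (fun x => iwin n (zipc x (code (F j) x))) s =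
      pr l' (fun z => iwin n (zipc (fstc z) (code (F j) (fstc z)))) s := by
    conv_lhs => rw [← hl'.map_fst]
    exact pr_map measurable_fstc ((finMeas_rs _).comp_meas (hzm j)) s
  have h4 := hj2 s
  rw [h3] at h4
  have hb : MeasurableSet {z : Conf (A × B) | sndc z 0 ≠ F j (fstc z)} := by
    have h5 : FinMeas fun z : Conf (A × B) => (sndc z 0, F j (fstc z)) :=
      FinMeas.pair (fun b => (measurable_pi_apply 0).comp measurable_sndc (measurableSet_singleton b))
        ((hFm j).comp_meas measurable_fstc)
    exact h5.preimage {p | p.1 ≠ p.2}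
  have h5 : l'.real {z | iwin n z ≠ iwin n (zipc (fstc z) (code (F j) (fstc z)))} ≤ n * (2 * e) := by
    have h6 : {z : Conf (A × B) | iwin n z ≠ iwin n (zipc (fstc z) (code (F j) (fstc z)))} ⊆
        ⋃ i ∈ Finset.range n, shift (S := A × B) i ⁻¹' {z | sndc z 0 ≠ F j (fstc z)} := fun z hz => by
      by_contra hcon
      refine hz (rs_eq_iff.2 fun t ht => ?_)
      simp only [mem_iUnion, not_exists] at hcon
      have ht := Finset.mem_Ico.1 ht
      have := hcon t.toNat (Finset.mem_range.2 (by omega))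
      simp only [mem_preimage, Set.mem_ofPred_eq, not_not] at this
      rw [Int.toNat_of_nonneg ht.1] at this
      have h0 : (0 : ℤ) + t = t := zero_add t
      simp only [GibbsFormal.sndc, GibbsFormal.shift, h0] at this
      ext1
      · rfl
      · exact this
    refine (measureReal_mono h6 (measure_ne_top _ _)).trans ((measureReal_biUnion_finset_le _ _).trans ?_)
    refine (sum_le_sum (g := fun _ => 2 * e) fun i _ => ?_).trans (by simp)
    rw [hl'.inv.real hb]; exact hle2
  have h6 := abs_pr_sub_pr_le (l := l') (iwin n) (fun z => iwin n (zipc (fstc z) (code (F j) (fstc z)))) s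
  have h7 := abs_sub_le (pr l' (iwin n) s)
    (pr l' (fun z => iwin n (zipc (fstc z) (code (F j) (fstc z)))) s) (pr l (iwin n) s)
  nlinarith

lemma IsJoin.of_tendsto {ι : Type*} {f : Filter ι}
    [f.NeBot] {j : ι → Measure (Conf (A × B))} (hj : ∀ i, IsJoin (j i) μ ν) [IsProbabilityMeasure l]
    (h : TendstoFdd f j l) : IsJoin l μ ν := by
  have := fun i => (hj i).prob
  refine ⟨inferInstance, inv_of_pr_rs fun I a => ?_, ?_, ?_⟩
  · have hd : Dep ((I.image (· + 1) : Finset ℤ) : Set ℤ)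
        fun x : Conf (A × B) => rs I (shift 1 x) := fun x y hxy =>
      rs_eq_iff.2 fun t ht => hxy _ (Finset.mem_coe.2 (Finset.mem_image_of_mem _ ht))
    refine tendsto_nhds_unique (h.pr hd a) ?_
    convert h I a using 2 with i
    exact (hj i).inv.pr (finMeas_rs I) 1 a
  · have := Measure.isProbabilityMeasure_map (μ := l) (measurable_fstc (A := A) (B := B)).aemeasurable
    refine ext_of_pr_rs fun I a => ?_
    rw [pr_map measurable_fstc (finMeas_rs I)]
    refine tendsto_nhds_unique (h.pr (Dep.fstc (dep_rs I)) a) ?_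
    refine tendsto_const_nhds.congr fun i => ?_
    rw [← (hj i).map_fst, pr_map measurable_fstc (finMeas_rs I)]
  · have := Measure.isProbabilityMeasure_map (μ := l) (measurable_sndc (A := A) (B := B)).aemeasurable
    refine ext_of_pr_rs fun I a => ?_
    rw [pr_map measurable_sndc (finMeas_rs I)]
    refine tendsto_nhds_unique (h.pr (Dep.sndc (dep_rs I)) a) ?_
    refine tendsto_const_nhds.congr fun i => ?_
    rw [← (hj i).map_snd, pr_map measurable_sndc (finMeas_rs I)]

variable (μ ν) in
/-- The space of joinings of two processes. -/
def Joinings : Type := {l : Measure (Conf (A × B)) // IsJoin l μ ν}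

/-- The finite-dimensional distributions of a joining. -/
def Joinings.fdd (l : Joinings μ ν) (p : Σ I : Finset ℤ, I → A × B) : ℝ := pr l.1 (rs p.1) p.2

instance : TopologicalSpace (Joinings μ ν) := TopologicalSpace.induced Joinings.fdd inferInstance

lemma Joinings.tendsto_iff {ι : Type*} {f : Filter ι} {j : ι → Joinings μ ν} {l : Joinings μ ν} :
    Tendsto j f (nhds l) ↔ TendstoFdd f (fun i => (j i).1) l.1 := by
  rw [nhds_induced, tendsto_comap_iff, tendsto_pi_nhds]
  exact ⟨fun h I a => h ⟨I, a⟩, fun h p => h p.1 p.2⟩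

lemma Joinings.fdd_injective : Function.Injective (Joinings.fdd (μ := μ) (ν := ν)) := fun l m h => by
  have := l.2.prob
  have := m.2.prob
  exact Subtype.ext (ext_of_pr_rs fun I a => congrFun h ⟨I, a⟩)

instance : T2Space (Joinings μ ν) :=
  (Topology.IsEmbedding.mk ⟨rfl⟩ Joinings.fdd_injective).t2Space

instance : CompactSpace (Joinings μ ν) := by
  refine ⟨isCompact_iff_ultrafilter_le_nhds.2 fun f _ => ?_⟩
  have := fun j : Joinings μ ν => j.2.prob
  obtain ⟨l, hl, h⟩ := exists_limit f fun j : Joinings μ ν => j.1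
  exact ⟨⟨l, IsJoin.of_tendsto (fun j : Joinings μ ν => j.2) h⟩, mem_univ _,
    Joinings.tendsto_iff (j := id).2 h⟩

lemma Joinings.isOpen_real_lt {I : Finset ℤ}
    {E : Set (Conf (A × B))} (hE : Dep (I : Set ℤ) (· ∈ E)) (c : ℝ) :
    IsOpen {j : Joinings μ ν | j.1.real E < c} := by
  classical
  refine isOpen_lt (continuous_iff_continuousAt.2 fun j => ?_) continuous_const
  have := fun j : Joinings μ ν => j.2.prob
  have h := (Joinings.tendsto_iff (j := id).1 (tendsto_id (x := nhds j))).pr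
    (f := fun z => decide (z ∈ E)) (hE.comp (fun p => decide p)) true
  simpa [pr, Set.preimage, ContinuousAt] using h

/-- The first coordinate of a pair process almost determines the second one. -/
def NearlyCodes (l : Measure (Conf (A × B))) (ε : ℝ) : Prop :=
  ∃ (W : Finset ℤ) (F : Conf A → B), Dep (W : Set ℤ) F ∧ l.real {z | sndc z 0 ≠ F (fstc z)} < ε

lemma dep_code_ne {W : Finset ℤ} {F : Conf A → B} (hF : Dep (W : Set ℤ) F) :
    Dep ((insert 0 W : Finset ℤ) : Set ℤ) (· ∈ {z : Conf (A × B) | sndc z 0 ≠ F (fstc z)}) :=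
  fun x y h => by
    have h1 : sndc x 0 = sndc y 0 := by
      simp only [GibbsFormal.sndc, h 0 (by simp)]
    have h2 : F (fstc x) = F (fstc y) := hF.fstc x y fun i hi => h i (by
      simp only [Finset.coe_insert]; exact Or.inr hi)
    simp only [Set.mem_ofPred_eq, h1, h2]

lemma NearlyCodes.isOpen (ε : ℝ) :
    IsOpen {j : Joinings μ ν | NearlyCodes j.1 ε} := by
  simp only [NearlyCodes, Set.ofPred_exists]
  refine isOpen_iUnion fun W => isOpen_iUnion fun F => ?_
  by_cases hF : Dep (W : Set ℤ) F
  · simpa only [hF, true_and] using Joinings.isOpen_real_lt (dep_code_ne hF) ε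
  · simp [hF]

lemma exists_approx_seq (hμν : EqualEntropy μ ν) (hl : IsJoin l μ ν)
    {ε : ℝ} (hε : 0 < ε) : ∃ j : ℕ → Measure (Conf (A × B)), (∀ k, IsJoin (j k) μ ν) ∧
      TendstoFdd atTop j l ∧ ∀ k, NearlyCodes (j k) ε := by
  have := hl.prob
  have hc0 : ∀ k : ℕ, (0 : ℝ) < Fintype.card (Word (A × B) k) := fun k => by
    exact_mod_cast Fintype.card_pos
  choose j hj h1 W F hF h2 using fun k : ℕ => approx_of_join hμν hl k
    (ε := min (1 / ((k + 1) * Fintype.card (Word (A × B) k))) (ε / 2))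
    (by have := hc0 k; positivity)
  have := fun k => (hj k).prob
  refine ⟨j, hj, tendstoFdd_of_iwin (fun k => (hj k).inv) hl.inv fun k s =>
    (h1 k s).trans (min_le_left ..), fun k => ⟨W k, F k, hF k, ?_⟩⟩
  exact ((h2 k).trans (min_le_right ..)).trans_lt (half_lt_self hε)

/-- Exchange of the two components of a pair of configurations. -/
def swapc (z : Conf (A × B)) : Conf (B × A) := fun i => (z i).swap

lemma measurable_swapc : Measurable (swapc (A := A) (B := B)) :=
  measurable_pi_lambda _ fun i => measurable_swap.comp (measurable_pi_apply i)

lemma IsJoin.swap (hl : IsJoin l μ ν) : IsJoin (l.map swapc) ν μ := by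
  have := hl.prob
  refine ⟨Measure.isProbabilityMeasure_map measurable_swapc.aemeasurable,
    hl.inv.map_of_comm measurable_swapc fun k x => rfl, ?_, ?_⟩
  · rw [Measure.map_map measurable_fstc measurable_swapc, ← hl.map_snd]; rfl
  · rw [Measure.map_map measurable_sndc measurable_swapc, ← hl.map_fst]; rfl

lemma map_swapc_swapc (l : Measure (Conf (A × B))) : (l.map swapc).map swapc = l := by
  rw [Measure.map_map measurable_swapc measurable_swapc]
  exact Measure.map_id

lemma TendstoFdd.swap {ι : Type*} {f : Filter ι} {j : ι → Measure (Conf (A × B))}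
    [∀ i, IsProbabilityMeasure (j i)] [IsProbabilityMeasure l] (h : TendstoFdd f j l) :
    TendstoFdd f (fun i => (j i).map swapc) (l.map swapc) := fun I a => by
  simp only [pr_map measurable_swapc (finMeas_rs I)]
  exact h.pr (I := I) (f := fun z => rs I (swapc z))
    (fun x y hxy => rs_eq_iff.2 fun t ht => by simp only [swapc, hxy t ht]) a

/-- The joining with the components exchanged. -/
def Joinings.swap (j : Joinings μ ν) : Joinings ν μ := ⟨_, j.2.swap⟩

lemma Joinings.continuous_swap : Continuous (Joinings.swap (μ := μ) (ν := ν)) := by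
  have := fun j : Joinings μ ν => j.2.prob
  refine continuous_iff_continuousAt.2 fun j => Joinings.tendsto_iff.2 ?_
  exact (Joinings.tendsto_iff (j := id).1 (tendsto_id (x := nhds j))).swap

lemma exists_join_nearlyCodes (hμν : EqualEntropy μ ν) :
    ∃ l, IsJoin l μ ν ∧ ∀ k : ℕ, NearlyCodes l ((1 / 2) ^ k) ∧ NearlyCodes (l.map swapc) ((1 / 2) ^ k) := by
  have h2 : ∀ ε > 0, Dense {j : Joinings μ ν | NearlyCodes j.1 ε} := fun ε hε j => by
    obtain ⟨i, hi, h1, h2⟩ := exists_approx_seq hμν j.2 hε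
    exact mem_closure_of_tendsto (f := fun k => (⟨i k, hi k⟩ : Joinings μ ν)) (b := atTop)
      (Joinings.tendsto_iff.2 h1) (Eventually.of_forall h2)
  have h3 : ∀ ε > 0, Dense {j : Joinings μ ν | NearlyCodes (j.1.map swapc) ε} := fun ε hε j => by
    obtain ⟨i, hi, h1, h2⟩ := exists_approx_seq hμν.symm j.2.swap hε
    have := fun k => (hi k).prob
    have := j.2.swap.prob
    refine mem_closure_of_tendsto (f := fun k => (⟨_, (hi k).swap⟩ : Joinings μ ν)) (b := atTop)
      (Joinings.tendsto_iff.2 ?_) (Eventually.of_forall fun k => ?_)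
    · have h4 := h1.swap
      rwa [map_swapc_swapc] at h4
    · change NearlyCodes (((i k).map swapc).map swapc) ε
      rw [map_swapc_swapc]; exact h2 k
  have : Nonempty (Joinings μ ν) := by
    have hz : Measurable fun p : Conf A × Conf B => zipc p.1 p.2 :=
      measurable_pi_lambda _ fun i => ((measurable_pi_apply i).comp measurable_fst).prodMk
        ((measurable_pi_apply i).comp measurable_snd)
    refine ⟨⟨(μ.prod ν).map fun p => zipc p.1 p.2,
      Measure.isProbabilityMeasure_map hz.aemeasurable, fun n => ?_, ?_, ?_⟩⟩
    · rw [Measure.map_map (measurable_shift n) hz]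
      conv_rhs => rw [← hμν.inv_left n, ← hμν.inv_right n, Measure.map_prod_map _ _
        (measurable_shift n) (measurable_shift n), Measure.map_map hz ((measurable_shift n).prodMap (measurable_shift n))]
      rfl
    · rw [Measure.map_map measurable_fstc hz]
      exact Measure.fst_prod (μ := μ) (ν := ν)
    · rw [Measure.map_map measurable_sndc hz]
      exact Measure.snd_prod (μ := μ) (ν := ν)
  have hp : ∀ k : ℕ, (0 : ℝ) < (1 / 2) ^ k := fun k => by positivity
  have := (dense_iInter_of_isOpen (f := fun k : ℕ => {j : Joinings μ ν |
      NearlyCodes j.1 ((1 / 2) ^ k)} ∩ {j | NearlyCodes (j.1.map swapc) ((1 / 2) ^ k)})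
    (fun k => (NearlyCodes.isOpen _).inter ((NearlyCodes.isOpen (μ := ν) (ν := μ) _).preimage Joinings.continuous_swap))
    (fun k => (h2 _ (hp k)).inter_of_isOpen_left (h3 _ (hp k)) (NearlyCodes.isOpen _))).nonempty
  obtain ⟨j, hj⟩ := this
  rw [mem_iInter] at hj
  exact ⟨j.1, j.2, hj⟩

/-- If the first coordinate almost determines the second one to any accuracy, it determines it. -/
lemma exists_code_of_nearlyCodes (hl : IsJoin l μ ν) (h : ∀ k : ℕ, NearlyCodes l ((1 / 2) ^ k)) :
    ∃ θ : Conf A → B, FinMeas θ ∧ ∀ᵐ z ∂l, sndc z = code θ (fstc z) := by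
  classical
  have := hl.prob
  choose W F hF h using h
  have hFm : ∀ k, FinMeas (F k) := fun k => (hF k).finMeas
  set G : B → Set (Conf A) := fun b => {x | ∀ᶠ k in atTop, F k x = b} with hG
  have hGm : ∀ b, MeasurableSet (G b) := fun b => by
    simp only [hG, eventually_atTop, Set.ofPred_exists, Set.ofPred_forall]
    exact MeasurableSet.iUnion fun k => MeasurableSet.iInter fun i => MeasurableSet.iInter fun _ => hFm i b
  have hGd : ∀ {b c x}, x ∈ G b → x ∈ G c → b = c := fun hb hc => by
    obtain ⟨k, h1, h2⟩ := (Eventually.and hb hc).exists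
    exact h1.symm.trans h2
  set θ : Conf A → B := fun x => if h : ∃ b, x ∈ G b then h.choose else Classical.arbitrary B with hθ
  have hθG : ∀ {b x}, x ∈ G b → θ x = b := fun {b x} hb => by
    have h : ∃ b, x ∈ G b := ⟨b, hb⟩
    simp only [hθ, dif_pos h]
    exact hGd h.choose_spec hb
  have hθm : FinMeas θ := fun b => by
    have : θ ⁻¹' {b} = G b ∪ ({_x | b = Classical.arbitrary B} ∩ (⋃ c, G c)ᶜ) := by
      ext x
      simp only [mem_preimage, mem_singleton_iff, mem_union, mem_inter_iff, Set.mem_ofPred_eq,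
        Set.mem_compl_iff, mem_iUnion]
      by_cases hx : ∃ c, x ∈ G c
      · obtain ⟨c, hc⟩ := hx
        rw [hθG hc]
        exact ⟨fun h => Or.inl (h ▸ hc), fun h => h.elim (hGd hc) fun h => (h.2 ⟨c, hc⟩).elim⟩
      · simp only [hθ, dif_neg hx]
        exact ⟨fun h => Or.inr ⟨h.symm, hx⟩, fun h => h.elim (fun h => (hx ⟨b, h⟩).elim) fun h => h.1.symm⟩
    rw [this]
    exact (hGm b).union ((MeasurableSet.const _).inter (MeasurableSet.iUnion hGm).compl)
  refine ⟨θ, hθm, ?_⟩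
  have h0 : ∀ᵐ z ∂l, sndc z 0 = θ (fstc z) := by
    have h1 : ∑' k, l {z | sndc z 0 ≠ F k (fstc z)} ≠ ⊤ := by
      have h2 : ∀ k, l {z | sndc z 0 ≠ F k (fstc z)} ≤ ENNReal.ofReal ((1 / 2) ^ k) := fun k =>
        (ENNReal.le_ofReal_iff_toReal_le (measure_ne_top _ _) (by positivity)).2 (h k).le
      refine ne_top_of_le_ne_top ?_ (ENNReal.tsum_le_tsum h2)
      rw [← ENNReal.ofReal_tsum_of_nonneg (fun k => by positivity) summable_geometric_two]
      exact ENNReal.ofReal_ne_top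
    filter_upwards [ae_eventually_notMem h1] with z hz
    refine (hθG ?_).symm
    filter_upwards [hz] with k hk
    simpa using Eq.symm (not_not.1 hk)
  have hi : ∀ i : ℤ, ∀ᵐ z ∂l, sndc (shift i z) 0 = θ (fstc (shift i z)) := fun i => by
    have h1 := h0
    rw [← hl.inv i] at h1
    exact ae_of_ae_map (measurable_shift i).aemeasurable h1
  filter_upwards [ae_all_iff.2 hi] with z hz
  funext i
  have := hz i
  have h0 : (0 : ℤ) + i = i := zero_add i
  simp only [GibbsFormal.sndc, GibbsFormal.shift, h0] at this
  exact this

/-- **Ornstein's isomorphism theorem** for uniformly mixing processes. -/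
theorem exists_isomorphism (hμν : EqualEntropy μ ν) :
    ∃ (θ : Conf A → B) (θ' : Conf B → A), FinMeas θ ∧ FinMeas θ' ∧ μ.map (code θ) = ν ∧
      (∀ᵐ x ∂μ, code θ' (code θ x) = x) ∧ ∀ᵐ y ∂ν, code θ (code θ' y) = y := by
  obtain ⟨l, hl, h⟩ := exists_join_nearlyCodes hμν
  obtain ⟨θ, hθ, h1⟩ := exists_code_of_nearlyCodes hl fun k => (h k).1
  obtain ⟨θ', hθ', h2⟩ := exists_code_of_nearlyCodes hl.swap fun k => (h k).2
  replace h2 : ∀ᵐ z ∂l, fstc z = code θ' (sndc z) := ae_of_ae_map measurable_swapc.aemeasurable h2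
  have key : ∀ {A B : Type} [Fintype A] [MeasurableSpace A] [MeasurableSingletonClass A] [Fintype B]
      [MeasurableSpace B] [MeasurableSingletonClass B] {θ : Conf A → B} {θ' : Conf B → A},
      FinMeas θ → FinMeas θ' → MeasurableSet {x | code θ' (code θ x) = x} := by
    intro A B _ _ _ _ _ _ θ θ' hθ hθ'
    simp only [funext_iff, Set.ofPred_forall]
    refine MeasurableSet.iInter fun i => ?_
    have h3 : FinMeas fun x => (code θ' (code θ x) i, x i) :=
      FinMeas.pair (fun a => ((measurable_pi_apply i).comp ((measurable_code hθ').comp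
        (measurable_code hθ))) (measurableSet_singleton a))
        fun a => measurable_pi_apply i (measurableSet_singleton a)
    exact h3.preimage {p | p.1 = p.2}
  refine ⟨θ, θ', hθ, hθ', ?_, ?_, ?_⟩
  · rw [← hl.map_fst, Measure.map_map (measurable_code hθ) measurable_fstc, ← hl.map_snd]
    refine Measure.map_congr ?_
    filter_upwards [h1] with z hz using hz.symm
  · rw [← hl.map_fst, ae_map_iff measurable_fstc.aemeasurable (key hθ hθ')]
    filter_upwards [h1, h2] with z hz hz'
    rw [← hz, ← hz']
  · rw [← hl.map_snd, ae_map_iff measurable_sndc.aemeasurable (key hθ' hθ)]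
    filter_upwards [h1, h2] with z hz hz'
    rw [← hz', ← hz]

end Iso

/-! ### Independent processes and the Bernoulli property -/

section Iid

lemma exists_prob_ent {B : Type} [Fintype B] [Nonempty B] [DecidableEq B] {h : ℝ} (h0 : 0 ≤ h)
    (h1 : h ≤ log (Fintype.card B)) :
    ∃ p : B → ℝ, (∀ b, 0 ≤ p b) ∧ ∑ b, p b = 1 ∧ ∑ b, negMulLog (p b) = h := by
  obtain ⟨b₀⟩ := ‹Nonempty B›
  set q : ℝ → B → ℝ := fun t b => (1 - t) * (if b = b₀ then 1 else 0) + t * (Fintype.card B : ℝ)⁻¹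
  have hc : (0 : ℝ) < Fintype.card B := by
    have : Nonempty B := ⟨b₀⟩
    exact_mod_cast Fintype.card_pos
  have hcont : ContinuousOn (fun t => ∑ b, negMulLog (q t b)) (Icc 0 1) := by
    refine (continuous_finsetSum _ fun b _ => Real.continuous_negMulLog.comp ?_).continuousOn
    fun_prop
  obtain ⟨t, ht, hte⟩ : h ∈ (fun t => ∑ b, negMulLog (q t b)) '' Icc 0 1 := by
    refine intermediate_value_Icc zero_le_one hcont ⟨?_, ?_⟩
    · refine le_of_eq_of_le (sum_eq_zero fun b _ => ?_) h0
      by_cases hb : b = b₀ <;> simp [q, hb]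
    · refine h1.trans (le_of_eq ?_)
      simp [q, negMulLog, hc.ne']
  refine ⟨q t, fun b => ?_, ?_, hte⟩
  · have : (0 : ℝ) ≤ if b = b₀ then 1 else 0 := by split_ifs <;> simp
    have := mul_nonneg (sub_nonneg.2 ht.2) this
    have := mul_nonneg ht.1 (inv_nonneg.2 hc.le)
    simp only [q]; linarith
  · simp only [q, sum_add_distrib, ← mul_sum, Finset.sum_ite_eq', Finset.mem_univ,
      if_true, sum_const, Finset.card_univ, nsmul_eq_mul]
    field_simp; ring

/-- Time reversal. -/
def refl {A : Type} (x : Conf A) : Conf A := fun i => x (-i)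

lemma refl_refl {A : Type} (x : Conf A) : refl (refl x) = x := by ext i; simp [refl]

lemma refl_shift {A : Type} (n : ℤ) (x : Conf A) : refl (shift n x) = shift (-n) (refl x) := by
  ext i; simp [refl, shift, add_comm]

lemma measurable_refl {A : Type} [MeasurableSpace A] : Measurable (refl (A := A)) :=
  measurable_pi_lambda _ fun _ => measurable_pi_apply _

lemma ent_pair_of_indep {Ω α β : Type*} [MeasurableSpace Ω] [Fintype α] [Fintype β]
    {μ : Measure Ω} [IsProbabilityMeasure μ] {X : Ω → α} {Y : Ω → β} (hX : FinMeas X)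
    (hY : FinMeas Y) (h : ∀ a b, pr μ (fun ω => (X ω, Y ω)) (a, b) = pr μ X a * pr μ Y b) :
    ent μ (fun ω => (X ω, Y ω)) = ent μ X + ent μ Y := by
  simp only [ent, Fintype.sum_prod_type, h, Real.negMulLog_mul, sum_add_distrib]
  simp only [← sum_mul, ← mul_sum, sum_pr hX, sum_pr hY, one_mul]

variable {B : Type} [Fintype B] [Nonempty B] [DecidableEq B] [MeasurableSpace B]
  [MeasurableSingletonClass B] (ρ : Measure B) [IsProbabilityMeasure ρ]

/-- The law of the i.i.d. process with marginal `ρ`. -/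
def iid : Measure (Conf B) := Measure.infinitePi fun _ : ℤ => ρ

instance : IsProbabilityMeasure (iid ρ) := by rw [iid]; infer_instance

lemma iid_inv : Inv (iid ρ) := fun n =>
  Measure.map_infinitePi_infinitePi_of_inj (P := fun _ : ℤ => ρ) (f := fun i : ℤ => i + n)
    (add_left_injective n)

lemma iid_refl : (iid ρ).map refl = iid ρ :=
  Measure.map_infinitePi_infinitePi_of_inj (P := fun _ : ℤ => ρ) (f := fun i : ℤ => -i)
    neg_injective

lemma iid_inter {I J : Finset ℤ} (hIJ : Disjoint I J) {P C : Set (Conf B)}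
    (hP : Dep (I : Set ℤ) (· ∈ P)) (hC : Dep (J : Set ℤ) (· ∈ C)) :
    (iid ρ).real (P ∩ C) = (iid ρ).real P * (iid ρ).real C := by
  have key : ∀ {I : Finset ℤ} {P : Set (Conf B)}, Dep (I : Set ℤ) (· ∈ P) →
      P = (fun x (i : I) => x i) ⁻¹' (rs I '' P) := by
    intro I P hP
    ext x
    refine ⟨fun h => ⟨x, h, rfl⟩, ?_⟩
    rintro ⟨y, hy, hyx⟩
    exact (hP y x fun i hi => rs_eq_iff.1 hyx i hi).mp hy
  have h := (ProbabilityTheory.iIndepFun_infinitePi (P := fun _ : ℤ => ρ)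
    (X := fun _ (b : B) => b) fun _ => measurable_id).indepFun_finset I J hIJ
      fun i => measurable_pi_apply i
  have := h.measure_inter_preimage_eq_mul (rs I '' P) (rs J '' C) (toFinite _).measurableSet
    (toFinite _).measurableSet
  rw [← key hP, ← key hC] at this
  rw [Measure.real, iid, this, ENNReal.toReal_mul]; rfl

lemma iid_um : UM (iid ρ) := by
  intro δ hδ
  refine ⟨0, fun k m P C hP hC => ?_⟩
  rw [iid_inter ρ (I := Finset.Ico (-(k : ℤ)) 0) (J := Finset.Ico (0 : ℤ) m) (P := P) (C := C)]
  · simpa using mul_nonneg hδ.le measureReal_nonneg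
  · exact Finset.disjoint_left.2 fun i hi hj => by
      simp only [Finset.mem_Ico] at hi hj; omega
  · simpa using hP
  · simpa using hC

lemma iid_rs (I : Finset ℤ) (ζ : I → B) :
    iid ρ {y | ∀ i : I, y i = ζ i} = ∏ i : I, ρ {ζ i} := by
  have : {y : Conf B | ∀ i : I, y i = ζ i} = I.restrict ⁻¹' (Set.univ.pi fun i : I => ({ζ i} : Set B)) := by
    ext y; simp
  rw [this, ← Measure.map_apply (Finset.measurable_restrict _)
    (MeasurableSet.univ_pi fun i => measurableSet_singleton _), iid,
    Measure.infinitePi_map_restrict, Measure.pi_pi]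

lemma iid_Hw (n : ℕ) : Hw (iid ρ) n = n * ∑ b, negMulLog (ρ.real {b}) := by
  have h1 : ∀ n : ℤ, FinMeas fun x : Conf B => x n := fun n =>
    Dep.finMeas (I := {n}) fun x y h => h n (by simp)
  induction n with
  | zero => simp [Hw_zero]
  | succ n ih =>
    have e : Hw (iid ρ) (n + 1) =
        GibbsFormal.ent (iid ρ) (fun x => (rs (Finset.Ico (0 : ℤ) n) x, x n)) := by
      rw [Hw]
      refine ent_congr ((finMeas_rs _).pair (h1 n)) fun x y => ?_
      simp only [Prod.mk.injEq, rs_eq_iff, Finset.mem_Ico]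
      push_cast
      constructor
      · rintro ⟨h0, h1⟩ i hi
        rcases (show i = n ∨ (0 ≤ i ∧ i < n) by omega) with rfl | h'
        exacts [h1, h0 i h']
      · intro h; exact ⟨fun i hi => h _ (by omega), h _ (by omega)⟩
    rw [e, ent_pair_of_indep (finMeas_rs _) (h1 n), ← Hw, ih]
    · have : ∀ b, pr (iid ρ) (fun x => x n) b = ρ.real {b} := by
        intro b
        have hm := Measure.infinitePi_map_eval (fun _ : ℤ => ρ) n
        rw [pr, Measure.real, Measure.real]
        conv_rhs => rw [← hm, Measure.map_apply (measurable_pi_apply _) (measurableSet_singleton _)]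
        rfl
      rw [GibbsFormal.ent]
      simp only [this]
      push_cast; ring
    · intro a b
      have := iid_inter ρ (I := Finset.Ico (0 : ℤ) n) (J := {(n : ℤ)}) (by simp)
        (P := rs (Finset.Ico (0 : ℤ) n) ⁻¹' {a}) (C := (fun x => x n) ⁻¹' {b})
        ((dep_rs _).comp (· = a)) fun x y h => by simp [h n (by simp)]
      rw [pr, pr, pr, ← this]
      congr 1
      ext x; simp

lemma iid_hrate : hrate (iid ρ) = ∑ b, negMulLog (ρ.real {b}) := by
  refine le_antisymm ?_ ((iid_inv ρ).le_hrate (C := 0) fun k => by rw [iid_Hw, sub_zero])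
  refine (hrate_le 0).trans (le_of_eq ?_)
  rw [crate, iid_Hw, iid_Hw]; simp

end Iid

lemma Inv.map_refl {A : Type} [MeasurableSpace A] {μ : Measure (Conf A)} (hμ : Inv μ) :
    Inv (μ.map refl) := fun n => by
  rw [Measure.map_map (measurable_shift n) measurable_refl]
  conv_rhs => rw [← hμ (-n), Measure.map_map measurable_refl (measurable_shift _)]
  congr 1; ext x : 1
  simp [refl_shift]

theorem isBernoulliSystem_of_um {A : Type} [Fintype A] [Nonempty A] [DecidableEq A]
    [MeasurableSpace A] [MeasurableSingletonClass A] {μ : Measure (Conf A)}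
    [IsProbabilityMeasure μ] (hμ : Inv μ) (hU : UM (μ.map refl)) (hh : 0 < hrate (μ.map refl)) :
    IsBernoulliSystem μ := by
  have : IsProbabilityMeasure (μ.map refl) :=
    Measure.isProbabilityMeasure_map measurable_refl.aemeasurable
  have hle : hrate (μ.map refl) ≤ log (Fintype.card (Fin (Fintype.card A))) := by
    refine (hrate_le 0).trans ?_
    rw [crate, Hw_zero, sub_zero, Hw, ent_congr (Y := fun x : Conf A => x 0)
      (Dep.finMeas (I := {0}) fun x y h => h 0 (by simp))
      fun x y => ?_]
    swap
    · simp only [rs_eq_iff, Finset.mem_Ico]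
      refine ⟨fun h i hi => ?_, fun h => h 0 (by simp)⟩
      obtain rfl : i = 0 := by push_cast at hi; omega
      exact h
    have h := sum_negMulLog_le (fun a => pr (μ.map refl) (fun x : Conf A => x 0) a)
      fun a => pr_nonneg ..
    rw [sum_pr (Dep.finMeas (I := {0}) fun x y h => h 0 (by simp))] at h
    simpa [GibbsFormal.ent] using h
  have : Nonempty (Fin (Fintype.card A)) := ⟨⟨0, Fintype.card_pos⟩⟩
  obtain ⟨p, hp0, hp1, hpe⟩ := exists_prob_ent hh.le hle
  set q := PMF.ofFintype (fun b => ENNReal.ofReal (p b))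
    (by rw [← ENNReal.ofReal_sum_of_nonneg fun b _ => hp0 b, hp1, ENNReal.ofReal_one]) with hq
  have hqb : ∀ b, q.toMeasure {b} = ENNReal.ofReal (p b) := fun b => by
    rw [PMF.toMeasure_apply_singleton _ _ (measurableSet_singleton _), hq, PMF.ofFintype_apply]
  have hhν : hrate (μ.map refl) = hrate (iid q.toMeasure) := by
    rw [iid_hrate, ← hpe]
    simp only [Measure.real, hqb, ENNReal.toReal_ofReal (hp0 _)]
  obtain ⟨θ, θ', hθ, hθ', hmap, h1, h2⟩ :=
    exists_isomorphism ⟨hμ.map_refl, iid_inv q.toMeasure, hU, iid_um _, hh, hhν⟩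
  refine ⟨_, fun b => ENNReal.ofReal (p b), iid q.toMeasure, inferInstance,
    by rw [← ENNReal.ofReal_sum_of_nonneg fun b _ => hp0 b, hp1, ENNReal.ofReal_one],
    fun Λ ζ => by rw [iid_rs]; simp only [hqb],
    fun x => refl (code θ (refl x)), fun y => refl (code θ' (refl y)),
    measurable_refl.comp ((measurable_code hθ).comp measurable_refl),
    measurable_refl.comp ((measurable_code hθ').comp measurable_refl), ?_, ?_, ?_, ?_⟩
  · conv_rhs => rw [← iid_refl, ← hmap, Measure.map_map (measurable_code hθ) measurable_refl,
      Measure.map_map measurable_refl ((measurable_code hθ).comp measurable_refl)]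
    rfl
  · refine .of_forall fun x => ?_
    beta_reduce
    rw [refl_shift, code_shift, refl_shift, neg_neg]; rfl
  · filter_upwards [ae_of_ae_map measurable_refl.aemeasurable h1] with x hx
    rw [refl_refl, hx, refl_refl]
  · rw [← iid_refl] at h2
    filter_upwards [ae_of_ae_map measurable_refl.aemeasurable h2] with y hy
    rw [refl_refl, hy, refl_refl]

/-! ### Sums of translation-invariant weights over families of finite sets -/

open scoped ENNReal

section Weights

/-- The total weight of a family of finite sets. -/
def wt (w : Finset ℤ → ℝ) (Q : Set (Finset ℤ)) : ℝ≥0∞ :=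
  ∑' K, Q.indicator (fun K => ENNReal.ofReal (w K)) K

/-- Translation invariance of a weight. -/
def TransInv (w : Finset ℤ → ℝ) : Prop := ∀ (n : ℤ) (K : Finset ℤ), w (K.image fun i => n + i) = w K

/-- The finite sets meeting `V`. -/
def Hit (V : Set ℤ) : Set (Finset ℤ) := {K | ∃ i ∈ K, i ∈ V}

variable {w : Finset ℤ → ℝ}

lemma wt_mono {Q R : Set (Finset ℤ)} (h : Q ⊆ R) : wt w Q ≤ wt w R :=
  ENNReal.tsum_le_tsum fun _ => indicator_le_indicator_of_subset h (fun _ => zero_le) _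

lemma indicator_le_of {Q : Set (Finset ℤ)} {K : Finset ℤ} {c : ℝ≥0∞}
    (h : K ∈ Q → ENNReal.ofReal (w K) ≤ c) : Q.indicator (fun K => ENNReal.ofReal (w K)) K ≤ c := by
  by_cases hK : K ∈ Q
  · rw [indicator_of_mem hK]; exact h hK
  · rw [indicator_of_notMem hK]; exact zero_le

lemma wt_iUnion_le {ι : Type*} [Countable ι] {Q : Set (Finset ℤ)} {R : ι → Set (Finset ℤ)}
    (h : Q ⊆ ⋃ i, R i) : wt w Q ≤ ∑' i, wt w (R i) := by
  simp only [wt]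
  rw [ENNReal.tsum_comm]
  refine ENNReal.tsum_le_tsum fun K => indicator_le_of fun hK => ?_
  obtain ⟨i, hi⟩ := mem_iUnion.1 (h hK)
  exact le_trans (by rw [indicator_of_mem hi]) (ENNReal.le_tsum i)

lemma wt_biUnion_le {ι : Type*} {s : Finset ι} {Q : Set (Finset ℤ)} {R : ι → Set (Finset ℤ)}
    (h : ∀ K ∈ Q, ∃ i ∈ s, K ∈ R i) : wt w Q ≤ ∑ i ∈ s, wt w (R i) := by
  simp only [wt]
  rw [← Summable.tsum_finsetSum fun _ _ => ENNReal.summable]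
  refine ENNReal.tsum_le_tsum fun K => indicator_le_of fun hK => ?_
  obtain ⟨i, hi, hK⟩ := h K hK
  exact le_trans (by rw [indicator_of_mem hK]) (Finset.single_le_sum_of_canonicallyOrdered hi)

lemma wt_union_le {Q R T : Set (Finset ℤ)} (h : Q ⊆ R ∪ T) : wt w Q ≤ wt w R + wt w T := by
  simp only [wt]
  rw [← ENNReal.tsum_add]
  refine ENNReal.tsum_le_tsum fun K => indicator_le_of fun hK => ?_
  rcases h hK with h' | h'
  · exact le_trans (by rw [indicator_of_mem h']) le_self_add
  · exact le_trans (by rw [indicator_of_mem h']) le_add_self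

lemma TransInv.wt (hw : TransInv w) (n : ℤ) (Q : Set (Finset ℤ)) :
    wt w {K | (K.image fun i => n + i) ∈ Q} = wt w Q := by
  have e : ∀ K, (Equiv.addLeft n).finsetCongr K = K.image fun i => n + i := fun K => by
    ext; simp [Equiv.finsetCongr_apply]
  refine Eq.trans (tsum_congr fun K => ?_) ((Equiv.addLeft n).finsetCongr.tsum_eq _)
  rw [e]
  by_cases h : (K.image fun i => n + i) ∈ Q
  · rw [indicator_of_mem h, indicator_of_mem (show K ∈ {K | (K.image fun i => n + i) ∈ Q} from h), hw]
  · rw [indicator_of_notMem h,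
      indicator_of_notMem (show K ∉ {K | (K.image fun i => n + i) ∈ Q} from h)]

/-- The weight of the sets through the origin reaching beyond `n`. -/
def tailW (w : Finset ℤ → ℝ) (n : ℕ) : ℝ≥0∞ := wt w {K | 0 ∈ K ∧ ∃ i ∈ K, (n : ℤ) ≤ i}

lemma TransInv.tail (hw : TransInv w) (e : ℤ) (n : ℕ) :
    GibbsFormal.wt w {K | e ∈ K ∧ ∃ i ∈ K, e + n ≤ i} = tailW w n := by
  rw [tailW, ← hw.wt e]
  refine congrArg _ (Set.ext fun K => ?_)
  simp only [Set.mem_ofPred_eq, Finset.mem_image]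
  constructor
  · rintro ⟨⟨j, hj, hje⟩, _, ⟨i, hi, rfl⟩, hn⟩
    obtain rfl : j = 0 := by omega
    exact ⟨hj, i, hi, by omega⟩
  · rintro ⟨h, i, hi, hn⟩
    exact ⟨⟨0, h, by simp⟩, _, ⟨i, hi, rfl⟩, by omega⟩

lemma tailW_antitone : Antitone (tailW w) := fun m n h => wt_mono fun K ⟨h0, i, hi, hn⟩ =>
  ⟨h0, i, hi, le_trans (by exact_mod_cast h) hn⟩

/-- The weight of the sets with prescribed maximum and diameter at least `n`. -/
lemma TransInv.max_le (hw : TransInv w) (m : ℤ) (n : ℕ) :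
    GibbsFormal.wt w {K | m ∈ K ∧ (∀ i ∈ K, i ≤ m) ∧ ∃ i ∈ K, i + n ≤ m} ≤ tailW w n := by
  have h1 : GibbsFormal.wt w {K | m ∈ K ∧ (∀ i ∈ K, i ≤ m) ∧ ∃ i ∈ K, i + n ≤ m} ≤
      ∑' s : ℕ, GibbsFormal.wt w
        {K | m ∈ K ∧ (∀ i ∈ K, i ≤ m) ∧ n ≤ s ∧ m - s ∈ K ∧ ∀ i ∈ K, m - s ≤ i} := by
    refine wt_iUnion_le fun K ⟨hm, hK, i, hi, hin⟩ => mem_iUnion.2 ?_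
    have hne : K.Nonempty := ⟨i, hi⟩
    have hmin := K.min'_mem hne
    have hle := hK _ hmin
    have hle' := K.min'_le i hi
    refine ⟨(m - K.min' hne).toNat, hm, hK, ?_, ?_, fun j hj => ?_⟩
    · omega
    · rw [Int.toNat_of_nonneg (by omega), sub_sub_cancel]; exact hmin
    · rw [Int.toNat_of_nonneg (by omega), sub_sub_cancel]; exact K.min'_le _ hj
  refine h1.trans ?_
  have h2 : ∀ s : ℕ, GibbsFormal.wt w
      {K | m ∈ K ∧ (∀ i ∈ K, i ≤ m) ∧ n ≤ s ∧ m - s ∈ K ∧ ∀ i ∈ K, m - s ≤ i} =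
      GibbsFormal.wt w {K | (s : ℤ) ∈ K ∧ (∀ i ∈ K, i ≤ s) ∧ n ≤ s ∧ 0 ∈ K ∧ ∀ i ∈ K, 0 ≤ i} := by
    intro s
    rw [← hw.wt (m - s)]
    refine congrArg _ (Set.ext fun K => ?_)
    simp only [Set.mem_ofPred_eq, Finset.mem_image, forall_exists_index, and_imp,
      forall_apply_eq_imp_iff₂]
    have e1 : (∃ a ∈ K, m - s + a = m) ↔ (s : ℤ) ∈ K :=
      ⟨fun ⟨a, ha, h⟩ => by obtain rfl : a = s := by omega
                            exact ha, fun h => ⟨s, h, by omega⟩⟩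
    have e2 : (∃ a ∈ K, m - s + a = m - s) ↔ 0 ∈ K :=
      ⟨fun ⟨a, ha, h⟩ => by obtain rfl : a = 0 := by omega
                            exact ha, fun h => ⟨0, h, by omega⟩⟩
    rw [e1, e2]
    refine and_congr_right fun _ => and_congr (forall₂_congr fun i _ => by omega) <|
      and_congr_right fun _ => and_congr_right fun _ => forall₂_congr fun i _ => by omega
  simp only [h2]
  simp only [GibbsFormal.wt, tailW]
  rw [ENNReal.tsum_comm]
  refine ENNReal.tsum_le_tsum fun K => ?_
  by_cases hK : ∃ s : ℕ, (s : ℤ) ∈ K ∧ (∀ i ∈ K, i ≤ s) ∧ n ≤ s ∧ 0 ∈ K ∧ ∀ i ∈ K, 0 ≤ i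
  · obtain ⟨s, hs⟩ := hK
    rw [tsum_eq_single s]
    · exact indicator_le_of fun _ => by
        rw [indicator_of_mem (show K ∈ {K : Finset ℤ | 0 ∈ K ∧ ∃ i ∈ K, (n : ℤ) ≤ i} from
          ⟨hs.2.2.2.1, s, hs.1, by exact_mod_cast hs.2.2.1⟩)]
    · intro s' hs'
      refine indicator_of_notMem (fun h => hs' ?_) _
      obtain ⟨h1, h2, -⟩ := h
      have := hs.2.1 _ h1
      have := h2 _ hs.1
      omega
  · refine le_of_eq_of_le (ENNReal.tsum_eq_zero.2 fun s => indicator_of_notMem ?_ _) zero_le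
    exact fun h => hK ⟨s, h⟩

/-- The weight of the sets meeting `[p, q]` and reaching beyond `q + n`. -/
lemma TransInv.right_le (hw : TransInv w) (p q : ℤ) (n : ℕ) :
    GibbsFormal.wt w (Hit (Icc p q) ∩ Hit (Ici (q + n))) ≤ (q + 1 - p).toNat * tailW w n := by
  refine (wt_biUnion_le (s := Finset.Icc p q) (R := fun f => {K | f ∈ K ∧ ∃ i ∈ K, f + n ≤ i})
    fun K hK => ?_).trans (by simp only [hw.tail]; simp)
  obtain ⟨⟨f, hf, hf'⟩, i, hi, hi'⟩ := hK
  simp only [mem_Icc, mem_Ici] at hf' hi'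
  exact ⟨f, by simpa using hf', hf, i, hi, by omega⟩

/-- The weight of the sets meeting `[p, q]` and reaching to the left of `p - n`. -/
lemma TransInv.left_le (hw : TransInv w) (p q : ℤ) (n h : ℕ) :
    GibbsFormal.wt w (Hit (Icc p q) ∩ Hit (Iic (p - n))) ≤
      (q + 1 - p).toNat * tailW w h + (q + h - p).toNat * tailW w n := by
  refine (wt_union_le (R := Hit (Icc p q) ∩ Hit (Ici (q + h)))
    (T := {K | ∃ m ∈ Finset.Ico p (q + h), m ∈ K ∧ (∀ i ∈ K, i ≤ m) ∧ ∃ i ∈ K, i + n ≤ m})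
    fun K hK => ?_).trans (add_le_add (hw.right_le p q h) ?_)
  · by_cases hmax : K ∈ Hit (Ici (q + h))
    · exact Or.inl ⟨hK.1, hmax⟩
    · obtain ⟨⟨f, hf, hf'⟩, i, hi, hi'⟩ := hK
      have hm := K.max'_mem ⟨f, hf⟩
      have h1 := K.le_max' f hf
      have h2 : K.max' ⟨f, hf⟩ < q + h := by
        by_contra hc
        exact hmax ⟨_, hm, by simpa using hc⟩
      simp only [mem_Icc, mem_Iic] at hf' hi'
      exact Or.inr ⟨_, by simp only [Finset.mem_Ico]; omega, hm, fun j hj => K.le_max' j hj, i, hi,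
        by omega⟩
  · refine (wt_biUnion_le fun K hK => hK).trans ?_
    refine (sum_le_sum fun m _ => hw.max_le m n).trans (by simp)

end Weights

section Gibbs

variable {A : Type} [Fintype A] [Nonempty A] [MeasurableSpace A] [MeasurableSingletonClass A]

/-! ### Interaction potentials: energies and their variation -/

namespace Potential

variable (P : Potential A)

/-- The variation of the interaction of a finite set. -/
def pv (K : Finset ℤ) : ℝ := pvar (P.Φ K)

/-- The norm of the interaction of a finite set. -/
def pn (K : Finset ℤ) : ℝ := pnorm (P.Φ K)

/-- The energy of the interactions in a family of finite sets. -/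
def en (Q : Set (Finset ℤ)) (x : Conf A) : ℝ := ∑' K, Q.indicator (fun K => P.Φ K x) K

lemma abs_le_pn (K : Finset ℤ) (x : Conf A) : |P.Φ K x| ≤ P.pn K := by
  obtain ⟨C, hC⟩ := P.bounded K
  exact le_ciSup (f := fun x => |P.Φ K x|) ⟨C, by rintro _ ⟨y, rfl⟩; exact hC y⟩ x

lemma sub_le_pv (K : Finset ℤ) (x y : Conf A) : P.Φ K x - P.Φ K y ≤ P.pv K := by
  obtain ⟨C, hC⟩ := P.bounded K
  have h1 := le_ciSup (f := P.Φ K) ⟨C, by rintro _ ⟨y, rfl⟩; exact (abs_le.1 (hC y)).2⟩ x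
  have h2 := ciInf_le (f := P.Φ K) ⟨-C, by rintro _ ⟨y, rfl⟩; exact (abs_le.1 (hC y)).1⟩ y
  simp only [pv, pvar]
  linarith

lemma abs_sub_le_pv (K : Finset ℤ) (x y : Conf A) : |P.Φ K x - P.Φ K y| ≤ P.pv K :=
  abs_sub_le_iff.2 ⟨P.sub_le_pv K x y, P.sub_le_pv K y x⟩

lemma pv_nonneg (K : Finset ℤ) : 0 ≤ P.pv K := by
  have := P.sub_le_pv K (Classical.arbitrary _) (Classical.arbitrary _)
  simpa using this

lemma pn_nonneg (K : Finset ℤ) : 0 ≤ P.pn K :=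
  (abs_nonneg _).trans (P.abs_le_pn K (Classical.arbitrary _))

lemma pv_le (K : Finset ℤ) : P.pv K ≤ 2 * P.pn K := by
  have h1 : (⨆ x, P.Φ K x) ≤ P.pn K := ciSup_le fun x => (abs_le.1 (P.abs_le_pn K x)).2
  have h2 : -P.pn K ≤ ⨅ x, P.Φ K x := le_ciInf fun x => (abs_le.1 (P.abs_le_pn K x)).1
  simp only [pv, pvar]
  linarith

lemma dep {K : Finset ℤ} (hK : K.Nonempty) : Dep (K : Set ℤ) (P.Φ K) := by
  intro x y h
  obtain ⟨t, -, ht⟩ := P.measurable K hK (measurableSet_singleton (P.Φ K x))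
  have h1 : (K : Set ℤ).domRestrict x ∈ t := ht.ge (rfl : P.Φ K x = P.Φ K x)
  have h2 : (K : Set ℤ).domRestrict y = (K : Set ℤ).domRestrict x :=
    funext fun i => (h i i.2).symm
  exact (ht.le (show (K : Set ℤ).domRestrict y ∈ t from h2 ▸ h1) : P.Φ K y = P.Φ K x).symm

lemma image_eq (n : ℤ) {K : Finset ℤ} (hK : K.Nonempty) :
    P.Φ (K.image fun i => n + i) = P.Φ K ∘ shift n := funext (P.invariant n K hK)

lemma shift_surjective (n : ℤ) : Function.Surjective (shift (S := A) n) := fun x =>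
  ⟨shift (-n) x, by rw [shift_shift]; simp [shift_zero]⟩

lemma transInv_pv : TransInv P.pv := by
  intro n K
  rcases K.eq_empty_or_nonempty with rfl | hK
  · simp
  · simp only [pv, pvar, P.image_eq n hK, Function.comp_apply]
    rw [(shift_surjective n).iSup_comp, (shift_surjective n).iInf_comp]

lemma transInv_pn : TransInv P.pn := by
  intro n K
  rcases K.eq_empty_or_nonempty with rfl | hK
  · simp
  · simp only [pn, pnorm, P.image_eq n hK, Function.comp_apply]
    exact (shift_surjective n).iSup_comp (fun x => |P.Φ K x|)

variable {P}

lemma wt_pv_le (Q : Set (Finset ℤ)) : wt P.pv Q ≤ 2 * wt P.pn Q := by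
  rw [wt, wt, ← ENNReal.tsum_mul_left]
  refine ENNReal.tsum_le_tsum fun K => indicator_le_of fun hK => ?_
  rw [indicator_of_mem hK, ← ENNReal.ofReal_ofNat, ← ENNReal.ofReal_mul zero_le_two]
  exact ENNReal.ofReal_le_ofReal (P.pv_le K)

lemma wt_pn_hit (hs : NormSummable P) (V : Finset ℤ) : wt P.pn (Hit (V : Set ℤ)) ≠ ⊤ := by
  have h0 : wt P.pn {K | 0 ∈ K} ≠ ⊤ := by
    have := hs.tsum_ofReal_ne_top
    rw [wt, ← tsum_subtype]
    exact this
  have h1 : ∀ e : ℤ, wt P.pn {K | e ∈ K} = wt P.pn {K | 0 ∈ K} := fun e => by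
    rw [← P.transInv_pn.wt e]
    refine congrArg _ (Set.ext fun K => ?_)
    simp only [Set.mem_ofPred_eq, Finset.mem_image]
    exact ⟨fun ⟨a, ha, h⟩ => by obtain rfl : a = 0 := by omega
                                exact ha, fun h => ⟨0, h, by simp⟩⟩
  have h2 := wt_biUnion_le (w := P.pn) (s := V) (Q := Hit (V : Set ℤ)) (R := fun e => {K | e ∈ K})
    fun K ⟨i, hi, hiV⟩ => ⟨i, hiV, hi⟩
  refine ne_top_of_le_ne_top ?_ h2
  simp only [h1, sum_const, nsmul_eq_mul]
  exact ENNReal.mul_ne_top (ENNReal.natCast_ne_top _) h0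

lemma summable_en (hs : NormSummable P) {V : Finset ℤ} {Q : Set (Finset ℤ)}
    (hQ : Q ⊆ Hit (V : Set ℤ)) (x : Conf A) : Summable (Q.indicator fun K => P.Φ K x) := by
  have h := ne_top_of_le_ne_top (wt_pn_hit hs V) (wt_mono (w := P.pn) hQ)
  refine .of_norm_bounded (ENNReal.summable_toReal h) fun K => ?_
  by_cases hK : K ∈ Q
  · rw [indicator_of_mem hK, indicator_of_mem hK, ENNReal.toReal_ofReal (P.pn_nonneg K)]
    exact P.abs_le_pn K x
  · simp [indicator_of_notMem hK]

lemma en_union (hs : NormSummable P) {V : Finset ℤ} {Q R : Set (Finset ℤ)}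
    (hQ : Q ⊆ Hit (V : Set ℤ)) (hR : R ⊆ Hit (V : Set ℤ)) (h : Disjoint Q R) (x : Conf A) :
    P.en (Q ∪ R) x = P.en Q x + P.en R x := by
  rw [en, en, en, ← (summable_en hs hQ x).tsum_add (summable_en hs hR x),
    indicator_union_of_disjoint h]

lemma en_congr {Q : Set (Finset ℤ)} (hQ : ∅ ∉ Q) {x y : Conf A}
    (h : ∀ K ∈ Q, ∀ i ∈ K, x i = y i) : P.en Q x = P.en Q y := by
  refine tsum_congr fun K => ?_
  by_cases hK : K ∈ Q
  · rw [indicator_of_mem hK, indicator_of_mem hK]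
    exact P.dep (K.nonempty_iff_ne_empty.2 fun h => hQ (h ▸ hK)) x y (h K hK)
  · simp [indicator_of_notMem hK]

lemma empty_notMem_hit {V : Set ℤ} {Q : Set (Finset ℤ)} (hQ : Q ⊆ Hit V) : ∅ ∉ Q := fun h => by
  obtain ⟨i, hi, -⟩ := hQ h
  simp at hi

/-- Energies of two configurations differ by at most the weight of the sets on which they differ. -/
lemma en_sub_le (hs : NormSummable P) {V : Finset ℤ} {Q : Set (Finset ℤ)}
    (hQ : Q ⊆ Hit (V : Set ℤ)) {x y : Conf A} {e : ℝ} (he : 0 ≤ e)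
    (h : wt P.pv {K | K ∈ Q ∧ ∃ i ∈ K, x i ≠ y i} ≤ ENNReal.ofReal e) :
    |P.en Q x - P.en Q y| ≤ e := by
  set R := {K | K ∈ Q ∧ ∃ i ∈ K, x i ≠ y i}
  have hR : wt P.pv R ≠ ⊤ := ne_top_of_le_ne_top ENNReal.ofReal_ne_top h
  rw [en, en, ← (summable_en hs hQ x).tsum_sub (summable_en hs hQ y), ← Real.norm_eq_abs]
  refine (tsum_of_norm_bounded (ENNReal.summable_toReal hR).hasSum fun K => ?_).trans ?_
  · by_cases hK : K ∈ R
    · rw [indicator_of_mem hK, indicator_of_mem hK.1, indicator_of_mem hK.1,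
        ENNReal.toReal_ofReal (P.pv_nonneg K)]
      exact P.abs_sub_le_pv K x y
    · rw [indicator_of_notMem hK]
      by_cases hK' : K ∈ Q
      · have : ∀ i ∈ K, x i = y i := fun i hi => by
          by_contra hc
          exact hK ⟨hK', i, hi, hc⟩
        rw [indicator_of_mem hK', indicator_of_mem hK',
          P.dep (K.nonempty_iff_ne_empty.2 fun h => empty_notMem_hit hQ (h ▸ hK')) x y this]
        simp
      · simp [indicator_of_notMem hK']
  · rw [← ENNReal.tsum_toReal_eq fun K => ne_top_of_le_ne_top hR (ENNReal.le_tsum K)]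
    exact ENNReal.toReal_le_of_le_ofReal he h

lemma hPot_eq (V : Finset ℤ) (x : Conf A) : HPot P V x = P.en (Hit (V : Set ℤ)) x := by
  have : Hit (V : Set ℤ) = {K | (K ∩ V).Nonempty} := Set.ext fun K => by
    rw [Set.mem_ofPred_eq]
    simp only [Finset.Nonempty, Finset.mem_inter]
    rfl
  rw [en, this, ← tsum_subtype]
  rfl

lemma tail_eq (hs : NormSummable P) (n : ℕ) : tailW P.pv n = ENNReal.ofReal (varTail P n) := by
  have h : tailW P.pv n ≠ ⊤ := by
    refine ne_top_of_le_ne_top (ENNReal.mul_ne_top (by simp) (wt_pn_hit hs {0}))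
      ((wt_mono fun K hK => ?_).trans (wt_pv_le (P := P) (Hit (({0} : Finset ℤ) : Set ℤ))))
    exact ⟨0, hK.1, by simp⟩
  have e : tailW P.pv n = ∑' K : {K : Finset ℤ // 0 ∈ K ∧ ∃ i ∈ K, (n : ℤ) ≤ i},
      ENNReal.ofReal (P.pv K) :=
    (tsum_subtype {K : Finset ℤ | 0 ∈ K ∧ ∃ i ∈ K, (n : ℤ) ≤ i}
      fun K => ENNReal.ofReal (P.pv K)).symm
  rw [e] at h ⊢
  have h' := ENNReal.summable_toReal h
  simp only [ENNReal.toReal_ofReal (P.pv_nonneg _)] at h'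
  exact (ENNReal.ofReal_tsum_of_nonneg (fun K => P.pv_nonneg _) h').symm

lemma varTail_nonneg (n : ℕ) : 0 ≤ varTail P n := tsum_nonneg fun K => P.pv_nonneg K

lemma varTail_antitone (hs : NormSummable P) : Antitone (varTail P) := fun m n h => by
  have := tailW_antitone (w := P.pv) h
  rwa [tail_eq hs, tail_eq hs, ENNReal.ofReal_le_ofReal_iff (varTail_nonneg m)] at this

end Potential

/-- An antitone sequence dominated by `β / n` plus a summable sequence is `O(1 / n)`. -/
lemma Antitone.le_div_of_le_add {r a : ℕ → ℝ} (hr : Antitone r) {β : ℝ} (hβ : 0 ≤ β)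
    (ha : ∀ n, 0 ≤ a n) (hs : Summable a) (h : ∀ n : ℕ, 1 ≤ n → r n ≤ β / n + a n) {n : ℕ}
    (hn : 1 ≤ n) : r n ≤ (4 * β + 2 * ∑' i, a i) / n := by
  have h0 : (0 : ℝ) < n := by exact_mod_cast hn
  have h1 : ∀ m ∈ Finset.Ioc (n / 2) n, r n ≤ 2 * β / n + a m := fun m hm => by
    rw [Finset.mem_Ioc] at hm
    refine (hr hm.2).trans ((h m (by omega)).trans (add_le_add_left ?_ _))
    have h2 : (0 : ℝ) < m := by exact_mod_cast (by omega : 0 < m)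
    have h3 : (n : ℝ) ≤ 2 * m := by exact_mod_cast (by omega : n ≤ 2 * m)
    rw [div_le_div_iff₀ h2 h0]
    nlinarith
  have h2 := sum_le_sum h1
  rw [sum_const, sum_add_distrib, sum_const, nsmul_eq_mul, nsmul_eq_mul,
    Nat.card_Ioc] at h2
  have h3 := hs.sum_le_tsum (Finset.Ioc (n / 2) n) fun i _ => ha i
  have h4 : (n : ℝ) ≤ 2 * (n - n / 2 : ℕ) := by exact_mod_cast (by omega : n ≤ 2 * (n - n / 2))
  have h5 : ((n - n / 2 : ℕ) : ℝ) ≤ n := by exact_mod_cast (by omega : n - n / 2 ≤ n)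
  have h6 : ((n - n / 2 : ℕ) : ℝ) * (2 * β / n) ≤ n * (2 * β / n) := by gcongr
  rw [mul_div_cancel₀ _ h0.ne'] at h6
  have h7 : 0 ≤ ∑' i, a i := tsum_nonneg ha
  rw [le_div_iff₀ h0]
  rcases le_or_gt (r n) 0 with h8 | h8
  · nlinarith
  · have : n * r n ≤ 2 * (n - n / 2 : ℕ) * r n := by gcongr
    nlinarith

/-! ### The averaging operators of the specification -/

lemma ov_of_mem {x : Conf A} {V : Finset ℤ} {ζ : V → A} {i : ℤ} (h : i ∈ V) :
    ov x V ζ i = ζ ⟨i, h⟩ := dif_pos h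

lemma ov_of_notMem {x : Conf A} {V : Finset ℤ} {ζ : V → A} {i : ℤ} (h : i ∉ V) :
    ov x V ζ i = x i := dif_neg h

lemma ov_congr {x y : Conf A} {V : Finset ℤ} (h : ∀ i ∉ V, x i = y i) (ζ : V → A) :
    ov x V ζ = ov y V ζ := funext fun i => by
  by_cases hi : i ∈ V
  · rw [ov_of_mem hi, ov_of_mem hi]
  · rw [ov_of_notMem hi, ov_of_notMem hi, h i hi]

lemma ov_self (x : Conf A) (V : Finset ℤ) : ov x V (fun i => x i) = x := funext fun i => by
  by_cases hi : i ∈ V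
  · rw [ov_of_mem hi]
  · rw [ov_of_notMem hi]

/-- Summation over the coordinates in `V`. -/
def sm (V : Finset ℤ) (Q : Conf A → ℝ) (x : Conf A) : ℝ := ∑ ζ : V → A, Q (ov x V ζ)

lemma sm_congr {V : Finset ℤ} {x y : Conf A} (h : ∀ i ∉ V, x i = y i) (Q : Conf A → ℝ) :
    sm V Q x = sm V Q y := sum_congr rfl fun ζ _ => by rw [ov_congr h]

lemma sm_ov (V : Finset ℤ) (Q : Conf A → ℝ) (x : Conf A) (ζ : V → A) :
    sm V Q (ov x V ζ) = sm V Q x := sm_congr (fun _ hi => ov_of_notMem hi) Q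

lemma sm_mul {V : Finset ℤ} {G : Conf A → ℝ} {x : Conf A} (h : ∀ ζ, G (ov x V ζ) = G x)
    (Q : Conf A → ℝ) : sm V (fun z => G z * Q z) x = G x * sm V Q x := by
  simp only [sm, h, mul_sum]

lemma sm_union {U W : Finset ℤ} (h : Disjoint U W) (Q : Conf A → ℝ) (x : Conf A) :
    sm (U ∪ W) Q x = sm U (sm W Q) x := by
  simp only [sm]
  rw [← Fintype.sum_prod_type' (f := fun (ζ : U → A) (η : W → A) => Q (ov (ov x U ζ) W η))]
  refine (Fintype.sum_equiv (Equiv.piFinsetUnion (fun _ => A) h) _ _ fun p => ?_).symm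
  congr 1
  funext i
  by_cases hW : i ∈ W
  · rw [ov_of_mem hW, ov_of_mem (Finset.mem_union_right _ hW)]
    exact (Equiv.piFinsetUnion_right (fun _ => A) h hW _).symm
  · rw [ov_of_notMem hW]
    by_cases hU : i ∈ U
    · rw [ov_of_mem hU, ov_of_mem (Finset.mem_union_left _ hU)]
      exact (Equiv.piFinsetUnion_left (fun _ => A) h hU _).symm
    · rw [ov_of_notMem hU, ov_of_notMem (by simp [hU, hW])]

lemma sm_of_subset {U V : Finset ℤ} (h : U ⊆ V) (Q : Conf A → ℝ) (x : Conf A) :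
    sm V Q x = sm (V \ U) (sm U Q) x := by
  rw [← sm_union Finset.sdiff_disjoint, Finset.sdiff_union_of_subset h]

namespace Potential

variable (P : Potential A)

/-- The Boltzmann factor of a finite volume. -/
def bw (V : Finset ℤ) (x : Conf A) : ℝ := exp (-HPot P V x)

/-- The averaging operator of the specification on a finite volume. -/
def gm (V : Finset ℤ) (F : Conf A → ℝ) (x : Conf A) : ℝ :=
  sm V (fun z => P.bw V z * F z) x / sm V (P.bw V) x

variable {P}

lemma bw_pos (V : Finset ℤ) (x : Conf A) : 0 < P.bw V x := exp_pos _

lemma sm_bw_pos (V : Finset ℤ) (x : Conf A) : 0 < sm V (P.bw V) x :=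
  Finset.sum_pos (fun _ _ => bw_pos _ _) Finset.univ_nonempty

lemma gm_eq_sum (V : Finset ℤ) (F : Conf A → ℝ) (x : Conf A) :
    P.gm V F x = ∑ ζ : V → A, potPhi P V (ov x V ζ) * F (ov x V ζ) := by
  rw [gm, sm, sum_div]
  refine sum_congr rfl fun ζ _ => ?_
  rw [mul_div_right_comm, ← sm_ov V (P.bw V) x ζ]
  rfl

lemma potPhi_pos (V : Finset ℤ) (x : Conf A) : 0 < potPhi P V x :=
  div_pos (exp_pos _) (sm_bw_pos (P := P) V x)

lemma sum_potPhi (V : Finset ℤ) (x : Conf A) : ∑ ζ : V → A, potPhi P V (ov x V ζ) = 1 := by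
  have h := gm_eq_sum (P := P) V (fun _ => 1) x
  simp only [mul_one, gm] at h
  rw [← h]
  exact div_self (sm_bw_pos V x).ne'

lemma gm_congr {V : Finset ℤ} {x y : Conf A} (h : ∀ i ∉ V, x i = y i) (F : Conf A → ℝ) :
    P.gm V F x = P.gm V F y := by rw [gm, gm, sm_congr h, sm_congr h]

lemma gm_ov (V : Finset ℤ) (F : Conf A → ℝ) (x : Conf A) (ζ : V → A) :
    P.gm V F (ov x V ζ) = P.gm V F x := gm_congr (fun _ hi => ov_of_notMem hi) F

lemma gm_mono {V : Finset ℤ} {x : Conf A} {F G : Conf A → ℝ}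
    (h : ∀ ζ, F (ov x V ζ) ≤ G (ov x V ζ)) : P.gm V F x ≤ P.gm V G x := by
  rw [gm_eq_sum, gm_eq_sum]
  exact sum_le_sum fun ζ _ => mul_le_mul_of_nonneg_left (h ζ) (potPhi_pos _ _).le

lemma gm_mul {V : Finset ℤ} {x : Conf A} {G : Conf A → ℝ} (h : ∀ ζ, G (ov x V ζ) = G x)
    (F : Conf A → ℝ) : P.gm V (fun z => G z * F z) x = G x * P.gm V F x := by
  simp only [gm_eq_sum, h, mul_sum]
  exact sum_congr rfl fun ζ _ => by ring

lemma gm_const (V : Finset ℤ) (c : ℝ) (x : Conf A) : P.gm V (fun _ => c) x = c := by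
  rw [gm_eq_sum, ← sum_mul, sum_potPhi, one_mul]

lemma gm_add (V : Finset ℤ) (F G : Conf A → ℝ) (x : Conf A) :
    P.gm V (fun z => F z + G z) x = P.gm V F x + P.gm V G x := by
  simp only [gm_eq_sum, mul_add, sum_add_distrib]

lemma gm_const_mul (V : Finset ℤ) (c : ℝ) (F : Conf A → ℝ) (x : Conf A) :
    P.gm V (fun z => c * F z) x = c * P.gm V F x :=
  gm_mul (G := fun _ => c) (fun _ => rfl) F

lemma gm_sub (V : Finset ℤ) (F G : Conf A → ℝ) (x : Conf A) :
    P.gm V (fun z => F z - G z) x = P.gm V F x - P.gm V G x := by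
  simp only [gm_eq_sum, mul_sub, sum_sub_distrib]

lemma gm_nonneg {V : Finset ℤ} {x : Conf A} {F : Conf A → ℝ} (h : ∀ ζ, 0 ≤ F (ov x V ζ)) :
    0 ≤ P.gm V F x := by
  rw [gm_eq_sum]
  exact sum_nonneg fun ζ _ => mul_nonneg (potPhi_pos _ _).le (h ζ)

lemma gm_of_const {V : Finset ℤ} {x : Conf A} {F : Conf A → ℝ} {c : ℝ}
    (h : ∀ ζ, F (ov x V ζ) = c) : P.gm V F x = c := by
  rw [gm_eq_sum]
  simp only [h]
  rw [← sum_mul, sum_potPhi, one_mul]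

lemma gm_mem_Icc {V : Finset ℤ} {x : Conf A} {F : Conf A → ℝ} {a b : ℝ}
    (h : ∀ ζ, F (ov x V ζ) ∈ Icc a b) : P.gm V F x ∈ Icc a b :=
  ⟨(gm_const V a x).symm.trans_le (gm_mono fun ζ => (h ζ).1),
    (gm_mono fun ζ => (h ζ).2).trans_eq (gm_const V b x)⟩

lemma hit_mono {U V : Finset ℤ} (h : U ⊆ V) : Hit (U : Set ℤ) ⊆ Hit (V : Set ℤ) :=
  fun _ ⟨i, hi, hU⟩ => ⟨i, hi, h hU⟩

/-- The part of the Boltzmann factor of `V` not involving `U`. -/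
lemma bw_of_subset (hs : NormSummable P) {U V : Finset ℤ} (h : U ⊆ V) (x : Conf A) :
    P.bw V x = exp (-P.en (Hit (V : Set ℤ) \ Hit (U : Set ℤ)) x) * P.bw U x := by
  rw [bw, bw, ← exp_add, hPot_eq, hPot_eq, ← neg_add, ← en_union hs sdiff_subset (hit_mono h)
    disjoint_sdiff_left, sdiff_union_of_subset (hit_mono h)]

lemma sm_bw_mul (hs : NormSummable P) {U V : Finset ℤ} (h : U ⊆ V) (F : Conf A → ℝ) (x : Conf A) :
    sm U (fun z => P.bw V z * F z) x =
      exp (-P.en (Hit (V : Set ℤ) \ Hit (U : Set ℤ)) x) * sm U (fun z => P.bw U z * F z) x := by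
  rw [← sm_mul (G := fun x => exp (-P.en (Hit (V : Set ℤ) \ Hit (U : Set ℤ)) x))]
  · exact congrArg (fun Q => sm U Q x) (funext fun z => by rw [bw_of_subset hs h, mul_assoc])
  · intro ζ
    refine congrArg (fun t => exp (-t)) (en_congr (empty_notMem_hit sdiff_subset) ?_)
    exact fun K hK i hi => ov_of_notMem fun hU => hK.2 ⟨i, hi, hU⟩

/-- Consistency of the specification. -/
lemma gm_gm (hs : NormSummable P) {U V : Finset ℤ} (h : U ⊆ V) (F : Conf A → ℝ) (x : Conf A) :
    P.gm V (P.gm U F) x = P.gm V F x := by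
  rw [gm, gm]
  congr 1
  rw [sm_of_subset h, sm_of_subset h]
  refine sum_congr rfl fun ζ _ => ?_
  rw [sm_bw_mul hs h, sm_bw_mul hs h]
  congr 1
  generalize ov x (V \ U) ζ = z
  have : (fun z => P.bw U z * P.gm U F z) = fun z => P.gm U F z * P.bw U z :=
    funext fun z => mul_comm _ _
  rw [this, sm_mul fun ζ => gm_ov U F z ζ]
  exact div_mul_cancel₀ _ (sm_bw_pos U z).ne'

/-- Comparison of the averages for two boundary conditions. -/
lemma gm_comparison (hs : NormSummable P) {V : Finset ℤ} {x y : Conf A} {F : Conf A → ℝ}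
    (hF : ∀ ζ, 0 ≤ F (ov y V ζ)) (hxy : ∀ ζ, F (ov x V ζ) = F (ov y V ζ)) {e : ℝ} (he : 0 ≤ e)
    (h : wt P.pv {K | K ∈ Hit (V : Set ℤ) ∧ ∃ i ∈ K, i ∉ V ∧ x i ≠ y i} ≤ ENNReal.ofReal e) :
    exp (-(2 * e)) * P.gm V F y ≤ P.gm V F x := by
  have h1 : ∀ ζ, |HPot P V (ov x V ζ) - HPot P V (ov y V ζ)| ≤ e := fun ζ => by
    rw [hPot_eq, hPot_eq]
    refine en_sub_le hs subset_rfl he ((wt_mono fun K hK => ?_).trans h)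
    obtain ⟨hK, i, hi, hne⟩ := hK
    by_cases hV : i ∈ V
    · exact absurd (by rw [ov_of_mem hV, ov_of_mem hV]) hne
    · rw [ov_of_notMem hV, ov_of_notMem hV] at hne
      exact ⟨hK, i, hi, hV, hne⟩
  have h2 : exp (-e) * sm V (fun z => P.bw V z * F z) y ≤
      sm V (fun z => P.bw V z * F z) x := by
    rw [sm, sm, mul_sum]
    refine sum_le_sum fun ζ _ => ?_
    rw [hxy, ← mul_assoc, bw, bw, ← exp_add]
    exact mul_le_mul_of_nonneg_right
      (Real.exp_le_exp.2 (by linarith [(abs_le.1 (h1 ζ)).2])) (hF ζ)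
  have h3 : sm V (P.bw V) x ≤ exp e * sm V (P.bw V) y := by
    rw [sm, sm, mul_sum]
    refine sum_le_sum fun ζ _ => ?_
    rw [bw, bw, ← exp_add]
    exact Real.exp_le_exp.2 (by linarith [(abs_le.1 (h1 ζ)).1])
  have h4 := sm_bw_pos (P := P) V x
  have h5 := sm_bw_pos (P := P) V y
  have h6 : 0 ≤ P.gm V F y := gm_nonneg hF
  rw [gm, gm] at *
  rw [le_div_iff₀ h4]
  calc _ ≤ exp (-(2 * e)) * (sm V (fun z => P.bw V z * F z) y / sm V (P.bw V) y) *
        (exp e * sm V (P.bw V) y) :=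
        mul_le_mul_of_nonneg_left h3 (mul_nonneg (exp_pos _).le h6)
    _ = exp (-e) * sm V (fun z => P.bw V z * F z) y := by
        rw [show -(2 * e) = -e + -e by ring, exp_add, Real.exp_neg e]
        field_simp
    _ ≤ _ := h2

end Potential

/-! ### A renewal inequality for iterated transfer operators -/

section Renewal

variable {T : Type} [Fintype T] [Nonempty T] [MeasurableSpace T] [MeasurableSingletonClass T]

lemma Dep.sm {I : Set ℤ} {Q : Conf T → ℝ} (h : Dep I Q) (V : Finset ℤ) :
    Dep (I \ V) (sm V Q) := fun x y hxy => sum_congr rfl fun ζ _ => h _ _ fun i hi => by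
  by_cases hV : i ∈ V
  · rw [ov_of_mem hV, ov_of_mem hV]
  · rw [ov_of_notMem hV, ov_of_notMem hV, hxy i ⟨hi, hV⟩]

/-- The partial products of a sequence. -/
def uprod (v : ℕ → ℝ) (j : ℕ) : ℝ := ∏ l ∈ Finset.range j, v l

/-- The sums of the partial products of a sequence. -/
def usum (v : ℕ → ℝ) (n : ℕ) : ℝ := ∑ j ∈ Finset.range n, uprod v j

/-- The transfer operator over the last `n` sites before `e`. -/
def Lr (V : Finset ℤ) (f : ℤ → Conf T → ℝ) (e : ℤ) (n : ℕ) (G : Conf T → ℝ) (w : Conf T) : ℝ :=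
  sm {i ∈ V | e - n ≤ i} (fun z => (∏ i ∈ V with e - n ≤ i, f i z) * G z) w

variable {V : Finset ℤ} {f : ℤ → Conf T → ℝ} {e : ℤ}

lemma Lr_add (n : ℕ) (G H : Conf T → ℝ) (w : Conf T) :
    Lr V f e n (fun z => G z + H z) w = Lr V f e n G w + Lr V f e n H w := by
  simp only [Lr, sm, mul_add, sum_add_distrib]

lemma Lr_const_mul (n : ℕ) (c : ℝ) (G : Conf T → ℝ) (w : Conf T) :
    Lr V f e n (fun z => c * G z) w = c * Lr V f e n G w := by
  simp only [Lr, sm, mul_sum]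
  exact sum_congr rfl fun _ _ => by ring

lemma Lr_mono (hf : ∀ i z, 0 ≤ f i z) (n : ℕ) {G H : Conf T → ℝ} (h : ∀ z, G z ≤ H z)
    (w : Conf T) : Lr V f e n G w ≤ Lr V f e n H w :=
  sum_le_sum fun _ _ =>
    mul_le_mul_of_nonneg_left (h _) (Finset.prod_nonneg fun i _ => hf i _)

lemma Lr_nonneg (hf : ∀ i z, 0 ≤ f i z) (n : ℕ) {G : Conf T → ℝ} (h : ∀ z, 0 ≤ G z)
    (w : Conf T) : 0 ≤ Lr V f e n G w :=
  sum_nonneg fun _ _ => mul_nonneg (Finset.prod_nonneg fun i _ => hf i _) (h _)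

lemma Lr_of_dep (n : ℕ) {G : Conf T → ℝ} (hG : Dep {l | l < e - n ∧ l ∉ V} G) (w : Conf T) :
    Lr V f e n G w = G w * Lr V f e n (fun _ => 1) w := by
  simp only [Lr]
  rw [← sm_mul]
  · exact congrArg (fun Q => sm _ Q w) (funext fun z => by ring)
  · exact fun ζ => hG _ _ fun i hi => ov_of_notMem fun h => hi.2 (Finset.mem_filter.1 h).1

lemma Lr_succ_of_notMem (n : ℕ) (h : e - n - 1 ∉ V) (G : Conf T → ℝ) :
    Lr V f e (n + 1) G = Lr V f e n G := by
  have : {i ∈ V | e - (n + 1 : ℕ) ≤ i} = {i ∈ V | e - n ≤ i} := Finset.filter_congr fun i hi => by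
    have : i ≠ e - n - 1 := fun h' => h (h' ▸ hi)
    omega
  funext w
  rw [Lr, Lr, this]

lemma Lr_succ_of_mem (hfd : ∀ i ∈ V, Dep {l | l ∈ V → i ≤ l} (f i)) (n : ℕ) (h : e - n - 1 ∈ V)
    (G : Conf T → ℝ) :
    Lr V f e (n + 1) G =
      Lr V f e n (sm {e - n - 1} fun z => f (e - n - 1) z * G z) := by
  set i := e - n - 1
  have hd : Disjoint {i ∈ V | e - n ≤ i} {i} := by
    simp only [Finset.disjoint_singleton_right, Finset.mem_filter, not_and]
    omega
  have hu : {i ∈ V | e - (n + 1 : ℕ) ≤ i} = {i ∈ V | e - n ≤ i} ∪ {i} := by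
    ext l
    simp only [Finset.mem_filter, Finset.mem_union, Finset.mem_singleton]
    constructor
    · rintro ⟨h1, h2⟩
      by_cases hl : l = i
      · exact Or.inr hl
      · exact Or.inl ⟨h1, by omega⟩
    · rintro (h1 | rfl)
      · exact ⟨h1.1, by omega⟩
      · exact ⟨h, by omega⟩
  funext w
  rw [Lr, Lr, hu, sm_union hd]
  refine congrArg (fun Q => sm _ Q w) (funext fun z => ?_)
  rw [← sm_mul (G := fun z => ∏ i ∈ V with e - n ≤ i, f i z)]
  · refine congrArg (fun Q => sm _ Q z) (funext fun z => ?_)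
    rw [Finset.prod_union hd, Finset.prod_singleton, mul_assoc]
  · refine fun ζ => Finset.prod_congr rfl fun l hl => ?_
    rw [Finset.mem_filter] at hl
    refine hfd l hl.1 _ _ fun j hj => ov_of_notMem fun hj' => ?_
    rw [Finset.mem_singleton] at hj'
    subst hj'
    have := hj h
    omega

/-- The configuration equal to `w` up to `t` and to `v` beyond. -/
def cut (t : ℤ) (w v : Conf T) : Conf T := fun l => if l ≤ t then w l else v l

/-- The infimum of a function given the coordinates up to `t`. -/
def infc (F : Conf T → ℝ) (t : ℤ) (w : Conf T) : ℝ := ⨅ w', F (cut t w w')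

lemma infc_le {F : Conf T → ℝ} (hF : ∀ z, 0 ≤ F z) (t : ℤ) (w w' : Conf T) :
    infc F t w ≤ F (cut t w w') := ciInf_le ⟨0, by rintro _ ⟨z, rfl⟩; exact hF _⟩ w'

lemma infc_le_self {F : Conf T → ℝ} (hF : ∀ z, 0 ≤ F z) (t : ℤ) (w : Conf T) :
    infc F t w ≤ F w := (infc_le hF t w w).trans_eq (congrArg F (funext fun l => ite_self _))

lemma infc_nonneg {F : Conf T → ℝ} (hF : ∀ z, 0 ≤ F z) (t : ℤ) (w : Conf T) : 0 ≤ infc F t w :=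
  Real.iInf_nonneg fun _ => hF _

lemma infc_mono {F : Conf T → ℝ} (hF : ∀ z, 0 ≤ F z) {s t : ℤ} (h : s ≤ t) (w : Conf T) :
    infc F s w ≤ infc F t w := le_ciInf fun w' => by
  refine (infc_le hF s w (cut t w w')).trans_eq (congrArg F (funext fun l => ?_))
  simp only [cut]
  split_ifs <;> first | rfl | omega

lemma Dep.infc {F : Conf T → ℝ} {I : Set ℤ} (h : Dep I F) (t : ℤ) : Dep (I ∩ Iic t) (infc F t) :=
  fun x y hxy => iInf_congr fun w' => h _ _ fun i hi => by
    simp only [cut]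
    split_ifs with hit
    · exact hxy i ⟨hi, hit⟩
    · rfl

lemma Dep.mul {F G : Conf T → ℝ} {I J : Set ℤ} (h : Dep I F) (h' : Dep J G) :
    Dep (I ∪ J) (fun z => F z * G z) := fun x y hxy => by
  simp only
  rw [h x y fun i hi => hxy i (Or.inl hi), h' x y fun i hi => hxy i (Or.inr hi)]

lemma uprod_pos {v : ℕ → ℝ} (hv : ∀ j, 0 < v j) (j : ℕ) : 0 < uprod v j :=
  Finset.prod_pos fun l _ => hv l

lemma uprod_antitone {v : ℕ → ℝ} (hv : ∀ j, 0 < v j) (hv1 : ∀ j, v j ≤ 1) :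
    Antitone (uprod v) := antitone_nat_of_succ_le fun j => by
  rw [uprod, Finset.prod_range_succ]
  exact mul_le_of_le_one_right (uprod_pos hv j).le (hv1 j)

lemma usum_mono {v : ℕ → ℝ} (hv : ∀ j, 0 < v j) : Monotone (usum v) :=
  monotone_nat_of_le_succ fun j => by
    rw [usum, usum, Finset.sum_range_succ]
    linarith [uprod_pos hv j]

/-- The renewal inequality: a change of the boundary condition beyond `e` has a controlled
effect on functions of the first `k` of `n` sites. -/
lemma renewal (hf : ∀ i z, 0 ≤ f i z) (hfd : ∀ i ∈ V, Dep {l | l ∈ V → i ≤ l} (f i))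
    {v : ℕ → ℝ} (hv : ∀ j, 0 < v j) (hv1 : ∀ j, v j ≤ 1)
    (hfv : ∀ i ∈ V, ∀ (j : ℕ) z z', (∀ l ≤ i + j, z l = z' l) → v j * f i z' ≤ f i z)
    {b b' : Conf T} (hb : ∀ i < e, i ∉ V → b i = b' i)
    (hsymm : ∀ n, Lr V f e n (fun _ => 1) b = Lr V f e n (fun _ => 1) b') (n : ℕ) :
    ∀ (k : ℕ) (G : Conf T → ℝ), (∀ z, 0 ≤ G z) → Dep {l | l < e - n + k ∧ (l ∈ V → e - n ≤ l)} G →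
      (usum v n - usum v k) * Lr V f e n G b' ≤ usum v n * Lr V f e n G b := by
  have hU0 : ∀ n, 0 ≤ usum v n := fun n => sum_nonneg fun j _ => (uprod_pos hv j).le
  have hUs : ∀ n, usum v (n + 1) = usum v n + uprod v n := fun n => Finset.sum_range_succ _ _
  induction n with
  | zero =>
    intro k G hG _
    have h1 := Lr_nonneg (V := V) (e := e) hf 0 hG b'
    have h2 := hU0 k
    simp only [usum, Finset.range_zero, Finset.sum_empty, zero_mul, zero_sub] at h2 ⊢
    nlinarith
  | succ n ih =>
    intro k G hG hGd
    rcases Nat.eq_zero_or_pos k with rfl | hk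
    · have hd : Dep {l | l < e - (n + 1 : ℕ) ∧ l ∉ V} G := hGd.mono fun l hl =>
        ⟨by have := hl.1; simp at *; omega, fun h => by have := hl.1; have := hl.2 h; omega⟩
      rw [Lr_of_dep _ hd, Lr_of_dep _ hd, hsymm, hd b b' fun i hi => hb i (by
        have := hi.1; omega) hi.2]
      simp [usum]
    have hLb := Lr_nonneg (V := V) (e := e) hf (n + 1) hG b
    have hLb' := Lr_nonneg (V := V) (e := e) hf (n + 1) hG b'
    rcases le_or_gt (n + 1) k with hkn | hkn
    · exact (mul_nonpos_of_nonpos_of_nonneg (sub_nonpos.2 (usum_mono hv hkn)) hLb').trans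
        (mul_nonneg (hU0 _) hLb)
    obtain ⟨k, rfl⟩ : ∃ k', k = k' + 1 := ⟨k - 1, by omega⟩
    by_cases hi : e - n - 1 ∈ V
    · set i := e - n - 1 with hi'
      set H : ℕ → Conf T → ℝ := fun j => sm {i} fun z => infc (f i) (i + j) z * G z with hH
      have hHmono : ∀ j z, H j z ≤ H (j + 1) z := fun j z => sum_le_sum fun ζ _ =>
        mul_le_mul_of_nonneg_right (infc_mono (hf i) (by push_cast; omega) _) (hG _)
      have hH0 : ∀ j z, 0 ≤ H j z := fun j z => sum_nonneg fun ζ _ =>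
        mul_nonneg (infc_nonneg (hf i) _ _) (hG _)
      have hHd : ∀ j, k ≤ j → Dep {l | l < e - n + j ∧ (l ∈ V → e - n ≤ l)} (H j) := by
        refine fun j hj => ((((hfd i hi).infc (i + j)).mul hGd).sm {i}).mono ?_
        rintro l ⟨hl, hli⟩
        have hli' : l ≠ i := fun h => hli (by simp [h])
        rcases hl with ⟨h1, h2⟩ | ⟨h1, h2⟩
        · exact ⟨by simp at h2; omega, fun h => by have := h1 h; omega⟩
        · exact ⟨by push_cast at h1; omega, fun h => by have := h2 h; push_cast at this; omega⟩
      have key : ∀ J, k ≤ J → (usum v n - usum v J) * Lr V f e n (H J) b' +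
          ∑ j ∈ Finset.Ico k J, uprod v j * Lr V f e n (H j) b' ≤
            usum v n * Lr V f e n (H J) b := by
        intro J hJ
        induction J, hJ using Nat.le_induction with
        | base => simpa using ih k (H k) (hH0 k) (hHd k le_rfl)
        | succ J hJ ihJ =>
          have h1 : ∀ b, Lr V f e n (H (J + 1)) b = Lr V f e n (H J) b +
              Lr V f e n (fun z => H (J + 1) z + -1 * H J z) b := fun b => by
            rw [Lr_add, Lr_const_mul]; ring
          have h2 := ih (J + 1) (fun z => H (J + 1) z + -1 * H J z)
            (fun z => by linarith [hHmono J z]) (by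
              intro x y hxy
              simp only
              rw [hHd (J + 1) (by omega) x y hxy, hHd J hJ x y fun l hl => hxy l
                ⟨by have := hl.1; push_cast; omega, hl.2⟩])
          rw [h1 b, Finset.sum_Ico_succ_top hJ, mul_add]
          have h3 := h1 b'
          rw [hUs] at h2 ⊢
          rw [h3]
          linarith
      have h1 := key n (by omega)
      rw [sub_self, zero_mul, zero_add] at h1
      have h2 : ∀ j, v j * Lr V f e (n + 1) G b' ≤ Lr V f e n (H j) b' := fun j => by
        rw [Lr_succ_of_mem hfd n hi, ← Lr_const_mul]
        refine Lr_mono hf n (fun z => ?_) b'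
        rw [sm, mul_sum]
        refine sum_le_sum fun ζ _ => ?_
        rw [← mul_assoc]
        refine mul_le_mul_of_nonneg_right (le_ciInf fun w' => hfv i hi j _ _ fun l hl => ?_) (hG _)
        simp only [cut, if_pos hl]
        rfl
      have h3 : Lr V f e n (H n) b ≤ Lr V f e (n + 1) G b := by
        rw [Lr_succ_of_mem hfd n hi]
        exact Lr_mono hf n (fun z => sum_le_sum fun ζ _ =>
          mul_le_mul_of_nonneg_right (infc_le_self (hf i) _ _) (hG _)) b
      have h4 : (usum v (n + 1) - usum v (k + 1)) * Lr V f e (n + 1) G b' ≤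
          ∑ j ∈ Finset.Ico k n, uprod v j * Lr V f e n (H j) b' := by
        rw [usum, usum, ← Finset.sum_Ico_eq_sub _ (by omega : k + 1 ≤ n + 1),
          ← Finset.sum_Ico_add' _ k n 1, sum_mul]
        refine sum_le_sum fun j _ => ?_
        rw [uprod, Finset.prod_range_succ, mul_assoc]
        exact mul_le_mul_of_nonneg_left (h2 j) (uprod_pos hv j).le
      calc _ ≤ usum v n * Lr V f e (n + 1) G b := h4.trans (h1.trans
            (mul_le_mul_of_nonneg_left h3 (hU0 n)))
        _ ≤ _ := mul_le_mul_of_nonneg_right (usum_mono hv (Nat.le_succ n)) hLb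
    · have h1 := ih k G hG (hGd.mono fun l hl => ⟨by have := hl.1; push_cast at this; omega,
        fun h => by
          have := hl.2 h
          have : l ≠ e - n - 1 := fun h' => hi (h' ▸ h)
          push_cast at *; omega⟩)
      rw [Lr_succ_of_notMem n hi] at *
      have h2 : uprod v n ≤ uprod v k := uprod_antitone hv hv1 (by omega)
      have h3 : usum v k ≤ usum v n := usum_mono hv (by omega)
      have h4 : usum v k * uprod v n ≤ usum v n * uprod v k :=
        mul_le_mul h3 h2 (uprod_pos hv n).le (hU0 n)
      have hn : 0 < usum v n := by
        have := usum_mono hv (by omega : 1 ≤ n)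
        simp [usum, uprod] at this ⊢
        linarith
      refine le_of_mul_le_mul_left ?_ hn
      calc usum v n * ((usum v (n + 1) - usum v (k + 1)) * Lr V f e n G b')
          ≤ usum v (n + 1) * ((usum v n - usum v k) * Lr V f e n G b') := by
            rw [← mul_assoc, ← mul_assoc]
            refine mul_le_mul_of_nonneg_right ?_ hLb'
            rw [hUs, hUs]
            linarith
        _ ≤ usum v (n + 1) * (usum v n * Lr V f e n G b) := mul_le_mul_of_nonneg_left h1 (hU0 _)
        _ = _ := by ring

/-- The partial products of a sequence with `v j ≥ exp (-2 (β / (j + 1) + a (j + 1)))` and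
`β < 1 / 2` decay slower than `1 / n`. -/
lemma usum_le {β : ℝ} (hβ : β < 1 / 2) {a v : ℕ → ℝ} (ha : ∀ n, 0 ≤ a n) (hs : Summable a)
    (hv0 : ∀ j, 0 < v j)
    (hv : ∀ j : ℕ, exp (-(2 * (β / (j + 1 : ℕ) + a (j + 1)))) ≤ v j) (d : ℕ) :
    usum v d ≤ exp (2 * ∑' i, a i) / (1 - 2 * β) * d * uprod v d := by
  have hβ' : 0 < 1 - 2 * β := by linarith
  have h : usum v d ≤ exp (2 * ∑ i ∈ Finset.range (d + 1), a i) / (1 - 2 * β) * d *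
      uprod v d := by
    induction d with
    | zero => simp [usum]
    | succ d ih =>
      rw [usum, Finset.sum_range_succ, ← usum, Finset.sum_range_succ a (d + 1), mul_add,
        exp_add, show uprod v (d + 1) = uprod v d * v d from Finset.prod_range_succ _ _]
      set E := exp (2 * ∑ i ∈ Finset.range (d + 1), a i)
      have hE : 1 ≤ E := Real.one_le_exp (mul_nonneg zero_le_two (sum_nonneg fun i _ => ha i))
      have hu := uprod_pos hv0 d
      have hd : (0 : ℝ) < (d + 1 : ℕ) := by positivity
      have h1 : E / (1 - 2 * β) * d + 1 ≤ E / (1 - 2 * β) * (d + 1 : ℕ) * (1 - 2 * β / (d + 1 : ℕ)) := by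
        rw [mul_sub, mul_one, mul_assoc _ ((d + 1 : ℕ) : ℝ) (2 * β / _), mul_div_cancel₀ _ hd.ne']
        have : 1 ≤ E / (1 - 2 * β) * (1 - 2 * β) := by rwa [div_mul_cancel₀ _ hβ'.ne']
        push_cast
        linarith
      have h2 : 1 - 2 * β / (d + 1 : ℕ) ≤ exp (2 * a (d + 1)) * v d := by
        have h3 := Real.add_one_le_exp (-(2 * β / (d + 1 : ℕ)))
        have h4 := mul_le_mul_of_nonneg_left (hv d) (exp_pos (2 * a (d + 1))).le
        rw [← exp_add] at h4
        have : 2 * a (d + 1) + -(2 * (β / (d + 1 : ℕ) + a (d + 1))) = -(2 * β / (d + 1 : ℕ)) := by ring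
        rw [this] at h4
        linarith
      calc usum v d + uprod v d ≤ (E / (1 - 2 * β) * d + 1) * uprod v d := by linarith
        _ ≤ E / (1 - 2 * β) * (d + 1 : ℕ) * (exp (2 * a (d + 1)) * v d) * uprod v d := by
            refine mul_le_mul_of_nonneg_right (h1.trans (mul_le_mul_of_nonneg_left h2 ?_)) hu.le
            positivity
        _ = _ := by ring
  refine h.trans ?_
  have := hs.sum_le_tsum (Finset.range (d + 1)) fun i _ => ha i
  have hu := uprod_pos hv0 d
  gcongr

/-- Under the hypotheses of `usum_le`, the first two thirds of the sums do not exhaust them. -/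
lemma usum_sub_ge {C : ℝ} (hC : 0 < C) {v : ℕ → ℝ} (hv0 : ∀ j, 0 < v j) (hv1 : ∀ j, v j ≤ 1)
    {k d : ℕ} (h : usum v d ≤ C * d * uprod v d) (hk : 3 * k ≤ 2 * d) :
    (3 * C)⁻¹ * usum v d ≤ usum v d - usum v k := by
  have h1 : ((d - k : ℕ) : ℝ) * uprod v d ≤ usum v d - usum v k := by
    rw [usum, usum, ← Finset.sum_Ico_eq_sub _ (by omega : k ≤ d), ← Nat.card_Ico, ← nsmul_eq_mul]
    exact Finset.card_nsmul_le_sum _ _ _ fun j hj =>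
      uprod_antitone hv0 hv1 (Finset.mem_Ico.1 hj).2.le
  have h2 : (d : ℝ) ≤ 3 * (d - k : ℕ) := by exact_mod_cast (by omega : d ≤ 3 * (d - k))
  refine le_trans ?_ h1
  rw [inv_mul_le_iff₀ (by positivity)]
  have hu := uprod_pos hv0 d
  calc usum v d ≤ C * d * uprod v d := h
    _ ≤ C * (3 * (d - k : ℕ)) * uprod v d := by gcongr
    _ = _ := by ring

end Renewal

/-! ### Comparison of boundary conditions on the right -/

lemma sm_pair (U : Finset ℤ) (Q R : Conf A → ℝ) (w : Conf (A × A)) :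
    sm U (fun w => Q (fstc w) * R (sndc w)) w = sm U Q (fstc w) * sm U R (sndc w) := by
  rw [sm, sm, sm, Finset.sum_mul_sum, ← Fintype.sum_prod_type']
  refine Fintype.sum_equiv (Equiv.arrowProdEquivProdArrow _ _ _) _ _ fun ζ => ?_
  have h1 : fstc (ov w U ζ) = ov (fstc w) U (fun i => (ζ i).1) := funext fun i => by
    simp only [fstc, ov]; split_ifs <;> rfl
  have h2 : sndc (ov w U ζ) = ov (sndc w) U (fun i => (ζ i).2) := funext fun i => by
    simp only [sndc, ov]; split_ifs <;> rfl
  rw [h1, h2]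
  rfl

lemma Dep.indicator {I : Set ℤ} {s : Set (Conf A)} (hd : Dep I (· ∈ s)) :
    Dep I (s.indicator fun _ => (1 : ℝ)) := fun x y hxy => by
  have h : x ∈ s ↔ y ∈ s := iff_of_eq (hd x y hxy)
  by_cases hx : x ∈ s
  · rw [indicator_of_mem hx, indicator_of_mem (h.1 hx)]
  · rw [indicator_of_notMem hx, indicator_of_notMem (mt h.2 hx)]

lemma dep_cylEvent (U : Finset ℤ) (η : U → A) : Dep (U : Set ℤ) (· ∈ cylEvent U η) :=
  fun _ _ h => propext (forall_congr' fun i => by rw [h i i.2])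

namespace Potential

variable (P : Potential A)

/-- The finite sets through `i` whose intersection with `V` has minimum `i`. -/
def minAt (V : Finset ℤ) (i : ℤ) : Set (Finset ℤ) := {K | i ∈ K ∧ ∀ l ∈ K, l ∈ V → i ≤ l}

/-- The factor of the Boltzmann weight attributed to the site `i`. -/
def bfac (V : Finset ℤ) (i : ℤ) (z : Conf A) : ℝ := exp (-P.en (minAt V i) z)

variable {P}

lemma minAt_subset (V : Finset ℤ) (i : ℤ) : minAt V i ⊆ Hit (({i} : Finset ℤ) : Set ℤ) :=
  fun _ hK => ⟨i, hK.1, by simp⟩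

lemma bw_eq_prod (hs : NormSummable P) (V : Finset ℤ) (z : Conf A) :
    P.bw V z = ∏ i ∈ V, P.bfac V i z := by
  simp only [bfac]
  rw [← Real.exp_sum, Finset.sum_neg_distrib, bw, hPot_eq]
  congr 2
  simp only [en]
  rw [← Summable.tsum_finsetSum fun i _ => summable_en hs (minAt_subset V i) z]
  refine tsum_congr fun K => ?_
  by_cases hK : K ∈ Hit (V : Set ℤ)
  · have hne : (K ∩ V).Nonempty := by
      obtain ⟨i, hi, hV⟩ := hK
      exact ⟨i, Finset.mem_inter.2 ⟨hi, hV⟩⟩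
    have hm := Finset.mem_inter.1 ((K ∩ V).min'_mem hne)
    rw [indicator_of_mem hK, Finset.sum_eq_single_of_mem _ hm.2, indicator_of_mem]
    · exact ⟨hm.1, fun l hl hV => (K ∩ V).min'_le l (Finset.mem_inter.2 ⟨hl, hV⟩)⟩
    · intro i hi hne'
      refine indicator_of_notMem (fun h => hne' (le_antisymm (h.2 _ hm.1 hm.2) ?_)) _
      exact (K ∩ V).min'_le i (Finset.mem_inter.2 ⟨h.1, hi⟩)
  · rw [indicator_of_notMem hK]
    exact (sum_eq_zero fun i hi => indicator_of_notMem (fun h => hK ⟨i, h.1, hi⟩) _).symm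

lemma bfac_pos (V : Finset ℤ) (i : ℤ) (z : Conf A) : 0 < P.bfac V i z := exp_pos _

lemma dep_bfac (V : Finset ℤ) (i : ℤ) : Dep {l | l ∈ V → i ≤ l} (P.bfac V i) := fun x y h =>
  congrArg (fun t => exp (-t)) (en_congr (empty_notMem_hit (minAt_subset V i))
    fun _ hK l hl => h l (hK.2 l hl))

lemma bfac_le (hs : NormSummable P) (V : Finset ℤ) (i : ℤ) (j : ℕ) {z z' : Conf A}
    (h : ∀ l ≤ i + j, z l = z' l) :
    exp (-varTail P (j + 1)) * P.bfac V i z' ≤ P.bfac V i z := by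
  have h1 : |P.en (minAt V i) z - P.en (minAt V i) z'| ≤ varTail P (j + 1) := by
    refine en_sub_le hs (minAt_subset V i) (varTail_nonneg _) ?_
    rw [← tail_eq hs, ← P.transInv_pv.tail i]
    refine wt_mono fun K hK => ?_
    obtain ⟨h1, l, hl, hne⟩ := hK
    refine ⟨h1.1, l, hl, ?_⟩
    by_contra hc
    exact hne (h l (by push_cast at hc; omega))
  rw [bfac, bfac, ← exp_add]
  exact Real.exp_le_exp.2 (by linarith [(abs_le.1 h1).2])

variable (P) in
/-- Boundary conditions differing only on the right of a volume are comparable on its first part. -/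
def RightComp (c : ℝ) : Prop :=
  ∀ (V : Finset ℤ) (e : ℤ) (d k : ℕ) (x y : Conf A) (F : Conf A → ℝ),
    0 < d → (∀ i ∈ V, e - d ≤ i ∧ i < e) → 3 * k ≤ 2 * d → (∀ i < e, i ∉ V → x i = y i) →
    (∀ z, 0 ≤ F z) → Dep (Iio (e - d + k)) F → c * P.gm V F y ≤ P.gm V F x

lemma exists_right_comparison (hs : NormSummable P) {β : ℝ} (hβ : β < 1 / 2) {a : ℕ → ℝ}
    (ha : ∀ n, 0 ≤ a n) (hsum : Summable a)
    (hr : ∀ n : ℕ, 1 ≤ n → varTail P n ≤ β / n + a n) :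
    ∃ c : ℝ, 0 < c ∧ P.RightComp c := by
  have hβ' : 0 < 1 - 2 * β := by linarith
  set C := exp (2 * ∑' i, a i) / (1 - 2 * β) with hC
  have hC0 : 0 < C := div_pos (exp_pos _) hβ'
  refine ⟨(3 * C)⁻¹, by positivity, fun V e d k x y F hd hV hk hxy hF hFd => ?_⟩
  set v : ℕ → ℝ := fun j => exp (-(2 * varTail P (j + 1))) with hv
  have hv0 : ∀ j, 0 < v j := fun j => exp_pos _
  have hv1 : ∀ j, v j ≤ 1 := fun j => by
    rw [hv, Real.exp_le_one_iff]
    linarith [varTail_nonneg (P := P) (j + 1)]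
  have hu := usum_le hβ ha hsum hv0
    (fun j => Real.exp_le_exp.2 (by linarith [hr (j + 1) (by omega)])) d
  have hud := usum_sub_ge hC0 hv0 hv1 hu hk
  set f : ℤ → Conf (A × A) → ℝ := fun i w => P.bfac V i (fstc w) * P.bfac V i (sndc w) with hf
  have hprod : ∀ (U : Finset ℤ) (F : Conf A → ℝ) (x y : Conf A),
      sm U (fun w => (∏ i ∈ U, f i w) * F (fstc w)) (zipc x y) =
        sm U (fun z => (∏ i ∈ U, P.bfac V i z) * F z) x * sm U (fun z => ∏ i ∈ U, P.bfac V i z) y := by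
    intro U F x y
    refine Eq.trans (congrArg (fun Q => sm U Q _) (funext fun w => ?_))
      (sm_pair U (fun z => (∏ i ∈ U, P.bfac V i z) * F z) (fun z => ∏ i ∈ U, P.bfac V i z) _)
    rw [hf, Finset.prod_mul_distrib]
    ring
  have hR := renewal (V := V) (f := f) (e := e) (b := zipc x y) (b' := zipc y x)
    (fun i z => mul_nonneg (bfac_pos _ _ _).le (bfac_pos _ _ _).le) (fun i _ z z' h => by
      rw [hf]
      simp only
      rw [dep_bfac V i (fstc z) (fstc z') fun l hl => congrArg Prod.fst (h l hl),
        dep_bfac V i (sndc z) (sndc z') fun l hl => congrArg Prod.snd (h l hl)]) hv0 hv1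
    (fun i _ j z z' h => by
      have h1 := bfac_le hs V i j (z := fstc z) (z' := fstc z') fun l hl => congrArg Prod.fst (h l hl)
      have h2 := bfac_le hs V i j (z := sndc z) (z' := sndc z') fun l hl => congrArg Prod.snd (h l hl)
      refine le_trans (le_of_eq ?_) (mul_le_mul h1 h2
        (mul_nonneg (exp_pos _).le (bfac_pos _ _ _).le) (bfac_pos _ _ _).le)
      simp only [hv, hf]
      rw [two_mul, neg_add, exp_add]
      ring)
    (fun i hi hiV => Prod.ext (hxy i hi hiV) (hxy i hi hiV).symm)
    (fun n => by
      rw [Lr, Lr, hprod _ (fun _ => 1), hprod _ (fun _ => 1)]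
      simp only [mul_one]
      exact mul_comm _ _) d k (fun w => F (fstc w)) (fun w => hF _)
    (fun z z' h => hFd _ _ fun l hl => congrArg Prod.fst (h l ⟨hl, fun hlV => (hV l hlV).1⟩))
  have hVd : {i ∈ V | e - d ≤ i} = V := Finset.filter_true_of_mem fun i hi => (hV i hi).1
  rw [Lr, Lr, hVd, hprod, hprod] at hR
  simp only [← bw_eq_prod hs] at hR
  have hx := sm_bw_pos (P := P) V x
  have hy := sm_bw_pos (P := P) V y
  have hU : 0 < usum v d := by
    refine lt_of_lt_of_le ?_ (usum_mono hv0 (Nat.one_le_iff_ne_zero.2 hd.ne'))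
    simp [usum, uprod]
  have hFy : 0 ≤ sm V (fun z => P.bw V z * F z) y :=
    sum_nonneg fun _ _ => mul_nonneg (bw_pos _ _).le (hF _)
  have h1 := (mul_le_mul_of_nonneg_right hud (mul_nonneg hFy hx.le)).trans hR
  rw [gm, gm, ← mul_div_assoc, div_le_div_iff₀ hy hx]
  refine le_of_mul_le_mul_left ?_ hU
  linarith

/-! ### Comparison of boundary conditions on both sides -/

lemma gm_sub_le {V : Finset ℤ} {x y : Conf A} {F : Conf A → ℝ} {c : ℝ}
    (h : ∀ ζ ζ', F (ov x V ζ) - F (ov y V ζ') ≤ c) : P.gm V F x - P.gm V F y ≤ c := by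
  have h1 : ∀ ζ', P.gm V F x ≤ c + F (ov y V ζ') := fun ζ' =>
    (gm_mono fun ζ => by linarith [h ζ ζ']).trans_eq (gm_const V (c + F (ov y V ζ')) x)
  have h2 := gm_mono (P := P) (V := V) (x := y) (F := fun _ => P.gm V F x - c) (G := F)
    fun ζ' => by linarith [h1 ζ']
  rw [gm_const] at h2
  linarith

/-- The averages of a function with values in `[0, 1]` are controlled by the energy difference. -/
lemma gm_sub_le_energy (hs : NormSummable P) {V : Finset ℤ} {x y : Conf A} {F : Conf A → ℝ}
    (hF : ∀ z, F z ∈ Icc (0 : ℝ) 1) (hxy : ∀ ζ, F (ov x V ζ) = F (ov y V ζ)) {e : ℝ} (he : 0 ≤ e)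
    (h : wt P.pv {K | K ∈ Hit (V : Set ℤ) ∧ ∃ i ∈ K, i ∉ V ∧ x i ≠ y i} ≤ ENNReal.ofReal e) :
    P.gm V F y - P.gm V F x ≤ 2 * e := by
  have h1 := gm_comparison hs (fun ζ => (hF _).1) hxy he h
  have h2 := gm_mem_Icc (P := P) (V := V) (x := y) (fun ζ => hF (ov y V ζ))
  have h3 := Real.add_one_le_exp (-(2 * e))
  nlinarith [h2.1, h2.2]

lemma ofReal_nat_mul_tail (hs : NormSummable P) {C : ℝ} (hC : ∀ n : ℕ, 1 ≤ n → varTail P n ≤ C / n)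
    {m n : ℕ} {b : ℝ} (hn : 1 ≤ n) (h : m * C ≤ b * n) :
    (m : ℝ≥0∞) * tailW P.pv n ≤ ENNReal.ofReal b := by
  rw [tail_eq hs, ← ENNReal.ofReal_natCast, ← ENNReal.ofReal_mul (Nat.cast_nonneg m)]
  refine ENNReal.ofReal_le_ofReal ((mul_le_mul_of_nonneg_left (hC n hn) (Nat.cast_nonneg m)).trans ?_)
  rw [← mul_div_assoc, div_le_iff₀ (by exact_mod_cast hn)]
  exact h

lemma indicator_cylEvent_mem (U : Finset ℤ) (η : U → A) (z : Conf A) :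
    (cylEvent U η).indicator (fun _ => (1 : ℝ)) z ∈ Icc (0 : ℝ) 1 :=
  ⟨indicator_nonneg (fun _ _ => zero_le_one) _, indicator_le_self' (fun _ _ => zero_le_one) _⟩

/-- Decorrelation of the left part of a volume from its centre, given the boundary condition. -/
lemma RightComp.decorrelation (hs : NormSummable P) {c : ℝ} (hR : P.RightComp c) (hc : 0 < c)
    {V : Finset ℤ} {t : ℤ} {M : ℕ} (hM : 1 ≤ M) (hV : ∀ i ∈ V, t - 4 * M ≤ i) {F : Conf A → ℝ}
    (hF : ∀ z, 0 ≤ F z) (hFd : Dep (Icc (t - M) (t + M)) F) (y : Conf A) :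
    c * P.gm V F y ≤ P.gm {i ∈ V | t - 3 * M < i} F y := by
  set B := {i ∈ V | t - 3 * M < i}
  set U := {i ∈ V | i ≤ t - 3 * M}
  set V₀ := {i ∈ V | i < t - M}
  set f : Conf A → ℝ := (cylEvent U fun i => y i).indicator fun _ => 1 with hf
  have hf0 : ∀ z, 0 ≤ f z := fun z => (indicator_cylEvent_mem U _ z).1
  have hUd : Dep (U : Set ℤ) f := (dep_cylEvent U _).indicator
  have hU : ∀ i ∈ U, i ∈ V ∧ i ≤ t - 3 * M := fun i hi => Finset.mem_filter.1 hi
  have hB : B ⊆ V := Finset.filter_subset _ _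
  have h1 : ∀ z : Conf A, (∀ i ∉ V, z i = y i) → c * P.gm V f y ≤ P.gm V₀ f z := by
    intro z hz
    have h2 : ∀ ζ, P.gm V₀ f (ov y V ζ) ≤ c⁻¹ * P.gm V₀ f z := fun ζ => by
      rw [le_inv_mul_iff₀ hc]
      refine hR V₀ (t - M) (3 * M) (M + 1) z _ f (by omega) (fun i hi => ?_) (by omega)
        (fun i hi hiV => ?_) hf0 (hUd.mono fun i hi => ?_)
      · have := Finset.mem_filter.1 hi
        have := hV i this.1
        push_cast
        omega
      · have : i ∉ V := fun h => hiV (Finset.mem_filter.2 ⟨h, hi⟩)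
        rw [ov_of_notMem this, hz i this]
      · have := (hU i hi).2
        simp only [mem_Iio]
        push_cast
        omega
    rw [← gm_gm hs (Finset.filter_subset _ V : V₀ ⊆ V), ← le_inv_mul_iff₀ hc]
    exact (gm_mono h2).trans_eq (gm_const V _ y)
  have h2 : P.gm V (fun z => F z * f z) y = P.gm V (fun z => F z * P.gm V₀ f z) y := by
    rw [← gm_gm hs (Finset.filter_subset _ V : V₀ ⊆ V)]
    congr 1
    funext z
    refine gm_mul (fun ζ => hFd _ _ fun i hi => ov_of_notMem fun h => ?_) f
    have := (Finset.mem_filter.1 h).2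
    have := hi.1
    omega
  have h3 : c * P.gm V f y * P.gm V F y ≤ P.gm V (fun z => F z * f z) y := by
    rw [h2, ← gm_const_mul]
    refine gm_mono fun ζ => ?_
    rw [mul_comm (F _)]
    exact mul_le_mul_of_nonneg_right (h1 _ fun i hi => ov_of_notMem hi) (hF _)
  have h4 : P.gm V (fun z => F z * f z) y = P.gm B F y * P.gm V f y := by
    rw [← gm_gm hs hB, ← gm_const_mul]
    have h5 : P.gm B (fun z => F z * f z) = fun z => f z * P.gm B F z := funext fun z => by
      simp only [mul_comm (F _)]
      refine gm_mul (fun ζ => hUd _ _ fun i hi => ov_of_notMem fun h => ?_) F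
      have := (Finset.mem_filter.1 h).2
      have := (hU i hi).2
      omega
    rw [h5]
    refine le_antisymm (gm_mono fun ζ => le_of_eq ?_) (gm_mono fun ζ => ge_of_eq ?_) <;>
    · by_cases hz : ov y V ζ ∈ cylEvent U fun i => y i
      · rw [mul_comm, gm_congr (x := ov y V ζ) (y := y)]
        intro i hi
        by_cases hiV : i ∈ V
        · have hiU : i ∈ U := Finset.mem_filter.2 ⟨hiV, by
            by_contra hc'
            exact hi (Finset.mem_filter.2 ⟨hiV, by omega⟩)⟩
          exact hz ⟨i, hiU⟩
        · exact ov_of_notMem hiV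
      · simp only [hf, indicator_of_notMem hz, zero_mul, mul_zero]
  have h5 : 0 < P.gm V f y := by
    rw [gm_eq_sum]
    refine Finset.sum_pos' (fun ζ _ => mul_nonneg (potPhi_pos _ _).le (hf0 _))
      ⟨fun i => y i, Finset.mem_univ _, mul_pos (potPhi_pos _ _) ?_⟩
    rw [ov_self, hf, indicator_of_mem (show y ∈ cylEvent U fun i => y i from fun i => rfl)]
    exact zero_lt_one
  rw [h4, mul_right_comm] at h3
  exact le_of_mul_le_mul_right h3 h5

/-- Comparison of boundary conditions for functions of the centre of a volume. -/
lemma RightComp.two_sided (hs : NormSummable P) {c : ℝ} (hR : P.RightComp c) (hc : 0 < c) {C : ℝ}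
    (hC0 : 0 ≤ C) (hC : ∀ n : ℕ, 1 ≤ n → varTail P n ≤ C / n)
    {V : Finset ℤ} {t : ℤ} {M : ℕ} (hM : 1 ≤ M) (hV : ∀ i ∈ V, t - 4 * M ≤ i ∧ i ≤ t + 4 * M)
    {x y : Conf A} (hxy : ∀ i, t - 4 * M ≤ i → i ≤ t + 4 * M → i ∉ V → x i = y i)
    {F : Conf A → ℝ} (hF : ∀ z, 0 ≤ F z) (hFd : Dep (Icc (t - M) (t + M)) F) :
    c * (exp (-(30 * C)) * c) * P.gm V F y ≤ P.gm V F x := by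
  set z : Conf A := cut (t + 4 * M) x y with hz
  have h1 : c * P.gm V F z ≤ P.gm V F x := by
    refine hR V (t + 4 * M + 1) (8 * M + 1) (5 * M + 1) x z F (by omega) (fun i hi => ?_) (by omega)
      (fun i hi _ => ?_) hF (hFd.mono fun i hi => ?_)
    · have := hV i hi
      push_cast
      omega
    · simp only [hz, cut, if_pos (by omega : i ≤ t + 4 * M)]
    · have := hi.2
      simp only [mem_Iio]
      push_cast
      omega
  have hzy : ∀ i, t - 4 * M ≤ i → i ∉ V → z i = y i := fun i hi hiV => by
    simp only [hz, cut]
    split_ifs with h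
    · exact hxy i hi h hiV
    · rfl
  set B := {i ∈ V | t - 3 * M < i}
  have hB : B ⊆ V := Finset.filter_subset _ _
  have h2 : ∀ ζ, exp (-(30 * C)) * c * P.gm V F y ≤ P.gm B F (ov z V ζ) := fun ζ => by
    have h3 := hR.decorrelation hs hc hM (fun i hi => (hV i hi).1) hF hFd (ov y V ζ)
    rw [gm_ov] at h3
    have h4 : exp (-(2 * (15 * C))) * P.gm B F (ov y V ζ) ≤ P.gm B F (ov z V ζ) := by
      refine gm_comparison hs (fun _ => hF _) (fun η => hFd _ _ fun i hi => ?_) (by positivity) ?_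
      · by_cases hiB : i ∈ B
        · rw [ov_of_mem hiB, ov_of_mem hiB]
        · rw [ov_of_notMem hiB, ov_of_notMem hiB]
          by_cases hiV : i ∈ V
          · rw [ov_of_mem hiV, ov_of_mem hiV]
          · rw [ov_of_notMem hiV, ov_of_notMem hiV, hzy i (by have := hi.1; omega) hiV]
      · refine (wt_mono fun K hK => ?_).trans
          ((P.transInv_pv.left_le (t - 3 * M + 1) (t + 4 * M) (M + 2) M).trans ?_)
        · obtain ⟨⟨j, hj, hjB⟩, i, hi, hiB, hne⟩ := hK
          have hjB' := Finset.mem_filter.1 hjB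
          have hiV : i ∉ V := fun h => hne (by rw [ov_of_mem h, ov_of_mem h])
          rw [ov_of_notMem hiV, ov_of_notMem hiV] at hne
          refine ⟨⟨j, hj, by omega, (hV j hjB'.1).2⟩, i, hi, ?_⟩
          by_contra hc'
          simp only [mem_Iic, Nat.cast_add, Nat.cast_ofNat] at hc'
          exact hne (hzy i (by omega) hiV)
        · rw [show 15 * C = 7 * C + 8 * C by ring, ENNReal.ofReal_add (by positivity) (by positivity)]
          have e1 : (t + 4 * M + 1 - (t - 3 * M + 1)).toNat = 7 * M := by omega
          have e2 : (t + 4 * M + M - (t - 3 * M + 1)).toNat ≤ 8 * M := by omega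
          rw [e1]
          have hM' : (0 : ℝ) ≤ M := Nat.cast_nonneg M
          refine add_le_add (ofReal_nat_mul_tail hs hC hM (by push_cast; linarith))
            (ofReal_nat_mul_tail hs hC (by omega) ?_)
          have e3 : ((t + 4 * M + M - (t - 3 * M + 1)).toNat : ℝ) ≤ 8 * M := by exact_mod_cast e2
          push_cast
          nlinarith
    calc _ = exp (-(2 * (15 * C))) * (c * P.gm V F y) := by ring_nf
      _ ≤ exp (-(2 * (15 * C))) * P.gm B F (ov y V ζ) :=
          mul_le_mul_of_nonneg_left h3 (exp_pos _).le
      _ ≤ _ := h4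
  have h3 : exp (-(30 * C)) * c * P.gm V F y ≤ P.gm V F z := by
    rw [← gm_gm hs hB F z]
    exact (gm_const V _ z).symm.trans_le (gm_mono h2)
  calc _ = c * (exp (-(30 * C)) * c * P.gm V F y) := by ring
    _ ≤ c * P.gm V F z := mul_le_mul_of_nonneg_left h3 hc.le
    _ ≤ _ := h1

/-! ### Decay of the influence of the boundary condition on one coordinate -/

variable (P) in
/-- Boundary conditions agreeing within distance `N` of `t` have influence at most `δ` at `t`. -/
def IsInfl (N : ℕ) (δ : ℝ) : Prop :=
  ∀ (t : ℤ) (V : Finset ℤ) (x y : Conf A) (F : Conf A → ℝ),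
    (∀ i, t - N ≤ i → i ≤ t + N → i ∉ V → x i = y i) → Dep {t} F → (∀ z, F z ∈ Icc (0 : ℝ) 1) →
    P.gm V F x - P.gm V F y ≤ δ

lemma isInfl_one (N : ℕ) : P.IsInfl N 1 := fun _ V x y _ _ _ hF => by
  have h1 := (gm_mem_Icc (P := P) fun ζ => hF (ov x V ζ)).2
  have h2 := (gm_mem_Icc (P := P) fun ζ => hF (ov y V ζ)).1
  linarith

variable (P) in
/-- The influence on a coordinate of the boundary condition at distance more than `N`. -/
def infl (N : ℕ) : ℝ := sInf {δ | 0 ≤ δ ∧ P.IsInfl N δ}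

lemma infl_nonneg (N : ℕ) : 0 ≤ P.infl N := Real.sInf_nonneg fun _ h => h.1

lemma infl_le {N : ℕ} {δ : ℝ} (h0 : 0 ≤ δ) (h : P.IsInfl N δ) : P.infl N ≤ δ :=
  csInf_le ⟨0, fun _ h => h.1⟩ ⟨h0, h⟩

lemma isInfl_infl (N : ℕ) : P.IsInfl N (P.infl N) := fun t V x y F hxy hFd hF =>
  le_csInf ⟨1, zero_le_one, isInfl_one N⟩ fun _ h => h.2 t V x y F hxy hFd hF

lemma infl_antitone : Antitone P.infl := fun M N h =>
  infl_le (infl_nonneg M) fun t V x y F hxy hFd hF => by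
    have h' : (M : ℤ) ≤ N := by exact_mod_cast h
    exact isInfl_infl M t V x y F (fun i hi hi' => hxy i (by omega) (by omega)) hFd hF

variable (P) in
/-- Boundary conditions agreeing near a volume are comparable at its centre. -/
def CentreComp (c : ℝ) : Prop :=
  ∀ (V : Finset ℤ) (t : ℤ) (M : ℕ) (x y : Conf A) (F : Conf A → ℝ), 1 ≤ M →
    (∀ i ∈ V, t - 4 * M ≤ i ∧ i ≤ t + 4 * M) →
    (∀ i, t - 4 * M ≤ i → i ≤ t + 4 * M → i ∉ V → x i = y i) →
    (∀ z, 0 ≤ F z) → Dep (Icc (t - M) (t + M)) F → c * P.gm V F y ≤ P.gm V F x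

lemma CentreComp.le_one {c : ℝ} (h : P.CentreComp c) : c ≤ 1 := by
  obtain ⟨x⟩ : Nonempty (Conf A) := inferInstance
  have := h ∅ 0 1 x x (fun _ => 1) le_rfl (by simp) (fun _ _ _ _ => rfl) (fun _ => zero_le_one)
    (fun _ _ _ => rfl)
  rwa [gm_const, mul_one] at this

/-- The effect of changing the configuration far away on the average of a local function. -/
lemma gm_sub_le_of_far (hs : NormSummable P) {C : ℝ} (hC0 : 0 ≤ C)
    (hC : ∀ n : ℕ, 1 ≤ n → varTail P n ≤ C / n) {W : Finset ℤ} {t : ℤ} {N s : ℕ} (hN : 1 ≤ N)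
    (h2 : 2 ≤ s) (hW : ∀ i ∈ W, t - N ≤ i ∧ i ≤ t + N) {F : Conf A → ℝ}
    (hF : ∀ z, F z ∈ Icc (0 : ℝ) 1) (hFd : Dep {t} F) {z z' : Conf A}
    (hz : ∀ i, t - (s ^ 2 * N : ℕ) ≤ i → i ≤ t + (s ^ 2 * N : ℕ) → z i = z' i) :
    P.gm W F z - P.gm W F z' ≤ 18 * C / s := by
  have hs0 : (2 : ℝ) ≤ s := by exact_mod_cast h2
  have hN0 : (1 : ℝ) ≤ N := by exact_mod_cast hN
  obtain ⟨n, hn⟩ : ∃ n : ℕ, n = s ^ 2 * N - N + 1 := ⟨_, rfl⟩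
  have hle : N ≤ s ^ 2 * N := Nat.le_mul_of_pos_left _ (by positivity)
  have hn' : (n : ℝ) = s ^ 2 * N - N + 1 := by rw [hn]; push_cast [hle]; ring
  have hnZ : (n : ℤ) = (s ^ 2 * N : ℕ) - N + 1 := by omega
  have hn3 : (3 / 4 : ℝ) * s ^ 2 * N ≤ n := by
    rw [hn']
    have : (4 : ℝ) ≤ s ^ 2 := by nlinarith
    nlinarith
  have hss : (2 : ℝ) * s * N ≤ s ^ 2 * N := by
    rw [sq]; gcongr
  have hn4 : (3 / 2 : ℝ) * (s * N) ≤ n := by linarith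
  have hsN : (2 : ℝ) ≤ s * N := by nlinarith
  have hz' : ∀ i, t - (s ^ 2 * N : ℕ) ≤ i → i ≤ t + (s ^ 2 * N : ℕ) → z' i = z i :=
    fun i h h' => (hz i h h').symm
  have key := gm_sub_le_energy (P := P) (V := W) (x := z') (y := z) (e := 9 * C / s) hs hF
    (fun ζ => hFd _ _ fun i hi => ?_) (by positivity) ?_
  · exact key.trans_eq (by ring)
  · obtain rfl : i = t := hi
    by_cases h : i ∈ W
    · rw [ov_of_mem h, ov_of_mem h]
    · rw [ov_of_notMem h, ov_of_notMem h, hz' i (by omega) (by omega)]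
  · refine (wt_union_le (R := Hit (Icc (t - N) (t + N)) ∩ Hit (Ici (t + N + n)))
      (T := Hit (Icc (t - N) (t + N)) ∩ Hit (Iic (t - N - n))) fun K hK => ?_).trans
      ((add_le_add (P.transInv_pv.right_le (t - N) (t + N) n)
        (P.transInv_pv.left_le (t - N) (t + N) n (s * N))).trans ?_)
    · obtain ⟨⟨j, hj, hjW⟩, i, hi, -, hne⟩ := hK
      have h1 : K ∈ Hit (Icc (t - N) (t + N)) := ⟨j, hj, hW j hjW⟩
      by_cases h : t - (s ^ 2 * N : ℕ) ≤ i
      · refine Or.inl ⟨h1, i, hi, ?_⟩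
        by_contra hc
        simp only [mem_Ici] at hc
        exact hne (hz' i h (by omega))
      · refine Or.inr ⟨h1, i, hi, ?_⟩
        simp only [mem_Iic]
        omega
    · have e1 : (t + N + 1 - (t - N)).toNat = 2 * N + 1 := by omega
      have e2 : (t + N + (s * N : ℕ) - (t - N)).toNat = 2 * N + s * N := by omega
      rw [e1, e2, show 9 * C / s = 2 * C / s + (3 * C / s + 4 * C / s) by ring,
        ENNReal.ofReal_add (by positivity) (by positivity),
        ENNReal.ofReal_add (by positivity) (by positivity)]
      refine add_le_add (ofReal_nat_mul_tail hs hC (by omega) ?_)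
        (add_le_add (ofReal_nat_mul_tail hs hC (by nlinarith) ?_)
          (ofReal_nat_mul_tail hs hC (by omega) ?_))
      · rw [div_mul_eq_mul_div, le_div_iff₀ (by positivity)]
        push_cast
        have h3 : (2 * N + 1 : ℝ) * s ≤ 2 * n := by nlinarith
        nlinarith
      · rw [div_mul_eq_mul_div, le_div_iff₀ (by positivity)]
        push_cast
        have h3 : (2 * N + 1 : ℝ) * s ≤ 3 * (s * N) := by nlinarith
        nlinarith
      · rw [div_mul_eq_mul_div, le_div_iff₀ (by positivity)]
        push_cast
        have h3 : (2 * N + s * N : ℝ) * s ≤ 4 * n := by nlinarith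
        nlinarith

/-- Recursion for the influence. -/
lemma CentreComp.isInfl (hs : NormSummable P) {c : ℝ} (hR : P.CentreComp c) {C : ℝ}
    (hC0 : 0 ≤ C) (hC : ∀ n : ℕ, 1 ≤ n → varTail P n ≤ C / n) {N s : ℕ} (hN : 1 ≤ N)
    (h2 : 2 ≤ s) {δ : ℝ} (hδ : P.IsInfl N δ) :
    P.IsInfl (4 * (s ^ 2 * N)) (36 * C / s + (1 - c) * δ) := by
  have hM : 1 ≤ s ^ 2 * N := Nat.mul_pos (by positivity) hN
  have hle : N ≤ s ^ 2 * N := Nat.le_mul_of_pos_left _ (by positivity)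
  set M := s ^ 2 * N with hMdef
  suffices H : ∀ (t : ℤ) (V : Finset ℤ) (x y : Conf A) (F : Conf A → ℝ),
      (∀ i ∈ V, t - 4 * M ≤ i ∧ i ≤ t + 4 * M) →
      (∀ i, t - 4 * M ≤ i → i ≤ t + 4 * M → i ∉ V → x i = y i) → Dep {t} F →
      (∀ z, F z ∈ Icc (0 : ℝ) 1) → P.gm V F x - P.gm V F y ≤ 36 * C / s + (1 - c) * δ by
    intro t V x y F hxy hFd hF
    have hV : {i ∈ V | t - 4 * M ≤ i ∧ i ≤ t + 4 * M} ⊆ V := Finset.filter_subset _ _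
    rw [← gm_gm hs hV, ← gm_gm hs hV F y]
    refine gm_sub_le fun ζ ζ' => H t _ _ _ F (fun i hi => (Finset.mem_filter.1 hi).2)
      (fun i h h' hi => ?_) hFd hF
    have hiV : i ∉ V := fun h'' => hi (Finset.mem_filter.2 ⟨h'', h, h'⟩)
    rw [ov_of_notMem hiV, ov_of_notMem hiV]
    exact hxy i (by push_cast; omega) (by push_cast; omega) hiV
  intro t V x y F hV hxy hFd hF
  set W := {i ∈ V | t - N ≤ i ∧ i ≤ t + N}
  have hW : ∀ i ∈ W, t - N ≤ i ∧ i ≤ t + N := fun i hi => (Finset.mem_filter.1 hi).2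
  have hWV : W ⊆ V := Finset.filter_subset _ _
  set q : Conf A → Conf A := fun z i => if i ∈ V ∧ t - M ≤ i ∧ i ≤ t + M then z i else x i with hq
  set G : Conf A → ℝ := fun z => P.gm W F (q z) with hG
  have hG1 : ∀ z z', G z - G z' ≤ δ := fun z z' =>
    hδ t W _ _ F (fun i hi hi' hiW => by
      have hiV : i ∉ V := fun h => hiW (Finset.mem_filter.2 ⟨h, hi, hi'⟩)
      simp only [hq, hiV, false_and, if_false]) hFd hF
  have hG0 : ∀ z, G z ∈ Icc (0 : ℝ) 1 := fun z => gm_mem_Icc fun _ => hF _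
  have hGd : Dep (Icc (t - M) (t + M)) G := fun z z' h => by
    have : q z = q z' := funext fun i => by
      simp only [hq]
      split_ifs with hi
      · exact h i hi.2
      · rfl
    simp only [hG, this]
  have hagree : ∀ z, (∀ i, t - 4 * M ≤ i → i ≤ t + 4 * M → i ∉ V → z i = x i) →
      ∀ i, t - M ≤ i → i ≤ t + M → z i = q z i := fun z hz i h h' => by
    simp only [hq]
    split_ifs with hi
    · rfl
    · exact hz i (by omega) (by omega) fun h'' => hi ⟨h'', h, h'⟩
  have hx : P.gm V F x - P.gm V G x ≤ 18 * C / s := by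
    rw [← gm_gm hs hWV, ← gm_sub]
    refine (gm_mono fun ζ => ?_).trans_eq (gm_const V _ x)
    exact gm_sub_le_of_far hs hC0 hC hN h2 hW hF hFd
      (hagree _ fun i _ _ hi => by rw [ov_of_notMem hi])
  have hy : P.gm V G y - P.gm V F y ≤ 18 * C / s := by
    rw [← gm_gm hs hWV F, ← gm_sub]
    refine (gm_mono fun ζ => ?_).trans_eq (gm_const V _ y)
    exact gm_sub_le_of_far hs hC0 hC hN h2 hW hF hFd fun i h h' =>
      (hagree _ (fun i h h' hi => by rw [ov_of_notMem hi, hxy i h h' hi]) i h h').symm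
  have hb : BddBelow (range G) := ⟨0, by rintro _ ⟨z, rfl⟩; exact (hG0 z).1⟩
  have h3 := hR V t M y x (fun z => G z - ⨅ z, G z) hM hV
    (fun i h h' hi => (hxy i h h' hi).symm) (fun z => sub_nonneg.2 (ciInf_le hb z))
    (fun z z' h => by simp only [hGd z z' h])
  have h4 : P.gm V (fun z => G z - ⨅ z, G z) x ≤ δ :=
    (gm_mono fun ζ => by
      have : G (ov x V ζ) - δ ≤ ⨅ z, G z := le_ciInf fun z' => by linarith [hG1 (ov x V ζ) z']
      linarith).trans_eq (gm_const V δ x)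
  rw [gm_sub, gm_sub, gm_const, gm_const] at h3
  rw [gm_sub, gm_const] at h4
  have h5 := mul_le_mul_of_nonneg_left h4 (sub_nonneg.2 hR.le_one)
  rw [show 36 * C / s = 18 * C / s + 18 * C / s by ring]
  linarith

end Potential

/-! ### Summability of the influence -/

lemma summable_of_le_mul_add {x b : ℕ → ℝ} {q : ℝ} (hx : ∀ n, 0 ≤ x n) (hb : ∀ n, 0 ≤ b n)
    (hs : Summable b) (hq0 : 0 ≤ q) (hq : q < 1) (h : ∀ n, x (n + 1) ≤ q * x n + b n) :
    Summable x := by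
  refine summable_of_sum_range_le (c := (x 0 + ∑' i, b i) / (1 - q)) hx fun n => ?_
  rw [le_div_iff₀ (by linarith)]
  have h1 : ∑ i ∈ Finset.range n, x i ≤ ∑ i ∈ Finset.range (n + 1), x i :=
    Finset.sum_le_sum_of_subset_of_nonneg (Finset.range_mono (Nat.le_succ n)) fun _ _ _ => hx _
  have h2 : ∑ i ∈ Finset.range (n + 1), x i ≤
      x 0 + (q * ∑ i ∈ Finset.range n, x i + ∑ i ∈ Finset.range n, b i) := by
    rw [Finset.sum_range_succ', mul_sum, ← sum_add_distrib, add_comm]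
    gcongr with i
    exact h i
  have h3 := hs.sum_le_tsum (Finset.range n) fun i _ => hb i
  linarith

/-- A decreasing sequence satisfying a contraction inequality between quadratic scales is summable
along powers of four. -/
lemma summable_of_scale {D : ℕ → ℝ} (h0 : ∀ n, 0 ≤ D n) (hD : Antitone D) {B q : ℝ} (hB : 0 ≤ B)
    (hq0 : 0 ≤ q) (hq : q < 1)
    (h : ∀ N s : ℕ, 1 ≤ N → 2 ≤ s → D (4 * (s ^ 2 * N)) ≤ B / s + q * D N) :
    Summable fun n : ℕ => D n / n := by
  have hpow : StrictMono fun l : ℕ => 4 ^ l := pow_right_strictMono₀ (by norm_num)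
  set E : ℕ → ℝ := fun l => D (4 ^ l) with hE
  have hE0 : ∀ l, 0 ≤ E l := fun l => h0 _
  have hEa : Antitone E := fun l m hlm => hD (hpow.monotone hlm)
  set x : ℕ → ℝ := fun s => E ((s + 1) ^ 2) with hx
  have hrec : ∀ s : ℕ, x (s + 1) ≤ q * x s + B * (1 / 4) ^ (s + 1) := fun s => by
    have h2 : 2 ≤ 2 ^ (2 * s + 2) := by
      rw [pow_succ]
      exact Nat.le_mul_of_pos_left _ (by positivity)
    have := h (4 ^ (s + 1) ^ 2) (2 ^ (2 * s + 2)) (Nat.one_le_pow _ _ (by norm_num)) h2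
    have e1 : 4 * ((2 ^ (2 * s + 2)) ^ 2 * 4 ^ (s + 1) ^ 2) = 4 ^ (s + 1 + 1) ^ 2 := by
      rw [← pow_mul, mul_comm (2 * s + 2), pow_mul, show (2 : ℕ) ^ 2 = 4 by norm_num, ← pow_add,
        ← pow_succ']
      congr 1
      ring
    have e2 : (B : ℝ) / ((2 ^ (2 * s + 2) : ℕ) : ℝ) = B * (1 / 4) ^ (s + 1) := by
      rw [show 2 * s + 2 = 2 * (s + 1) by ring, pow_mul]
      push_cast
      rw [one_div_pow, mul_one_div]
    rw [e1, e2] at this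
    simp only [hx, hE]
    linarith
  have hgeo : Summable fun s : ℕ => (1 / 4 : ℝ) ^ s :=
    summable_geometric_of_lt_one (by norm_num) (by norm_num)
  have hg : Summable fun s : ℕ => B * (1 / 4 : ℝ) ^ (s + 1) :=
    ((summable_nat_add_iff (f := fun s : ℕ => (1 / 4 : ℝ) ^ s) 1).2 hgeo).mul_left B
  have hg2 : Summable fun s : ℕ => ((s : ℝ) + 2) * (B * (1 / 4 : ℝ) ^ (s + 1)) := by
    have h1 := (summable_nat_add_iff (f := fun s : ℕ => (s : ℝ) ^ 1 * (1 / 4 : ℝ) ^ s) 1).2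
      (summable_pow_mul_geometric_of_norm_lt_one 1
        (by rw [Real.norm_eq_abs, abs_of_pos] <;> norm_num))
    refine ((h1.mul_left B).add hg).congr fun s => ?_
    push_cast
    ring
  have hx1 : Summable x := summable_of_le_mul_add (fun _ => hE0 _) (fun _ => by positivity) hg hq0 hq hrec
  have hx2 : Summable fun s : ℕ => ((s : ℝ) + 1) * x s := by
    refine summable_of_le_mul_add (b := fun s => q * x s + ((s : ℝ) + 2) * (B * (1 / 4 : ℝ) ^ (s + 1)))
      (fun s => mul_nonneg (by positivity) (hE0 _))
      (fun s => add_nonneg (mul_nonneg hq0 (hE0 _)) (by positivity))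
      ((hx1.mul_left q).add hg2) hq0 hq fun s => ?_
    have := mul_le_mul_of_nonneg_left (hrec s) (by positivity : (0 : ℝ) ≤ s + 2)
    push_cast
    linarith
  have hEs : Summable E := by
    refine (summable_schlomilch_iff_of_nonneg (C := 2) (u := fun s => (s + 1) ^ 2) hE0
      (fun _ _ _ h => hEa h) (fun _ => by positivity) ?_ (by norm_num) ?_).1 ?_
    · exact strictMono_nat_of_lt_succ fun n => by
        show (n + 1) ^ 2 < (n + 1 + 1) ^ 2
        gcongr
        omega
    · intro n
      simp only [smul_eq_mul]
      have e : (n + 2 + 1) ^ 2 - (n + 1 + 1) ^ 2 = 2 * n + 5 := by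
        rw [Nat.sub_eq_of_eq_add]; ring
      have e' : (n + 1 + 1) ^ 2 - (n + 1) ^ 2 = 2 * n + 3 := by
        rw [Nat.sub_eq_of_eq_add]; ring
      rw [e, e']
      omega
    · refine (hx2.mul_left 3).of_nonneg_of_le (fun s => ?_) fun s => ?_
      · refine mul_nonneg ?_ (hE0 _)
        push_cast
        nlinarith [(Nat.cast_nonneg s : (0 : ℝ) ≤ s)]
      · rw [← mul_assoc]
        refine mul_le_mul_of_nonneg_right ?_ (hE0 _)
        push_cast
        nlinarith [(Nat.cast_nonneg s : (0 : ℝ) ≤ s)]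
  refine (summable_schlomilch_iff_of_nonneg (C := 4) (u := fun l => 4 ^ l)
    (fun n => div_nonneg (h0 n) (Nat.cast_nonneg n)) (fun m n hm hmn => ?_)
    (fun _ => by positivity) hpow (by norm_num) ?_).1 ?_
  · have : (0 : ℝ) < m := by exact_mod_cast hm
    exact div_le_div₀ (h0 m) (hD hmn) this (by exact_mod_cast hmn)
  · intro n
    have e : 4 ^ (n + 2) - 4 ^ (n + 1) = 4 * (4 ^ (n + 1) - 4 ^ n) := by
      rw [Nat.mul_sub, ← pow_succ', ← pow_succ']
    simp only [e, smul_eq_mul, le_refl]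
  · refine (hEs.mul_left 3).congr fun l => ?_
    have : (4 : ℝ) ^ l ≠ 0 := by positivity
    push_cast
    rw [pow_succ, hE]
    field_simp
    ring

lemma upd_same (s : A) (n : ℤ) (x : Conf A) : upd s n x n = s := if_pos rfl

lemma upd_of_ne {i n : ℤ} (h : i ≠ n) (s : A) (x : Conf A) : upd s n x i = x i := if_neg h

namespace Potential

variable {P : Potential A}

/-- The influence on a local function is at most the sum of the influences on its coordinates. -/
lemma gm_sub_le_sum_infl (hs : NormSummable P) (N : ℤ → ℕ) {E : Finset ℤ} :
    ∀ {V : Finset ℤ} {x y : Conf A} {F : Conf A → ℝ}, Dep (E : Set ℤ) F →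
      (∀ z, F z ∈ Icc (0 : ℝ) 1) →
      (∀ e ∈ E, ∀ i, e - N e ≤ i → i ≤ e + N e → i ∉ V → x i = y i) →
      P.gm V F x - P.gm V F y ≤ ∑ e ∈ E, P.infl (N e) := by
  induction E using Finset.induction_on with
  | empty =>
    intro V x y F hFd hF _
    have : ∀ z, F z = F x := fun z => hFd _ _ (by simp)
    rw [gm_of_const fun ζ => this _, gm_of_const fun ζ => this _, sub_self, Finset.sum_empty]
  | insert e E he ih =>
    intro V x y F hFd hF hxy
    set U := V.erase e with hU
    have hUV : U ⊆ V := Finset.erase_subset _ _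
    have heU : e ∉ U := Finset.notMem_erase _ _
    have hG : ∀ x : Conf A, P.gm V F x = P.gm V (fun z => P.gm U F (upd (z e) e x)) x := fun x => by
      rw [← gm_gm hs hUV, gm_eq_sum, gm_eq_sum]
      refine sum_congr rfl fun ζ _ => ?_
      congr 1
      refine gm_congr (fun i hi => ?_) F
      by_cases hie : i = e
      · rw [hie, upd_same]
      · rw [upd_of_ne hie, ov_of_notMem fun h => hi (Finset.mem_erase.2 ⟨hie, h⟩)]
    have h1 : ∀ c : A, P.gm U F (upd c e x) - P.gm U F (upd c e y) ≤ ∑ e ∈ E, P.infl (N e) := by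
      intro c
      have hc : ∀ x : Conf A, P.gm U F (upd c e x) = P.gm U (fun z => F (upd c e z)) (upd c e x) :=
        fun x => by
          rw [gm_eq_sum, gm_eq_sum]
          refine sum_congr rfl fun ζ _ => ?_
          congr 2
          funext i
          by_cases hie : i = e
          · rw [hie, upd_same, ov_of_notMem heU, upd_same]
          · rw [upd_of_ne hie]
      rw [hc, hc]
      refine ih (fun z z' h => hFd _ _ fun i hi => ?_) (fun z => hF _) fun e' he' i h h' hi => ?_
      · by_cases hie : i = e
        · rw [hie, upd_same, upd_same]
        · rw [upd_of_ne hie, upd_of_ne hie]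
          exact h i ((Finset.mem_insert.1 hi).resolve_left hie)
      · by_cases hie : i = e
        · rw [hie, upd_same, upd_same]
        · rw [upd_of_ne hie, upd_of_ne hie]
          exact hxy e' (Finset.mem_insert_of_mem he') i h h'
            fun h => hi (Finset.mem_erase.2 ⟨hie, h⟩)
    have h2 := isInfl_infl (P := P) (N e) e V x y (fun z => P.gm U F (upd (z e) e y))
      (hxy e (Finset.mem_insert_self _ _)) (fun z z' h => by simp only [h e rfl])
      fun z => gm_mem_Icc fun _ => hF _
    have h3 := (gm_mono (P := P) (V := V) (x := x)
      (F := fun z => P.gm U F (upd (z e) e x) - P.gm U F (upd (z e) e y)) fun ζ => h1 _).trans_eq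
      (gm_const V _ x)
    rw [gm_sub, ← hG] at h3
    rw [← hG] at h2
    rw [Finset.sum_insert he]
    linarith

end Potential

/-! ### Comparison of boundary conditions far to the right -/

section TwoPoint

variable {ι : Type*} [Fintype ι] {p q : ι → ℝ}

/-- The symmetrised relative entropy. -/
def jdiv (p q : ι → ℝ) : ℝ := ∑ i, (p i - q i) * (log (p i) - log (q i))

lemma sum_abs_le_sqrt_jdiv (hp : ∀ i, 0 < p i) (hq : ∀ i, 0 < q i) (hp1 : ∑ i, p i = 1)
    (hq1 : ∑ i, q i = 1) : ∑ i, |p i - q i| ≤ √(2 * jdiv p q) := by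
  have h1 := pinsker p q (fun i => (hp i).le) (fun i => (hq i).le)
    (fun i h => absurd h (hq i).ne') hp1 hq1.le
  have h2 := pinsker q p (fun i => (hq i).le) (fun i => (hp i).le)
    (fun i h => absurd h (hp i).ne') hq1 hp1.le
  simp only [abs_sub_comm (q _)] at h2
  have h3 : jdiv p q = ∑ i, p i * (log (p i) - log (q i)) +
      ∑ i, q i * (log (q i) - log (p i)) := by
    rw [jdiv, ← sum_add_distrib]
    exact sum_congr rfl fun i _ => by ring
  refine Real.le_sqrt_of_sq_le ?_
  rw [h3]
  linarith

lemma le_sum_min (hp : ∀ i, 0 < p i) (hq : ∀ i, 0 < q i) (hp1 : ∑ i, p i = 1) {J : ℝ}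
    (hJ0 : 0 ≤ J) (hJ : jdiv p q ≤ J) :
    exp (-(2 * J + 2)) / (J + 1) ≤ ∑ i, min (p i) (q i) := by
  set T := 2 * J + 2 with hT
  have hT0 : 0 < T := by positivity
  have h2 : exp (-T) ≤ 1 / 2 := by
    rw [Real.exp_neg, one_div]
    exact inv_anti₀ two_pos (by linarith [Real.add_one_le_exp T])
  have key : ∀ i, exp (-T) *
      (p i - 2 / T * ((p i - q i) * (log (p i) - log (q i)))) ≤ min (p i) (q i) := by
    intro i
    by_cases h : exp (-T) * p i ≤ q i
    · have h3 : 0 ≤ (p i - q i) * (log (p i) - log (q i)) := by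
        rcases le_total (p i) (q i) with h' | h'
        · exact mul_nonneg_of_nonpos_of_nonpos (sub_nonpos.2 h')
            (sub_nonpos.2 (Real.log_le_log (hp i) h'))
        · exact mul_nonneg (sub_nonneg.2 h') (sub_nonneg.2 (Real.log_le_log (hq i) h'))
      have h4 : exp (-T) *
          (p i - 2 / T * ((p i - q i) * (log (p i) - log (q i)))) ≤
            exp (-T) * p i :=
        mul_le_mul_of_nonneg_left (sub_le_self _ (by positivity)) (exp_pos _).le
      exact le_min (h4.trans (by nlinarith [hp i])) (h4.trans h)
    · push Not at h
      have h5 : q i ≤ p i / 2 := by nlinarith [hp i]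
      have h6 : T ≤ log (p i) - log (q i) := by
        have := Real.log_le_log (hq i) h.le
        rw [Real.log_mul (exp_pos _).ne' (hp i).ne', Real.log_exp] at this
        linarith
      have h7 : p i / 2 * T ≤ (p i - q i) * (log (p i) - log (q i)) :=
        mul_le_mul (by linarith) h6 hT0.le (by linarith [hp i])
      have h8 : p i ≤ 2 / T * ((p i - q i) * (log (p i) - log (q i))) := by
        rw [div_mul_eq_mul_div, le_div_iff₀ hT0]
        linarith
      exact (mul_nonpos_of_nonneg_of_nonpos (exp_pos _).le (sub_nonpos.2 h8)).trans
        (le_min (hp i).le (hq i).le)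
  refine le_trans ?_ (sum_le_sum fun i _ => key i)
  rw [← mul_sum, sum_sub_distrib, ← mul_sum, hp1, div_eq_mul_inv]
  refine mul_le_mul_of_nonneg_left ?_ (exp_pos _).le
  have h9 : 2 / T * jdiv p q ≤ 2 / T * J := mul_le_mul_of_nonneg_left hJ (by positivity)
  have h10 : (J + 1)⁻¹ = 1 - 2 / T * J := by
    rw [hT]
    field_simp
    ring
  rw [h10]
  exact sub_le_sub_left h9 1

end TwoPoint

namespace Potential

variable {P : Potential A}

lemma gm_sub_le_mul_sum_infl (hs : NormSummable P) (N : ℤ → ℕ) {E V : Finset ℤ} {x y : Conf A}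
    {F : Conf A → ℝ} (hFd : Dep (E : Set ℤ) F) {v : ℝ} (hF : ∀ z z', F z - F z' ≤ v)
    (hxy : ∀ e ∈ E, ∀ i, e - N e ≤ i → i ≤ e + N e → i ∉ V → x i = y i) :
    P.gm V F x - P.gm V F y ≤ v * ∑ e ∈ E, P.infl (N e) := by
  have hv : 0 ≤ v := by simpa using hF x x
  have hb : BddBelow (range F) := ⟨F x - v, by rintro _ ⟨z, rfl⟩; linarith [hF x z]⟩
  have hle : ∀ z, F z - v ≤ ⨅ z, F z := fun z => le_ciInf fun z' => by linarith [hF z z']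
  rcases hv.eq_or_lt with rfl | hv
  · rw [zero_mul, sub_nonpos]
    refine (gm_mono fun ζ => ?_).trans ((gm_const V (F x) x).le.trans
      ((gm_const V (F x) y).symm.le.trans (gm_mono fun ζ => ?_)))
    · linarith [hF (ov x V ζ) x]
    · linarith [hF x (ov y V ζ)]
  · have h := gm_sub_le_sum_infl hs N (V := V) (x := x) (y := y)
      (F := fun z => v⁻¹ * (F z - ⨅ z, F z)) (fun z z' h => by simp only [hFd z z' h])
      (fun z => ⟨mul_nonneg (inv_nonneg.2 hv.le) (sub_nonneg.2 (ciInf_le hb z)), by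
        rw [inv_mul_le_iff₀ hv]
        linarith [hle z]⟩) hxy
    rw [gm_const_mul, gm_const_mul, gm_sub, gm_sub, gm_const, gm_const, ← mul_sub,
      inv_mul_le_iff₀ hv] at h
    linarith

lemma sum_pv_le (hs : NormSummable P) (e : ℤ) (m : ℕ) {s : Finset (Finset ℤ)}
    (h : ∀ K ∈ s, e ∈ K ∧ ∃ i ∈ K, e + m ≤ i) : ∑ K ∈ s, P.pv K ≤ varTail P m := by
  have h1 : ENNReal.ofReal (∑ K ∈ s, P.pv K) ≤ ENNReal.ofReal (varTail P m) := by
    rw [← tail_eq hs, ← P.transInv_pv.tail e, ENNReal.ofReal_sum_of_nonneg fun K _ => P.pv_nonneg K]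
    refine le_trans (sum_le_sum fun K hK => ?_) (ENNReal.sum_le_tsum s)
    rw [indicator_of_mem (show K ∈ {K | e ∈ K ∧ ∃ i ∈ K, e + m ≤ i} from h K hK)]
  exact (ENNReal.ofReal_le_ofReal_iff (varTail_nonneg m)).1 h1

/-- The symmetrised relative entropy of two finite volume distributions whose boundary conditions
differ only far to the right. -/
lemma jdiv_le_sum (hs : NormSummable P) {n : ℤ} {k : ℕ} {V : Finset ℤ} (hV : ∀ i ∈ V, i ≤ n)
    {x y : Conf A} (hxy : ∀ i ≤ n + k, i ∉ V → x i = y i) :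
    jdiv (fun ζ : V → A => potPhi P V (ov x V ζ)) (fun ζ => potPhi P V (ov y V ζ)) ≤
      2 * ∑ e ∈ V, P.infl (n + k - e).toNat * varTail P ((n + k - e).toNat + 1) := by
  set p : (V → A) → ℝ := fun ζ => potPhi P V (ov x V ζ) with hp
  set q : (V → A) → ℝ := fun ζ => potPhi P V (ov y V ζ) with hq
  have hlog : ∀ (x : Conf A) (ζ : V → A), log (potPhi P V (ov x V ζ)) =
      -P.en (Hit (V : Set ℤ)) (ov x V ζ) - log (sm V (P.bw V) x) := fun x ζ => by
    have : potPhi P V (ov x V ζ) = P.bw V (ov x V ζ) / sm V (P.bw V) x := by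
      rw [← sm_ov V (P.bw V) x ζ]
      rfl
    rw [this, Real.log_div (bw_pos _ _).ne' (sm_bw_pos _ _).ne', bw, Real.log_exp, hPot_eq]
  set T : Finset ℤ → ℝ := fun K => ∑ ζ, (q ζ - p ζ) *
    ((Hit (V : Set ℤ)).indicator (fun K => P.Φ K (ov x V ζ)) K -
      (Hit (V : Set ℤ)).indicator (fun K => P.Φ K (ov y V ζ)) K) with hT
  have hsum : ∀ ζ : V → A, Summable fun K => (q ζ - p ζ) *
    ((Hit (V : Set ℤ)).indicator (fun K => P.Φ K (ov x V ζ)) K -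
      (Hit (V : Set ℤ)).indicator (fun K => P.Φ K (ov y V ζ)) K) := fun ζ =>
    ((summable_en hs subset_rfl _).sub (summable_en hs subset_rfl _)).mul_left _
  have hJ : jdiv p q = ∑' K, T K := by
    rw [hT, Summable.tsum_finsetSum fun ζ _ => hsum ζ]
    have h1 : ∀ ζ, (p ζ - q ζ) * (log (p ζ) - log (q ζ)) =
        (∑' K, (q ζ - p ζ) *
    ((Hit (V : Set ℤ)).indicator (fun K => P.Φ K (ov x V ζ)) K -
      (Hit (V : Set ℤ)).indicator (fun K => P.Φ K (ov y V ζ)) K)) +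
        (p ζ - q ζ) * (log (sm V (P.bw V) y) - log (sm V (P.bw V) x)) := fun ζ => by
      rw [tsum_mul_left, (summable_en hs subset_rfl _).tsum_sub (summable_en hs subset_rfl _)]
      simp only [hp, hq, hlog, en]
      ring
    rw [jdiv, sum_congr rfl fun ζ _ => h1 ζ, sum_add_distrib, ← sum_mul,
      sum_sub_distrib, hp, hq, sum_potPhi, sum_potPhi, sub_self, zero_mul, add_zero]
  have hTle : ∀ K, T K ≤ if ∃ i ∈ K, n + k + 1 ≤ i then
      2 * (P.pv K * ∑ e ∈ V with e ∈ K, P.infl (n + k - e).toNat) else 0 := by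
    intro K
    by_cases hKV : K ∈ Hit (V : Set ℤ)
    swap
    · have : T K = 0 := by simp [hT, hKV]
      rw [this]
      split_ifs
      · exact mul_nonneg zero_le_two (mul_nonneg (P.pv_nonneg K)
          (sum_nonneg fun e _ => infl_nonneg _))
      · exact le_rfl
    simp only [hT, indicator_of_mem hKV]
    split_ifs with hK
    swap
    · refine (sum_eq_zero fun ζ _ => ?_).le
      push Not at hK
      have hK0 : K.Nonempty := let ⟨i, hi, _⟩ := hKV; ⟨i, hi⟩
      rw [P.dep hK0 (ov x V ζ) (ov y V ζ) fun i hi => ?_, sub_self, mul_zero]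
      by_cases hiV : i ∈ V
      · rw [ov_of_mem hiV, ov_of_mem hiV]
      · rw [ov_of_notMem hiV, ov_of_notMem hiV, hxy i (by have := hK i hi; omega) hiV]
    have hK0 : K.Nonempty := let ⟨i, hi, _⟩ := hKV; ⟨i, hi⟩
    have hinf : ∀ w x y : Conf A, (∀ i ≤ n + k, i ∉ V → x i = y i) →
        P.gm V (fun z => P.Φ K (ov w V fun i => z i)) x -
          P.gm V (fun z => P.Φ K (ov w V fun i => z i)) y ≤
        P.pv K * ∑ e ∈ V with e ∈ K, P.infl (n + k - e).toNat := fun w x y h =>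
      gm_sub_le_mul_sum_infl hs (fun e => (n + k - e).toNat)
        (fun z z' h => P.dep hK0 _ _ fun i hi => by
          by_cases hiV : i ∈ V
          · rw [ov_of_mem hiV, ov_of_mem hiV]
            exact h i (Finset.mem_coe.2 (Finset.mem_filter.2 ⟨hiV, hi⟩))
          · rw [ov_of_notMem hiV, ov_of_notMem hiV])
        (fun z z' => P.sub_le_pv K _ _)
        fun e he i _ hi hiV => h i (by have := hV e (Finset.mem_filter.1 he).1; omega) hiV
    have h1 := hinf x y x fun i hi hiV => (hxy i hi hiV).symm
    have h2 := hinf y x y hxy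
    have hres : ∀ w z : Conf A, ∀ ζ : V → A, (ov w V fun i => ov z V ζ i) = ov w V ζ := fun w z ζ => by
      congr 1
      funext i
      exact ov_of_mem i.2
    simp only [gm_eq_sum, hres] at h1 h2
    have h3 : ∑ ζ, (q ζ - p ζ) * (P.Φ K (ov x V ζ) - P.Φ K (ov y V ζ)) =
        (∑ ζ, q ζ * P.Φ K (ov x V ζ) - ∑ ζ, p ζ * P.Φ K (ov x V ζ)) +
        (∑ ζ, p ζ * P.Φ K (ov y V ζ) - ∑ ζ, q ζ * P.Φ K (ov y V ζ)) := by
      simp only [← sum_sub_distrib, ← sum_add_distrib]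
      exact sum_congr rfl fun ζ _ => by ring
    rw [h3]
    simp only [hp, hq]
    linarith
  rw [hJ]
  refine (summable_sum fun ζ _ => hsum ζ).tsum_le_of_sum_le fun s => ?_
  refine (sum_le_sum fun K _ => hTle K).trans ?_
  rw [← Finset.sum_filter, ← mul_sum]
  refine mul_le_mul_of_nonneg_left ?_ zero_le_two
  simp only [Finset.sum_filter (s := V), mul_sum, mul_ite, mul_zero]
  rw [sum_comm]
  refine sum_le_sum fun e he => ?_
  rw [← Finset.sum_filter, ← sum_mul, mul_comm]
  refine mul_le_mul_of_nonneg_left (sum_pv_le hs e _ fun K hK => ?_) (infl_nonneg _)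
  simp only [Finset.mem_filter] at hK
  obtain ⟨⟨-, i, hi, hi'⟩, heK⟩ := hK
  exact ⟨heK, i, hi, by have := hV e he; push_cast; omega⟩

/-! ### Decay of the influence of the boundary condition on the right -/

variable (P) in
/-- The bound for the symmetrised relative entropy at distance `k`. -/
def divBound (k : ℕ) : ℝ := 2 * ∑' m, P.infl (m + k) * varTail P (m + k + 1)

lemma summable_infl_mul {C : ℝ} (hC : ∀ n : ℕ, 1 ≤ n → varTail P n ≤ C / n)
    (hD : Summable fun n : ℕ => P.infl n / n) :
    Summable fun m => P.infl m * varTail P (m + 1) := by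
  have hC0 : 0 ≤ C := by simpa using (varTail_nonneg 1).trans (hC 1 le_rfl)
  refine (summable_nat_add_iff 1).1 (Summable.of_nonneg_of_le
    (fun m => mul_nonneg (infl_nonneg _) (varTail_nonneg _)) (fun m => ?_)
    (((summable_nat_add_iff 1).2 hD).mul_left C))
  have h1 : varTail P (m + 1 + 1) ≤ C / (m + 1 : ℕ) := (hC _ (by omega)).trans
    (div_le_div_of_nonneg_left hC0 (by positivity) (by push_cast; linarith))
  refine (mul_le_mul_of_nonneg_left h1 (infl_nonneg _)).trans_eq ?_
  ring

lemma divBound_nonneg (k : ℕ) : 0 ≤ P.divBound k :=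
  mul_nonneg zero_le_two (tsum_nonneg fun _ => mul_nonneg (infl_nonneg _) (varTail_nonneg _))

lemma tendsto_divBound (P : Potential A) : Tendsto P.divBound atTop (nhds 0) := by
  have := (tendsto_sum_nat_add fun m => P.infl m * varTail P (m + 1)).const_mul 2
  rwa [mul_zero] at this

variable (hs : NormSummable P) (hD : Summable fun m => P.infl m * varTail P (m + 1))

include hs hD in
lemma jdiv_le {n : ℤ} {k : ℕ} {V : Finset ℤ} (hV : ∀ i ∈ V, i ≤ n)
    {x y : Conf A} (hxy : ∀ i ≤ n + k, i ∉ V → x i = y i) :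
    jdiv (fun ζ : V → A => potPhi P V (ov x V ζ)) (fun ζ => potPhi P V (ov y V ζ)) ≤
      P.divBound k := by
  refine (jdiv_le_sum hs hV hxy).trans (mul_le_mul_of_nonneg_left ?_ zero_le_two)
  have h1 : ∑ e ∈ V, P.infl (n + k - e).toNat * varTail P ((n + k - e).toNat + 1) =
      ∑ m ∈ V.image fun e => (n - e).toNat, P.infl (m + k) * varTail P (m + k + 1) := by
    rw [Finset.sum_image fun e he e' he' h => by
      have := hV e he
      have := hV e' he'
      omega]
    refine sum_congr rfl fun e he => ?_
    have : (n + k - e).toNat = (n - e).toNat + k := by have := hV e he; omega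
    rw [this]
  rw [h1]
  exact ((summable_nat_add_iff k).2 hD).sum_le_tsum _ fun _ _ =>
    mul_nonneg (infl_nonneg _) (varTail_nonneg _)

include hs hD in
lemma gm_sub_le_sqrt {n : ℤ} {k : ℕ} {V : Finset ℤ} (hV : ∀ i ∈ V, i ≤ n)
    {x y : Conf A} (hxy : ∀ i ≤ n + k, i ∉ V → x i = y i) {F : Conf A → ℝ}
    (hF : ∀ z, F z ∈ Icc (0 : ℝ) 1) (hFxy : ∀ ζ, F (ov x V ζ) = F (ov y V ζ)) :
    P.gm V F x - P.gm V F y ≤ √(2 * P.divBound k) := by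
  rw [gm_eq_sum, gm_eq_sum, ← sum_sub_distrib]
  refine le_trans (sum_le_sum fun ζ _ => ?_) ((sum_abs_le_sqrt_jdiv
    (fun ζ => potPhi_pos V (ov x V ζ)) (fun ζ => potPhi_pos V (ov y V ζ)) (sum_potPhi V x)
    (sum_potPhi V y)).trans (Real.sqrt_le_sqrt
      (mul_le_mul_of_nonneg_left (jdiv_le hs hD hV hxy) zero_le_two)))
  rw [hFxy ζ, ← sub_mul]
  have h := hF (ov y V ζ)
  exact (mul_le_mul_of_nonneg_right (le_abs_self _) h.1).trans
    (mul_le_of_le_one_right (abs_nonneg _) h.2)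

include hs hD in
lemma gm_sub_le_contract {n : ℤ} {V : Finset ℤ} (hV : ∀ i ∈ V, i ≤ n)
    {x y : Conf A} (hxy : ∀ i ≤ n, i ∉ V → x i = y i) {F : Conf A → ℝ} {θ : ℝ}
    (hF : ∀ z z', F z - F z' ≤ θ) (hFxy : ∀ ζ, F (ov x V ζ) = F (ov y V ζ)) :
    P.gm V F x - P.gm V F y ≤
      (1 - exp (-(2 * P.divBound 0 + 2)) / (P.divBound 0 + 1)) * θ := by
  have hθ : 0 ≤ θ := by simpa using hF x x
  set p : (V → A) → ℝ := fun ζ => potPhi P V (ov x V ζ) with hp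
  set q : (V → A) → ℝ := fun ζ => potPhi P V (ov y V ζ) with hq
  have hmin := le_sum_min (p := p) (q := q) (fun ζ => potPhi_pos V (ov x V ζ))
    (fun ζ => potPhi_pos V (ov y V ζ)) (sum_potPhi V x) (divBound_nonneg 0)
    (jdiv_le hs hD hV (by simpa using hxy))
  have hb : BddBelow (range F) := ⟨F x - θ, by rintro _ ⟨z, rfl⟩; linarith [hF x z]⟩
  have hle : ∀ z, F z - θ ≤ ⨅ z, F z := fun z => le_ciInf fun z' => by linarith [hF z z']
  have h1 : P.gm V F x - P.gm V F y = ∑ ζ, (p ζ - q ζ) * (F (ov x V ζ) - ⨅ z, F z) := by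
    simp only [sub_mul, mul_sub, sum_sub_distrib, ← sum_mul, hp, hq, sum_potPhi]
    rw [gm_eq_sum, gm_eq_sum]
    simp only [hFxy]
    ring
  have h2 : ∑ ζ, (p ζ - q ζ) * (F (ov x V ζ) - ⨅ z, F z) ≤ ∑ ζ, (p ζ - min (p ζ) (q ζ)) * θ :=
    sum_le_sum fun ζ _ =>
      (mul_le_mul_of_nonneg_right (sub_le_sub_left (min_le_right _ _) _)
        (sub_nonneg.2 (ciInf_le hb _))).trans
        (mul_le_mul_of_nonneg_left (by linarith [hle (ov x V ζ)]) (sub_nonneg.2 (min_le_left _ _)))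
  rw [h1]
  refine h2.trans ?_
  rw [← sum_mul, sum_sub_distrib, hp, sum_potPhi]
  exact mul_le_mul_of_nonneg_right (sub_le_sub_left hmin 1) hθ

variable (P) in
/-- Boundary conditions agreeing up to `n` have influence at most `θ` on functions of the
coordinates up to `n - N`. -/
def IsTail (N : ℕ) (θ : ℝ) : Prop :=
  ∀ (n : ℤ) (V : Finset ℤ) (x y : Conf A) (F : Conf A → ℝ),
    (∀ i ≤ n, i ∉ V → x i = y i) → Dep (Iic (n - N)) F → (∀ z, F z ∈ Icc (0 : ℝ) 1) →
    P.gm V F x - P.gm V F y ≤ θ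

include hs hD in
lemma IsTail.step {N L : ℕ} {θ : ℝ} (h : P.IsTail N θ) :
    P.IsTail (N + L) (√(2 * P.divBound L) +
      (1 - exp (-(2 * P.divBound 0 + 2)) / (P.divBound 0 + 1)) * θ) := by
  suffices H : ∀ (n : ℤ) (V : Finset ℤ) (x y : Conf A) (F : Conf A → ℝ), (∀ i ∈ V, i ≤ n) →
      (∀ i ≤ n, i ∉ V → x i = y i) → Dep (Iic (n - (N + L : ℕ))) F →
      (∀ z, F z ∈ Icc (0 : ℝ) 1) → P.gm V F x - P.gm V F y ≤ √(2 * P.divBound L) +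
      (1 - exp (-(2 * P.divBound 0 + 2)) / (P.divBound 0 + 1)) * θ by
    intro n V x y F hxy hFd hF
    have hV : {i ∈ V | i ≤ n} ⊆ V := Finset.filter_subset _ _
    rw [← gm_gm hs hV, ← gm_gm hs hV F y]
    refine gm_sub_le fun ζ ζ' => H n _ _ _ F (fun i hi => (Finset.mem_filter.1 hi).2)
      (fun i h hi => ?_) hFd hF
    have hiV : i ∉ V := fun h'' => hi (Finset.mem_filter.2 ⟨h'', h⟩)
    rw [ov_of_notMem hiV, ov_of_notMem hiV]
    exact hxy i h hiV
  intro n V x y F hV hxy hFd hF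
  set U := {i ∈ V | i ≤ n - L}
  have hU : ∀ i ∈ U, i ≤ n - L := fun i hi => (Finset.mem_filter.1 hi).2
  have hUV : U ⊆ V := Finset.filter_subset _ _
  have hFd' : Dep (Iic (n - L - N)) F := hFd.mono fun i hi => by
    simp only [mem_Iic] at hi ⊢
    push_cast at hi
    omega
  have hres : ∀ z : Conf A, ∀ ζ : V → A, (ov x V fun i => ov z V ζ i) = ov x V ζ := fun z ζ => by
    congr 1
    funext i
    exact ov_of_mem i.2
  set G : Conf A → ℝ := fun z => P.gm U F (ov x V fun i => z i) with hG
  have hx : P.gm V F x = P.gm V G x := by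
    rw [← gm_gm hs hUV, gm_eq_sum, gm_eq_sum]
    simp only [hG, hres]
  have hy : P.gm V G y - P.gm V F y ≤ √(2 * P.divBound L) := by
    rw [← gm_gm hs hUV F, ← gm_sub]
    refine (gm_mono fun ζ => ?_).trans_eq (gm_const V _ y)
    simp only [hG, hres]
    have hag : ∀ i ≤ n, ov x V ζ i = ov y V ζ i := fun i hi => by
      by_cases hiV : i ∈ V
      · rw [ov_of_mem hiV, ov_of_mem hiV]
      · rw [ov_of_notMem hiV, ov_of_notMem hiV, hxy i hi hiV]
    refine gm_sub_le_sqrt hs hD hU (fun i hi _ => hag i (by omega)) hF fun η =>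
      hFd' _ _ fun i hi => ?_
    simp only [mem_Iic] at hi
    by_cases hiU : i ∈ U
    · rw [ov_of_mem hiU, ov_of_mem hiU]
    · rw [ov_of_notMem hiU, ov_of_notMem hiU, hag i (by omega)]
  have h3 := gm_sub_le_contract hs hD hV hxy (F := G) (θ := θ)
    (fun z z' => h (n - L) U _ _ F (fun i hi hiU => by
      have hiV : i ∉ V := fun h => hiU (Finset.mem_filter.2 ⟨h, hi⟩)
      rw [ov_of_notMem hiV, ov_of_notMem hiV]) hFd' hF) fun ζ => by simp only [hG, hres]
  linarith

include hs hD in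
/-- The influence of the boundary condition on the right decays uniformly. -/
theorem exists_isTail {ε : ℝ} (hε : 0 < ε) : ∃ N, P.IsTail N ε := by
  set c := exp (-(2 * P.divBound 0 + 2)) / (P.divBound 0 + 1) with hc
  have h0 := divBound_nonneg (P := P) 0
  have hc0 : 0 < c := by positivity
  have hc1 : c ≤ 1 := by
    rw [hc, div_le_one (by positivity)]
    have := Real.exp_le_one_iff.2 (by linarith : -(2 * P.divBound 0 + 2) ≤ 0)
    linarith
  obtain ⟨L, hL⟩ : ∃ L, √(2 * P.divBound L) ≤ c * (ε / 2) := by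
    have h1 : Tendsto (fun L => √(2 * P.divBound L)) atTop (nhds 0) := by
      have := ((tendsto_divBound P).const_mul 2).sqrt
      rwa [mul_zero, Real.sqrt_zero] at this
    exact ((h1.eventually_lt_const (by positivity : 0 < c * (ε / 2))).mono fun _ => le_of_lt).exists
  have hit : ∀ j : ℕ, P.IsTail (j * L) ((1 - c) ^ j + ε / 2) := fun j => by
    induction j with
    | zero =>
      intro n V x y F _ _ hF
      have h1 := (gm_mem_Icc (P := P) fun ζ => hF (ov x V ζ)).2
      have h2 := (gm_mem_Icc (P := P) fun ζ => hF (ov y V ζ)).1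
      simp only [pow_zero]
      linarith
    | succ j ih =>
      have h := IsTail.step hs hD (L := L) ih
      rw [← hc] at h
      rw [Nat.succ_mul]
      intro n V x y F hxy hFd hF
      refine (h n V x y F hxy hFd hF).trans ?_
      rw [pow_succ]
      linarith
  obtain ⟨j, hj⟩ := exists_pow_lt_of_lt_one (half_pos hε) (by linarith : 1 - c < 1)
  exact ⟨j * L, fun n V x y F hxy hFd hF => (hit j n V x y F hxy hFd hF).trans (by linarith)⟩

end Potential

/-! ### Existence of Gibbs states -/

lemma exhausts_Icc (M : ℤ) : ∀ᶠ n : ℕ in atTop, Finset.Icc (-M) M ⊆ Finset.Icc (-(n : ℤ)) n := by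
  filter_upwards [eventually_ge_atTop M.toNat] with n hn
  exact Finset.Icc_subset_Icc (by omega) (by omega)

lemma exists_subset_Icc (E : Finset ℤ) : ∃ M : ℤ, 0 ≤ M ∧ E ⊆ Finset.Icc (-M) M :=
  ⟨∑ e ∈ E, |e|, sum_nonneg fun _ _ => abs_nonneg _, fun _ he => Finset.mem_Icc.2 <| abs_le.1 <|
    single_le_sum (f := fun e : ℤ => |e|) (fun _ _ => abs_nonneg _) he⟩

lemma cylSA_le (I : Set ℤ) : cylSA I ≤ (inferInstance : MeasurableSpace (Conf A)) := by
  rintro _ ⟨t, ht, rfl⟩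
  exact measurable_pi_lambda _ (fun i => measurable_pi_apply _) ht

lemma measurable_ov (V : Finset ℤ) (ζ : V → A) : Measurable fun x : Conf A => ov x V ζ :=
  measurable_pi_lambda _ fun i => by
    by_cases h : i ∈ V
    · simp only [ov_of_mem h]; exact measurable_const
    · simp only [ov_of_notMem h]; exact measurable_pi_apply i

variable [TopologicalSpace A] [DiscreteTopology A]

lemma Dep.continuous {β : Type*} [TopologicalSpace β] {I : Finset ℤ} {F : Conf A → β}
    (hF : Dep (I : Set ℤ) F) : Continuous F := by
  obtain ⟨x⟩ : Nonempty (Conf A) := inferInstance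
  have : F = (fun ζ => F (ov x I ζ)) ∘ rs I := funext fun y => hF _ _ fun i hi =>
    (ov_of_mem (x := x) (ζ := rs I y) (Finset.mem_coe.1 hi)).symm
  rw [this]
  exact continuous_of_discreteTopology.comp (continuous_pi fun i => continuous_apply (i : ℤ))

lemma continuous_ov (V : Finset ℤ) (ζ : V → A) : Continuous fun x : Conf A => ov x V ζ :=
  continuous_pi fun i => by
    by_cases h : i ∈ V
    · simp only [ov_of_mem h]; exact continuous_const
    · simp only [ov_of_notMem h]; exact continuous_apply i

namespace Potential

variable {P : Potential A}

lemma continuous_potPhi (hs : NormSummable P) (V : Finset ℤ) : Continuous (potPhi P V) := by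
  have h1 : Continuous (HPot P V) := by
    simp only [funext (hPot_eq V)]
    have h := wt_pn_hit hs V
    refine continuous_tsum (fun K => ?_) (ENNReal.summable_toReal h) fun K x => ?_
    all_goals by_cases hK : K ∈ Hit (V : Set ℤ)
    · simp only [indicator_of_mem hK]
      obtain ⟨i, hi, -⟩ := hK
      exact (P.dep ⟨i, hi⟩).continuous
    · simp only [indicator_of_notMem hK]
      exact continuous_const
    · rw [indicator_of_mem hK, indicator_of_mem hK, ENNReal.toReal_ofReal (P.pn_nonneg K)]
      exact P.abs_le_pn K x
    · simp [indicator_of_notMem hK]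
  refine (Real.continuous_exp.comp h1.neg).div
    (continuous_finsetSum _ fun ζ _ => Real.continuous_exp.comp (h1.comp (continuous_ov V ζ)).neg)
    fun x => (sm_bw_pos (P := P) V x).ne'

/-- A measure consistent with the finite-volume averages is a Gibbs state. -/
lemma isGibbsPot_of_integral_gm (hs : NormSummable P) {μ : Measure (Conf A)} [IsProbabilityMeasure μ]
    (h : ∀ (V : Finset ℤ) (F : Conf A → ℝ), Continuous F → ∫ x, P.gm V F x ∂μ = ∫ x, F x ∂μ) :
    IsGibbsPot P μ := by
  refine ⟨inferInstance, fun V _ ζ => ?_⟩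
  set f : (V → A) → Conf A → ℝ := fun ζ x => potPhi P V (ov x V ζ) with hf
  have hf0 : ∀ ζ x, 0 ≤ f ζ x := fun ζ x => (potPhi_pos V _).le
  have hfc : ∀ ζ, Continuous (f ζ) := fun ζ => (continuous_potPhi hs V).comp (continuous_ov V ζ)
  have hfm : ∀ ζ, Measurable (f ζ) := fun ζ => (hfc ζ).measurable
  have hf1 : ∀ ζ x, f ζ x ≤ 1 := fun ζ x => by
    rw [← sum_potPhi (P := P) V x]
    exact single_le_sum (fun ζ _ => hf0 ζ x) (Finset.mem_univ ζ)
  have hfi : ∀ ζ, Integrable (f ζ) μ := fun ζ => .of_bound (hfm ζ).aestronglyMeasurable 1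
    (.of_forall fun x => by rw [Real.norm_eq_abs, abs_of_nonneg (hf0 ζ x)]; exact hf1 ζ x)
  set ν : Measure (Conf A) := ∑ ζ, (μ.withDensity fun x => ENNReal.ofReal (f ζ x)).map fun x => ov x V ζ
    with hν
  have hνa : ∀ s : Set (Conf A), MeasurableSet s → ν s =
      ENNReal.ofReal (∑ ζ, ∫ x in {x | ov x V ζ ∈ s}, f ζ x ∂μ) := fun s hms => by
    rw [hν, Measure.finsetSum_apply, ENNReal.ofReal_sum_of_nonneg fun ζ _ => integral_nonneg (hf0 ζ)]
    refine sum_congr rfl fun ζ _ => ?_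
    rw [Measure.map_apply (measurable_ov V ζ) hms, withDensity_apply _ (measurable_ov V ζ hms),
      ofReal_integral_eq_lintegral_ofReal (hfi ζ).integrableOn (.of_forall (hf0 ζ))]
    rfl
  have hνi : ∀ s : Set (Conf A), MeasurableSet s →
      ∑ ζ, ∫ x in {x | ov x V ζ ∈ s}, f ζ x ∂μ = ∫ x, P.gm V (s.indicator fun _ => 1) x ∂μ :=
    fun s hms => by
      have e : ∀ x, P.gm V (s.indicator fun _ => 1) x =
          ∑ ζ, {x | ov x V ζ ∈ s}.indicator (f ζ) x := fun x => by
        rw [gm_eq_sum]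
        refine sum_congr rfl fun ζ _ => ?_
        by_cases hx : ov x V ζ ∈ s
        · rw [indicator_of_mem hx, indicator_of_mem (show x ∈ {x | ov x V ζ ∈ s} from hx), mul_one]
        · rw [indicator_of_notMem hx, indicator_of_notMem (show x ∉ {x | ov x V ζ ∈ s} from hx),
            mul_zero]
      simp only [e]
      have hmv : ∀ ζ, MeasurableSet {x | ov x V ζ ∈ s} := fun ζ => measurable_ov V ζ hms
      rw [integral_finsetSum _ fun ζ _ => (hfi ζ).indicator (hmv ζ)]
      exact sum_congr rfl fun ζ _ => (integral_indicator (hmv ζ)).symm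
  have hloc : ∀ (I : Finset ℤ) (s : Set (Conf A)), Dep (I : Set ℤ) (· ∈ s) → ν s = μ s :=
    fun I s hd => by
      have hc : Continuous (s.indicator fun _ => (1 : ℝ)) := by
        exact Dep.continuous (hd.indicator)
      rw [hνa s hd.measurableSet, hνi s hd.measurableSet, h V _ hc,
        integral_indicator_const _ hd.measurableSet, smul_eq_mul, mul_one, ofReal_measureReal]
  have hνp : IsProbabilityMeasure ν := ⟨by
    rw [hloc ∅ univ fun _ _ _ => rfl]; exact measure_univ⟩
  have hνμ : ν = μ := ext_of_pr_rs fun I a => by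
    rw [pr, pr, Measure.real, Measure.real, hloc I]
    exact fun x y hxy => by simp only [mem_preimage, dep_rs I x y hxy]
  have hcyl : MeasurableSet (cylEvent V ζ) := (dep_cylEvent V ζ).measurableSet
  refine ae_eq_condExp_of_forall_setIntegral_eq (cylSA_le _)
    ((integrable_const 1).indicator hcyl) (fun _ _ _ => (hfi ζ).integrableOn) (fun s hms _ => ?_) ?_
  · have hsm := cylSA_le _ s hms
    obtain ⟨t, -, rfl⟩ := hms
    have hov : ∀ (x : Conf A) ζ', ((V : Set ℤ)ᶜ).domRestrict (ov x V ζ') =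
        ((V : Set ℤ)ᶜ).domRestrict x := fun x ζ' => funext fun i => ov_of_notMem i.2
    rw [setIntegral_indicator hcyl, integral_const, smul_eq_mul, mul_one, measureReal_restrict_apply_univ]
    nth_rw 2 [← hνμ]
    rw [Measure.real, hνa _ (hsm.inter hcyl), ENNReal.toReal_ofReal
      (sum_nonneg fun ζ _ => integral_nonneg (hf0 ζ)), Finset.sum_eq_single ζ]
    · congr 2
      ext x
      exact ⟨fun hx => ⟨(iff_of_eq (congrArg (· ∈ t) (hov x ζ))).2 hx, fun i => ov_of_mem i.2⟩,
        fun hx => (iff_of_eq (congrArg (· ∈ t) (hov x ζ))).1 hx.1⟩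
    · intro ζ' _ hne
      rw [show {x | ov x V ζ' ∈ _ ∩ cylEvent V ζ} = (∅ : Set (Conf A)) from
        eq_empty_of_forall_notMem fun x hx => hne (funext fun i => by
          rw [← hx.2 i, ov_of_mem i.2]), setIntegral_empty]
    · simp
  · obtain ⟨x₀⟩ : Nonempty (Conf A) := inferInstance
    refine (Measurable.stronglyMeasurable ?_).aestronglyMeasurable
    have e : (fun x => potPhi P V (ov x V ζ)) = (fun y : ((V : Set ℤ)ᶜ : Set ℤ) → A =>
        f ζ fun i => if hi : i ∈ V then x₀ i else y ⟨i, hi⟩) ∘ ((V : Set ℤ)ᶜ).domRestrict :=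
      funext fun x => by
        simp only [hf, Function.comp_apply]
        rw [ov_congr]
        intro i hi
        simp [hi]
    rw [e]
    refine Measurable.comp ((hfm ζ).comp (measurable_pi_lambda _ fun i => ?_))
      (comap_measurable _)
    by_cases hi : i ∈ V
    · simp only [hi, dite_true]; exact measurable_const
    · simp only [hi, dite_false]; exact measurable_pi_apply _

theorem exists_isGibbsPot (hs : NormSummable P) : ∃ μ, IsGibbsPot P μ := by
  obtain ⟨x⟩ : Nonempty (Conf A) := inferInstance
  set V : ℕ → Finset ℤ := fun n => Finset.Icc (-(n : ℤ)) n
  set m : ℕ → Measure (Conf A) := fun n => ∑ ζ, ENNReal.ofReal (potPhi P (V n) (ov x (V n) ζ)) •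
    Measure.dirac (ov x (V n) ζ) with hm
  have hm1 : ∀ n, IsProbabilityMeasure (m n) := fun n => ⟨by
    simp only [hm, Measure.finsetSum_apply, Measure.smul_apply, measure_univ, smul_eq_mul, mul_one]
    rw [← ENNReal.ofReal_sum_of_nonneg fun _ _ => (potPhi_pos _ _).le, sum_potPhi, ENNReal.ofReal_one]⟩
  have hmi : ∀ n (F : Conf A → ℝ), ∫ z, F z ∂m n = P.gm (V n) F x := fun n F => by
    rw [hm, integral_finsetSum_measure fun ζ _ =>
      (integrable_dirac (by simp)).smul_measure ENNReal.ofReal_ne_top, gm_eq_sum]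
    refine sum_congr rfl fun ζ _ => ?_
    rw [integral_smul_measure, integral_dirac, ENNReal.toReal_ofReal (potPhi_pos _ _).le, smul_eq_mul]
  let f : ℕ → ProbabilityMeasure (Conf A) := fun n => ⟨m n, hm1 n⟩
  obtain ⟨μ, -, hμ⟩ := isCompact_univ.ultrafilter_le_nhds ((hyperfilter ℕ).map f) (by simp)
  have ht : Tendsto f (hyperfilter ℕ) (nhds μ) := hμ
  have hlim : ∀ F : Conf A → ℝ, Continuous F →
      Tendsto (fun n => P.gm (V n) F x) (hyperfilter ℕ) (nhds (∫ z, F z ∂(μ : Measure (Conf A)))) :=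
    fun F hF => by
      exact (ProbabilityMeasure.tendsto_iff_forall_integral_tendsto.1 ht
        (.mkOfCompact ⟨F, hF⟩)).congr fun n => hmi n F
  refine ⟨μ, isGibbsPot_of_integral_gm hs fun W F hF => ?_⟩
  have hg : Continuous (P.gm W F) := by
    rw [funext (gm_eq_sum W F)]
    exact continuous_finsetSum _ fun ζ _ => ((continuous_potPhi hs W).comp (continuous_ov W ζ)).mul
      (hF.comp (continuous_ov W ζ))
  refine tendsto_nhds_unique ((hlim _ hg).congr' ?_) (hlim F hF)
  obtain ⟨M, -, hM⟩ := exists_subset_Icc W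
  filter_upwards [(exhausts_Icc M).filter_mono Nat.hyperfilter_le_atTop] with n hn
  exact gm_gm hs (hM.trans hn) F x

/-! ### Gibbs states as limits of finite-volume averages -/

lemma integral_gm_indicator {μ : Measure (Conf A)} (hμ : IsGibbsPot P μ) {V : Finset ℤ}
    (hV : V.Nonempty) {D : Set (Conf A)} (hD : Dep (V : Set ℤ) (· ∈ D)) :
    Integrable (P.gm V (D.indicator fun _ => 1)) μ ∧
      ∫ x, P.gm V (D.indicator fun _ => 1) x ∂μ = μ.real D := by
  classical
  have := hμ.1
  obtain ⟨x₀⟩ : Nonempty (Conf A) := inferInstance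
  have hrs : ∀ ζ : V → A, cylEvent V ζ = rs V ⁻¹' {ζ} := fun ζ => by
    ext x; exact funext_iff.symm
  have hi : ∀ ζ : V → A, Integrable (fun x => potPhi P V (ov x V ζ)) μ := fun ζ =>
    integrable_condExp.congr (hμ.2 V hV ζ).symm
  have h1 : ∀ ζ : V → A, ∫ x, potPhi P V (ov x V ζ) ∂μ = pr μ (rs V) ζ := fun ζ => by
    rw [integral_congr_ae (hμ.2 V hV ζ), integral_condExp (cylSA_le _), hrs,
      integral_indicator_const _ (finMeas_rs V ζ), smul_eq_mul, mul_one, pr]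
  have e : P.gm V (D.indicator fun _ => 1) = fun x => ∑ ζ : V → A,
      potPhi P V (ov x V ζ) * D.indicator (fun _ => 1) (ov x₀ V ζ) := funext fun x => by
    rw [gm_eq_sum]
    refine sum_congr rfl fun ζ _ => congrArg _ (hD.indicator _ _ fun i hi => ?_)
    rw [ov_of_mem hi, ov_of_mem hi]
  have hi' := fun ζ : V → A => (hi ζ).mul_const (D.indicator (fun _ => (1 : ℝ)) (ov x₀ V ζ))
  rw [e]
  refine ⟨integrable_finsetSum _ fun ζ _ => hi' ζ, ?_⟩
  rw [integral_finsetSum _ fun ζ _ => hi' ζ]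
  have hD' : D = rs V ⁻¹' {ζ | ov x₀ V ζ ∈ D} := Set.ext fun x =>
    iff_of_eq (hD _ _ fun i hi => (ov_of_mem (x := x₀) (ζ := rs V x) hi).symm)
  conv_rhs => rw [hD', measureReal_preimage (finMeas_rs V)]
  refine sum_congr rfl fun ζ _ => ?_
  rw [integral_mul_const, h1, indicator_apply, mul_ite, mul_one, mul_zero]
  rfl

lemma tendsto_infl (hD : Summable fun n : ℕ => P.infl n / n) : Tendsto P.infl atTop (nhds 0) := by
  have hb : BddBelow (range P.infl) := ⟨0, by rintro _ ⟨n, rfl⟩; exact infl_nonneg n⟩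
  have h := tendsto_atTop_ciInf (infl_antitone (P := P)) hb
  have h0 : ⨅ n, P.infl n = 0 := by
    refine ((Real.iInf_nonneg infl_nonneg).eq_or_lt).elim Eq.symm fun hpos => ?_
    refine (Real.not_summable_one_div_natCast ((hD.mul_left (⨅ n, P.infl n)⁻¹).of_nonneg_of_le
      (fun n => by positivity) fun n => ?_)).elim
    rw [← mul_div_assoc]
    refine div_le_div_of_nonneg_right ?_ n.cast_nonneg
    rw [le_inv_mul_iff₀ hpos, mul_one]
    exact ciInf_le hb n
  rwa [h0] at h

/-- An exhaustion of the integers by finite volumes. -/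
def Exhausts (V : ℕ → Finset ℤ) : Prop := ∀ M : ℤ, ∀ᶠ n in atTop, Finset.Icc (-M) M ⊆ V n

lemma tendsto_gm (hs : NormSummable P) (hI : Tendsto P.infl atTop (nhds 0)) {μ : Measure (Conf A)}
    (hμ : IsGibbsPot P μ) {E : Finset ℤ} {D : Set (Conf A)} (hD : Dep (E : Set ℤ) (· ∈ D))
    {V : ℕ → Finset ℤ} (hV : Exhausts V) (x : ℕ → Conf A) :
    Tendsto (fun n => P.gm (V n) (D.indicator fun _ => 1) (x n)) atTop (nhds (μ.real D)) := by
  have := hμ.1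
  refine Metric.tendsto_nhds.2 fun ε hε => ?_
  have h0 := hI.const_mul (E.card : ℝ)
  rw [mul_zero] at h0
  obtain ⟨N, hN⟩ := (h0.eventually_lt_const hε).exists
  obtain ⟨M, hM0, hM⟩ := exists_subset_Icc E
  filter_upwards [hV (M + N)] with n hn
  have hin : ∀ e ∈ E, ∀ i : ℤ, e - N ≤ i → i ≤ e + N → i ∈ V n := fun e he i h1 h2 => by
    have := Finset.mem_Icc.1 (hM he)
    exact hn (Finset.mem_Icc.2 ⟨by omega, by omega⟩)
  have hsub : (E : Set ℤ) ⊆ V n := fun e he => hin e he e (by omega) (by omega)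
  have hle : ∀ y z, P.gm (V n) (D.indicator fun _ => 1) y - P.gm (V n) (D.indicator fun _ => 1) z ≤
      E.card * P.infl N := fun y z =>
    (gm_sub_le_sum_infl hs (fun _ => N) hD.indicator (fun w => ⟨indicator_nonneg (by simp) w,
      indicator_le_self' (by simp) w⟩) fun e he i h1 h2 h3 => (h3 (hin e he i h1 h2)).elim).trans_eq
      (by rw [sum_const, nsmul_eq_mul])
  obtain ⟨hi, h⟩ := integral_gm_indicator hμ ⟨0, hn (Finset.mem_Icc.2 ⟨by omega, by omega⟩)⟩
    (hD.mono hsub)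
  rw [dist_comm, Real.dist_eq, ← h]
  have h2 := norm_integral_le_of_norm_le_const (μ := μ) (f := fun z =>
    P.gm (V n) (D.indicator fun _ => 1) z - P.gm (V n) (D.indicator fun _ => 1) (x n))
    (C := E.card * P.infl N) (.of_forall fun z => abs_sub_le_iff.2 ⟨hle _ _, hle _ _⟩)
  rw [integral_sub hi (integrable_const _), integral_const] at h2
  simp only [probReal_univ, smul_eq_mul, one_mul, mul_one, Real.norm_eq_abs] at h2
  exact h2.trans_lt hN

lemma dep_rs_preimage (I : Finset ℤ) (a : I → A) : Dep (I : Set ℤ) (· ∈ rs (A := A) I ⁻¹' {a}) :=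
  fun x y h => by simp only [mem_preimage, dep_rs I x y h]

lemma eq_of_isGibbsPot (hs : NormSummable P) (hI : Tendsto P.infl atTop (nhds 0))
    {μ ν : Measure (Conf A)} (hμ : IsGibbsPot P μ) (hν : IsGibbsPot P ν) : ν = μ := by
  have := hμ.1
  have := hν.1
  obtain ⟨x⟩ : Nonempty (Conf A) := inferInstance
  exact ext_of_pr_rs fun I a => tendsto_nhds_unique
    (tendsto_gm hs hI hν (dep_rs_preimage I a) exhausts_Icc fun _ => x)
    (tendsto_gm hs hI hμ (dep_rs_preimage I a) exhausts_Icc fun _ => x)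

lemma hPot_shift (n : ℤ) (V : Finset ℤ) (x : Conf A) :
    HPot P (V.image fun i => n + i) x = HPot P V (shift n x) := by
  rw [hPot_eq, hPot_eq, Potential.en, Potential.en, ← (Equiv.addLeft n).finsetCongr.tsum_eq]
  refine tsum_congr fun K => ?_
  have e : (Equiv.addLeft n).finsetCongr K = K.image fun i => n + i := by
    ext; simp [Equiv.finsetCongr_apply]
  have hK : K.image (fun i => n + i) ∈ Hit ((V.image fun i => n + i : Finset ℤ) : Set ℤ) ↔
      K ∈ Hit (V : Set ℤ) := by
    simp only [Hit, Set.mem_ofPred_eq, Finset.mem_coe, Finset.mem_image]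
    constructor
    · rintro ⟨_, ⟨i, hi, rfl⟩, j, hj, h⟩
      exact ⟨i, hi, add_left_cancel h ▸ hj⟩
    · rintro ⟨i, hi, hV⟩
      exact ⟨_, ⟨i, hi, rfl⟩, i, hV, rfl⟩
  rw [e]
  by_cases h : K ∈ Hit (V : Set ℤ)
  · rw [indicator_of_mem (hK.2 h), indicator_of_mem h]
    obtain ⟨i, hi, -⟩ := h
    exact P.invariant n K ⟨i, hi⟩ x
  · rw [indicator_of_notMem (mt hK.1 h), indicator_of_notMem h]

lemma gm_shift (n : ℤ) (V : Finset ℤ) (F : Conf A → ℝ) (x : Conf A) :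
    P.gm (V.image fun i => n + i) (fun z => F (shift n z)) x = P.gm V F (shift n x) := by
  have hV : ∀ i, i ∈ V ↔ n + i ∈ V.image fun i => n + i := fun i => by simp
  have key : ∀ Q : Conf A → ℝ,
      sm (V.image fun i => n + i) (fun z => Q (shift n z)) x = sm V Q (shift n x) := fun Q => by
    refine Fintype.sum_equiv (((Equiv.addLeft n).subtypeEquiv hV).symm.arrowCongr (Equiv.refl A))
      _ _ fun ζ => congrArg Q (funext fun i => ?_)
    by_cases hi : i ∈ V
    · have hi' : i + n ∈ V.image fun i => n + i := by rw [add_comm]; exact (hV i).1 hi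
      rw [ov_of_mem hi, GibbsFormal.shift, ov_of_mem hi']
      exact congrArg ζ (Subtype.ext (add_comm i n))
    · have hi' : i + n ∉ V.image fun i => n + i := by rw [add_comm]; exact mt (hV i).2 hi
      rw [ov_of_notMem hi, GibbsFormal.shift, ov_of_notMem hi']
      rfl
  have hb : P.bw (V.image fun i => n + i) = fun z => P.bw V (shift n z) := funext fun z => by
    rw [bw, hPot_shift, bw]
  rw [gm, gm, hb]
  exact congrArg₂ (· / ·) (key fun z => P.bw V z * F z) (key (P.bw V))

lemma inv_of_isGibbsPot (hs : NormSummable P) (hI : Tendsto P.infl atTop (nhds 0))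
    {μ : Measure (Conf A)} (hμ : IsGibbsPot P μ) : Inv μ := by
  have := hμ.1
  obtain ⟨x⟩ : Nonempty (Conf A) := inferInstance
  refine inv_of_pr_rs fun I a => tendsto_nhds_unique ?_
    (tendsto_gm hs hI hμ (dep_rs_preimage I a) exhausts_Icc fun _ => shift 1 x)
  refine (tendsto_gm hs hI hμ (E := I.image (· + 1)) (D := (fun x => rs I (shift 1 x)) ⁻¹' {a})
    (V := fun k => (Finset.Icc (-(k : ℤ)) k).image fun i => 1 + i) (fun y z h => ?_) (fun M => ?_)
    fun _ => x).congr fun k => gm_shift 1 _ _ x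
  · simp only [mem_preimage]
    rw [rs_eq_iff.2 fun i hi => ?_]
    exact h _ (by simpa using hi)
  · filter_upwards [exhausts_Icc (M + 1)] with k hk i hi
    rw [Finset.mem_Icc] at hi
    exact Finset.mem_image.2 ⟨i - 1, hk (Finset.mem_Icc.2 ⟨by omega, by omega⟩), by omega⟩

end Potential

/-! ### Mixing and entropy of the Gibbs state -/

lemma Dep.refl_preimage {I : Finset ℤ} {s : Set (Conf A)} (h : Dep (I : Set ℤ) (· ∈ s)) :
    Dep ((I.image Neg.neg : Finset ℤ) : Set ℤ) (· ∈ refl ⁻¹' s) := fun _ _ hxy =>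
  h _ _ fun i hi => hxy (-i) (Finset.mem_coe.2 (Finset.mem_image_of_mem _ hi))

lemma map_refl_real {μ : Measure (Conf A)} {I : Finset ℤ} {s : Set (Conf A)}
    (h : Dep (I : Set ℤ) (· ∈ s)) : (μ.map refl).real s = μ.real (refl ⁻¹' s) :=
  map_measureReal_apply measurable_refl h.measurableSet

namespace Potential

variable {P : Potential A}

lemma abs_gm_mul_sub_le {V : Finset ℤ} {x : Conf A} {p G : Conf A → ℝ} {κ ε : ℝ} (hp : ∀ z, 0 ≤ p z)
    (hG : ∀ ζ, |G (ov x V ζ) - κ| ≤ ε) :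
    |P.gm V (fun z => p z * G z) x - κ * P.gm V p x| ≤ ε * P.gm V p x := by
  have h := fun ζ => abs_sub_le_iff.1 (hG ζ)
  have h1 : P.gm V (fun z => p z * G z) x ≤ P.gm V (fun z => (κ + ε) * p z) x := gm_mono fun ζ => by
    nlinarith [hp (ov x V ζ), h ζ]
  have h2 : P.gm V (fun z => (κ - ε) * p z) x ≤ P.gm V (fun z => p z * G z) x := gm_mono fun ζ => by
    nlinarith [hp (ov x V ζ), h ζ]
  rw [gm_const_mul] at h1 h2
  exact abs_sub_le_iff.2 ⟨by linarith, by linarith⟩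

lemma um_map_refl (hs : NormSummable P) (hI : Tendsto P.infl atTop (nhds 0))
    (hT : ∀ ε > 0, ∃ N, P.IsTail N ε) {μ : Measure (Conf A)} (hμ : IsGibbsPot P μ) :
    UM (μ.map refl) := by
  intro δ hδ
  obtain ⟨g, hg⟩ := hT (δ / 2) (half_pos hδ)
  obtain ⟨x⟩ : Nonempty (Conf A) := inferInstance
  refine ⟨g, fun k m B C hB hC => ?_⟩
  rw [← Finset.coe_Ico] at hB hC
  have hB' := hB.refl_preimage
  have hC' := hC.refl_preimage
  have hBC : Dep ((Finset.Ico (-(k : ℤ)) 0 ∪ Finset.Ico (g : ℤ) (g + m) : Finset ℤ) : Set ℤ)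
      (· ∈ B ∩ C) := fun y z h => by
    rw [Finset.coe_union] at h
    exact congrArg₂ And (hB y z fun i hi => h i (.inl hi)) (hC y z fun i hi => h i (.inr hi))
  rw [map_refl_real hB, map_refl_real hC, map_refl_real hBC]
  have lB := tendsto_gm hs hI hμ hB' exhausts_Icc fun _ => x
  have lC := tendsto_gm hs hI hμ hC' exhausts_Icc fun _ => x
  have lBC := tendsto_gm hs hI hμ hBC.refl_preimage exhausts_Icc fun _ => x
  refine le_of_tendsto_of_tendsto' (lBC.sub (lB.mul lC)).abs (lB.const_mul δ) fun n => ?_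
  set V := Finset.Icc (-(n : ℤ)) n
  set U := Finset.Icc (-(n : ℤ)) 0
  have hUV : U ⊆ V := Finset.Icc_subset_Icc_right n.cast_nonneg
  set p : Conf A → ℝ := (refl ⁻¹' B).indicator fun _ => 1
  set F : Conf A → ℝ := (refl ⁻¹' C).indicator fun _ => 1
  have hp : ∀ z, 0 ≤ p z := fun z => indicator_nonneg (by simp) z
  have hF : ∀ z, F z ∈ Icc (0 : ℝ) 1 := fun z =>
    ⟨indicator_nonneg (by simp) z, indicator_le_self' (by simp) z⟩
  have hFd : Dep (Iic ((0 : ℤ) - g)) F := hC'.indicator.mono fun i hi => by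
    simp only [Finset.coe_image, mem_image, Finset.coe_Ico, mem_Ico] at hi
    obtain ⟨j, hj, rfl⟩ := hi
    exact mem_Iic.2 (by omega)
  have ht : ∀ ζ, |P.gm U F (ov x V ζ) - P.gm U F x| ≤ δ / 2 := fun ζ => by
    have e : ∀ i ≤ 0, i ∉ U → ov x V ζ i = x i := fun i hi hU => ov_of_notMem fun h =>
      hU (Finset.mem_Icc.2 ⟨(Finset.mem_Icc.1 h).1, hi⟩)
    exact abs_sub_le_iff.2 ⟨hg 0 U _ _ F e hFd hF,
      hg 0 U _ _ F (fun i hi hU => (e i hi hU).symm) hFd hF⟩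
  have h1 := abs_gm_mul_sub_le (P := P) hp ht
  have h2 := abs_gm_mul_sub_le (P := P) (p := fun _ => 1) (fun _ => zero_le_one) ht
  have e1 : P.gm V ((refl ⁻¹' (B ∩ C)).indicator fun _ => 1) x =
      P.gm V (fun z => p z * P.gm U F z) x := by
    rw [← gm_gm hs hUV]
    congr 1
    funext z
    rw [← gm_mul (G := p) (fun ζ => hB'.indicator _ _ fun i hi => ov_of_notMem fun h => ?_)]
    · congr 1
      funext z
      rw [preimage_inter]
      simpa using inter_indicator_mul (fun _ => (1 : ℝ)) (fun _ => 1) z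
    · simp only [Finset.coe_image, mem_image, Finset.coe_Ico, mem_Ico] at hi
      obtain ⟨j, hj, rfl⟩ := hi
      have := (Finset.mem_Icc.1 h).2
      omega
  simp only [one_mul, gm_const, mul_one] at h2
  rw [gm_gm hs hUV] at h2
  have hp0 : 0 ≤ P.gm V p x := gm_nonneg fun ζ => hp _
  have h3 := mul_le_mul_of_nonneg_left h2 hp0
  rw [← abs_of_nonneg hp0, ← abs_mul, abs_of_nonneg hp0] at h3
  rw [e1]
  calc _ = |(P.gm V (fun z => p z * P.gm U F z) x - P.gm U F x * P.gm V p x) -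
        P.gm V p x * (P.gm V F x - P.gm U F x)| := by congr 1; ring
    _ ≤ _ := (abs_sub _ _).trans (by linarith)

lemma exists_gm_le [Nontrivial A] [DecidableEq A] (hs : NormSummable P) :
    ∃ q, 0 < q ∧ q < 1 ∧ ∀ (e : ℤ) (a : A) (x : Conf A),
      P.gm {e} (fun z => if z e = a then 1 else 0) x ≤ q := by
  have hT := exp_pos (-varTail P 0)
  refine ⟨1 / (1 + exp (-varTail P 0)), by positivity,
    (div_lt_one (by positivity)).2 (by linarith), fun e a x => ?_⟩
  obtain ⟨b, hb⟩ := exists_ne a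
  have key : ∀ c, P.gm {e} (fun z => if z e = c then 1 else 0) x =
      potPhi P {e} (ov x {e} fun _ => c) := fun c => by
    rw [gm_eq_sum, Fintype.sum_eq_single fun _ => c, ov_of_mem (Finset.mem_singleton_self e),
      if_pos rfl, mul_one]
    intro ζ hζ
    rw [ov_of_mem (Finset.mem_singleton_self e), if_neg, mul_zero]
    rintro rfl
    exact hζ (funext fun i => congrArg ζ (Subtype.ext (Finset.mem_singleton.1 i.2)))
  have hle : P.gm {e} (fun z => if z e = a then 1 else 0) x +
      P.gm {e} (fun z => if z e = b then 1 else 0) x ≤ 1 := by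
    rw [← gm_add]
    refine (gm_mono (G := fun _ => 1) fun ζ => ?_).trans_eq (gm_const _ _ _)
    split_ifs with h h' <;> simp_all
  have hH := (abs_sub_le_iff.1 (en_sub_le hs (V := {e}) subset_rfl (x := ov x {e} fun _ => b)
    (y := ov x {e} fun _ => a) (varTail_nonneg 0) (by
      rw [← tail_eq hs, ← P.transInv_pv.tail e]
      refine wt_mono fun K ⟨⟨i, hi, h⟩, _⟩ => ?_
      obtain rfl : i = e := by simpa using h
      exact ⟨hi, i, hi, by simp⟩))).1
  rw [← hPot_eq, ← hPot_eq] at hH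
  rw [key, key] at hle
  have hba : exp (-varTail P 0) * potPhi P {e} (ov x {e} fun _ => a) ≤
      potPhi P {e} (ov x {e} fun _ => b) := by
    have h0 := sm_bw_pos (P := P) {e} x
    have h : ∀ ζ, potPhi P {e} (ov x {e} ζ) = P.bw {e} (ov x {e} ζ) / sm {e} (P.bw {e}) x :=
      fun ζ => by rw [← sm_ov {e} _ x ζ]; rfl
    rw [h, h, ← mul_div_assoc, bw, bw, ← exp_add]
    exact div_le_div_of_nonneg_right (Real.exp_le_exp.2 (by linarith)) h0.le
  rw [key, le_div_iff₀ (by positivity)]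
  linarith

lemma gm_prod_le [DecidableEq A] (hs : NormSummable P) {q : ℝ} (hq : 0 < q)
    (h : ∀ (e : ℤ) (a : A) (x : Conf A), P.gm {e} (fun z => if z e = a then 1 else 0) x ≤ q)
    (b x : Conf A) {V : Finset ℤ} (J : Finset ℤ) (hJ : J ⊆ V) :
    P.gm V (fun z => ∏ i ∈ J, if z i = b i then 1 else 0) x ≤ q ^ J.card := by
  induction J using Finset.induction_on with
  | empty => simp [gm_const]
  | insert e J he ih =>
    have hp : ∀ z : Conf A, (0 : ℝ) ≤ ∏ i ∈ J, if z i = b i then 1 else 0 := fun z =>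
      Finset.prod_nonneg fun i _ => by split_ifs <;> simp
    rw [Finset.card_insert_of_notMem he, pow_succ', ← gm_gm hs (U := {e}) fun i hi =>
      hJ (Finset.mem_singleton.1 hi ▸ Finset.mem_insert_self e J)]
    refine le_trans ?_ (mul_le_mul_of_nonneg_left
      (ih ((Finset.subset_insert e J).trans hJ)) hq.le)
    rw [← gm_const_mul]
    refine gm_mono fun ζ => ?_
    have : ∀ z : Conf A, (∏ i ∈ insert e J, if z i = b i then (1 : ℝ) else 0) =
        (∏ i ∈ J, if z i = b i then 1 else 0) * if z e = b e then 1 else 0 := fun z => by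
      rw [Finset.prod_insert he, mul_comm]
    simp only [this]
    rw [gm_mul (G := fun z => ∏ i ∈ J, if z i = b i then 1 else 0) fun η =>
      Finset.prod_congr rfl fun i hi => by rw [ov_of_notMem (by simpa using ne_of_mem_of_not_mem hi he)],
      mul_comm]
    exact mul_le_mul_of_nonneg_right (h _ _ _) (hp _)

lemma hrate_map_refl_pos [Nontrivial A] (hs : NormSummable P) (hI : Tendsto P.infl atTop (nhds 0))
    {μ : Measure (Conf A)} (hμ : IsGibbsPot P μ) (hi : Inv (μ.map refl)) :
    0 < hrate (μ.map refl) := by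
  classical
  have := hμ.1
  have := Measure.isProbabilityMeasure_map (μ := μ) (measurable_refl (A := A)).aemeasurable
  obtain ⟨q, hq0, hq1, hq⟩ := exists_gm_le hs
  obtain ⟨x⟩ : Nonempty (Conf A) := inferInstance
  have hpr : ∀ (I : Finset ℤ) (a : I → A), pr (μ.map refl) (rs I) a ≤ q ^ I.card := fun I a => by
    rw [pr, map_refl_real (dep_rs_preimage I a)]
    have hd := (dep_rs_preimage I a).refl_preimage
    obtain ⟨M, -, hM⟩ := exists_subset_Icc (I.image Neg.neg)
    refine le_of_tendsto (tendsto_gm hs hI hμ hd exhausts_Icc fun _ => x) ?_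
    filter_upwards [exhausts_Icc M] with n hn
    rw [← Finset.card_image_of_injective I neg_injective]
    refine le_of_eq_of_le ?_ (gm_prod_le hs hq0 hq (refl (ov x I a)) x _ (hM.trans hn))
    congr 1
    funext z
    rw [Finset.prod_ite_zero, Finset.prod_const_one, indicator_apply]
    refine if_congr ?_ rfl rfl
    rw [mem_preimage, mem_preimage, mem_singleton_iff, funext_iff]
    simp only [Finset.forall_mem_image, refl, neg_neg, Subtype.forall]
    exact forall₂_congr fun i hi => by rw [ov_of_mem hi]; rfl
  refine (neg_pos.2 (Real.log_neg hq0 hq1)).trans_le (hi.le_hrate (C := 0) fun k => ?_)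
  rw [sub_zero, Hw, GibbsFormal.ent, ← mul_one ((k : ℝ) * _), ← sum_pr (μ := μ.map refl)
    (finMeas_rs (A := A) (Finset.Ico 0 (k : ℤ))), mul_sum]
  refine sum_le_sum fun a _ => ?_
  rcases (pr_nonneg (μ.map refl) (rs (Finset.Ico (0 : ℤ) k)) a).eq_or_lt with h | h
  · simp [← h]
  · have h1 := Real.log_le_log h (hpr _ a)
    rw [Real.log_pow, Int.card_Ico, sub_zero, Int.toNat_natCast] at h1
    rw [negMulLog]
    nlinarith

lemma exists_uniqueness_data (hs : NormSummable P) {β : ℝ} (hβ : β < 1 / 2) {a : ℕ → ℝ}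
    (ha : ∀ n, 0 ≤ a n) (hsum : Summable a)
    (hr : ∀ n : ℕ, 1 ≤ n → varTail P n ≤ β / n + a n) :
    Tendsto P.infl atTop (nhds 0) ∧ ∀ ε > 0, ∃ N, P.IsTail N ε := by
  have hC : ∀ n : ℕ, 1 ≤ n → varTail P n ≤ (4 * max β 0 + 2 * ∑' n, a n) / n := fun n =>
    Antitone.le_div_of_le_add (varTail_antitone hs) (le_max_right _ _) ha hsum fun m hm =>
      (hr m hm).trans (by gcongr; exact le_max_left _ _)
  have hC0 : 0 ≤ 4 * max β 0 + 2 * ∑' n, a n := by simpa using (varTail_nonneg 1).trans (hC 1 le_rfl)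
  obtain ⟨c, hc, hR⟩ := exists_right_comparison hs hβ ha hsum hr
  have hK : P.CentreComp (c * (exp (-(30 * _)) * c)) := fun V t M x y F hM hV hxy hF hFd =>
    RightComp.two_sided hs hR hc hC0 hC hM hV hxy hF hFd
  have hD := summable_of_scale infl_nonneg infl_antitone (mul_nonneg (by norm_num : (0 : ℝ) ≤ 36) hC0)
    (sub_nonneg.2 hK.le_one) (sub_lt_self 1 (by positivity)) fun N s hN h2 =>
      have h := hK.isInfl hs hC0 hC hN h2 (isInfl_infl N)
      infl_le (add_nonneg (by positivity) (mul_nonneg (sub_nonneg.2 hK.le_one) (infl_nonneg N))) h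
  exact ⟨tendsto_infl hD, fun ε => exists_isTail hs (summable_infl_mul hC hD)⟩

end Potential

lemma isBernoulliSystem_of_subsingleton [Subsingleton A] (μ : Measure (Conf A))
    [IsProbabilityMeasure μ] : IsBernoulliSystem μ := by
  obtain ⟨x⟩ : Nonempty (Conf A) := inferInstance
  refine ⟨1, fun _ => 1, .dirac fun _ => 0, inferInstance, by simp, fun Λ ζ => ?_, fun _ _ => 0,
    fun _ => x, measurable_const, measurable_const, by simp [Measure.map_const],
    .of_forall fun _ => rfl, .of_forall fun _ => Subsingleton.elim _ _,
    .of_forall fun _ => Subsingleton.elim _ _⟩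
  have : {y : ℤ → Fin 1 | ∀ i : Λ, y i = ζ i} = univ := eq_univ_of_forall fun _ _ =>
    Subsingleton.elim _ _
  rw [this]; simp

end Gibbs

/-- **Theorem 1.2.**  A `T`-invariant interaction potential with summable norms whose
tail variations satisfy `∑_{Λ∋0, Λ∩[n,∞)≠∅} var(Φ_Λ) ≤ β/n + a_n` for some `β < 1/2`
and summable nonnegative `(a_n)` has a unique Gibbs state, which is shift-invariant
and Bernoulli. -/
theorem unique_bernoulli_gibbs_of_potential
    {S : Type} [Fintype S] [Nonempty S] [DecidableEq S]
    [TopologicalSpace S] [DiscreteTopology S]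
    [MeasurableSpace S] [MeasurableSingletonClass S]
    (P : Potential S) (hsum : NormSummable P)
    (β : ℝ) (hβ : β < 1 / 2) (a : ℕ → ℝ) (ha : ∀ n, 0 ≤ a n) (hasum : Summable a)
    (hbound : ∀ n : ℕ, 1 ≤ n → varTail P n ≤ β / (n : ℝ) + a n) :
    ∃ μ : Measure (Conf S), IsGibbsPot P μ ∧
      (∀ ν : Measure (Conf S), IsGibbsPot P ν → ν = μ) ∧
      μ.map (shift 1) = μ ∧ IsBernoulliSystem μ := by
  obtain ⟨hI, hT⟩ := Potential.exists_uniqueness_data hsum hβ ha hasum hbound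
  obtain ⟨μ, hμ⟩ := Potential.exists_isGibbsPot hsum
  have := hμ.1
  have hi := Potential.inv_of_isGibbsPot hsum hI hμ
  refine ⟨μ, hμ, fun ν hν => Potential.eq_of_isGibbsPot hsum hI hμ hν, hi 1, ?_⟩
  rcases subsingleton_or_nontrivial S with hS | hS
  · exact isBernoulliSystem_of_subsingleton μ
  · exact isBernoulliSystem_of_um hi (Potential.um_map_refl hsum hI hT hμ)
      (Potential.hrate_map_refl_pos hsum hI hμ hi.map_refl)

end GibbsFormal
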